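/- Let K be a quadratic number field with discriminant D, and for n ≥ 1 let r_K(n) denote the number of nonzero integral ideals of the ring of integers O_K of absolute norm n. Let χ_D be the real Dirichlet character for which ζ_K(s) = ζ(s) L(s, χ_D). Then, as x → ∞, ∑_{n ≤ x} (r_K(n))² = A₁ x log x + B₁ x + O( x^{1/2} (log x)^3 log log x ), where A₁ = (6/π²) L(1, χ_D)² ∏_{p|D} p/(p+1) and B₁ = A₁ · ( −1 + 2γ + ∑_{p|D} (log p)/(p+1) + 2 L′(1, χ_D)/L(1, χ_D) − (12/π²) ζ′(2) ), with γ the Euler–Mascheroni constant and the sums and products over the rational primes p dividing D. -/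

import Mathlib

open Complex Filter Asymptotics

/-- `rK K n` is the number of nonzero integral ideals of the ring of integers of `K`
of absolute norm `n`. -/
noncomputable def rK (K : Type*) [Field K] [NumberField K] (n : ℕ) : ℕ :=
  Nat.card {I : Ideal (NumberField.RingOfIntegers K) // Ideal.absNorm I = n ∧ I ≠ ⊥}

namespace QuadIdealSq

open MeasureTheory Topology

section MeanValue

lemma integral_cexp_mul_gaussian {T : ℝ} (hT : 0 < T) (u : ℝ) :
    ∫ t : ℝ, cexp (I * u * t) * cexp (-(1 / T ^ 2 : ℝ) * t ^ 2) =
      ((Real.sqrt Real.pi * T * Real.exp (-(T ^ 2 * u ^ 2 / 4)) : ℝ) : ℂ) := by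
  have hb : 0 < ((1 / T ^ 2 : ℝ) : ℂ).re := by rw [ofReal_re]; positivity
  rw [fourierIntegral_gaussian hb u]
  have hT' : (T : ℂ) ≠ 0 := by exact_mod_cast hT.ne'
  have h1 : ((Real.pi : ℂ) / ((1 / T ^ 2 : ℝ) : ℂ)) ^ (1 / 2 : ℂ) =
      ((Real.sqrt Real.pi * T : ℝ) : ℂ) := by
    rw [← ofReal_div, show (1 / 2 : ℂ) = ((1 / 2 : ℝ) : ℂ) by push_cast; rfl,
      ← ofReal_cpow (by positivity), ← Real.sqrt_eq_rpow]
    congr 1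
    rw [show Real.pi / (1 / T ^ 2) = Real.pi * T ^ 2 by field_simp,
      Real.sqrt_mul Real.pi_pos.le, Real.sqrt_sq hT.le]
  rw [h1]
  push_cast
  congr 2
  field_simp

lemma exp_neg_sq_le {x y : ℝ} (hx : 0 < x) (hxy : x ≤ y) {T : ℝ} (hT : 2 ≤ T) :
    Real.exp (-(T ^ 2 * (Real.log y - Real.log x) ^ 2 / 4)) ≤
      Real.exp 1 * (1 / (1 + T * ((y - x) / x) / 2) ^ 2) := by
  set v := Real.log y - Real.log x with hv
  have hy : 0 < y := hx.trans_le hxy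
  have hd : 0 ≤ (y - x) / x := div_nonneg (by linarith) hx.le
  have h1 : Real.exp (-(T ^ 2 * v ^ 2 / 4)) ≤ Real.exp 1 * Real.exp (-(T * v)) := by
    rw [← Real.exp_add]
    apply Real.exp_le_exp.mpr
    nlinarith [sq_nonneg (T * v / 2 - 1)]
  refine h1.trans (mul_le_mul_of_nonneg_left ?_ (Real.exp_pos _).le)
  have h2 : 1 + T * ((y - x) / x) / 2 ≤ Real.exp (T / 2 * v) := by
    have hb := one_add_mul_self_le_rpow_one_add (s := (y - x) / x) (by linarith) (p := T / 2)
      (by linarith)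
    have h3 : (1 + (y - x) / x) = Real.exp v := by
      rw [hv, Real.exp_sub, Real.exp_log hx, Real.exp_log hy]; field_simp; ring
    rw [h3, ← Real.exp_mul] at hb
    calc _ = 1 + T / 2 * ((y - x) / x) := by ring
      _ ≤ _ := hb
      _ = _ := by rw [mul_comm]
  have h4 : Real.exp (-(T * v)) = 1 / Real.exp (T / 2 * v) ^ 2 := by
    rw [← Real.exp_nat_mul, one_div, ← Real.exp_neg]; congr 1; push_cast; ring
  rw [h4]
  have : 0 < 1 + T * ((y - x) / x) / 2 := by positivity
  gcongr

lemma sum_range_one_div_sq_le {c : ℝ} (hc : 0 < c) (N : ℕ) :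
    ∑ d ∈ Finset.range N, 1 / (1 + c * d) ^ 2 ≤ 1 + 1 / c := by
  have key : ∀ N : ℕ, ∑ d ∈ Finset.range (N + 1), 1 / (1 + c * d) ^ 2 ≤
      1 + 1 / c - 1 / (c * (1 + c * N)) := by
    intro N
    induction N with
    | zero => simp
    | succ N ih =>
      rw [Finset.sum_range_succ]
      have h : 1 / (1 + c * ((N + 1 : ℕ) : ℝ)) ^ 2 ≤
          1 / (c * (1 + c * N)) - 1 / (c * (1 + c * ((N + 1 : ℕ) : ℝ))) := by
        have h1 : (0 : ℝ) < 1 + c * N := by positivity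
        have h2 : 1 / (c * (1 + c * N)) - 1 / (c * (1 + c * ((N + 1 : ℕ) : ℝ))) =
            1 / ((1 + c * N) * (1 + c * ((N + 1 : ℕ) : ℝ))) := by
          have h3 : (0 : ℝ) < 1 + c * ((N + 1 : ℕ) : ℝ) := by positivity
          field_simp
          push_cast; ring
        rw [h2, sq]
        push_cast
        gcongr
        linarith
      linarith
  rcases N with _ | N
  · simp; positivity
  · refine (key N).trans ?_
    have : 0 ≤ 1 / (c * (1 + c * N)) := by positivity
    linarith

lemma exp_log_sub_le {m n : ℕ} (hm : 0 < m) (hn : 0 < n) {T : ℝ} (hT : 2 ≤ T) :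
    Real.exp (-(T ^ 2 * (Real.log n - Real.log m) ^ 2 / 4)) ≤
      Real.exp 1 * (1 / (1 + T / (2 * m) * (((n - m : ℕ) : ℝ) + ((m - n : ℕ) : ℝ))) ^ 2) := by
  have hm' : (0 : ℝ) < m := by exact_mod_cast hm
  have hn' : (0 : ℝ) < n := by exact_mod_cast hn
  rcases le_total m n with h | h
  · have h' : (m : ℝ) ≤ n := by exact_mod_cast h
    refine (exp_neg_sq_le hm' h' hT).trans (le_of_eq ?_)
    rw [Nat.sub_eq_zero_of_le h, Nat.cast_sub h]
    congr 3
    field_simp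
    push_cast; ring
  · have h' : (n : ℝ) ≤ m := by exact_mod_cast h
    have := exp_neg_sq_le hn' h' hT
    rw [show (Real.log n - Real.log m) ^ 2 = (Real.log m - Real.log n) ^ 2 by ring]
    refine this.trans ?_
    rw [Nat.sub_eq_zero_of_le h, Nat.cast_sub h]
    have h2 : T / (2 * m) * (((0 : ℕ) : ℝ) + (m - n)) ≤ T * ((m - n) / n) / 2 := by
      have : T / (2 * m) * (((0 : ℕ) : ℝ) + ((m : ℝ) - n)) = T * ((m - n) / m) / 2 := by
        field_simp; push_cast; ring
      rw [this]
      have h0 : (0 : ℝ) ≤ m - n := by linarith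
      gcongr
    have h3 : 0 ≤ T / (2 * m) * (((0 : ℕ) : ℝ) + (m - n)) := by
      have : (0 : ℝ) ≤ m - n := by linarith
      positivity
    gcongr

lemma sum_exp_log_sub_le (s : Finset ℕ) (hs : ∀ n ∈ s, 0 < n) {m : ℕ} (hm : 0 < m) {T : ℝ}
    (hT : 2 ≤ T) :
    ∑ n ∈ s, Real.exp (-(T ^ 2 * (Real.log n - Real.log m) ^ 2 / 4)) ≤
      Real.exp 1 * (2 + 4 * m / T) := by
  have hm' : (0 : ℝ) < m := by exact_mod_cast hm
  set c : ℝ := T / (2 * m) with hc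
  have hc0 : 0 < c := by positivity
  set N := s.sup id + m + 1 with hN
  have h1 : ∑ n ∈ s, Real.exp (-(T ^ 2 * (Real.log n - Real.log m) ^ 2 / 4)) ≤
      ∑ n ∈ s, Real.exp 1 * (1 / (1 + c * (n - m : ℕ)) ^ 2 * (if m ≤ n then 1 else 0) +
        1 / (1 + c * (m - n : ℕ)) ^ 2 * (if n < m then 1 else 0)) := by
    refine Finset.sum_le_sum fun n hn => (exp_log_sub_le hm (hs n hn) hT).trans ?_
    gcongr
    rcases le_or_gt m n with h | h
    · simp [h, h.not_gt, Nat.sub_eq_zero_of_le h, hc]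
    · simp [h, h.not_ge, Nat.sub_eq_zero_of_le h.le, hc]
  refine h1.trans ?_
  rw [← Finset.mul_sum]
  gcongr
  rw [Finset.sum_add_distrib]
  have e1 : ∑ n ∈ s, 1 / (1 + c * (n - m : ℕ)) ^ 2 * (if m ≤ n then (1 : ℝ) else 0) ≤ 1 + 1 / c := by
    simp_rw [mul_ite, mul_one, mul_zero]
    rw [← Finset.sum_filter]
    refine le_trans ?_ (sum_range_one_div_sq_le hc0 N)
    rw [← Finset.sum_image (s := s.filter (m ≤ ·)) (g := fun n => n - m)
      (f := fun d : ℕ => 1 / (1 + c * (d : ℝ)) ^ 2)]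
    · apply Finset.sum_le_sum_of_subset_of_nonneg
      · intro d hd
        simp only [Finset.mem_image, Finset.mem_filter] at hd
        obtain ⟨n, ⟨hn, _⟩, rfl⟩ := hd
        have : n ≤ s.sup id := Finset.le_sup (f := id) hn
        simp only [Finset.mem_range]; omega
      · intros; positivity
    · intro a ha b hb hab
      simp only [Finset.coe_filter, Set.mem_ofPred_eq] at ha hb
      simp only at hab
      omega
  have e2 : ∑ n ∈ s, 1 / (1 + c * (m - n : ℕ)) ^ 2 * (if n < m then (1 : ℝ) else 0) ≤ 1 + 1 / c := by
    simp_rw [mul_ite, mul_one, mul_zero]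
    rw [← Finset.sum_filter]
    refine le_trans ?_ (sum_range_one_div_sq_le hc0 N)
    rw [← Finset.sum_image (s := s.filter (· < m)) (g := fun n => m - n)
      (f := fun d : ℕ => 1 / (1 + c * (d : ℝ)) ^ 2)]
    · apply Finset.sum_le_sum_of_subset_of_nonneg
      · intro d hd
        simp only [Finset.mem_image, Finset.mem_filter] at hd
        obtain ⟨n, ⟨hn, _⟩, rfl⟩ := hd
        simp only [Finset.mem_range]; omega
      · intros; positivity
    · intro a ha b hb hab
      simp only [Finset.coe_filter, Set.mem_ofPred_eq] at ha hb
      simp only at hab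
      omega
  have e3 : 1 / c = 2 * m / T := by rw [hc]; field_simp
  rw [e3] at e1 e2
  calc _ ≤ (1 + 2 * m / T) + (1 + 2 * m / T) := add_le_add e1 e2
    _ = _ := by ring

lemma natCast_cpow_mul_I {n : ℕ} (hn : 0 < n) (t : ℝ) :
    (n : ℂ) ^ (-(t * I)) = cexp (-(t * Real.log n) * I) := by
  rw [cpow_def_of_ne_zero (by exact_mod_cast hn.ne'), natCast_log]
  congr 1; ring

lemma norm_natCast_cpow_mul_I (n : ℕ) (t : ℝ) : ‖(n : ℂ) ^ (-(t * I))‖ ≤ 1 := by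
  rcases Nat.eq_zero_or_pos n with rfl | hn
  · by_cases h : -(t * I) = 0
    · simp [h]
    · simp [zero_cpow h]
  · rw [natCast_cpow_mul_I hn, ← ofReal_mul, ← ofReal_neg, norm_exp_ofReal_mul_I]

lemma continuous_natCast_cpow_mul_I {n : ℕ} (hn : 0 < n) :
    Continuous fun t : ℝ => (n : ℂ) ^ (-(t * I)) := by
  simp_rw [natCast_cpow_mul_I hn]; fun_prop

lemma integrable_gaussian {T : ℝ} (hT : 0 < T) :
    Integrable fun t : ℝ => Real.exp (-(t ^ 2 / T ^ 2)) := by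
  have := integrable_exp_neg_mul_sq (b := 1 / T ^ 2) (by positivity)
  refine this.congr (ae_of_all _ fun t => ?_)
  simp only; congr 1; ring

lemma sum_sum_symm (s : Finset ℕ) (w : ℕ → ℝ) (K : ℕ → ℕ → ℝ) (hK : ∀ m n, K m n = K n m) (c : ℝ) :
    ∑ m ∈ s, ∑ n ∈ s, (w m + w n) / 2 * (c * K m n) = c * ∑ m ∈ s, w m * ∑ n ∈ s, K m n := by
  have h1 : ∑ m ∈ s, ∑ n ∈ s, (w m + w n) / 2 * (c * K m n) =
      ∑ m ∈ s, ∑ n ∈ s, w m / 2 * (c * K m n) + ∑ m ∈ s, ∑ n ∈ s, w n / 2 * (c * K m n) := by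
    simp_rw [← Finset.sum_add_distrib]
    exact Finset.sum_congr rfl fun m _ => Finset.sum_congr rfl fun n _ => by ring
  have h2 : ∑ m ∈ s, ∑ n ∈ s, w n / 2 * (c * K m n) = ∑ m ∈ s, ∑ n ∈ s, w m / 2 * (c * K m n) := by
    rw [Finset.sum_comm]
    exact Finset.sum_congr rfl fun m _ => Finset.sum_congr rfl fun n _ => by rw [hK m n]
  rw [h1, h2, ← Finset.sum_add_distrib, Finset.mul_sum]
  refine Finset.sum_congr rfl fun m _ => ?_
  rw [← Finset.sum_add_distrib, Finset.mul_sum, Finset.mul_sum]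
  exact Finset.sum_congr rfl fun n _ => by ring

/-- Mean value estimate for Dirichlet polynomials with a Gaussian weight. -/
theorem meanValue_finset (s : Finset ℕ) (hs : ∀ n ∈ s, 0 < n) (a : ℕ → ℂ) {T : ℝ} (hT : 2 ≤ T) :
    ∫ t : ℝ, ‖∑ n ∈ s, a n * (n : ℂ) ^ (-(t * I))‖ ^ 2 * Real.exp (-(t ^ 2 / T ^ 2)) ≤
      30 * ∑ n ∈ s, (T + n) * ‖a n‖ ^ 2 := by
  have hT0 : 0 < T := by linarith
  obtain ⟨K, hK⟩ : ∃ K : ℕ → ℕ → ℝ, K = fun m n : ℕ =>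
      Real.exp (-(T ^ 2 * (Real.log n - Real.log m) ^ 2 / 4)) := ⟨_, rfl⟩
  have hKs : ∀ m n, K m n = K n m := by
    intro m n; rw [hK]; dsimp only; congr 3; ring
  have hint : ∀ m n : ℕ, Integrable fun t : ℝ => (a m * (starRingEnd ℂ) (a n)) *
      (cexp (I * ((Real.log n - Real.log m : ℝ) : ℂ) * t) *
        cexp (-(1 / T ^ 2 : ℝ) * (t : ℂ) ^ 2)) := by
    intro m n
    apply Integrable.const_mul
    have := integrable_cexp_quadratic' (b := -((1 / T ^ 2 : ℝ) : ℂ))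
      (by rw [neg_re, ofReal_re]; simp only [Left.neg_neg_iff]; positivity)
      (I * ((Real.log n - Real.log m : ℝ) : ℂ)) 0
    refine this.congr (ae_of_all _ fun t => ?_)
    simp only
    rw [← Complex.exp_add]; congr 1; ring
  have hpt : ∀ t : ℝ, ((‖∑ n ∈ s, a n * (n : ℂ) ^ (-(t * I))‖ ^ 2 *
      Real.exp (-(t ^ 2 / T ^ 2)) : ℝ) : ℂ) =
      ∑ m ∈ s, ∑ n ∈ s, (a m * (starRingEnd ℂ) (a n)) *
      (cexp (I * ((Real.log n - Real.log m : ℝ) : ℂ) * t) *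
        cexp (-(1 / T ^ 2 : ℝ) * (t : ℂ) ^ 2)) := by
    intro t
    rw [ofReal_mul, ofReal_pow, ← mul_conj', map_sum, Finset.sum_mul_sum, Finset.sum_mul]
    refine Finset.sum_congr rfl fun m hm => ?_
    rw [Finset.sum_mul]
    refine Finset.sum_congr rfl fun n hn => ?_
    rw [natCast_cpow_mul_I (hs m hm), natCast_cpow_mul_I (hs n hn), map_mul, ← exp_conj]
    rw [show a m * cexp (-(↑t * ↑(Real.log ↑m)) * I) * ((starRingEnd ℂ) (a n) *
        cexp ((starRingEnd ℂ) (-(↑t * ↑(Real.log ↑n)) * I))) * ↑(Real.exp (-(t ^ 2 / T ^ 2))) =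
        (a m * (starRingEnd ℂ) (a n)) * (cexp (-(↑t * ↑(Real.log ↑m)) * I) *
        cexp ((starRingEnd ℂ) (-(↑t * ↑(Real.log ↑n)) * I)) * ↑(Real.exp (-(t ^ 2 / T ^ 2)))) by ring]
    congr 1
    rw [← Complex.exp_add, ofReal_exp, ← Complex.exp_add, ← Complex.exp_add]
    congr 1
    simp only [map_mul, map_neg, conj_ofReal, conj_I]
    push_cast; ring
  have hmain : ((∫ t : ℝ, ‖∑ n ∈ s, a n * (n : ℂ) ^ (-(t * I))‖ ^ 2 *
      Real.exp (-(t ^ 2 / T ^ 2)) : ℝ) : ℂ) = ∑ m ∈ s, ∑ n ∈ s, (a m * (starRingEnd ℂ) (a n)) *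
        ((Real.sqrt Real.pi * T * K m n : ℝ) : ℂ) := by
    rw [← integral_complex_ofReal, integral_congr_ae (ae_of_all _ hpt), integral_finsetSum _ fun m _ =>
      integrable_finsetSum _ fun n _ => hint m n]
    refine Finset.sum_congr rfl fun m _ => ?_
    rw [integral_finsetSum _ fun n _ => hint m n]
    refine Finset.sum_congr rfl fun n _ => ?_
    rw [integral_const_mul, integral_cexp_mul_gaussian hT0, hK]
  have hbound : ∫ t : ℝ, ‖∑ n ∈ s, a n * (n : ℂ) ^ (-(t * I))‖ ^ 2 *
      Real.exp (-(t ^ 2 / T ^ 2)) ≤ ∑ m ∈ s, ∑ n ∈ s, (‖a m‖ ^ 2 + ‖a n‖ ^ 2) / 2 *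
        (Real.sqrt Real.pi * T * K m n) := by
    refine (le_abs_self _).trans ?_
    rw [← Real.norm_eq_abs, ← norm_real, hmain]
    refine (norm_sum_le _ _).trans (Finset.sum_le_sum fun m _ => (norm_sum_le _ _).trans
      (Finset.sum_le_sum fun n _ => ?_))
    rw [norm_mul, norm_mul, RCLike.norm_conj, norm_real, Real.norm_of_nonneg (by rw [hK]; positivity)]
    have : 0 ≤ K m n := by rw [hK]; positivity
    gcongr
    nlinarith [sq_nonneg (‖a m‖ - ‖a n‖)]
  refine hbound.trans ?_
  rw [sum_sum_symm s (fun n => ‖a n‖ ^ 2) K hKs, Finset.mul_sum, Finset.mul_sum]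
  refine Finset.sum_le_sum fun m hm => ?_
  have hrow := sum_exp_log_sub_le s hs (hs m hm) hT
  have hpi : Real.sqrt Real.pi ≤ 2 := by
    rw [Real.sqrt_le_left (by norm_num)]
    linarith [Real.pi_lt_four]
  have he : Real.exp 1 ≤ 3 := by linarith [Real.exp_one_lt_d9]
  have hK0 : 0 ≤ ∑ n ∈ s, K m n := Finset.sum_nonneg fun n _ => by rw [hK]; positivity
  have hrow' : ∑ n ∈ s, K m n ≤ 3 * (2 + 4 * m / T) := by
    rw [hK]
    exact hrow.trans (by gcongr)
  calc Real.sqrt Real.pi * T * (‖a m‖ ^ 2 * ∑ n ∈ s, K m n)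
      ≤ 2 * T * (‖a m‖ ^ 2 * (3 * (2 + 4 * m / T))) := by
        gcongr
    _ = (12 * T + 24 * m) * ‖a m‖ ^ 2 := by field_simp; ring
    _ ≤ 30 * ((T + m) * ‖a m‖ ^ 2) := by
        rw [← mul_assoc]
        gcongr
        nlinarith [Nat.cast_nonneg (α := ℝ) m]

/-- Mean value estimate for absolutely convergent Dirichlet series with a Gaussian weight. -/
theorem meanValue_tsum (a : ℕ → ℂ) (ha0 : a 0 = 0) (ha : Summable fun n => ‖a n‖) {T B : ℝ}
    (hT : 2 ≤ T) (hB : ∀ s : Finset ℕ, ∑ n ∈ s, (T + n) * ‖a n‖ ^ 2 ≤ B) :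
    ∫ t : ℝ, ‖∑' n, a n * (n : ℂ) ^ (-(t * I))‖ ^ 2 * Real.exp (-(t ^ 2 / T ^ 2)) ≤ 30 * B := by
  have hT0 : 0 < T := by linarith
  have hsum : ∀ t : ℝ, Summable fun n => a n * (n : ℂ) ^ (-(t * I)) := by
    intro t
    refine Summable.of_norm_bounded ha fun n => ?_
    rw [norm_mul]
    exact mul_le_of_le_one_right (norm_nonneg _) (norm_natCast_cpow_mul_I n t)
  set A := ∑' n, ‖a n‖ with hA
  have hA0 : 0 ≤ A := tsum_nonneg fun _ => norm_nonneg _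
  have hlim : Tendsto (fun N : ℕ => ∫ t : ℝ, ‖∑ n ∈ Finset.range N, a n * (n : ℂ) ^ (-(t * I))‖ ^ 2 *
      Real.exp (-(t ^ 2 / T ^ 2))) atTop
      (𝓝 (∫ t : ℝ, ‖∑' n, a n * (n : ℂ) ^ (-(t * I))‖ ^ 2 * Real.exp (-(t ^ 2 / T ^ 2)))) := by
    refine tendsto_integral_of_dominated_convergence
      (fun t => A ^ 2 * Real.exp (-(t ^ 2 / T ^ 2))) (fun N => ?_)
      ((integrable_gaussian hT0).const_mul _) (fun N => ae_of_all _ fun t => ?_)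
      (ae_of_all _ fun t => ?_)
    · apply Continuous.aestronglyMeasurable
      refine Continuous.mul (Continuous.pow (Continuous.norm ?_) _) (by fun_prop)
      refine continuous_finsetSum _ fun n _ => ?_
      rcases Nat.eq_zero_or_pos n with rfl | hn
      · simp [ha0, continuous_const]
      · exact continuous_const.mul (continuous_natCast_cpow_mul_I hn)
    · rw [Real.norm_of_nonneg (by positivity)]
      gcongr
      refine (norm_sum_le _ _).trans ((Finset.sum_le_sum fun n _ => ?_).trans
        (ha.sum_le_tsum (Finset.range N) fun _ _ => norm_nonneg _))
      rw [norm_mul]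
      exact mul_le_of_le_one_right (norm_nonneg _) (norm_natCast_cpow_mul_I n t)
    · exact (((hsum t).hasSum.tendsto_sum_nat.norm).pow 2).mul_const _
  refine le_of_tendsto hlim (Eventually.of_forall fun N => ?_)
  have hrw : ∀ t : ℝ, ∑ n ∈ Finset.range N, a n * (n : ℂ) ^ (-(t * I)) =
      ∑ n ∈ (Finset.range N).erase 0, a n * (n : ℂ) ^ (-(t * I)) := fun t =>
    (Finset.sum_erase _ (by simp [ha0])).symm
  simp_rw [hrw]
  refine (meanValue_finset _ (fun n hn => Nat.pos_of_ne_zero (Finset.ne_of_mem_erase hn)) a hT).trans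
    ?_
  gcongr
  exact hB _

end MeanValue

/-- Vertical line integrals of a holomorphic function decaying in a strip agree. -/
theorem integral_vertical_eq {a b : ℝ} (hab : a ≤ b) {f : ℂ → ℂ}
    (hf : DifferentiableOn ℂ f {z | a ≤ z.re ∧ z.re ≤ b})
    (ha : Integrable fun t : ℝ => f (a + t * I)) (hb : Integrable fun t : ℝ => f (b + t * I))
    {g : ℝ → ℝ} (hg : Tendsto g atTop (𝓝 0))
    (hfg : ∀ σ t : ℝ, a ≤ σ → σ ≤ b → 1 ≤ |t| → ‖f (σ + t * I)‖ ≤ g |t|) :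
    ∫ t : ℝ, f (a + t * I) = ∫ t : ℝ, f (b + t * I) := by
  have hrect : ∀ T : ℝ, 0 ≤ T →
      (∫ t in (-T)..T, f (b + t * I)) - (∫ t in (-T)..T, f (a + t * I)) =
      I * ((∫ x in a..b, f (x + (-T : ℝ) * I)) - (∫ x in a..b, f (x + T * I))) := by
    intro T hT
    have h := integral_boundary_rect_eq_zero_of_differentiableOn f ⟨a, -T⟩ ⟨b, T⟩ (by
      apply hf.mono
      intro z hz
      rw [mem_reProdIm] at hz
      simp only [Set.uIcc_of_le hab] at hz
      exact hz.1)
    simp only [smul_eq_mul] at h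
    linear_combination (-I) * h +
      ((∫ t in (-T)..T, f (b + t * I)) - (∫ t in (-T)..T, f (a + t * I))) * I_sq
  have hlim1 := (intervalIntegral_tendsto_integral hb tendsto_neg_atTop_atBot tendsto_id).sub
    (intervalIntegral_tendsto_integral ha tendsto_neg_atTop_atBot tendsto_id)
  have hlim2 : Tendsto (fun T : ℝ => (∫ t in (-T)..T, f (b + t * I)) -
      (∫ t in (-T)..T, f (a + t * I))) atTop (𝓝 0) := by
    have hz : Tendsto (fun T => g T * |b - a| + g T * |b - a|) atTop (𝓝 0) := by
      have h := hg.mul_const (|b - a|)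
      rw [zero_mul] at h
      simpa using h.add h
    rw [tendsto_zero_iff_norm_tendsto_zero]
    refine squeeze_zero' (Eventually.of_forall fun _ => norm_nonneg _)
      (g := fun T => g T * |b - a| + g T * |b - a|) ?_ hz
    filter_upwards [eventually_ge_atTop 1] with T hT
    rw [hrect T (by linarith), norm_mul, norm_I, one_mul]
    refine (norm_sub_le _ _).trans (add_le_add ?_ ?_)
    · refine intervalIntegral.norm_integral_le_of_norm_le_const fun x hx => ?_
      rw [Set.uIoc_of_le hab] at hx
      have := hfg x (-T) hx.1.le hx.2 (by rw [abs_neg, abs_of_pos] <;> linarith)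
      rwa [abs_neg, abs_of_pos (by linarith)] at this
    · refine intervalIntegral.norm_integral_le_of_norm_le_const fun x hx => ?_
      rw [Set.uIoc_of_le hab] at hx
      have := hfg x T hx.1.le hx.2 (by rw [abs_of_pos] <;> linarith)
      rwa [abs_of_pos (by linarith)] at this
  exact (sub_eq_zero.mp (tendsto_nhds_unique hlim1 hlim2)).symm

section Approx

/-- The remainder in the approximation of partial sums of `c` by a linear function. -/
noncomputable def sumRemainder (c : ℕ → ℂ) (κ : ℂ) (N : ℕ) (u : ℝ) : ℂ :=
  (Set.Ioi (N : ℝ)).indicator (fun u => ∑ k ∈ Finset.Ioc N ⌊u⌋₊, c k - κ * (u - N)) u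

variable {c : ℕ → ℂ} {κ : ℂ} {K : ℝ}

lemma norm_sumRemainder_le (hK : 0 ≤ K)
    (hS : ∀ m n : ℕ, m ≤ n → ‖∑ k ∈ Finset.Ioc m n, c k - κ * (n - m)‖ ≤ K) (N : ℕ) (u : ℝ) :
    ‖sumRemainder c κ N u‖ ≤ K + ‖κ‖ := by
  unfold sumRemainder
  by_cases hu : u ∈ Set.Ioi (N : ℝ)
  · rw [Set.indicator_of_mem hu]
    have hu' : (N : ℝ) < u := hu
    have hu0 : 0 ≤ u := (Nat.cast_nonneg N).trans hu'.le
    have h1 : N ≤ ⌊u⌋₊ := Nat.le_floor hu'.le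
    have h2 : ∑ k ∈ Finset.Ioc N ⌊u⌋₊, c k - κ * (u - N) =
        (∑ k ∈ Finset.Ioc N ⌊u⌋₊, c k - κ * ((⌊u⌋₊ : ℕ) - N)) - κ * ((u - ⌊u⌋₊ : ℝ) : ℂ) := by
      push_cast; ring
    rw [h2]
    refine (norm_sub_le _ _).trans (add_le_add (hS _ _ h1) ?_)
    rw [norm_mul, norm_real]
    refine mul_le_of_le_one_right (norm_nonneg _) ?_
    rw [Real.norm_eq_abs, abs_le]
    constructor <;> linarith [Nat.floor_le hu0, Nat.lt_floor_add_one u]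
  · rw [Set.indicator_of_notMem hu, norm_zero]; positivity

lemma measurable_sumRemainder (N : ℕ) : Measurable (sumRemainder c κ N) := by
  unfold sumRemainder
  refine Measurable.indicator ?_ measurableSet_Ioi
  refine Measurable.sub ?_ (by fun_prop)
  exact (measurable_from_nat (f := fun m => ∑ k ∈ Finset.Ioc N m, c k)).comp Nat.measurable_floor

lemma integrableOn_sumRemainder (hK : 0 ≤ K)
    (hS : ∀ m n : ℕ, m ≤ n → ‖∑ k ∈ Finset.Ioc m n, c k - κ * (n - m)‖ ≤ K) {N : ℕ} (hN : 0 < N)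
    {s : ℂ} (hs : 0 < s.re) :
    IntegrableOn (fun u : ℝ => sumRemainder c κ N u * (u : ℂ) ^ (-(s + 1))) (Set.Ioi N) := by
  have hN' : (0 : ℝ) < N := by exact_mod_cast hN
  have h := integrableOn_Ioi_cpow_of_lt (a := -(s + 1)) (by simp; linarith) hN'
  exact h.bdd_mul (c := K + ‖κ‖) (measurable_sumRemainder N).aestronglyMeasurable
    (ae_of_all _ fun u => norm_sumRemainder_le hK hS N u)

lemma norm_integral_sumRemainder_le (hK : 0 ≤ K)
    (hS : ∀ m n : ℕ, m ≤ n → ‖∑ k ∈ Finset.Ioc m n, c k - κ * (n - m)‖ ≤ K) {N : ℕ} (hN : 0 < N)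
    {s : ℂ} (hs : 0 < s.re) :
    ‖∫ u in Set.Ioi (N : ℝ), sumRemainder c κ N u * (u : ℂ) ^ (-(s + 1))‖ ≤
      (K + ‖κ‖) * (N : ℝ) ^ (-s.re) / s.re := by
  have hN' : (0 : ℝ) < N := by exact_mod_cast hN
  have hlt : -(s.re + 1) < -1 := by linarith
  calc _ ≤ ∫ u in Set.Ioi (N : ℝ), (K + ‖κ‖) * u ^ (-(s.re + 1)) := by
        refine norm_integral_le_of_norm_le ((integrableOn_Ioi_rpow_of_lt hlt hN').const_mul _) ?_
        refine (ae_restrict_mem measurableSet_Ioi).mono fun u hu => ?_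
        rw [norm_mul, norm_cpow_eq_rpow_re_of_pos (hN'.trans hu)]
        rw [show (-(s + 1)).re = -(s.re + 1) by simp]
        exact mul_le_mul_of_nonneg_right (norm_sumRemainder_le hK hS N u)
          (Real.rpow_nonneg (hN'.trans hu).le _)
    _ = _ := by
        rw [integral_const_mul, integral_Ioi_rpow_of_lt hlt hN']
        rw [show -(s.re + 1) + 1 = -s.re by ring]
        field_simp

lemma differentiableAt_integral_sumRemainder (hK : 0 ≤ K)
    (hS : ∀ m n : ℕ, m ≤ n → ‖∑ k ∈ Finset.Ioc m n, c k - κ * (n - m)‖ ≤ K) {N : ℕ} (hN : 0 < N)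
    {s : ℂ} (hs : 0 < s.re) :
    DifferentiableAt ℂ (fun s : ℂ =>
      ∫ u in Set.Ioi (N : ℝ), sumRemainder c κ N u * (u : ℂ) ^ (-(s + 1))) s := by
  have hN' : (0 : ℝ) < N := by exact_mod_cast hN
  have heq : (fun s : ℂ => ∫ u in Set.Ioi (N : ℝ), sumRemainder c κ N u * (u : ℂ) ^ (-(s + 1))) =
      fun s => mellin (sumRemainder c κ N) (-s) := by
    funext s
    unfold mellin
    symm
    rw [setIntegral_eq_of_subset_of_forall_sdiff_eq_zero (s := Set.Ioi (N : ℝ)) measurableSet_Ioi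
      (Set.Ioi_subset_Ioi hN'.le)]
    · refine setIntegral_congr_fun measurableSet_Ioi fun u _ => ?_
      simp only [smul_eq_mul]
      rw [mul_comm, neg_add, sub_eq_add_neg]
    · intro u hu
      simp [sumRemainder, Set.indicator_of_notMem hu.2]
  rw [heq]
  refine DifferentiableAt.comp (f := fun s : ℂ => -s) (g := mellin (sumRemainder c κ N)) s ?_
    differentiableAt_id.neg
  refine mellin_differentiableAt_of_isBigO_rpow (a := 0) (b := -s.re - 1) ?_ ?_ (by simpa using hs)
    ?_ (by simp)
  · apply LocallyIntegrable.locallyIntegrableOn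
    refine (locallyIntegrable_const (K + ‖κ‖)).mono
      (measurable_sumRemainder N).aestronglyMeasurable (ae_of_all _ fun u => ?_)
    rw [Real.norm_of_nonneg (by positivity)]
    exact norm_sumRemainder_le hK hS N u
  · refine Asymptotics.IsBigO.of_bound (K + ‖κ‖) (Eventually.of_forall fun u => ?_)
    simpa using norm_sumRemainder_le hK hS N u
  · refine Asymptotics.IsBigO.of_bound 0 ?_
    filter_upwards [Ioo_mem_nhdsGT hN'] with u hu
    rw [sumRemainder, Set.indicator_of_notMem (by simpa using hu.2.le)]
    simp

lemma LSeries_eq_sum_add_integral (hc : ∀ n, ‖c n‖ ≤ 1) (hK : 0 ≤ K)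
    (hS : ∀ m n : ℕ, m ≤ n → ‖∑ k ∈ Finset.Ioc m n, c k - κ * (n - m)‖ ≤ K) {N : ℕ} (hN : 0 < N)
    {s : ℂ} (hs : 1 < s.re) :
    LSeries c s = ∑ n ∈ Finset.Icc 1 N, c n * (n : ℂ) ^ (-s) + κ * (N : ℂ) ^ (1 - s) / (s - 1) +
      s * ∫ u in Set.Ioi (N : ℝ), sumRemainder c κ N u * (u : ℂ) ^ (-(s + 1)) := by
  have hN' : (0 : ℝ) < N := by exact_mod_cast hN
  have hs0 : s ≠ 0 := by rintro rfl; simp at hs; linarith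
  have hs1 : s - 1 ≠ 0 := by
    intro h; rw [sub_eq_zero.mp h] at hs; simp at hs
  set c' : ℕ → ℂ := fun n => if n ≤ N then 0 else c n with hc'
  have hsum : LSeriesSummable c s := LSeriesSummable_of_bounded_of_one_lt_re (fun n _ => hc n) hs
  have h1 : LSeries c s = ∑ n ∈ Finset.Icc 1 N, c n * (n : ℂ) ^ (-s) + LSeries c' s := by
    have h2 : LSeries c s = LSeries c' s + LSeries (fun n => if n ≤ N then c n else 0) s := by
      rw [← LSeries_add]
      · congr 1; funext n
        by_cases h : n ≤ N <;> simp [hc', h]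
      · refine LSeriesSummable_of_bounded_of_one_lt_re (m := 1) (fun n _ => ?_) hs
        simp only [hc']; split_ifs <;> simp [hc n]
      · refine LSeriesSummable_of_bounded_of_one_lt_re (m := 1) (fun n _ => ?_) hs
        split_ifs <;> simp [hc n]
    rw [h2, add_comm]
    congr 1
    rw [LSeries, tsum_eq_sum (s := Finset.Icc 1 N)]
    · refine Finset.sum_congr rfl fun n hn => ?_
      rw [Finset.mem_Icc] at hn
      rw [LSeries.term_of_ne_zero (by omega), if_pos hn.2, cpow_neg, div_eq_mul_inv]
    · intro n hn
      rcases Nat.eq_zero_or_pos n with rfl | h0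
      · simp
      · have : ¬ n ≤ N := fun h => hn (Finset.mem_Icc.mpr ⟨h0, h⟩)
        rw [LSeries.term_of_ne_zero (by omega), if_neg this, zero_div]
  have hc'1 : ∀ n, ‖c' n‖ ≤ 1 := by
    intro n; simp only [hc']; split_ifs <;> simp [hc n]
  have h3 := LSeries_eq_mul_integral' c' (r := 1) zero_le_one hs (by
    refine Asymptotics.IsBigO.of_bound 1 (Eventually.of_forall fun n => ?_)
    rw [Real.norm_of_nonneg (Finset.sum_nonneg fun _ _ => norm_nonneg _)]
    refine (Finset.sum_le_sum fun k _ => hc'1 k).trans ?_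
    simp)
  have h4 : ∫ t in Set.Ioi (1 : ℝ), (∑ k ∈ Finset.Icc 1 ⌊t⌋₊, c' k) * (t : ℂ) ^ (-(s + 1)) =
      ∫ t in Set.Ioi (N : ℝ), (κ * ((t : ℂ) ^ (-s) - N * (t : ℂ) ^ (-(s + 1))) +
        sumRemainder c κ N t * (t : ℂ) ^ (-(s + 1))) := by
    rw [setIntegral_eq_of_subset_of_forall_sdiff_eq_zero (s := Set.Ioi (N : ℝ)) measurableSet_Ioi
      (Set.Ioi_subset_Ioi (by exact_mod_cast hN))]
    · refine setIntegral_congr_fun measurableSet_Ioi fun t ht => ?_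
      have ht0 : (0 : ℝ) < t := hN'.trans ht
      have h5 : ∑ k ∈ Finset.Icc 1 ⌊t⌋₊, c' k = ∑ k ∈ Finset.Ioc N ⌊t⌋₊, c k := by
        symm
        refine Finset.sum_subset_zero_on_sdiff ?_ ?_ ?_
        · intro k hk; rw [Finset.mem_Ioc] at hk; rw [Finset.mem_Icc]; omega
        · intro k hk
          rw [Finset.mem_sdiff, Finset.mem_Icc, Finset.mem_Ioc] at hk
          exact if_pos (by omega)
        · intro k hk
          rw [Finset.mem_Ioc] at hk
          exact (if_neg (by omega)).symm
      have h6 : (t : ℂ) ^ (-s) = t * (t : ℂ) ^ (-(s + 1)) := by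
        rw [show -s = 1 + -(s + 1) by ring, cpow_add _ _ (by exact_mod_cast ht0.ne'), cpow_one]
      simp only [h5, sumRemainder, Set.indicator_of_mem ht, h6]
      ring
    · intro t ht
      have ht2 : t ≤ N := by simpa using ht.2
      have ht1 : (1 : ℝ) < t := ht.1
      rw [Finset.sum_eq_zero, zero_mul]
      intro k hk
      rw [Finset.mem_Icc] at hk
      refine if_pos ?_
      have := (Nat.le_floor_iff (by linarith)).mp hk.2
      exact_mod_cast this.trans ht2
  have hi1 := integrableOn_Ioi_cpow_of_lt (a := -s) (by simpa using hs) hN'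
  have hi2 := integrableOn_Ioi_cpow_of_lt (a := -(s + 1)) (by simp; linarith) hN'
  have hN0 : (N : ℂ) ≠ 0 := by exact_mod_cast hN.ne'
  rw [h1, h3, h4, integral_add, integral_const_mul, integral_sub hi1 (hi2.const_mul _),
    integral_const_mul, integral_Ioi_cpow_of_lt (by simpa using hs) hN',
    integral_Ioi_cpow_of_lt (by simp; linarith) hN']
  · rw [show -(s + 1) + 1 = -s by ring, show -s + 1 = 1 - s by ring, ofReal_natCast,
      show (1 : ℂ) - s = 1 + -s by ring, cpow_add _ _ hN0, cpow_one]
    rw [show (1 : ℂ) + -s = -(s - 1) by ring]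
    field_simp
    ring
  · exact ((hi1.sub (hi2.const_mul _)).const_mul _)
  · exact integrableOn_sumRemainder hK hS hN (by linarith)

/-- Approximation of an analytically continued Dirichlet series in the critical strip. -/
theorem eq_sum_add_integral (hc : ∀ n, ‖c n‖ ≤ 1) (hK : 0 ≤ K)
    (hS : ∀ m n : ℕ, m ≤ n → ‖∑ k ∈ Finset.Ioc m n, c k - κ * (n - m)‖ ≤ K) {f : ℂ → ℂ}
    (hf1 : ∀ s : ℂ, 1 < s.re → f s = LSeries c s) (hf2 : ∀ s : ℂ, s ≠ 1 → DifferentiableAt ℂ f s)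
    {N : ℕ} (hN : 0 < N) {s : ℂ} (hs : 0 < s.re) (hs' : s.im ≠ 0) :
    f s = ∑ n ∈ Finset.Icc 1 N, c n * (n : ℂ) ^ (-s) + κ * (N : ℂ) ^ (1 - s) / (s - 1) +
      s * ∫ u in Set.Ioi (N : ℝ), sumRemainder c κ N u * (u : ℂ) ^ (-(s + 1)) := by
  obtain ⟨ε, hε, hεs⟩ : ∃ ε : ℝ, ε ≠ 0 ∧ 0 < ε * s.im := ⟨s.im, hs', mul_self_pos.mpr hs'⟩
  set U : Set ℂ := {z | 0 < z.re} ∩ {z | 0 < ε * z.im} with hU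
  have hUo : IsOpen U := by
    apply IsOpen.inter
    · exact isOpen_lt continuous_const continuous_re
    · exact isOpen_lt continuous_const (continuous_const.mul continuous_im)
  have hUc : Convex ℝ U := by
    apply Convex.inter
    · exact convex_halfSpace_re_gt 0
    · rintro x hx y hy a b ha hb hab
      simp only [Set.mem_ofPred_eq, add_im, smul_im, smul_eq_mul] at hx hy ⊢
      rcases ha.eq_or_lt with rfl | ha
      · rw [zero_add] at hab; subst hab; simpa using hy
      · nlinarith [mul_pos ha hx, mul_nonneg hb hy.le]
  have hU1 : ∀ z ∈ U, z ≠ 1 := by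
    rintro z hz rfl
    simp [hU] at hz
  have hN0 : (N : ℂ) ≠ 0 := by exact_mod_cast hN.ne'
  have hd1 : DifferentiableOn ℂ f U := fun z hz => (hf2 z (hU1 z hz)).differentiableWithinAt
  have hd2 : DifferentiableOn ℂ (fun s => ∑ n ∈ Finset.Icc 1 N, c n * (n : ℂ) ^ (-s) +
      κ * (N : ℂ) ^ (1 - s) / (s - 1) +
      s * ∫ u in Set.Ioi (N : ℝ), sumRemainder c κ N u * (u : ℂ) ^ (-(s + 1))) U := by
    intro z hz
    apply DifferentiableAt.differentiableWithinAt
    refine DifferentiableAt.add (DifferentiableAt.add ?_ ?_) (differentiableAt_id.mul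
      (differentiableAt_integral_sumRemainder hK hS hN hz.1))
    · refine DifferentiableAt.fun_sum fun n hn => ?_
      refine DifferentiableAt.const_mul (DifferentiableAt.const_cpow (by fun_prop) (Or.inl ?_)) _
      rw [Finset.mem_Icc] at hn
      exact_mod_cast (by omega : n ≠ 0)
    · refine DifferentiableAt.div (DifferentiableAt.const_mul
        (DifferentiableAt.const_cpow (by fun_prop) (Or.inl hN0)) _) (by fun_prop)
        (sub_ne_zero.mpr (hU1 z hz))
  refine (hd1.analyticOnNhd hUo).eqOn_of_preconnected_of_eventuallyEq (hd2.analyticOnNhd hUo)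
    hUc.isPreconnected (z₀ := s + 1) ⟨by simp; linarith, by simpa using hεs⟩ ?_ ⟨hs, hεs⟩
  have : {z : ℂ | 1 < z.re} ∈ 𝓝 (s + 1) :=
    (isOpen_lt continuous_const continuous_re).mem_nhds (by simpa using hs)
  filter_upwards [this] with z hz
  rw [hf1 z hz, LSeries_eq_sum_add_integral hc hK hS hN hz]

theorem norm_sub_sum_le (hc : ∀ n, ‖c n‖ ≤ 1) (hK : 0 ≤ K)
    (hS : ∀ m n : ℕ, m ≤ n → ‖∑ k ∈ Finset.Ioc m n, c k - κ * (n - m)‖ ≤ K) {f : ℂ → ℂ}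
    (hf1 : ∀ s : ℂ, 1 < s.re → f s = LSeries c s) (hf2 : ∀ s : ℂ, s ≠ 1 → DifferentiableAt ℂ f s)
    {N : ℕ} (hN : 0 < N) {s : ℂ} (hs : 0 < s.re) (hs' : s.im ≠ 0) :
    ‖f s - ∑ n ∈ Finset.Icc 1 N, c n * (n : ℂ) ^ (-s)‖ ≤
      ‖κ‖ * (N : ℝ) ^ (1 - s.re) / |s.im| + (K + ‖κ‖) * ‖s‖ / s.re * (N : ℝ) ^ (-s.re) := by
  have hN' : (0 : ℝ) < N := by exact_mod_cast hN
  rw [eq_sum_add_integral hc hK hS hf1 hf2 hN hs hs', add_assoc, add_sub_cancel_left]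
  refine (norm_add_le _ _).trans (add_le_add ?_ ?_)
  · rw [norm_div, norm_mul, norm_natCast_cpow_of_pos hN]
    simp only [sub_re, one_re]
    gcongr
    simpa using abs_im_le_norm (s - 1)
  · rw [norm_mul]
    calc _ ≤ ‖s‖ * ((K + ‖κ‖) * (N : ℝ) ^ (-s.re) / s.re) := by
          gcongr
          exact norm_integral_sumRemainder_le hK hS hN hs
      _ = _ := by ring

end Approx

/-- `f` is the analytic continuation of the Dirichlet series with bounded coefficients `c`, whose
partial sums are approximated by a linear function of slope `κ` up to `K`. -/
structure IsLinearLSeries (c : ℕ → ℂ) (κ : ℂ) (K : ℝ) (f : ℂ → ℂ) : Prop where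
  norm_le (n : ℕ) : ‖c n‖ ≤ 1
  nonneg : 0 ≤ K
  sum_le (m n : ℕ) (h : m ≤ n) : ‖∑ k ∈ Finset.Ioc m n, c k - κ * (n - m)‖ ≤ K
  eq_LSeries (s : ℂ) (hs : 1 < s.re) : f s = LSeries c s
  differentiableAt (s : ℂ) (hs : s ≠ 1) : DifferentiableAt ℂ f s

lemma isLinearLSeries_riemannZeta : IsLinearLSeries (fun _ => 1) 1 0 riemannZeta where
  norm_le _ := by simp
  nonneg := le_rfl
  sum_le m n h := by
    rw [Finset.sum_const, Nat.card_Ioc, nsmul_eq_mul, Nat.cast_sub h]; simp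
  eq_LSeries s hs := (LSeries_one_eq_riemannZeta hs).symm
  differentiableAt _ hs := differentiableAt_riemannZeta hs

section Character

variable {q : ℕ} [NeZero q] {χ : DirichletCharacter ℂ q}

lemma sum_range_character_eq_zero (hχ : χ ≠ 1) : ∑ k ∈ Finset.range q, χ (k : ZMod q) = 0 := by
  rw [← MulChar.sum_eq_zero_of_ne_one hχ]
  refine Finset.sum_bij' (fun k _ => (k : ZMod q)) (fun a _ => a.val) (by simp)
    (fun a _ => by simpa using ZMod.val_lt a) (fun k hk => ?_) (by simp) (by simp)
  exact ZMod.val_cast_of_lt (by simpa using hk)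

lemma norm_sum_range_character_le (hχ : χ ≠ 1) (n : ℕ) :
    ‖∑ k ∈ Finset.range n, χ (k : ZMod q)‖ ≤ q := by
  have h0 : ∀ a : ℕ, ∑ k ∈ Finset.range (q * a), χ (k : ZMod q) = 0 := by
    intro a
    induction a with
    | zero => simp
    | succ a ih =>
      rw [mul_add, mul_one, Finset.sum_range_add, ih, zero_add]
      simpa using sum_range_character_eq_zero hχ
  rw [← Nat.div_add_mod n q, Finset.sum_range_add, h0, zero_add]
  refine (norm_sum_le _ _).trans ((Finset.sum_le_sum fun k _ => χ.norm_le_one _).trans ?_)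
  simp only [Finset.sum_const, Finset.card_range, nsmul_eq_mul, mul_one]
  exact_mod_cast (Nat.mod_lt n (NeZero.pos q)).le

lemma isLinearLSeries_LFunction (hχ : χ ≠ 1) :
    IsLinearLSeries (fun n => χ (n : ZMod q)) 0 (2 * q) (DirichletCharacter.LFunction χ) where
  norm_le _ := χ.norm_le_one _
  nonneg := by positivity
  sum_le m n h := by
    have h1 : ∑ k ∈ Finset.Ioc m n, χ (k : ZMod q) =
        ∑ k ∈ Finset.range (n + 1), χ (k : ZMod q) - ∑ k ∈ Finset.range (m + 1), χ (k : ZMod q) := by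
      rw [← Finset.sum_Ico_eq_sub _ (by omega)]
      refine Finset.sum_congr ?_ fun _ _ => rfl
      ext k; simp only [Finset.mem_Ioc, Finset.mem_Ico]; omega
    rw [zero_mul, sub_zero, h1, two_mul]
    exact (norm_sub_le _ _).trans
      (add_le_add (norm_sum_range_character_le hχ _) (norm_sum_range_character_le hχ _))
  eq_LSeries s hs := DirichletCharacter.LFunction_eq_LSeries χ hs
  differentiableAt s _ := (DirichletCharacter.differentiable_LFunction hχ) s

end Character

lemma sum_Icc_rpow_neg_half_le (N : ℕ) :
    ∑ n ∈ Finset.Icc 1 N, (n : ℝ) ^ (-(1 / 2 : ℝ)) ≤ 2 * (N : ℝ) ^ (1 / 2 : ℝ) := by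
  induction N with
  | zero => simp
  | succ N ih =>
    rw [Finset.sum_Icc_succ_top (by omega)]
    refine (add_le_add_left ih _).trans ?_
    rw [Real.rpow_neg (by positivity), ← Real.sqrt_eq_rpow, ← Real.sqrt_eq_rpow]
    have h0 : (0 : ℝ) < ((N + 1 : ℕ) : ℝ) := by positivity
    have h1 := Real.sq_sqrt (Nat.cast_nonneg (α := ℝ) N)
    have h2 := Real.sq_sqrt h0.le
    have h3 := Real.sqrt_pos.mpr h0
    have h4 : ((N + 1 : ℕ) : ℝ) = N + 1 := by push_cast; ring
    rw [← sub_nonneg]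
    have : 2 * Real.sqrt ((N + 1 : ℕ) : ℝ) - (2 * Real.sqrt N + (Real.sqrt ((N + 1 : ℕ) : ℝ))⁻¹) =
        (Real.sqrt ((N + 1 : ℕ) : ℝ) - Real.sqrt N) ^ 2 / Real.sqrt ((N + 1 : ℕ) : ℝ) := by
      field_simp
      nlinarith
    rw [this]; positivity

section Bounds

variable {c : ℕ → ℂ} {κ : ℂ} {K : ℝ} {f : ℂ → ℂ}

/-- Approximation with at least `t²` terms on the critical line. -/
theorem IsLinearLSeries.norm_sub_sum_le_of_sq (h : IsLinearLSeries c κ K f) {t : ℝ} (ht : 1 ≤ |t|) :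
    ‖f (1 / 2 + t * I) - ∑ n ∈ Finset.Icc 1 ⌈t ^ 2⌉₊, c n * (n : ℂ) ^ (-(1 / 2 + t * I))‖ ≤
      3 * K + 5 * ‖κ‖ := by
  have ht2 : (1 : ℝ) ≤ t ^ 2 := by rw [← sq_abs]; nlinarith
  have hre : (1 / 2 + t * I : ℂ).re = 1 / 2 := by simp
  have him : (1 / 2 + t * I : ℂ).im = t := by simp
  set N := ⌈t ^ 2⌉₊ with hN
  have hN1 : t ^ 2 ≤ N := Nat.le_ceil _
  have hN2 : (N : ℝ) ≤ 2 * t ^ 2 := (Nat.ceil_lt_add_one (by positivity)).le.trans (by linarith)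
  have hN0 : 0 < N := Nat.ceil_pos.mpr (by linarith)
  have ht0 : t ≠ 0 := by rintro rfl; norm_num at ht
  refine (norm_sub_sum_le h.norm_le h.nonneg h.sum_le h.eq_LSeries h.differentiableAt hN0
    (by rw [hre]; norm_num) (by rwa [him])).trans ?_
  rw [hre, him]
  have e1 : (N : ℝ) ^ (1 - 1 / 2 : ℝ) ≤ 2 * |t| := by
    rw [show (1 - 1 / 2 : ℝ) = 1 / 2 by norm_num, ← Real.sqrt_eq_rpow]
    refine Real.sqrt_le_iff.mpr ⟨by positivity, ?_⟩
    rw [mul_pow, sq_abs]; linarith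
  have e2 : (N : ℝ) ^ (-(1 / 2 : ℝ)) ≤ 1 / |t| := by
    rw [Real.rpow_neg (by positivity), ← Real.sqrt_eq_rpow, one_div]
    gcongr
    rw [← Real.sqrt_sq_eq_abs]
    exact Real.sqrt_le_sqrt hN1
  have e3 : ‖(1 / 2 + t * I : ℂ)‖ ≤ 1 / 2 + |t| := by
    refine (norm_add_le _ _).trans ?_
    simp
  have hK := h.nonneg
  calc _ ≤ ‖κ‖ * (2 * |t|) / |t| + (K + ‖κ‖) * (1 / 2 + |t|) / (1 / 2) * (1 / |t|) := by gcongr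
    _ ≤ ‖κ‖ * 2 + (K + ‖κ‖) * 3 := by
        have : (1 / 2 + |t|) / |t| ≤ 3 / 2 := by
          rw [div_le_iff₀ (by positivity)]; linarith
        have e4 : (K + ‖κ‖) * (1 / 2 + |t|) / (1 / 2) * (1 / |t|) =
          (K + ‖κ‖) * 2 * ((1 / 2 + |t|) / |t|) := by ring
        rw [e4, mul_div_assoc, mul_div_cancel_right₀ _ (by positivity)]
        nlinarith [mul_le_mul_of_nonneg_left this (show 0 ≤ (K + ‖κ‖) * 2 by positivity)]
    _ = _ := by ring

/-- A crude bound to the right of the critical line. -/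
theorem IsLinearLSeries.norm_le_sqrt (h : IsLinearLSeries c κ K f) {s : ℂ} (hs : 1 / 2 ≤ s.re)
    (ht : 1 ≤ |s.im|) :
    ‖f s‖ ≤ (4 + 3 * K + 5 * ‖κ‖) * |s.im| ^ (1 / 2 : ℝ) := by
  set N := ⌈|s.im|⌉₊ with hN
  have hN1 : |s.im| ≤ N := Nat.le_ceil _
  have hN2 : (N : ℝ) ≤ 2 * |s.im| := (Nat.ceil_lt_add_one (by positivity)).le.trans (by linarith)
  have hN0 : 0 < N := Nat.ceil_pos.mpr (by linarith)
  have hN3 : (1 : ℝ) ≤ N := by exact_mod_cast hN0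
  have ht0 : s.im ≠ 0 := by intro h; rw [h] at ht; norm_num at ht
  have hmain := norm_sub_sum_le h.norm_le h.nonneg h.sum_le h.eq_LSeries h.differentiableAt hN0
    (s := s) (by linarith) ht0
  have h1 : ‖∑ n ∈ Finset.Icc 1 N, c n * (n : ℂ) ^ (-s)‖ ≤ 2 * (N : ℝ) ^ (1 / 2 : ℝ) := by
    refine (norm_sum_le _ _).trans (le_trans (Finset.sum_le_sum fun n hn => ?_)
      (sum_Icc_rpow_neg_half_le N))
    have hn1 := (Finset.mem_Icc.mp hn).1
    rw [norm_mul, norm_natCast_cpow_of_pos hn1, neg_re]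
    refine (mul_le_of_le_one_left (by positivity) (h.norm_le n)).trans ?_
    exact Real.rpow_le_rpow_of_exponent_le (by exact_mod_cast hn1) (by linarith)
  set u := |s.im| ^ (1 / 2 : ℝ) with hu
  have hu1 : 1 ≤ u := Real.one_le_rpow ht (by norm_num)
  have huu : u * u = |s.im| := by
    rw [hu, ← Real.rpow_add (by linarith)]; norm_num
  have h2 : (N : ℝ) ^ (1 / 2 : ℝ) ≤ 2 * u := by
    refine (Real.rpow_le_rpow (by positivity) hN2 (by norm_num)).trans ?_
    rw [Real.mul_rpow (by norm_num) (by positivity)]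
    gcongr
    exact (Real.rpow_le_rpow_of_exponent_le (by norm_num) (by norm_num : (1 / 2 : ℝ) ≤ 1)).trans
      (by norm_num)
  have h3 : (N : ℝ) ^ (1 - s.re) ≤ 2 * u :=
    (Real.rpow_le_rpow_of_exponent_le hN3 (by linarith)).trans h2
  have h4 : (N : ℝ) ^ (-s.re) ≤ 1 / u := by
    refine (Real.rpow_le_rpow_of_exponent_le hN3 (by linarith : -s.re ≤ -(1 / 2))).trans ?_
    have h6 : u ≤ (N : ℝ) ^ (1 / 2 : ℝ) :=
      Real.rpow_le_rpow (abs_nonneg _) hN1 (by norm_num)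
    rw [Real.rpow_neg N.cast_nonneg, one_div u]
    exact inv_anti₀ (by linarith) h6
  have h5 : ‖s‖ / s.re ≤ 3 * |s.im| := by
    rw [div_le_iff₀ (by linarith)]
    refine (norm_le_abs_re_add_abs_im s).trans ?_
    rw [abs_of_nonneg (by linarith)]
    nlinarith
  have hK := h.nonneg
  calc ‖f s‖ ≤ ‖∑ n ∈ Finset.Icc 1 N, c n * (n : ℂ) ^ (-s)‖ + (‖κ‖ * (N : ℝ) ^ (1 - s.re) / |s.im| +
        (K + ‖κ‖) * ‖s‖ / s.re * (N : ℝ) ^ (-s.re)) := by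
        refine le_trans ?_ (add_le_add_right hmain _)
        exact norm_le_norm_add_norm_sub' _ _
    _ ≤ 2 * (2 * u) + (‖κ‖ * (2 * u) / 1 + (K + ‖κ‖) * (3 * |s.im|) * (1 / u)) := by
        rw [mul_div_assoc (K + ‖κ‖)]
        gcongr
        exact h1.trans (by gcongr)
    _ = _ := by
        rw [← huu]; field_simp; ring

end Bounds

section ExponentialSums

lemma norm_cexp_I_mul (x : ℝ) : ‖cexp (I * x)‖ = 1 := by
  rw [mul_comm, norm_exp_ofReal_mul_I]

lemma inv_cexp_sub_one {x : ℝ} (hx : Real.sin (x / 2) ≠ 0) :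
    (cexp (I * x) - 1)⁻¹ = -1 / 2 - I / 2 * (Real.cot (x / 2) : ℝ) := by
  have hs : (Real.sin (x / 2) : ℂ) ≠ 0 := by exact_mod_cast hx
  have h1 : cexp (I * x) - 1 = 2 * I * Real.sin (x / 2) * cexp (I * (x / 2 : ℝ)) := by
    have h2 : cexp (I * x) = cexp (I * (x / 2 : ℝ)) * cexp (I * (x / 2 : ℝ)) := by
      rw [← Complex.exp_add]; congr 1; push_cast; ring
    have h3 : cexp (I * (x / 2 : ℝ)) = Real.cos (x / 2) + Real.sin (x / 2) * I := by
      rw [mul_comm, exp_mul_I, ← ofReal_cos, ← ofReal_sin]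
    have h4 : (Real.sin (x / 2) : ℂ) ^ 2 + (Real.cos (x / 2) : ℂ) ^ 2 = 1 := by
      exact_mod_cast Real.sin_sq_add_cos_sq (x / 2)
    rw [h2, h3]
    linear_combination h4 +
      ((-2) * (Real.sin (x / 2) : ℂ) ^ 2 + (Real.sin (x / 2) : ℂ) ^ 2) * I_sq
  have he : cexp (I * (x / 2 : ℝ)) = Real.cos (x / 2) + Real.sin (x / 2) * I := by
    rw [mul_comm, exp_mul_I, ← ofReal_cos, ← ofReal_sin]
  have hne := Complex.exp_ne_zero (I * (x / 2 : ℝ))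
  have h4 : (Real.sin (x / 2) : ℂ) ^ 2 + (Real.cos (x / 2) : ℂ) ^ 2 = 1 := by
    exact_mod_cast Real.sin_sq_add_cos_sq (x / 2)
  refine inv_eq_of_mul_eq_one_left ?_
  rw [h1, Real.cot_eq_cos_div_sin, he, ofReal_div]
  field_simp
  linear_combination h4 + (-(I * Real.sin (x / 2) * Real.cos (x / 2)) -
    ((Real.sin (x / 2) : ℂ) ^ 2 + (Real.cos (x / 2) : ℂ) ^ 2)) * I_sq

lemma two_div_pi_mul_le_norm {x : ℝ} (h0 : 0 ≤ x) (hπ : x ≤ Real.pi) :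
    2 / Real.pi * x ≤ ‖cexp (I * x) - 1‖ := by
  rw [Complex.norm_exp_I_mul_ofReal_sub_one, Real.norm_eq_abs]
  have := Real.mul_le_sin (x := x / 2) (by linarith) (by linarith)
  refine le_trans ?_ (le_abs_self _)
  calc 2 / Real.pi * x = 2 * (2 / Real.pi * (x / 2)) := by ring
    _ ≤ _ := by linarith

lemma cot_le_cot {x y : ℝ} (hx : 0 < x) (hxy : x ≤ y) (hy : y ≤ Real.pi / 2) :
    Real.cot y ≤ Real.cot x := by
  have hsx : 0 < Real.sin x := Real.sin_pos_of_pos_of_lt_pi hx (by linarith [Real.pi_pos])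
  have hsy : Real.sin x ≤ Real.sin y :=
    Real.sin_le_sin_of_le_of_le_pi_div_two (by linarith [Real.pi_pos]) hy hxy
  have hc : Real.cos y ≤ Real.cos x :=
    Real.cos_le_cos_of_nonneg_of_le_pi hx.le (by linarith [Real.pi_pos]) hxy
  have hc0 : 0 ≤ Real.cos y := Real.cos_nonneg_of_mem_Icc ⟨by linarith, hy⟩
  rw [Real.cot_eq_cos_div_sin, Real.cot_eq_cos_div_sin]
  exact div_le_div₀ (hc0.trans hc) hc hsx hsy

/-- The Kusmin–Landau inequality, for a decreasing sequence of phase increments. -/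
theorem norm_sum_cexp_le {φ : ℕ → ℝ} {θ : ℝ} (hθ : 0 < θ) (L : ℕ)
    (hle : ∀ j < L, θ ≤ φ (j + 1) - φ j) (hπ : ∀ j < L, φ (j + 1) - φ j ≤ Real.pi)
    (hanti : ∀ j, j + 1 < L → φ (j + 2) - φ (j + 1) ≤ φ (j + 1) - φ j) :
    ‖∑ j ∈ Finset.range L, cexp (I * φ j)‖ ≤ 5 / θ := by
  obtain ⟨δ, hδ⟩ : ∃ δ : ℕ → ℝ, ∀ j, δ j = φ (j + 1) - φ j := ⟨_, fun _ => rfl⟩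
  obtain ⟨w, hw⟩ : ∃ w : ℕ → ℂ, ∀ j, w j = (cexp (I * δ j) - 1)⁻¹ := ⟨_, fun _ => rfl⟩
  simp only [← hδ] at hle hπ
  have hanti' : ∀ j, j + 1 < L → δ (j + 1) ≤ δ j := fun j hj => by
    rw [hδ, hδ]; exact hanti j hj
  have hδ0 : ∀ j < L, 0 < δ j := fun j hj => hθ.trans_le (hle j hj)
  have hnorm : ∀ j < L, 2 / Real.pi * θ ≤ ‖cexp (I * δ j) - 1‖ := fun j hj =>
    (mul_le_mul_of_nonneg_left (hle j hj) (by positivity)).trans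
      (two_div_pi_mul_le_norm (hδ0 j hj).le (hπ j hj))
  have hne : ∀ j < L, cexp (I * δ j) - 1 ≠ 0 := fun j hj h => by
    have := hnorm j hj
    rw [h, norm_zero] at this
    exact absurd this (not_le.2 (by positivity))
  have hwle : ∀ j < L, ‖w j‖ ≤ (5 / 3) / θ := fun j hj => by
    rw [hw, norm_inv]
    calc _ ≤ (2 / Real.pi * θ)⁻¹ := inv_anti₀ (by positivity) (hnorm j hj)
      _ = (Real.pi / 2) / θ := by field_simp
      _ ≤ _ := div_le_div_of_nonneg_right (by linarith [Real.pi_lt_d2]) hθ.le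
  have hsin : ∀ j < L, 0 < Real.sin (δ j / 2) := fun j hj =>
    Real.sin_pos_of_pos_of_lt_pi (by linarith [hδ0 j hj]) (by linarith [hπ j hj, Real.pi_pos])
  have hwc : ∀ j < L, w j = -1 / 2 - I / 2 * (Real.cot (δ j / 2) : ℝ) := fun j hj => by
    rw [hw, inv_cexp_sub_one (hsin j hj).ne']
  have hcot0 : ∀ j < L, 0 ≤ Real.cot (δ j / 2) := fun j hj => by
    rw [Real.cot_eq_cos_div_sin]
    exact div_nonneg (Real.cos_nonneg_of_mem_Icc
      ⟨by linarith [hδ0 j hj, Real.pi_pos], by linarith [hπ j hj]⟩) (hsin j hj).le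
  have hcotle : ∀ j < L, Real.cot (δ j / 2) / 2 ≤ (5 / 3) / θ := fun j hj => by
    refine le_trans ?_ (hwle j hj)
    refine le_trans ?_ (Complex.abs_im_le_norm _)
    rw [hwc j hj]
    simp only [sub_im, div_ofNat_im, neg_im, one_im, mul_im, div_ofNat_re, I_re, I_im, ofReal_re,
      ofReal_im]
    refine le_trans (le_of_eq ?_) (neg_le_abs _)
    ring
  have hstep : ∀ j < L, cexp (I * φ j) = (cexp (I * φ (j + 1)) - cexp (I * φ j)) * w j := by
    intro j hj
    have h1 : cexp (I * φ (j + 1)) = cexp (I * φ j) * cexp (I * δ j) := by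
      rw [← Complex.exp_add, hδ]; congr 1; push_cast; ring
    rw [h1, hw]
    field_simp [hne j hj]
  rcases Nat.eq_zero_or_pos L with rfl | hL
  · simp; positivity
  have key : ∀ n, n + 1 ≤ L → ‖∑ j ∈ Finset.range (n + 1), cexp (I * φ j)
      - cexp (I * φ (n + 1)) * w n‖
        ≤ ‖w 0‖ + (Real.cot (δ n / 2) - Real.cot (δ 0 / 2)) / 2 := by
    intro n
    induction n with
    | zero =>
      intro h
      rw [Finset.sum_range_one, hstep 0 h]
      refine le_of_eq ?_
      rw [zero_add, show (cexp (I * φ 1) - cexp (I * φ 0)) * w 0 - cexp (I * φ 1) * w 0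
        = - (cexp (I * φ 0) * w 0) by ring, norm_neg, norm_mul, norm_cexp_I_mul]
      ring
    | succ n ih =>
      intro h
      have h1 := ih (by omega)
      rw [Finset.sum_range_succ]
      have h2 : ∑ j ∈ Finset.range (n + 1), cexp (I * φ j) + cexp (I * φ (n + 1))
          - cexp (I * φ (n + 1 + 1)) * w (n + 1)
          = (∑ j ∈ Finset.range (n + 1), cexp (I * φ j) - cexp (I * φ (n + 1)) * w n)
            + cexp (I * φ (n + 1)) * (w n - w (n + 1)) := by
        linear_combination hstep (n + 1) h
      rw [h2]
      refine (norm_add_le _ _).trans ?_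
      rw [norm_mul, norm_cexp_I_mul, one_mul]
      have h3 : ‖w n - w (n + 1)‖
          = (Real.cot (δ (n + 1) / 2) - Real.cot (δ n / 2)) / 2 := by
        rw [hwc n (by omega), hwc (n + 1) h,
          show (-1 / 2 - I / 2 * (Real.cot (δ n / 2) : ℝ))
            - (-1 / 2 - I / 2 * (Real.cot (δ (n + 1) / 2) : ℝ))
            = I * ((Real.cot (δ (n + 1) / 2) - Real.cot (δ n / 2)) / 2 : ℝ) by push_cast; ring,
          norm_mul, norm_I, one_mul, norm_real, Real.norm_eq_abs, abs_of_nonneg]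
        have := cot_le_cot (x := δ (n + 1) / 2) (y := δ n / 2) (by linarith [hδ0 _ h])
          (by linarith [hanti' n h]) (by linarith [hπ n (by omega)])
        linarith
      linarith
  obtain ⟨n, rfl⟩ : ∃ n, L = n + 1 := ⟨L - 1, by omega⟩
  have h1 := key n le_rfl
  have h2 : ‖cexp (I * φ (n + 1)) * w n‖ ≤ (5 / 3) / θ := by
    rw [norm_mul, norm_cexp_I_mul, one_mul]; exact hwle n (by omega)
  have h3 := norm_sub_norm_le (∑ j ∈ Finset.range (n + 1), cexp (I * φ j))
    (cexp (I * φ (n + 1)) * w n)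
  have h4 := hcotle n (by omega)
  have h5 := hcot0 0 hL
  have h6 := hwle 0 hL
  calc _ ≤ (5 / 3) / θ + (5 / 3) / θ + (5 / 3) / θ := by linarith
    _ = 5 / θ := by ring

/-- The Kusmin–Landau inequality for a differentiable phase. -/
theorem norm_sum_cexp_le_of_hasDerivAt {Φ F : ℝ → ℝ} {X θ : ℝ} (hθ : 0 < θ) (L : ℕ)
    (hΦ : ∀ x, X ≤ x → HasDerivAt Φ (F x) x) (hF : ∀ x y, X ≤ x → x ≤ y → F y ≤ F x)
    (hle : θ ≤ F (X + L)) (hπ : F X ≤ Real.pi) :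
    ‖∑ j ∈ Finset.range L, cexp (I * Φ (X + j))‖ ≤ 5 / θ := by
  have hmvt : ∀ j : ℕ, ∃ ξ, X + j ≤ ξ ∧ ξ ≤ X + j + 1 ∧ Φ (X + (j + 1 : ℕ)) - Φ (X + j) = F ξ := by
    intro j
    have hj : (0 : ℝ) ≤ j := Nat.cast_nonneg j
    obtain ⟨ξ, hξ, h⟩ := exists_hasDerivAt_eq_slope Φ F (a := X + j) (b := X + j + 1) (by linarith)
      (fun x hx => (hΦ x (by linarith [hx.1])).continuousAt.continuousWithinAt)
      (fun x hx => hΦ x (by linarith [hx.1]))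
    refine ⟨ξ, hξ.1.le, hξ.2.le, ?_⟩
    rw [h, show X + j + 1 - (X + j) = 1 by ring, div_one]
    push_cast
    rw [add_assoc]
  choose ξ h1 h2 h3 using hmvt
  have hX : ∀ j, X ≤ ξ j := fun j => by
    have hj : (0 : ℝ) ≤ j := Nat.cast_nonneg j
    linarith [h1 j]
  refine norm_sum_cexp_le (φ := fun j => Φ (X + j)) hθ L (fun j hj => ?_) (fun j hj => ?_)
    (fun j hj => ?_)
  · refine hle.trans ((hF (ξ j) (X + L) (hX j) ?_).trans_eq (h3 j).symm)
    have : ((j : ℝ) + 1) ≤ L := by exact_mod_cast hj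
    linarith [h2 j]
  · exact (h3 j).trans_le ((hF X (ξ j) le_rfl (hX j)).trans hπ)
  · refine (h3 (j + 1)).trans_le (le_trans (hF (ξ j) _ (hX j) ?_) (h3 j).symm.le)
    have := h1 (j + 1)
    push_cast at this
    linarith [h2 j]

/-- The Weyl–van der Corput inequality. -/
theorem weyl_vanDerCorput {z : ℕ → ℂ} (hz : ∀ j, ‖z j‖ ≤ 1) (L H : ℕ) (hH : 0 < H) :
    H * ‖∑ j ∈ Finset.range L, z j‖ ^ 2 ≤ (L + H) * (L + 2 * ∑ d ∈ Finset.Ico 1 H,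
      ‖∑ j ∈ Finset.range (L - d), z (j + d) * (starRingEnd ℂ) (z j)‖) := by
  obtain ⟨Y, hY⟩ : ∃ Y : ℕ → ℕ → ℂ, ∀ m h, Y m h = if h ≤ m ∧ m - h < L then z (m - h) else 0 :=
    ⟨_, fun _ _ => rfl⟩
  obtain ⟨c, hc⟩ : ∃ c : ℕ → ℝ, ∀ d, c d =
      ‖∑ j ∈ Finset.range (L - d), z (j + d) * (starRingEnd ℂ) (z j)‖ := ⟨_, fun _ => rfl⟩
  have hc0 : ∀ d, 0 ≤ c d := fun d => by rw [hc]; positivity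
  obtain ⟨C, hC⟩ : ∃ C : ℕ → ℕ → ℂ, ∀ h k, C h k =
      ∑ m ∈ Finset.range (L + H), Y m h * (starRingEnd ℂ) (Y m k) := ⟨_, fun _ _ => rfl⟩
  have hYsum : ∀ h < H, ∑ m ∈ Finset.range (L + H), Y m h = ∑ j ∈ Finset.range L, z j := by
    intro h hh
    simp only [hY]
    rw [← Finset.sum_filter]
    refine Finset.sum_bij' (fun m _ => m - h) (fun j _ => j + h) ?_ ?_ ?_ ?_ fun _ _ => rfl <;>
      intro m hm <;> simp only [Finset.mem_filter, Finset.mem_range] at hm ⊢ <;> omega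
  have hCle : ∀ h k, h ≤ k → k < H → ‖C h k‖ = c (k - h) := by
    intro h k hhk hk
    rw [hC, hc]
    congr 1
    have : ∀ m ∈ Finset.range (L + H), Y m h * (starRingEnd ℂ) (Y m k) =
        if k ≤ m ∧ m - h < L then z (m - h) * (starRingEnd ℂ) (z (m - k)) else 0 := by
      intro m _
      rw [hY, hY]
      by_cases h1 : k ≤ m ∧ m - h < L
      · rw [if_pos h1, if_pos (by omega), if_pos (by omega)]
      · rw [if_neg h1]
        by_cases h2 : h ≤ m ∧ m - h < L
        · rw [if_neg (show ¬ (k ≤ m ∧ m - k < L) by omega)]; simp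
        · rw [if_neg h2, zero_mul]
    rw [Finset.sum_congr rfl this, ← Finset.sum_filter]
    refine Finset.sum_bij' (fun m _ => m - k) (fun j _ => j + k) ?_ ?_ ?_ ?_ fun m hm => ?_
    on_goal 5 => rw [show m - k + (k - h) = m - h by have := (Finset.mem_filter.1 hm).2; omega]
    all_goals intro m hm; simp only [Finset.mem_filter, Finset.mem_range] at hm ⊢; omega
  have hCsymm : ∀ h k, ‖C h k‖ = ‖C k h‖ := by
    intro h k
    rw [← Complex.norm_conj (C k h), hC, hC, map_sum]
    congr 2 with m
    rw [map_mul, Complex.conj_conj, mul_comm]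
  have hc0L : c 0 ≤ L := by
    rw [hc]
    refine (norm_sum_le _ _).trans ?_
    calc _ ≤ ∑ j ∈ Finset.range (L - 0), (1 : ℝ) := by
          refine Finset.sum_le_sum fun j _ => ?_
          rw [norm_mul, Complex.norm_conj]
          exact mul_le_one₀ (hz _) (norm_nonneg _) (hz _)
      _ = L := by simp
  have hrow : ∀ h < H, ∑ k ∈ Finset.range H, ‖C h k‖ ≤ L + 2 * ∑ d ∈ Finset.Ico 1 H, c d := by
    intro h hh
    rw [← Finset.sum_range_add_sum_Ico _ hh.le, Finset.sum_eq_sum_Ico_succ_bot hh]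
    have himage {s : Finset ℕ} {g : ℕ → ℕ} (hg : Set.InjOn g s)
        (hs : ∀ k ∈ s, g k ∈ Finset.Ico 1 H ∧ ‖C h k‖ = c (g k)) :
        ∑ k ∈ s, ‖C h k‖ ≤ ∑ d ∈ Finset.Ico 1 H, c d := by
      rw [Finset.sum_congr rfl fun k hk => (hs k hk).2, ← Finset.sum_image hg]
      exact Finset.sum_le_sum_of_subset_of_nonneg
        (Finset.image_subset_iff.2 fun k hk => (hs k hk).1) fun d _ _ => hc0 d
    have h1 : ∑ k ∈ Finset.range h, ‖C h k‖ ≤ ∑ d ∈ Finset.Ico 1 H, c d := by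
      refine himage (g := fun k => h - k) (fun a ha b hb hab => ?_) fun k hk => ?_
      · simp only [Finset.coe_range, Set.mem_Iio] at ha hb hab
        omega
      · have := Finset.mem_range.1 hk
        exact ⟨Finset.mem_Ico.2 (by omega), by rw [hCsymm, hCle k h (by omega) hh]⟩
    have h2 : ∑ k ∈ Finset.Ico (h + 1) H, ‖C h k‖ ≤ ∑ d ∈ Finset.Ico 1 H, c d := by
      refine himage (g := fun k => k - h) (fun a ha b hb hab => ?_) fun k hk => ?_
      · simp only [Finset.coe_Ico, Set.mem_Ico] at ha hb hab
        omega
      · have := Finset.mem_Ico.1 hk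
        exact ⟨Finset.mem_Ico.2 (by omega), hCle h k (by omega) this.2⟩
    have h3 : ‖C h h‖ ≤ L := by rw [hCle h h le_rfl hh, Nat.sub_self]; exact hc0L
    linarith
  have hsq : ((∑ m ∈ Finset.range (L + H), ‖∑ h ∈ Finset.range H, Y m h‖ ^ 2 : ℝ) : ℂ)
      = ∑ h ∈ Finset.range H, ∑ k ∈ Finset.range H, C h k := by
    push_cast
    simp only [hC]
    rw [Finset.sum_congr rfl fun h _ => Finset.sum_comm, Finset.sum_comm]
    refine Finset.sum_congr rfl fun m _ => ?_
    rw [← Complex.mul_conj', map_sum, Finset.sum_mul_sum]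
  have hS : (H : ℂ) * ∑ j ∈ Finset.range L, z j
      = ∑ m ∈ Finset.range (L + H), ∑ h ∈ Finset.range H, Y m h := by
    rw [Finset.sum_comm, Finset.sum_congr rfl fun h hh => hYsum h (Finset.mem_range.1 hh)]
    simp
  have hbound : ∑ m ∈ Finset.range (L + H), ‖∑ h ∈ Finset.range H, Y m h‖ ^ 2
      ≤ H * (L + 2 * ∑ d ∈ Finset.Ico 1 H, c d) := by
    have h0 : 0 ≤ ∑ m ∈ Finset.range (L + H), ‖∑ h ∈ Finset.range H, Y m h‖ ^ 2 := by positivity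
    rw [← abs_of_nonneg h0, ← Real.norm_eq_abs, ← Complex.norm_real, hsq]
    refine (norm_sum_le _ _).trans ?_
    calc _ ≤ ∑ h ∈ Finset.range H, (L + 2 * ∑ d ∈ Finset.Ico 1 H, c d) :=
          Finset.sum_le_sum fun h hh => (norm_sum_le _ _).trans (hrow h (Finset.mem_range.1 hh))
      _ = _ := by simp [mul_add]
  have hCS : ((H : ℝ) * ‖∑ j ∈ Finset.range L, z j‖) ^ 2
      ≤ (L + H) * ∑ m ∈ Finset.range (L + H), ‖∑ h ∈ Finset.range H, Y m h‖ ^ 2 := by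
    have h1 : (H : ℝ) * ‖∑ j ∈ Finset.range L, z j‖
        ≤ ∑ m ∈ Finset.range (L + H), ‖∑ h ∈ Finset.range H, Y m h‖ := by
      have : (H : ℝ) * ‖∑ j ∈ Finset.range L, z j‖ = ‖(H : ℂ) * ∑ j ∈ Finset.range L, z j‖ := by
        rw [norm_mul, Complex.norm_natCast]
      rw [this, hS]
      exact norm_sum_le _ _
    calc _ ≤ (∑ m ∈ Finset.range (L + H), ‖∑ h ∈ Finset.range H, Y m h‖) ^ 2 := by gcongr
      _ ≤ _ := by
        refine sq_sum_le_card_mul_sum_sq.trans_eq ?_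
        rw [Finset.card_range]; push_cast; ring
  have hH' : (0 : ℝ) < H := by exact_mod_cast hH
  simp only [hc] at hbound
  refine le_of_mul_le_mul_left ?_ hH'
  calc _ = ((H : ℝ) * ‖∑ j ∈ Finset.range L, z j‖) ^ 2 := by ring
    _ ≤ _ := hCS
    _ ≤ _ := mul_le_mul_of_nonneg_left hbound (by positivity)
    _ = _ := by ring

lemma sum_Ico_one_div_le (H : ℕ) :
    ∑ d ∈ Finset.Ico 1 H, 1 / (d : ℝ) ≤ 1 + Real.log H := by
  have h1 : ∑ d ∈ Finset.Ico 1 H, 1 / (d : ℝ) ≤ ∑ d ∈ Finset.Icc 1 H, 1 / (d : ℝ) :=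
    Finset.sum_le_sum_of_subset_of_nonneg
      (fun d hd => by simp only [Finset.mem_Ico, Finset.mem_Icc] at hd ⊢; omega)
      (fun d _ _ => by positivity)
  refine h1.trans ?_
  have := harmonic_le_one_add_log H
  rw [harmonic_eq_sum_Icc] at this
  push_cast at this
  simpa [one_div] using this

lemma norm_sum_cexp_neg (s : Finset ℕ) (φ : ℕ → ℝ) :
    ‖∑ j ∈ s, cexp (I * φ j)‖ = ‖∑ j ∈ s, cexp (I * (-φ j : ℝ))‖ := by
  rw [← Complex.norm_conj, map_sum]
  congr 2 with j
  rw [← Complex.exp_conj, map_mul, conj_I, conj_ofReal]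
  push_cast
  ring_nf

lemma weyl_vanDerCorput_phase {Φ : ℝ → ℝ} {X : ℝ} {E : ℕ → ℝ} (L H : ℕ) (hH : 0 < H)
    (hE : ∀ d ∈ Finset.Ico 1 H, ‖∑ j ∈ Finset.range (L - d),
      cexp (I * (Φ (X + j + d) - Φ (X + j) : ℝ))‖ ≤ E d) :
    H * ‖∑ j ∈ Finset.range L, cexp (I * Φ (X + j))‖ ^ 2
      ≤ (L + H) * (L + 2 * ∑ d ∈ Finset.Ico 1 H, E d) := by
  refine (weyl_vanDerCorput (z := fun j : ℕ => cexp (I * Φ (X + j)))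
    (fun j => (norm_cexp_I_mul _).le) L H hH).trans ?_
  refine mul_le_mul_of_nonneg_left ?_ (by positivity)
  gcongr with d hd
  refine le_trans (le_of_eq ?_) (hE d hd)
  congr 2 with j
  rw [← Complex.exp_conj, map_mul, conj_I, conj_ofReal, ← Complex.exp_add]
  congr 1
  push_cast
  rw [add_assoc]
  ring

lemma norm_sum_cexp_log_le {t X : ℝ} (ht : 0 < t) (hX : 0 < X) (htX : t ≤ X) (L : ℕ) :
    ‖∑ j ∈ Finset.range L, cexp (I * (t * Real.log (X + j) : ℝ))‖ ≤ 5 * ((X + L) / t) := by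
  have := norm_sum_cexp_le_of_hasDerivAt (Φ := fun x => t * Real.log x) (F := fun x => t * x⁻¹)
    (X := X) (θ := t * (X + L)⁻¹) (by positivity) L
    (fun x hx => (Real.hasDerivAt_log (hX.trans_le hx).ne').const_mul t)
    (fun x y hx hxy => mul_le_mul_of_nonneg_left (inv_anti₀ (hX.trans_le hx) hxy) ht.le) le_rfl
    (by
      have : t * X⁻¹ ≤ 1 := by rw [← div_eq_mul_inv, div_le_one hX]; exact htX
      linarith [Real.pi_gt_three])
  refine this.trans (le_of_eq ?_)
  field_simp

lemma norm_sum_cexp_log_sub_le {t X : ℝ} (ht : 0 < t) (hX : 0 < X) {h : ℕ} (hh : 0 < h)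
    (htX : t * h ≤ X ^ 2) (L : ℕ) :
    ‖∑ j ∈ Finset.range L, cexp (I * (t * Real.log (X + j + h) - t * Real.log (X + j) : ℝ))‖
      ≤ 5 * ((X + L + h) ^ 2 / (t * h)) := by
  have hh' : (0 : ℝ) < h := by exact_mod_cast hh
  have := norm_sum_cexp_le_of_hasDerivAt
    (Φ := fun x => t * Real.log x - t * Real.log (x + h)) (F := fun x => t * h / (x * (x + h)))
    (X := X) (θ := t * h / (X + L + h) ^ 2) (by positivity) L
    (fun x hx => by
      have hx0 : 0 < x := hX.trans_le hx
      refine (((Real.hasDerivAt_log hx0.ne').const_mul t).sub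
        ((((hasDerivAt_id x).add_const (h : ℝ)).log (by simp; positivity)).const_mul t)).congr_deriv
        ?_
      simp only [id]
      field_simp
      ring)
    (fun x y hx hxy => by
      have hx0 : 0 < x := hX.trans_le hx
      have hy0 : 0 < y := hx0.trans_le hxy
      gcongr) (by
      refine div_le_div_of_nonneg_left (by positivity) (by positivity) ?_
      nlinarith [show (0 : ℝ) ≤ L from Nat.cast_nonneg L, mul_pos hX hh',
        mul_nonneg (show (0 : ℝ) ≤ L from Nat.cast_nonneg L) hh'.le])
    (by
      have : t * h / (X * (X + h)) ≤ 1 := by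
        rw [div_le_one (by positivity)]; nlinarith
      linarith [Real.pi_gt_three])
  rw [norm_sum_cexp_neg]
  refine le_trans (le_of_eq ?_) (this.trans (le_of_eq ?_))
  · congr 2 with j
    rw [neg_sub]
  · field_simp

lemma mul_mul_le_pow_three {a b c m : ℝ} (ha : 0 ≤ a) (hb : 0 ≤ b) (hc : 0 ≤ c) (ham : a ≤ m)
    (hbm : b ≤ m) (hcm : c ≤ m) : a * b * c ≤ m ^ 3 :=
  (mul_le_mul (mul_le_mul ham hbm hb (ha.trans ham)) hcm hc
    (mul_nonneg (ha.trans ham) (ha.trans ham))).trans_eq (by ring)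

lemma pow_three_le_mul_mul {a b c m : ℝ} (hm : 0 ≤ m) (ham : m ≤ a) (hbm : m ≤ b) (hcm : m ≤ c) :
    m ^ 3 ≤ a * b * c :=
  le_trans (le_of_eq (by ring)) (mul_le_mul (mul_le_mul ham hbm hm (hm.trans ham)) hcm hm
    (mul_nonneg (hm.trans ham) (hm.trans hbm)))

lemma norm_sum_cexp_log_sub_sub_le {t X : ℝ} (ht : 0 < t) (hX : 0 < X) {h k : ℕ} (hh : 0 < h)
    (hk : 0 < k) (htX : 2 * t * h * k ≤ 3 * X ^ 3) (L : ℕ) :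
    ‖∑ j ∈ Finset.range L, cexp (I * ((t * Real.log (X + j + k + h) - t * Real.log (X + j + k))
        - (t * Real.log (X + j + h) - t * Real.log (X + j)) : ℝ))‖
      ≤ 5 * ((X + L + h + k) ^ 3 / (t * h * k)) := by
  have hh' : (0 : ℝ) < h := by exact_mod_cast hh
  have hk' : (0 : ℝ) < k := by exact_mod_cast hk
  have hL : (0 : ℝ) ≤ L := Nat.cast_nonneg L
  have := norm_sum_cexp_le_of_hasDerivAt
    (Φ := fun x => (t * Real.log (x + (k + h)) - t * Real.log (x + k))
      - (t * Real.log (x + h) - t * Real.log x))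
    (F := fun x => t * h * k / ((x + h) * (x + k) * (x + (k + h)))
      + t * h * k / (x * (x + h) * (x + k)))
    (X := X) (θ := t * h * k / (X + L + h + k) ^ 3) (by positivity) L
    (fun x hx => by
      have hx0 : 0 < x := hX.trans_le hx
      have hd : ∀ a : ℝ, 0 ≤ a → HasDerivAt (fun x => t * Real.log (x + a)) (t * (1 / (x + a))) x :=
        fun a ha => (((hasDerivAt_id x).add_const a).log (by simp; positivity)).const_mul t
      refine (((hd (k + h) (by positivity)).sub (hd k hk'.le)).sub
        ((hd h hh'.le).sub ((Real.hasDerivAt_log hx0.ne').const_mul t))).congr_deriv ?_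
      field_simp
      ring)
    (fun x y hx hxy => by
      have hx0 : 0 < x := hX.trans_le hx
      have hy0 : 0 < y := hx0.trans_le hxy
      gcongr) (by
      have h1 : t * h * k / (X + L + h + k) ^ 3
          ≤ t * h * k / ((X + L + h) * (X + L + k) * (X + L + (k + h))) := by
        refine div_le_div_of_nonneg_left (by positivity) (by positivity) ?_
        exact mul_mul_le_pow_three (by positivity) (by positivity) (by positivity) (by linarith)
          (by linarith) (by linarith)
      have h2 : 0 ≤ t * h * k / ((X + L) * (X + L + h) * (X + L + k)) := by positivity
      linarith)
    (by
      have h0 : X ^ 3 ≤ X * (X + h) * (X + k) := by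
        exact pow_three_le_mul_mul hX.le (by linarith) (by linarith) (by linarith)
      have h0' : X ^ 3 ≤ (X + h) * (X + k) * (X + (k + h)) := by
        exact pow_three_le_mul_mul hX.le (by linarith) (by linarith) (by linarith)
      have h1 : t * h * k / (X * (X + h) * (X + k)) ≤ t * h * k / X ^ 3 := by
        gcongr
      have h2 : t * h * k / ((X + h) * (X + k) * (X + (k + h))) ≤ t * h * k / X ^ 3 := by
        gcongr
      have h3 : t * h * k / X ^ 3 + t * h * k / X ^ 3 ≤ 3 := by
        rw [← add_div, div_le_iff₀ (by positivity)]; linarith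
      linarith [Real.pi_gt_three])
  refine le_trans (le_of_eq ?_) (this.trans (le_of_eq ?_))
  · congr 2 with j
    simp only [add_assoc]
  · field_simp

/-- One Weyl step followed by Kusmin–Landau. -/
lemma norm_sum_cexp_log_sq_le {t X : ℝ} (ht : 1 ≤ t) (hX : 1 ≤ X) (htX : t ≤ X ^ 2)
    (hXt : X ≤ t) (L : ℕ) (hL : L ≤ 2 * X) :
    ‖∑ j ∈ Finset.range L, cexp (I * (t * Real.log (X + j) : ℝ))‖ ^ 2
      ≤ 972 * (t * (1 + Real.log t)) := by
  obtain ⟨H, hHdef⟩ : ∃ H, H = ⌊X ^ 2 / t⌋₊ := ⟨_, rfl⟩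
  have ht0 : 0 < t := by linarith
  have hX0 : 0 < X := by linarith
  have hq1 : 1 ≤ X ^ 2 / t := by rwa [one_le_div ht0]
  have hH1 : 1 ≤ H := by rw [hHdef]; exact Nat.one_le_floor_iff _ |>.2 hq1
  have hHle : (H : ℝ) ≤ X ^ 2 / t := by rw [hHdef]; exact Nat.floor_le (by positivity)
  have hHlt : X ^ 2 / t < H + 1 := by rw [hHdef]; exact Nat.lt_floor_add_one _
  have hH1' : (1 : ℝ) ≤ H := by exact_mod_cast hH1
  have hHX : (H : ℝ) ≤ X := hHle.trans (by rw [div_le_iff₀ ht0]; nlinarith)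
  have hl : Real.log H ≤ Real.log t := Real.log_le_log (by linarith) (hHX.trans hXt)
  have hl0 : 0 ≤ Real.log H := Real.log_nonneg hH1'
  have hE : ∀ d ∈ Finset.Ico 1 H, ‖∑ j ∈ Finset.range (L - d),
      cexp (I * (t * Real.log (X + j + d) - t * Real.log (X + j) : ℝ))‖
        ≤ 80 * X ^ 2 / t * (1 / d) := by
    intro d hd
    have hd1 := (Finset.mem_Ico.1 hd).1
    have hd2 : (d : ℝ) ≤ H := by exact_mod_cast (Finset.mem_Ico.1 hd).2.le
    have hd0 : (0 : ℝ) < d := by exact_mod_cast hd1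
    have hsub : ((L - d : ℕ) : ℝ) ≤ L := by exact_mod_cast Nat.sub_le _ _
    refine (norm_sum_cexp_log_sub_le ht0 hX0 hd1 ?_ (L - d)).trans ?_
    · have := hd2.trans hHle
      rw [le_div_iff₀ ht0] at this
      linarith
    · calc 5 * ((X + (L - d : ℕ) + d) ^ 2 / (t * d)) ≤ 5 * ((4 * X) ^ 2 / (t * d)) := by
            gcongr; linarith
        _ = _ := by field_simp; ring
  have key := weyl_vanDerCorput_phase (Φ := fun x => t * Real.log x) L H hH1 hE
  rw [← Finset.mul_sum] at key
  have hsum := sum_Ico_one_div_le H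
  have hsum' : ∑ d ∈ Finset.Ico 1 H, 1 / (d : ℝ) ≤ 1 + Real.log t := by linarith
  have hS : 0 ≤ ‖∑ j ∈ Finset.range L, cexp (I * (t * Real.log (X + j) : ℝ))‖ ^ 2 := by positivity
  obtain ⟨S, hSdef⟩ : ∃ S, S = ‖∑ j ∈ Finset.range L, cexp (I * (t * Real.log (X + j) : ℝ))‖ ^ 2 :=
    ⟨_, rfl⟩
  rw [← hSdef] at hS key ⊢
  have hq2 : X ^ 2 / t ≤ 2 * H := by linarith
  have h1 : X ^ 2 / t * S ≤ 2 * (3 * X * (2 * X + 160 * X ^ 2 / t * (1 + Real.log t))) := by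
    calc X ^ 2 / t * S ≤ 2 * (H * S) := by nlinarith
      _ ≤ 2 * ((L + H) * (L + 2 * (80 * X ^ 2 / t * ∑ d ∈ Finset.Ico 1 H, 1 / (d : ℝ)))) := by
          linarith
      _ ≤ 2 * ((L + H) * (L + 2 * (80 * X ^ 2 / t * (1 + Real.log t)))) := by gcongr
      _ ≤ 2 * ((3 * X) * (2 * X + 2 * (80 * X ^ 2 / t * (1 + Real.log t)))) := by
          have : 0 ≤ 80 * X ^ 2 / t * (1 + Real.log t) := by
            have : 0 ≤ 1 + Real.log t := by linarith
            positivity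
          gcongr
          linarith
      _ = _ := by ring
  have h2 : S ≤ 12 * t + 960 * X * (1 + Real.log t) := by
    have h3 : X ^ 2 / t * S ≤ X ^ 2 / t * (12 * t + 960 * X * (1 + Real.log t)) := by
      refine h1.trans (le_of_eq ?_)
      field_simp
      ring
    exact le_of_mul_le_mul_left h3 (by positivity)
  have h4 : X * (1 + Real.log t) ≤ t * (1 + Real.log t) := by
    gcongr; linarith
  nlinarith

/-- Two Weyl steps followed by Kusmin–Landau. -/
lemma norm_sum_cexp_log_sq_le_sqrt {t X V : ℝ} (ht : 1 ≤ t) (hX : 1 ≤ X) (hV : 1 ≤ V)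
    (hXV : X ^ 2 ≤ t * V) {H : ℕ} (hH : 1 ≤ H) (hHX : H ≤ X) (hHt : H ≤ t)
    (htH : 2 * t * H ^ 2 ≤ 3 * X ^ 3) (L : ℕ) (hL : L ≤ 2 * X) :
    ‖∑ j ∈ Finset.range L, cexp (I * (t * Real.log (X + j) : ℝ))‖ ^ 2
      ≤ 400 * (X ^ 2 * √(V * (1 + Real.log t) / H)) := by
  have ht0 : 0 < t := by linarith
  have hX0 : 0 < X := by linarith
  have hH1 : (1 : ℝ) ≤ H := by exact_mod_cast hH
  have hl : Real.log H ≤ Real.log t := Real.log_le_log (by linarith) hHt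
  have hl0 : 0 ≤ Real.log H := Real.log_nonneg hH1
  obtain ⟨W, hW⟩ : ∃ W, W = V * (1 + Real.log t) := ⟨_, rfl⟩
  have hW1 : 1 ≤ W := by rw [hW]; nlinarith
  have hsum : ∑ d ∈ Finset.Ico 1 H, 1 / (d : ℝ) ≤ 1 + Real.log t := by
    linarith [sum_Ico_one_div_le H]
  have hsum0 : 0 ≤ ∑ d ∈ Finset.Ico 1 H, 1 / (d : ℝ) := by positivity
  rw [← hW]
  have hinner : ∀ d ∈ Finset.Ico 1 H, ‖∑ j ∈ Finset.range (L - d),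
      cexp (I * (t * Real.log (X + j + d) - t * Real.log (X + j) : ℝ))‖
        ≤ 62 * (X * √(W / H)) := by
    intro d hd
    have hd1 := (Finset.mem_Ico.1 hd).1
    have hd1' : (1 : ℝ) ≤ d := by exact_mod_cast hd1
    have hd2 : (d : ℝ) ≤ H := by exact_mod_cast (Finset.mem_Ico.1 hd).2.le
    have hsub : ((L - d : ℕ) : ℝ) ≤ L := by exact_mod_cast Nat.sub_le _ _
    have hE : ∀ k ∈ Finset.Ico 1 H, ‖∑ j ∈ Finset.range (L - d - k),
        cexp (I * ((t * Real.log (X + j + k + d) - t * Real.log (X + j + k))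
          - (t * Real.log (X + j + d) - t * Real.log (X + j)) : ℝ))‖
          ≤ 625 * X ^ 3 / t * (1 / k) := by
      intro k hk
      have hk1 := (Finset.mem_Ico.1 hk).1
      have hk1' : (1 : ℝ) ≤ k := by exact_mod_cast hk1
      have hk2 : (k : ℝ) ≤ H := by exact_mod_cast (Finset.mem_Ico.1 hk).2.le
      have hsub' : ((L - d - k : ℕ) : ℝ) ≤ L := by
        exact_mod_cast (Nat.sub_le _ _).trans (Nat.sub_le _ _)
      refine (norm_sum_cexp_log_sub_sub_le ht0 hX0 hd1 hk1 ?_ (L - d - k)).trans ?_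
      · refine le_trans ?_ htH
        rw [pow_two, ← mul_assoc]
        gcongr
      · calc 5 * ((X + (L - d - k : ℕ) + d + k) ^ 3 / (t * d * k))
            ≤ 5 * ((5 * X) ^ 3 / (t * 1 * k)) := by
              gcongr; linarith
          _ = _ := by field_simp; ring
    have key := weyl_vanDerCorput_phase
      (Φ := fun x => t * Real.log (x + d) - t * Real.log x) (L - d) H hH hE
    rw [← Finset.mul_sum] at key
    refine abs_le_of_sq_le_sq' ?_ (by positivity) |>.2
    rw [mul_pow, mul_pow, Real.sq_sqrt (by positivity)]
    have hXX : X ^ 3 / t ≤ X * V := by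
      rw [div_le_iff₀ ht0]; nlinarith
    have h1 : H * ‖∑ j ∈ Finset.range (L - d),
      cexp (I * (t * Real.log (X + j + d) - t * Real.log (X + j) : ℝ))‖ ^ 2
        ≤ 3 * X * (2 * X + 1250 * (X * W)) := by
      refine key.trans ?_
      refine mul_le_mul (by linarith) ?_ (by positivity) (by positivity)
      calc ((L - d : ℕ) : ℝ) + 2 * (625 * X ^ 3 / t * ∑ d ∈ Finset.Ico 1 H, 1 / (d : ℝ))
          ≤ 2 * X + 2 * (625 * (X ^ 3 / t) * (1 + Real.log t)) := by
            rw [mul_div_assoc]; gcongr; linarith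
        _ ≤ 2 * X + 2 * (625 * (X * V) * (1 + Real.log t)) := by
            have : 0 ≤ 1 + Real.log t := by linarith
            gcongr
        _ = _ := by rw [hW]; ring
    have h2 : 62 ^ 2 * (X ^ 2 * (W / H)) = 62 ^ 2 * (X ^ 2 * W) / H := by ring
    rw [h2, le_div_iff₀ (by linarith), mul_comm]
    refine h1.trans ?_
    nlinarith [mul_le_mul_of_nonneg_left hW1 (sq_nonneg X)]
  have key := weyl_vanDerCorput_phase (Φ := fun x => t * Real.log x) L H hH hinner
  rw [Finset.sum_const, Nat.card_Ico, nsmul_eq_mul] at key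
  have hs0 : 0 ≤ √(W / H) := Real.sqrt_nonneg _
  have hs1 : 1 / (H : ℝ) ≤ √(W / H) := by
    refine Real.le_sqrt_of_sq_le ?_
    rw [div_pow, one_pow, pow_two]
    gcongr
    · nlinarith
  have hHsub : ((H - 1 : ℕ) : ℝ) ≤ H := by exact_mod_cast Nat.sub_le _ _
  have h1 : H * ‖∑ j ∈ Finset.range L, cexp (I * (t * Real.log (X + j) : ℝ))‖ ^ 2
      ≤ 3 * X * (2 * X + 2 * (H * (62 * (X * √(W / H))))) := by
    refine key.trans ?_
    gcongr
    linarith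
  have h2 : 3 * X * (2 * X + 2 * (H * (62 * (X * √(W / H)))))
      = H * (6 * X ^ 2 * (1 / H) + 372 * (X ^ 2 * √(W / H))) := by
    field_simp
    ring
  rw [h2] at h1
  have h3 := le_of_mul_le_mul_left h1 (by linarith)
  refine h3.trans ?_
  nlinarith [mul_le_mul_of_nonneg_left hs1 (sq_nonneg X), mul_nonneg (sq_nonneg X) hs0]

lemma norm_sum_cexp_log_le_add {t X : ℝ} (ht : 1 ≤ t) (hX : 1 ≤ X) (L : ℕ) (hL : L ≤ 2 * X) :
    ‖∑ j ∈ Finset.range L, cexp (I * (t * Real.log (X + j) : ℝ))‖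
      ≤ 441 * (√X * t ^ (197 / 800 : ℝ) + X / t) := by
  have ht0 : 0 < t := by linarith
  have hX0 : 0 < X := by linarith
  obtain ⟨u, hu⟩ : ∃ u, u = t ^ (1 / 400 : ℝ) := ⟨_, rfl⟩
  have hu1 : 1 ≤ u := hu ▸ Real.one_le_rpow ht (by norm_num)
  have hu0 : 0 < u := by linarith
  have hut : t = u ^ 400 := by
    rw [hu, ← Real.rpow_natCast, ← Real.rpow_mul ht0.le]; norm_num
  have huv : (t ^ (197 / 800 : ℝ)) ^ 2 = u ^ 197 := by
    rw [hu, ← Real.rpow_natCast, ← Real.rpow_natCast, ← Real.rpow_mul ht0.le,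
      ← Real.rpow_mul ht0.le]
    norm_num
  have hlog : 1 + Real.log t ≤ 200 * u ^ 2 := by
    have h1 : Real.log t = 200 * Real.log (u ^ 2) := by
      rw [hut, Real.log_pow, Real.log_pow]; push_cast; ring
    have h2 := Real.log_le_sub_one_of_pos (show 0 < u ^ 2 by positivity)
    linarith
  have hlog0 : 0 ≤ Real.log t := Real.log_nonneg ht
  have hmono : ∀ {a b : ℕ}, a ≤ b → u ^ a ≤ u ^ b := fun h => pow_le_pow_right₀ hu1 h
  by_cases hXt : t ≤ X
  · refine (norm_sum_cexp_log_le ht0 hX0 hXt L).trans ?_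
    have h1 : (X + L) / t ≤ 3 * (X / t) := by
      rw [← mul_div_assoc]; gcongr; linarith
    have h2 : 0 ≤ √X * t ^ (197 / 800 : ℝ) := by positivity
    have h3 : 0 ≤ X / t := by positivity
    linarith
  push Not at hXt
  have h3 : 0 ≤ X / t := by positivity
  suffices h : ‖∑ j ∈ Finset.range L, cexp (I * (t * Real.log (X + j) : ℝ))‖ ^ 2
      ≤ 441 ^ 2 * (X * u ^ 197) by
    have := (sq_le_sq₀ (norm_nonneg _) (by positivity)).1
      (h.trans_eq (b := 441 ^ 2 * (X * u ^ 197)) (c := (441 * (√X * t ^ (197 / 800 : ℝ))) ^ 2)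
        (by rw [mul_pow, mul_pow, Real.sq_sqrt hX0.le, huv]))
    linarith
  by_cases h1 : u ^ 205 ≤ X
  · have h2 : t ≤ X ^ 2 := by
      calc t = u ^ 400 := hut
        _ ≤ u ^ 410 := hmono (by norm_num)
        _ = (u ^ 205) ^ 2 := by ring
        _ ≤ X ^ 2 := by gcongr
    refine (norm_sum_cexp_log_sq_le ht hX h2 hXt.le L hL).trans ?_
    calc 972 * (t * (1 + Real.log t)) ≤ 972 * (u ^ 400 * (200 * u ^ 2)) := by
          rw [← hut]; gcongr
      _ = 194400 * (u ^ 205 * u ^ 197) := by ring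
      _ ≤ 194400 * (X * u ^ 197) := by gcongr
      _ ≤ _ := by gcongr; norm_num
  push Not at h1
  by_cases h2 : u ^ 195 ≤ X
  · have hf1 : 1 ≤ u ^ 40 := one_le_pow₀ hu1
    have hH1 : 1 ≤ ⌊u ^ 40⌋₊ := (Nat.one_le_floor_iff _).2 hf1
    have hHle : (⌊u ^ 40⌋₊ : ℝ) ≤ u ^ 40 := Nat.floor_le (by positivity)
    have hHge : u ^ 40 ≤ 2 * (⌊u ^ 40⌋₊ : ℝ) := by
      have h4 := Nat.lt_floor_add_one (u ^ 40)
      have h5 : (1 : ℝ) ≤ (⌊u ^ 40⌋₊ : ℝ) := by exact_mod_cast hH1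
      linarith
    obtain ⟨H, hH⟩ : ∃ H, H = ⌊u ^ 40⌋₊ := ⟨_, rfl⟩
    rw [← hH] at hH1 hHle hHge
    have hHpos : (0 : ℝ) < H := by exact_mod_cast hH1
    refine (norm_sum_cexp_log_sq_le_sqrt ht hX (V := u ^ 10) (one_le_pow₀ hu1) ?_ hH1
      ((hHle.trans (hmono (by norm_num))).trans h2)
      (hHle.trans ((hmono (by norm_num)).trans_eq hut.symm)) ?_ L hL).trans ?_
    · calc X ^ 2 ≤ (u ^ 205) ^ 2 := by gcongr
        _ = t * u ^ 10 := by rw [hut]; ring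
    · calc 2 * t * (H : ℝ) ^ 2 ≤ 2 * u ^ 400 * (u ^ 40) ^ 2 := by rw [← hut]; gcongr
        _ = 2 * u ^ 480 := by ring
        _ ≤ 2 * u ^ 585 := by linarith [hmono (show 480 ≤ 585 by norm_num)]
        _ ≤ 3 * (u ^ 195) ^ 3 := by rw [← pow_mul]; norm_num; linarith [pow_pos hu0 585]
        _ ≤ _ := by gcongr
    · have h4 : √(u ^ 10 * (1 + Real.log t) / H) ≤ 20 / u ^ 14 := by
        refine Real.sqrt_le_iff.2 ⟨by positivity, ?_⟩
        rw [div_le_iff₀ hHpos, div_pow]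
        calc u ^ 10 * (1 + Real.log t) ≤ u ^ 10 * (200 * u ^ 2) := by gcongr
          _ = 20 ^ 2 / (u ^ 14) ^ 2 * (u ^ 40 / 2) := by field_simp; ring
          _ ≤ _ := by gcongr; linarith
      calc 400 * (X ^ 2 * √(u ^ 10 * (1 + Real.log t) / H))
          ≤ 400 * (X ^ 2 * (20 / u ^ 14)) := by gcongr
        _ = 8000 * (X * (X / u ^ 14)) := by ring
        _ ≤ 8000 * (X * (u ^ 205 / u ^ 14)) := by gcongr
        _ = 8000 * (X * u ^ 191) := by field_simp
        _ ≤ _ := by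
          have := hmono (show 191 ≤ 197 by norm_num)
          gcongr
          norm_num
  · push Not at h2
    have h4 : ‖∑ j ∈ Finset.range L, cexp (I * (t * Real.log (X + j) : ℝ))‖ ≤ 2 * X := by
      refine ((norm_sum_le _ _).trans_eq ?_).trans hL
      simp [-ofReal_mul]
    calc _ ≤ (2 * X) ^ 2 := by gcongr
      _ = 4 * (X * X) := by ring
      _ ≤ 4 * (X * u ^ 197) := by
        have := hmono (show 195 ≤ 197 by norm_num)
        gcongr
        linarith
      _ ≤ _ := by gcongr; norm_num

lemma norm_sum_range_cexp_log_le {t α : ℝ} (ht : 1 ≤ t) (hα : 0 < α) (hα1 : α ≤ 1) (M : ℕ) :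
    ‖∑ j ∈ Finset.range M, cexp (I * (t * Real.log (j + α) : ℝ))‖
      ≤ 2646 * (√M * t ^ (197 / 800 : ℝ) + M / t) := by
  have ht0 : 0 < t := by linarith
  have hta : 1 ≤ t ^ (197 / 800 : ℝ) := Real.one_le_rpow ht (by norm_num)
  induction M using Nat.strong_induction_on with
  | _ M ih =>
  rcases Nat.lt_or_ge M 2 with hM | hM
  · interval_cases M
    · simp
    · have : 0 ≤ 1 / t := by positivity
      simp [-ofReal_mul]
      rw [one_div] at this
      linarith
  obtain ⟨A, hA⟩ : ∃ A, A = (M + 1) / 2 := ⟨_, rfl⟩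
  have h1 := ih A (by omega)
  have hAM : A ≤ M := by omega
  rw [← Finset.sum_range_add_sum_Ico _ hAM, Finset.sum_Ico_eq_sum_range]
  have h2 := norm_sum_cexp_log_le_add (X := A + α) ht
    (by have : (1 : ℝ) ≤ A := by exact_mod_cast (by omega : 1 ≤ A)
        linarith) (M - A)
    (by have : ((M - A : ℕ) : ℝ) ≤ A := by exact_mod_cast (by omega : M - A ≤ A)
        have : (0 : ℝ) ≤ A := Nat.cast_nonneg _
        linarith)
  have h3 : ∑ k ∈ Finset.range (M - A), cexp (I * (t * Real.log ((A + k : ℕ) + α) : ℝ))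
      = ∑ k ∈ Finset.range (M - A), cexp (I * (t * Real.log (A + α + k) : ℝ)) := by
    refine Finset.sum_congr rfl fun k _ => ?_
    rw [show ((A + k : ℕ) : ℝ) + α = A + α + k by push_cast; ring]
  rw [h3]
  have hA3 : (A : ℝ) ≤ 2 / 3 * M := by
    have : (3 * A : ℝ) ≤ 2 * M := by exact_mod_cast (by omega : 3 * A ≤ 2 * M)
    linarith
  have hXM : (A : ℝ) + α ≤ M := by
    have : (A + 1 : ℝ) ≤ M := by exact_mod_cast (by omega : A + 1 ≤ M)
    linarith
  have hs : √(A : ℝ) ≤ 5 / 6 * √(M : ℝ) := by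
    refine Real.sqrt_le_iff.2 ⟨by positivity, ?_⟩
    rw [mul_pow, Real.sq_sqrt (Nat.cast_nonneg _)]
    have : (0 : ℝ) ≤ M := Nat.cast_nonneg _
    linarith
  have hs2 : √((A : ℝ) + α) ≤ √(M : ℝ) := Real.sqrt_le_sqrt hXM
  have hM0 : 0 ≤ (M : ℝ) / t := by positivity
  calc _ ≤ 2646 * (√A * t ^ (197 / 800 : ℝ) + A / t)
        + 441 * (√(A + α) * t ^ (197 / 800 : ℝ) + (A + α) / t) :=
        (norm_add_le _ _).trans (add_le_add h1 h2)
    _ ≤ 2646 * ((5 / 6 * √M) * t ^ (197 / 800 : ℝ) + (2 / 3 * M) / t)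
        + 441 * (√M * t ^ (197 / 800 : ℝ) + M / t) := by gcongr
    _ = 2646 * (√M * t ^ (197 / 800 : ℝ)) + 2205 * (M / t) := by ring
    _ ≤ _ := by linarith

lemma sum_range_mul_eq {f : ℕ → ℂ} (q M : ℕ) :
    ∑ n ∈ Finset.range (q * M), f n
      = ∑ a ∈ Finset.range q, ∑ m ∈ Finset.range M, f (q * m + a) := by
  induction M with
  | zero => simp
  | succ M ih =>
    rw [mul_add, mul_one, Finset.sum_range_add, ih, ← Finset.sum_add_distrib]
    exact Finset.sum_congr rfl fun a _ => (Finset.sum_range_succ _ _).symm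

lemma natCast_cpow_eq_cexp {n : ℕ} (hn : n ≠ 0) (t : ℝ) :
    (n : ℂ) ^ (-(t * I)) = cexp (I * (-(t * Real.log n) : ℝ)) := by
  rw [cpow_def_of_ne_zero (by exact_mod_cast hn), ← natCast_log]
  congr 1; push_cast; ring

/-- Sums `∑ c(n) n^{-it}` with bounded periodic coefficients. -/
lemma norm_sum_periodic_mul_cpow_le {q : ℕ} (hq : 0 < q) {c : ℕ → ℂ} (hc : ∀ n, ‖c n‖ ≤ 1)
    (hper : ∀ n, c (n + q) = c n) {t : ℝ} (ht : 1 ≤ |t|) (N : ℕ) :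
    ‖∑ n ∈ Finset.range N, c (n + 1) * ((n + 1 : ℕ) : ℂ) ^ (-(t * I))‖
      ≤ 2647 * q * (√N * |t| ^ (197 / 800 : ℝ) + N / |t|) := by
  have hta : 1 ≤ |t| ^ (197 / 800 : ℝ) := Real.one_le_rpow ht (by norm_num)
  have hq' : (0 : ℝ) < q := by exact_mod_cast hq
  obtain ⟨M, hM⟩ : ∃ M, M = N / q := ⟨_, rfl⟩
  have hMN : q * M ≤ N := hM ▸ Nat.mul_div_le N q
  have hMN' : M ≤ N := hM ▸ Nat.div_le_self N q
  have hper' : ∀ m a, c (q * m + a) = c a := by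
    intro m a
    induction m with
    | zero => simp
    | succ m ih => rw [← ih, ← hper (q * m + a)]; congr 1; ring
  have habs : ∀ α : ℝ, 0 < α → ‖∑ j ∈ Finset.range M, cexp (I * (-(t * Real.log (j + α)) : ℝ))‖
      = ‖∑ j ∈ Finset.range M, cexp (I * (|t| * Real.log (j + α) : ℝ))‖ := by
    intro α _
    rcases abs_cases t with ⟨h, _⟩ | ⟨h, _⟩
    · rw [h, ← norm_sum_cexp_neg _ fun j : ℕ => t * Real.log (j + α)]
    · rw [h]; simp only [neg_mul]
  have hblock : ∀ a ∈ Finset.range q, ‖∑ m ∈ Finset.range M,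
      c (q * m + a + 1) * ((q * m + a + 1 : ℕ) : ℂ) ^ (-(t * I))‖
        ≤ 2646 * (√M * |t| ^ (197 / 800 : ℝ) + M / |t|) := by
    intro a ha
    have ha' : ((a : ℝ) + 1) ≤ q := by exact_mod_cast Finset.mem_range.1 ha
    have hα : 0 < ((a : ℝ) + 1) / q := by positivity
    refine le_trans ?_ (norm_sum_range_cexp_log_le ht hα ((div_le_one hq').2 ha') M)
    rw [← habs _ hα]
    have : ∀ m ∈ Finset.range M, c (q * m + a + 1) * ((q * m + a + 1 : ℕ) : ℂ) ^ (-(t * I))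
        = c (a + 1) * cexp (I * (-(t * Real.log q) : ℝ))
          * cexp (I * (-(t * Real.log (m + (a + 1) / q)) : ℝ)) := by
      intro m _
      rw [natCast_cpow_eq_cexp (by omega), add_assoc, hper', mul_assoc, ← Complex.exp_add]
      congr 2
      rw [← mul_add, ← ofReal_add]
      congr 2
      have : ((q * m + (a + 1) : ℕ) : ℝ) = q * (m + (a + 1) / q) := by
        push_cast; field_simp
      rw [this, Real.log_mul hq'.ne' (by positivity)]
      ring
    rw [Finset.sum_congr rfl this, ← Finset.mul_sum, norm_mul, norm_mul, norm_cexp_I_mul, mul_one]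
    exact mul_le_of_le_one_left (norm_nonneg _) (hc _)
  rcases Nat.eq_zero_or_pos N with rfl | hN
  · simp
  have hN1 : 1 ≤ √(N : ℝ) := Real.one_le_sqrt.2 (by exact_mod_cast hN)
  rw [← Finset.sum_range_add_sum_Ico _ hMN, sum_range_mul_eq (f := fun n : ℕ =>
    c (n + 1) * ((n + 1 : ℕ) : ℂ) ^ (-(t * I)))]
  refine (norm_add_le _ _).trans ?_
  have h1 : ‖∑ a ∈ Finset.range q, ∑ m ∈ Finset.range M,
      c (q * m + a + 1) * ((q * m + a + 1 : ℕ) : ℂ) ^ (-(t * I))‖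
      ≤ q * (2646 * (√M * |t| ^ (197 / 800 : ℝ) + M / |t|)) := by
    refine (norm_sum_le _ _).trans ((Finset.sum_le_sum hblock).trans_eq ?_)
    simp
  have h2 : ‖∑ n ∈ Finset.Ico (q * M) N, c (n + 1) * ((n + 1 : ℕ) : ℂ) ^ (-(t * I))‖ ≤ q := by
    refine (norm_sum_le _ _).trans ?_
    calc _ ≤ ∑ n ∈ Finset.Ico (q * M) N, (1 : ℝ) := by
          refine Finset.sum_le_sum fun n _ => ?_
          rw [norm_mul]
          exact mul_le_one₀ (hc _) (norm_nonneg _) (norm_natCast_cpow_mul_I _ _)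
      _ = (N - q * M : ℕ) := by simp
      _ ≤ q := by
          have := Nat.mod_add_div N q
          have := (Nat.mod_lt N hq).le
          rw [← hM] at *
          exact_mod_cast (by omega : N - q * M ≤ q)
  have h3 : q ≤ q * (√N * |t| ^ (197 / 800 : ℝ) + N / |t|) := by
    refine le_mul_of_one_le_right hq'.le ?_
    have : 0 ≤ N / |t| := by positivity
    nlinarith
  have h4 : √(M : ℝ) ≤ √(N : ℝ) := Real.sqrt_le_sqrt (by exact_mod_cast hMN')
  have h5 : (M : ℝ) ≤ N := by exact_mod_cast hMN'
  calc _ ≤ q * (2646 * (√M * |t| ^ (197 / 800 : ℝ) + M / |t|)) + q := add_le_add h1 h2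
    _ ≤ q * (2646 * (√N * |t| ^ (197 / 800 : ℝ) + N / |t|))
        + q * (√N * |t| ^ (197 / 800 : ℝ) + N / |t|) := by gcongr
    _ = _ := by ring

end ExponentialSums

section Subconvexity

lemma norm_sum_mul_le_of_antitone {w : ℕ → ℝ} (hw : Antitone w) (hw0 : ∀ n, 0 ≤ w n)
    {u : ℕ → ℂ} {B : ℕ → ℝ} (hB : ∀ n, ‖∑ i ∈ Finset.range n, u i‖ ≤ B n) (N : ℕ) :
    ‖∑ i ∈ Finset.range N, (w i : ℂ) * u i‖
      ≤ w (N - 1) * B N + ∑ i ∈ Finset.range (N - 1), (w i - w (i + 1)) * B (i + 1) := by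
  have h := Finset.sum_range_by_parts (fun i => (w i : ℂ)) u N
  simp only [smul_eq_mul] at h
  rw [h]
  refine (norm_sub_le _ _).trans (add_le_add ?_ ((norm_sum_le _ _).trans
    (Finset.sum_le_sum fun i _ => ?_)))
  · rw [norm_mul, norm_real, Real.norm_of_nonneg (hw0 _)]
    exact mul_le_mul_of_nonneg_left (hB N) (hw0 _)
  · rw [norm_mul, ← ofReal_sub, norm_real, norm_sub_rev,
      Real.norm_of_nonneg (sub_nonneg.2 (hw (Nat.le_succ i)))]
    exact mul_le_mul_of_nonneg_left (hB _) (sub_nonneg.2 (hw (Nat.le_succ i)))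

lemma rpow_neg_half_sub_le {n : ℝ} (hn : 0 < n) :
    n ^ (-(1 / 2) : ℝ) - (n + 1) ^ (-(1 / 2) : ℝ) ≤ 1 / (2 * n * √n) := by
  have h1 : 0 < √n := Real.sqrt_pos.2 hn
  have h2 : 0 < √(n + 1) := Real.sqrt_pos.2 (by linarith)
  have h3 : √n ≤ √(n + 1) := Real.sqrt_le_sqrt (by linarith)
  have h4 : √n ^ 2 = n := Real.sq_sqrt hn.le
  have h5 : √(n + 1) ^ 2 = n + 1 := Real.sq_sqrt (by linarith)
  rw [Real.rpow_neg hn.le, Real.rpow_neg (by linarith), ← Real.sqrt_eq_rpow,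
    ← Real.sqrt_eq_rpow, ← one_div, ← one_div, div_sub_div _ _ h1.ne' h2.ne',
    div_le_div_iff₀ (by positivity) (by positivity), one_mul, one_mul, mul_one]
  have h6 : (√(n + 1) - √n) * (√(n + 1) + √n) = 1 := by nlinarith
  have h7 : (√(n + 1) - √n) * (2 * √n) ≤ 1 := by nlinarith
  have h8 : (√(n + 1) - √n) * (2 * n * √n) = n * ((√(n + 1) - √n) * (2 * √n)) := by ring
  have h9 : n ≤ √n * √(n + 1) := by nlinarith
  nlinarith

variable {c : ℕ → ℂ} {κ : ℂ} {K : ℝ} {f : ℂ → ℂ}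

/-- A subconvex bound on the critical line for Dirichlet series with periodic coefficients. -/
theorem IsLinearLSeries.exists_norm_le_rpow (h : IsLinearLSeries c κ K f) {q : ℕ} (hq : 0 < q)
    (hper : ∀ n, c (n + q) = c n) :
    ∃ C, 0 < C ∧ ∀ t : ℝ, 1 ≤ |t| → ‖f (1 / 2 + t * I)‖ ≤ C * |t| ^ (99 / 400 : ℝ) := by
  have hq' : (0 : ℝ) < q := by exact_mod_cast hq
  refine ⟨3 * K + 5 * ‖κ‖ + 2647 * q * 5607, by have := h.nonneg; positivity, fun t ht => ?_⟩
  obtain ⟨T, hT⟩ : ∃ T, T = |t| := ⟨_, rfl⟩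
  rw [← hT] at ht ⊢
  have hT0 : 0 < T := by linarith
  obtain ⟨N, hN⟩ : ∃ N, N = ⌈t ^ 2⌉₊ := ⟨_, rfl⟩
  obtain ⟨v, hv⟩ : ∃ v, v = T ^ (197 / 800 : ℝ) := ⟨_, rfl⟩
  have hv1 : 1 ≤ v := hv ▸ Real.one_le_rpow ht (by norm_num)
  have hT2 : t ^ 2 = T ^ 2 := by rw [hT, sq_abs]
  have hN1 : 1 ≤ N := by rw [hN, Nat.one_le_ceil_iff, hT2]; positivity
  have hN2 : (N : ℝ) ≤ (2 * T) ^ 2 := by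
    have := Nat.ceil_lt_add_one (sq_nonneg t)
    rw [← hN, hT2] at this
    nlinarith
  have hsN : √(N : ℝ) ≤ 2 * T := Real.sqrt_le_iff.2 ⟨by linarith, hN2⟩
  have hN0 : (0 : ℝ) < N := by exact_mod_cast hN1
  have hlogT0 : 0 ≤ Real.log T := Real.log_nonneg ht
  have hlogN : Real.log N ≤ 2 + 2 * Real.log T := by
    have h1 := Real.log_le_log hN0 hN2
    rw [Real.log_pow, Real.log_mul (by norm_num) hT0.ne'] at h1
    have := Real.log_two_lt_d9
    push_cast at h1
    linarith
  have hvlog : v * (1 + Real.log T) ≤ 801 * T ^ (99 / 400 : ℝ) := by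
    have h1 : Real.log T ≤ T ^ (1 / 800 : ℝ) / (1 / 800) := Real.log_le_rpow_div hT0.le (by norm_num)
    have h2 : 1 ≤ T ^ (1 / 800 : ℝ) := Real.one_le_rpow ht (by norm_num)
    calc v * (1 + Real.log T) ≤ v * (801 * T ^ (1 / 800 : ℝ)) := by gcongr; linarith
      _ = 801 * (v * T ^ (1 / 800 : ℝ)) := by ring
      _ = _ := by rw [hv, ← Real.rpow_add hT0]; norm_num
  have hTT : 1 ≤ T ^ (99 / 400 : ℝ) := Real.one_le_rpow ht (by norm_num)
  obtain ⟨w, hw⟩ : ∃ w : ℕ → ℝ, ∀ n, w n = ((n : ℝ) + 1) ^ (-(1 / 2) : ℝ) := ⟨_, fun _ => rfl⟩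
  have hwa : Antitone w := fun a b hab => by
    rw [hw, hw]
    exact Real.rpow_le_rpow_of_nonpos (by positivity) (by gcongr) (by norm_num)
  have hw0 : ∀ n, 0 ≤ w n := fun n => by rw [hw]; positivity
  have hsum := norm_sum_mul_le_of_antitone hwa hw0
    (norm_sum_periodic_mul_cpow_le hq h.norm_le hper (hT ▸ ht)) N
  rw [← hT, ← hv] at hsum
  have heq : ∑ i ∈ Finset.range N, (w i : ℂ) * (c (i + 1) * ((i + 1 : ℕ) : ℂ) ^ (-(t * I)))
      = ∑ n ∈ Finset.Icc 1 N, c n * (n : ℂ) ^ (-(1 / 2 + t * I)) := by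
    rw [show Finset.Icc 1 N = Finset.Ico 1 (N + 1) from rfl, Finset.sum_Ico_eq_sum_range,
      Nat.add_sub_cancel]
    refine Finset.sum_congr rfl fun i _ => ?_
    have h1 : ((1 + i : ℕ) : ℂ) ≠ 0 := by exact_mod_cast (by omega : 1 + i ≠ 0)
    rw [neg_add, cpow_add _ _ h1, add_comm i 1, hw, ofReal_cpow (by positivity)]
    push_cast
    ring_nf
  rw [heq] at hsum
  have hfirst : w (N - 1) * (2647 * q * (√N * v + N / T)) ≤ 2647 * q * (v + 2) := by
    have h1 : w (N - 1) = (√(N : ℝ))⁻¹ := by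
      rw [hw, Nat.cast_sub hN1, Nat.cast_one, sub_add_cancel, Real.rpow_neg hN0.le,
        ← Real.sqrt_eq_rpow]
    have hs0 : 0 < √(N : ℝ) := Real.sqrt_pos.2 hN0
    have h2 : (√(N : ℝ))⁻¹ * (√N * v + N / T) = v + √N / T := by
      have : (N : ℝ) = √N * √N := (Real.mul_self_sqrt hN0.le).symm
      field_simp
      nlinarith
    rw [h1]
    calc _ = 2647 * q * ((√(N : ℝ))⁻¹ * (√N * v + N / T)) := by ring
      _ = 2647 * q * (v + √N / T) := by rw [h2]
      _ ≤ _ := by gcongr; rwa [div_le_iff₀ hT0]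
  have hrest : ∑ i ∈ Finset.range (N - 1), (w i - w (i + 1)) * (2647 * q * (√(i + 1 : ℕ) * v +
      (i + 1 : ℕ) / T)) ≤ 2647 * q * (v / 2 * (1 + Real.log N) + √N / T) := by
    have hterm : ∀ i : ℕ, (w i - w (i + 1)) * (2647 * q * (√(i + 1 : ℕ) * v + (i + 1 : ℕ) / T))
        ≤ 2647 * q * (v / 2 * (1 / ((i + 1 : ℕ) : ℝ))
          + 1 / (2 * T) * ((i + 1 : ℕ) : ℝ) ^ (-(1 / 2) : ℝ)) := by
      intro i
      obtain ⟨n, hn⟩ : ∃ n : ℝ, n = ((i + 1 : ℕ) : ℝ) := ⟨_, rfl⟩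
      have hn0 : 0 < n := by rw [hn]; positivity
      have hs0 : 0 < √n := Real.sqrt_pos.2 hn0
      have hD : w i - w (i + 1) ≤ 1 / (2 * n * √n) := by
        have := rpow_neg_half_sub_le hn0
        rw [hw, hw]
        rw [hn] at this ⊢
        push_cast at this ⊢
        exact this
      rw [← hn, Real.rpow_neg hn0.le, ← Real.sqrt_eq_rpow]
      calc _ ≤ 1 / (2 * n * √n) * (2647 * q * (√n * v + n / T)) := by gcongr
        _ = _ := by field_simp
    refine (Finset.sum_le_sum fun i _ => hterm i).trans ?_
    rw [← Finset.mul_sum, Finset.sum_add_distrib, ← Finset.mul_sum, ← Finset.mul_sum]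
    have hshift : ∀ g : ℕ → ℝ, (∀ n, 0 ≤ g n) →
        ∑ i ∈ Finset.range (N - 1), g (i + 1) ≤ ∑ n ∈ Finset.Icc 1 N, g n := by
      intro g hg
      rw [show Finset.Icc 1 N = Finset.Ico 1 (N + 1) from rfl, Finset.sum_Ico_eq_sum_range,
        Nat.add_sub_cancel]
      simp only [add_comm 1]
      exact Finset.sum_le_sum_of_subset_of_nonneg (Finset.range_mono (Nat.sub_le _ _))
        fun i _ _ => hg _
    have h1 : ∑ i ∈ Finset.range (N - 1), 1 / ((i + 1 : ℕ) : ℝ) ≤ 1 + Real.log N := by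
      refine (hshift (fun n => 1 / (n : ℝ)) fun n => by positivity).trans ?_
      have := harmonic_le_one_add_log N
      rw [harmonic_eq_sum_Icc] at this
      push_cast at this
      simpa [one_div] using this
    have h2 : ∑ i ∈ Finset.range (N - 1), ((i + 1 : ℕ) : ℝ) ^ (-(1 / 2) : ℝ) ≤ 2 * √N := by
      refine (hshift (fun n => (n : ℝ) ^ (-(1 / 2) : ℝ)) fun n => by positivity).trans ?_
      rw [Real.sqrt_eq_rpow]
      exact sum_Icc_rpow_neg_half_le N
    calc _ ≤ 2647 * q * (v / 2 * (1 + Real.log N) + 1 / (2 * T) * (2 * √N)) := by gcongr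
      _ = _ := by field_simp
  have hfin := h.norm_sub_sum_le_of_sq (t := t) (by rw [← hT]; exact ht)
  rw [← hN] at hfin
  have h2T : √(N : ℝ) / T ≤ 2 := by rwa [div_le_iff₀ hT0]
  have hS : ‖∑ n ∈ Finset.Icc 1 N, c n * (n : ℂ) ^ (-(1 / 2 + t * I))‖
      ≤ 2647 * q * (5607 * T ^ (99 / 400 : ℝ)) := by
    refine hsum.trans ((add_le_add hfirst hrest).trans ?_)
    rw [← mul_add]
    refine mul_le_mul_of_nonneg_left ?_ (by positivity)
    have : v / 2 * (1 + Real.log N) ≤ v / 2 * (3 + 2 * Real.log T) :=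
      mul_le_mul_of_nonneg_left (by linarith) (by positivity)
    nlinarith
  have hK : (3 * K + 5 * ‖κ‖) * 1 ≤ (3 * K + 5 * ‖κ‖) * T ^ (99 / 400 : ℝ) :=
    mul_le_mul_of_nonneg_left hTT (by have := h.nonneg; positivity)
  have htri := norm_sub_norm_le (f (1 / 2 + t * I))
    (∑ n ∈ Finset.Icc 1 N, c n * (n : ℂ) ^ (-(1 / 2 + t * I)))
  calc _ ≤ (3 * K + 5 * ‖κ‖) * 1 + 2647 * q * (5607 * T ^ (99 / 400 : ℝ)) := by linarith
    _ ≤ (3 * K + 5 * ‖κ‖) * T ^ (99 / 400 : ℝ) + 2647 * q * (5607 * T ^ (99 / 400 : ℝ)) := by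
        linarith
    _ = _ := by ring

end Subconvexity

section Identity

open ArithmeticFunction

/-- The function `μ` restricted to the divisors of `q`. -/
noncomputable def moebiusDvd (q : ℕ) : ArithmeticFunction ℂ :=
  ⟨fun n => if n ∣ q then (moebius n : ℂ) else 0, by simp⟩

/-- The function taking the value `μ(m)` at squares `m²` with `m` coprime to `q`. -/
noncomputable def moebiusSq (q : ℕ) : ArithmeticFunction ℂ :=
  ⟨fun n => if n.sqrt ^ 2 = n ∧ n.Coprime q then (moebius n.sqrt : ℂ) else 0, by simp⟩

lemma moebiusDvd_apply (q n : ℕ) : moebiusDvd q n = if n ∣ q then (moebius n : ℂ) else 0 := rfl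

lemma moebiusSq_apply (q n : ℕ) : moebiusSq q n =
    if n.sqrt ^ 2 = n ∧ n.Coprime q then (moebius n.sqrt : ℂ) else 0 := rfl

lemma isMultiplicative_moebiusDvd (q : ℕ) : (moebiusDvd q).IsMultiplicative := by
  refine ⟨by simp [moebiusDvd_apply], fun {m n} h => ?_⟩
  simp only [moebiusDvd_apply, isMultiplicative_moebius.map_mul_of_coprime h]
  by_cases h1 : m ∣ q
  · by_cases h2 : n ∣ q
    · rw [if_pos (h.mul_dvd_of_dvd_of_dvd h1 h2), if_pos h1, if_pos h2]; push_cast; rfl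
    · rw [if_neg h2, if_neg fun h3 => h2 ((dvd_mul_left _ _).trans h3), mul_zero]
  · rw [if_neg h1, if_neg fun h3 => h1 ((dvd_mul_right _ _).trans h3), zero_mul]

lemma isMultiplicative_moebiusSq (q : ℕ) : (moebiusSq q).IsMultiplicative := by
  refine ⟨by simp [moebiusSq_apply], fun {m n} h => ?_⟩
  simp only [moebiusSq_apply]
  by_cases h1 : m.sqrt ^ 2 = m ∧ m.Coprime q
  · by_cases h2 : n.sqrt ^ 2 = n ∧ n.Coprime q
    · have h3 : (m * n).sqrt = m.sqrt * n.sqrt := by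
        rw [← h1.1, ← h2.1, ← mul_pow, Nat.sqrt_eq', Nat.sqrt_eq', Nat.sqrt_eq']
      have h4 : m.sqrt.Coprime n.sqrt := by
        have := h
        rw [← h1.1, ← h2.1] at this
        exact Nat.Coprime.coprime_dvd_left (dvd_pow_self _ two_ne_zero)
          (Nat.Coprime.coprime_dvd_right (dvd_pow_self _ two_ne_zero) this)
      rw [if_pos h1, if_pos h2, if_pos, h3, isMultiplicative_moebius.map_mul_of_coprime h4]
      · push_cast; rfl
      · refine ⟨by rw [h3, mul_pow, h1.1, h2.1], Nat.Coprime.mul_left h1.2 h2.2⟩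
    · rw [if_neg h2, mul_zero, if_neg]
      rintro ⟨h3, h4⟩
      refine h2 ⟨?_, Nat.Coprime.coprime_dvd_left (dvd_mul_left _ _) h4⟩
      obtain ⟨a, ha⟩ := exists_eq_pow_of_mul_eq_pow (Nat.isUnit_iff.2 h.symm)
        ((mul_comm n m).trans h3.symm)
      rw [ha, Nat.sqrt_eq']
  · rw [if_neg h1, zero_mul, if_neg]
    rintro ⟨h3, h4⟩
    refine h1 ⟨?_, Nat.Coprime.coprime_dvd_left (dvd_mul_right _ _) h4⟩
    obtain ⟨a, ha⟩ := exists_eq_pow_of_mul_eq_pow (Nat.isUnit_iff.2 h) h3.symm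
    rw [ha, Nat.sqrt_eq']

lemma mul_apply_prime_pow (f g : ArithmeticFunction ℂ) {p : ℕ} (hp : p.Prime) (k : ℕ) :
    (f * g) (p ^ k) = ∑ i ∈ Finset.range (k + 1), f (p ^ i) * g (p ^ (k - i)) := by
  rw [mul_apply, Nat.sum_divisorsAntidiagonal (fun a b => f a * g b),
    Nat.sum_divisors_prime_pow hp]
  refine Finset.sum_congr rfl fun i hi => ?_
  rw [Nat.pow_div (by simpa [Nat.lt_succ_iff] using hi) hp.pos]

lemma mul_apply_prime_pow_of_ite (f g : ArithmeticFunction ℂ) {p : ℕ} (hp : p.Prime) {d : ℕ}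
    {v : ℂ} (hg : ∀ j, g (p ^ j) = if j = 0 then 1 else if j = d then v else 0) (hd : 0 < d)
    (k : ℕ) :
    (f * g) (p ^ k) = f (p ^ k) + v * if d ≤ k then f (p ^ (k - d)) else 0 := by
  rw [mul_apply_prime_pow f g hp]
  have h : ∀ i ∈ Finset.range (k + 1), f (p ^ i) * g (p ^ (k - i)) =
      (if i = k then f (p ^ i) else 0) + if i = k - d then (if d ≤ k then v * f (p ^ i) else 0)
        else 0 := by
    intro i hi
    have hi := Finset.mem_range.1 hi
    rw [hg]
    by_cases h1 : i = k
    · subst h1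
      have : ¬ (d ≤ i ∧ i = i - d) := by omega
      by_cases h2 : d ≤ i
      · have : i ≠ i - d := by omega
        simp [this]
      · simp [h2]
    · have h3 : k - i ≠ 0 := by omega
      by_cases h2 : d ≤ k
      · by_cases h4 : k - i = d
        · have : i = k - d := by omega
          rw [if_neg h3, if_pos h4, if_neg h1, if_pos this, if_pos h2]; ring
        · have : i ≠ k - d := by omega
          rw [if_neg h3, if_neg h4, if_neg h1, if_neg this]; ring
      · have h4 : k - i ≠ d := by omega
        rw [if_neg h3, if_neg h4, if_neg h1, if_neg h2]; simp
  rw [Finset.sum_congr rfl h, Finset.sum_add_distrib, Finset.sum_ite_eq', Finset.sum_ite_eq',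
    if_pos (by simp), if_pos (by simp), mul_ite, mul_zero]

lemma moebiusDvd_prime_pow {q p : ℕ} (hp : p.Prime) (j : ℕ) :
    moebiusDvd q (p ^ j) = if j = 0 then 1 else if j = 1 then (if p ∣ q then -1 else 0) else 0 := by
  rw [moebiusDvd_apply]
  rcases eq_or_ne j 0 with rfl | hj
  · simp
  rw [moebius_apply_prime_pow hp hj]
  by_cases h1 : j = 1
  · subst h1; simp
  · simp [hj, h1]

lemma moebiusSq_prime_pow {q p : ℕ} (hp : p.Prime) (j : ℕ) :
    moebiusSq q (p ^ j) = if j = 0 then 1 else if j = 2 then (if p ∣ q then 0 else -1) else 0 := by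
  rw [moebiusSq_apply]
  rcases eq_or_ne j 0 with rfl | hj
  · simp
  simp only [Nat.coprime_pow_left_iff (Nat.pos_of_ne_zero hj), hp.coprime_iff_not_dvd]
  by_cases h1 : j = 2
  · subst h1
    rw [Nat.sqrt_eq', moebius_apply_prime hp]
    by_cases h : p ∣ q <;> simp [h]
  · rw [if_neg hj, if_neg h1]
    split_ifs with h
    · obtain ⟨i, hi, hi'⟩ := (Nat.dvd_prime_pow hp).1 (Dvd.intro_left ((p ^ j).sqrt ^ 1)
        ((by rw [pow_one, ← sq, h.1]) : (p ^ j).sqrt ^ 1 * (p ^ j).sqrt = p ^ j))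
      have h2 : i * 2 = j := by
        have := h.1
        rw [hi', ← pow_mul] at this
        exact Nat.pow_right_injective hp.two_le this
      rw [hi', moebius_apply_prime_pow hp (by omega), if_neg (by omega), Int.cast_zero]
    · rfl

variable {q : ℕ} {χ : DirichletCharacter ℂ q}

lemma zetaMul_apply (n : ℕ) : χ.zetaMul n = ∑ d ∈ n.divisors, χ (d : ZMod q) := by
  rw [DirichletCharacter.zetaMul, coe_zeta_mul_apply]
  refine Finset.sum_congr rfl fun d hd => ?_
  exact if_neg (Nat.pos_of_mem_divisors hd).ne'

lemma zetaMul_prime_pow {p : ℕ} (hp : p.Prime) (k : ℕ) :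
    χ.zetaMul (p ^ k) = ∑ i ∈ Finset.range (k + 1), χ (p : ZMod q) ^ i := by
  rw [zetaMul_apply, Nat.sum_divisors_prime_pow hp]
  simp

lemma sum_range_add_one_mul (k n : ℕ) (hn : n ≤ k + 1) : ∑ i ∈ Finset.range n,
    ((i : ℂ) + 1) * ((k - i : ℕ) + 1) = n * (n + 1) * (3 * k + 5 - 2 * n) / 6 := by
  induction n with
  | zero => simp
  | succ n ih =>
    rw [Finset.sum_range_succ, ih (by omega), Nat.cast_sub (by omega)]
    push_cast; ring

lemma sum_range_neg_one_pow (n : ℕ) :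
    ∑ i ∈ Finset.range n, (-1 : ℂ) ^ i = (1 - (-1) ^ n) / 2 := by
  induction n with
  | zero => simp
  | succ n ih => rw [Finset.sum_range_succ, ih]; ring

lemma sum_range_neg_one_pow_mul (k n : ℕ) (hn : n ≤ k + 1) : ∑ i ∈ Finset.range n,
    ((1 + (-1 : ℂ) ^ i) / 2) * ((1 + (-1) ^ (k - i)) / 2) =
      (1 + (-1) ^ k) * (n + (1 - (-1) ^ n) / 2) / 4 := by
  induction n with
  | zero => simp
  | succ n ih =>
    have h1 : ((-1 : ℂ) ^ n) * (-1) ^ n = 1 := by rw [← mul_pow]; simp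
    have h2 : (-1 : ℂ) ^ (k - n) = (-1) ^ k * (-1) ^ n := by
      conv_rhs => rw [← Nat.sub_add_cancel (show n ≤ k by omega), pow_add, mul_assoc, h1, mul_one]
    rw [Finset.sum_range_succ, ih (by omega), h2]
    push_cast
    linear_combination (-1 : ℂ) ^ k / 4 * h1

lemma zetaMul_sq_prime_pow [NeZero q] (hχ : χ ^ 2 = 1) {p : ℕ} (hp : p.Prime) (k : ℕ) :
    χ.zetaMul (p ^ k) ^ 2 =
      (χ.zetaMul * χ.zetaMul * (moebiusDvd q * moebiusSq q)) (p ^ k) := by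
  rw [← mul_assoc, mul_apply_prime_pow_of_ite _ _ hp (moebiusSq_prime_pow hp) two_pos]
  have hD : ∀ j, (χ.zetaMul * χ.zetaMul * moebiusDvd q) (p ^ j) = _ :=
    mul_apply_prime_pow_of_ite _ _ hp (moebiusDvd_prime_pow hp) one_pos
  have hu : IsUnit (p : ZMod q) ↔ ¬ p ∣ q := by
    rw [ZMod.isUnit_iff_coprime, hp.coprime_iff_not_dvd]
  simp only [hD, mul_apply_prime_pow _ _ hp, zetaMul_prime_pow hp]
  rcases MulChar.isQuadratic_iff_sq_eq_one.mpr hχ p with h | h | h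
  · have hpq : p ∣ q := by
      by_contra hpq
      exact (hu.2 hpq).map χ |>.ne_zero h
    have h0 : ∀ j : ℕ, ∑ i ∈ Finset.range (j + 1), (0 : ℂ) ^ i = 1 := fun j => by
      simp [Finset.sum_range_succ']
    simp only [h, h0, if_pos hpq]
    rcases k with _ | k <;> simp
  · have hpq : ¬ p ∣ q := fun hpq => by
      have := χ.map_nonunit (hu.not_left.2 hpq)
      simp [h] at this
    simp only [h, if_neg hpq, one_pow, Finset.sum_const, Finset.card_range, nsmul_eq_mul, mul_one,
      Nat.cast_add, Nat.cast_one, sum_range_add_one_mul _ _ le_rfl, zero_mul, add_zero]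
    rcases k with _ | _ | k
    · norm_num
    · norm_num
    · rw [if_pos (by omega), show k + 1 + 1 - 2 = k by omega]
      push_cast; ring
  · have hpq : ¬ p ∣ q := fun hpq => by
      have := χ.map_nonunit (hu.not_left.2 hpq)
      simp [h] at this
    have h0 : ∀ j : ℕ, ∑ i ∈ Finset.range (j + 1), (-1 : ℂ) ^ i = (1 + (-1) ^ j) / 2 := fun j => by
      rw [sum_range_neg_one_pow]; ring
    simp only [h, if_neg hpq, h0, sum_range_neg_one_pow_mul _ _ le_rfl, zero_mul, add_zero]
    rcases k with _ | _ | k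
    · norm_num
    · norm_num
    · rw [if_pos (by omega), show k + 1 + 1 - 2 = k by omega]
      have h1 : ((-1 : ℂ) ^ k) * (-1) ^ k = 1 := by rw [← mul_pow]; simp
      push_cast
      linear_combination h1 / 4

/-- The Dirichlet series identity `∑ r(n)² n⁻ˢ = ζ(s)² L(s, χ)² G(s)`, on the level of
coefficients. -/
lemma zetaMul_sq_eq [NeZero q] (hχ : χ ^ 2 = 1) (n : ℕ) :
    χ.zetaMul n ^ 2 = (χ.zetaMul * χ.zetaMul * (moebiusDvd q * moebiusSq q)) n := by
  have hz := χ.isMultiplicative_zetaMul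
  rw [← ppow_apply two_pos]
  refine DFunLike.congr_fun ((IsMultiplicative.eq_iff_eq_on_prime_powers _ hz.ppow _
    ((hz.mul hz).mul
      ((isMultiplicative_moebiusDvd q).mul (isMultiplicative_moebiusSq q)))).2 ?_) n
  intro p i hp
  rw [ppow_apply two_pos, zetaMul_sq_prime_pow hχ hp]

open scoped ComplexOrder

lemma zetaMul_sq_le [NeZero q] (hχ : χ ^ 2 = 1) (n : ℕ) :
    χ.zetaMul n ^ 2 ≤ (χ.zetaMul * χ.zetaMul) n := by
  have hz := χ.isMultiplicative_zetaMul
  have hnn : ∀ n, 0 ≤ (χ.zetaMul * χ.zetaMul) n := fun n => by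
    rw [mul_apply]
    exact Finset.sum_nonneg fun x _ => mul_nonneg
      (DirichletCharacter.zetaMul_nonneg hχ _) (DirichletCharacter.zetaMul_nonneg hχ _)
  rcases eq_or_ne n 0 with rfl | hn
  · simp
  rw [← ppow_apply two_pos, hz.ppow.multiplicative_factorization _ hn,
    (hz.mul hz).multiplicative_factorization _ hn]
  refine Finset.prod_le_prod (fun p _ => ?_) fun p hp => ?_
  · beta_reduce
    rw [ppow_apply two_pos]
    exact pow_nonneg (DirichletCharacter.zetaMul_nonneg hχ _) 2
  have hp := Nat.prime_of_mem_primeFactors hp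
  beta_reduce
  rw [ppow_apply two_pos, zetaMul_sq_prime_pow hχ hp, ← mul_assoc,
    mul_apply_prime_pow_of_ite _ _ hp (moebiusSq_prime_pow hp) two_pos]
  rw [mul_apply_prime_pow_of_ite _ _ hp (moebiusDvd_prime_pow hp) one_pos]
  by_cases hpq : p ∣ q
  · simp only [if_pos hpq, neg_mul, one_mul, zero_mul, add_zero]
    refine add_le_of_nonpos_right (neg_nonpos.2 ?_)
    split_ifs
    exacts [hnn _, le_rfl]
  · simp only [if_neg hpq, neg_mul, one_mul, zero_mul, add_zero]
    refine add_le_of_nonpos_right (neg_nonpos.2 ?_)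
    split_ifs
    · rw [mul_apply_prime_pow_of_ite _ _ hp (moebiusDvd_prime_pow hp) one_pos]
      simpa only [if_neg hpq, zero_mul, add_zero] using hnn _
    · exact le_rfl

end Identity

section ZetaProduct

open DirichletCharacter

variable {q : ℕ} {χ : DirichletCharacter ℂ q}

lemma LSeriesSummable_zetaMul_mul {s : ℂ} (hs : 1 < s.re) :
    LSeriesSummable (fun n => (χ.zetaMul * χ.zetaMul) n) s :=
  ArithmeticFunction.LSeriesSummable_mul (χ.LSeriesSummable_zetaMul hs)
    (χ.LSeriesSummable_zetaMul hs)

open scoped ComplexOrder in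
lemma zetaMul_mul_nonneg (hχ : χ ^ 2 = 1) (n : ℕ) : 0 ≤ (χ.zetaMul * χ.zetaMul) n := by
  rw [ArithmeticFunction.mul_apply]
  exact Finset.sum_nonneg fun x _ => mul_nonneg (zetaMul_nonneg hχ _) (zetaMul_nonneg hχ _)

variable [NeZero q]

/-- The product `ζ(s) L(s, χ)`. -/
noncomputable def zetaL (χ : DirichletCharacter ℂ q) (s : ℂ) : ℂ :=
  riemannZeta s * χ.LFunction s

/-- The entire function `(s - 1) ζ(s) L(s, χ)`. -/
noncomputable def zetaLReg (χ : DirichletCharacter ℂ q) (s : ℂ) : ℂ :=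
  LFunctionTrivChar₁ 1 s * χ.LFunction s

lemma zetaLReg_eq {s : ℂ} (hs : s ≠ 1) : zetaLReg χ s = (s - 1) * zetaL χ s := by
  rw [zetaLReg, zetaL, LFunctionTrivChar₁, Function.update_of_ne hs, LFunctionTrivChar,
    LFunction_modOne_eq, mul_assoc]

lemma zetaLReg_one : zetaLReg χ 1 = χ.LFunction 1 := by
  simp [zetaLReg, LFunctionTrivChar₁]

lemma differentiable_zetaLReg (hχ : χ ≠ 1) : Differentiable ℂ (zetaLReg χ) :=
  (differentiable_LFunctionTrivChar₁ 1).mul (differentiable_LFunction hχ)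

lemma differentiableAt_zetaL (hχ : χ ≠ 1) {s : ℂ} (hs : s ≠ 1) :
    DifferentiableAt ℂ (zetaL χ) s :=
  (differentiableAt_riemannZeta hs).mul (differentiable_LFunction hχ s)

lemma LSeries_zetaMul {s : ℂ} (hs : 1 < s.re) : LSeries χ.zetaMul s = zetaL χ s := by
  have h1 : LSeriesSummable (fun n => (ArithmeticFunction.zeta : ArithmeticFunction ℂ) n) s :=
    ArithmeticFunction.LSeriesSummable_zeta_iff.mpr hs
  have h2 : LSeriesSummable (fun n => toArithmeticFunction (χ ·) n) s :=
    (LSeriesSummable_congr _ fun h => (χ.apply_eq_toArithmeticFunction_apply h).symm).mpr <|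
      ZMod.LSeriesSummable_of_one_lt_re χ hs
  have := ArithmeticFunction.LSeries_mul' h1 h2
  rw [zetaMul, this, zetaL, χ.LFunction_eq_LSeries hs]
  congr 1
  · rw [← ArithmeticFunction.LSeries_zeta_eq_riemannZeta hs]
    rfl
  · exact LSeries_congr (fun h => (χ.apply_eq_toArithmeticFunction_apply h).symm) s

lemma LSeries_zetaMul_mul {s : ℂ} (hs : 1 < s.re) :
    LSeries (fun n => (χ.zetaMul * χ.zetaMul) n) s = zetaL χ s ^ 2 := by
  have h1 := χ.LSeriesSummable_zetaMul hs
  have := ArithmeticFunction.LSeries_mul' h1 h1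
  rw [this, LSeries_zetaMul hs, sq]

lemma exists_norm_zetaL_le (hχ : χ ≠ 1) :
    ∃ C, 0 < C ∧ ∀ σ : ℝ, 1 < σ → σ ≤ 2 → ‖zetaL χ σ‖ ≤ C / (σ - 1) := by
  obtain ⟨C, hC⟩ := (isCompact_Icc (a := (1 : ℝ)) (b := 2)).exists_bound_of_continuousOn
    (f := fun σ : ℝ => zetaLReg χ σ)
    ((differentiable_zetaLReg hχ).continuous.comp continuous_ofReal).continuousOn
  refine ⟨C + 1, by linarith [(norm_nonneg _).trans (hC 1 (by simp))], fun σ h1 h2 => ?_⟩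
  have h3 := hC σ ⟨h1.le, h2⟩
  have h4 : 0 < σ - 1 := by linarith
  rw [zetaLReg_eq (by exact_mod_cast h1.ne'), norm_mul, ← ofReal_one, ← ofReal_sub, norm_real,
    Real.norm_of_nonneg h4.le] at h3
  rw [le_div_iff₀ h4]
  linarith

open scoped ComplexOrder in
lemma norm_zetaMul_sq_le (hχ : χ ^ 2 = 1) (n : ℕ) :
    ‖χ.zetaMul n‖ ^ 2 ≤ ‖(χ.zetaMul * χ.zetaMul) n‖ := by
  rw [← norm_pow]
  exact CStarAlgebra.norm_le_norm_of_nonneg_of_le (pow_nonneg (zetaMul_nonneg hχ n) 2)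
    (zetaMul_sq_le hχ n)

open scoped ComplexOrder in
lemma sum_zetaMul_sq_mul_rpow_le (hχ : χ ^ 2 = 1) {σ : ℝ} (hσ : 1 < σ) (s : Finset ℕ)
    (hs : ∀ n ∈ s, 0 < n) :
    ∑ n ∈ s, ‖χ.zetaMul n‖ ^ 2 * (n : ℝ) ^ (-σ) ≤ ‖zetaL χ σ‖ ^ 2 := by
  have hσ' : 1 < (σ : ℂ).re := by simpa using hσ
  have hsum : Summable fun n => ‖LSeries.term (fun n => (χ.zetaMul * χ.zetaMul) n) σ n‖ :=
    (LSeriesSummable_zetaMul_mul hσ').norm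
  have hterm : ∀ n : ℕ, 0 < n → ‖LSeries.term (fun n => (χ.zetaMul * χ.zetaMul) n) σ n‖ =
      ‖(χ.zetaMul * χ.zetaMul) n‖ * (n : ℝ) ^ (-σ) := by
    intro n hn
    rw [LSeries.norm_term_eq, if_neg hn.ne', ofReal_re, Real.rpow_neg (Nat.cast_nonneg _),
      div_eq_mul_inv]
  have hre : ∀ n, LSeries.term (fun n => (χ.zetaMul * χ.zetaMul) n) σ n =
      (‖LSeries.term (fun n => (χ.zetaMul * χ.zetaMul) n) σ n‖ : ℂ) := by
    intro n
    rcases n.eq_zero_or_pos with rfl | hn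
    · simp
    rw [hterm n hn, LSeries.term_of_ne_zero hn.ne']
    push_cast
    rw [← Complex.eq_coe_norm_of_nonneg (zetaMul_mul_nonneg hχ n),
      ofReal_cpow (Nat.cast_nonneg _), ofReal_neg, cpow_neg, ofReal_natCast, div_eq_mul_inv]
  have htot : ‖zetaL χ σ‖ ^ 2 =
      ∑' n, ‖LSeries.term (fun n => (χ.zetaMul * χ.zetaMul) n) σ n‖ := by
    rw [← norm_pow, ← LSeries_zetaMul_mul hσ', LSeries, tsum_congr hre, ← ofReal_tsum, norm_real,
      Real.norm_of_nonneg (tsum_nonneg fun _ => norm_nonneg _)]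
  rw [htot]
  refine le_trans (Finset.sum_le_sum fun n hn => ?_) (hsum.sum_le_tsum s fun _ _ => norm_nonneg _)
  rw [hterm n (hs n hn)]
  exact mul_le_mul_of_nonneg_right (norm_zetaMul_sq_le hχ n) (by positivity)

lemma exists_sum_zetaMul_sq_le (hχ : χ ^ 2 = 1) (hχ1 : χ ≠ 1) :
    ∃ C, 0 < C ∧ ∀ T : ℝ, 3 ≤ T → ∀ s : Finset ℕ, (∀ n ∈ s, 0 < n) →
      ∑ n ∈ s, ‖χ.zetaMul n‖ ^ 2 * (n : ℝ) ^ (-(1 + 1 / Real.log T)) ≤ C * Real.log T ^ 2 := by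
  obtain ⟨C, hC, h⟩ := exists_norm_zetaL_le hχ1
  refine ⟨C ^ 2, by positivity, fun T hT s hs => ?_⟩
  have hl : 1 ≤ Real.log T := by
    rw [Real.le_log_iff_exp_le (by linarith)]
    linarith [Real.exp_one_lt_d9]
  have h1 : 1 / Real.log T ≤ 1 := by rw [div_le_one (by linarith)]; exact hl
  have h2 : 0 < 1 / Real.log T := by positivity
  refine (sum_zetaMul_sq_mul_rpow_le hχ (by linarith) s hs).trans ?_
  rw [← mul_pow]
  refine pow_le_pow_left₀ (norm_nonneg _) ((h _ (by linarith) (by linarith)).trans_eq ?_) 2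
  field_simp
  ring

lemma exists_sum_zetaMul_sq_div_le (hχ : χ ^ 2 = 1) (hχ1 : χ ≠ 1) :
    ∃ C, 0 < C ∧ ∀ T : ℝ, 3 ≤ T → ∀ s : Finset ℕ, (∀ n ∈ s, 0 < n ∧ (n : ℝ) ≤ T) →
      ∑ n ∈ s, ‖χ.zetaMul n‖ ^ 2 / n ≤ C * Real.log T ^ 2 := by
  obtain ⟨C, hC, h⟩ := exists_sum_zetaMul_sq_le hχ hχ1
  refine ⟨Real.exp 1 * C, by positivity, fun T hT s hs => ?_⟩
  have hl : 0 < Real.log T := Real.log_pos (by linarith)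
  have := h T hT s fun n hn => (hs n hn).1
  rw [mul_assoc]
  refine le_trans ?_ (mul_le_mul_of_nonneg_left this (Real.exp_pos 1).le)
  rw [Finset.mul_sum]
  refine Finset.sum_le_sum fun n hn => ?_
  have hn0 : (0 : ℝ) < n := by exact_mod_cast (hs n hn).1
  have h1 : (n : ℝ) ^ (1 / Real.log T) ≤ Real.exp 1 := by
    rw [Real.rpow_def_of_pos hn0]
    refine Real.exp_le_exp.2 ?_
    rw [mul_one_div, div_le_one hl]
    exact Real.log_le_log hn0 (hs n hn).2
  have h2 : (n : ℝ) ^ (-(1 + 1 / Real.log T)) * (n : ℝ) ^ (1 / Real.log T) = 1 / n := by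
    rw [← Real.rpow_add hn0, show -(1 + 1 / Real.log T) + 1 / Real.log T = -1 by ring,
      Real.rpow_neg_one, one_div]
  rw [div_eq_mul_one_div, ← h2, ← mul_assoc]
  exact (mul_comm _ _).trans_le <|
    mul_le_mul_of_nonneg_right h1 (by positivity)

lemma exists_sum_zetaMul_sq_div_sq_le (hχ : χ ^ 2 = 1) (hχ1 : χ ≠ 1) :
    ∃ C, 0 < C ∧ ∀ T : ℝ, 3 ≤ T → ∀ s : Finset ℕ, (∀ n ∈ s, T ≤ n) →
      ∑ n ∈ s, ‖χ.zetaMul n‖ ^ 2 / (n : ℝ) ^ 2 ≤ C * Real.log T ^ 2 / T := by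
  obtain ⟨C, hC, h⟩ := exists_sum_zetaMul_sq_le hχ hχ1
  refine ⟨Real.exp 1 * C, by positivity, fun T hT s hs => ?_⟩
  have hl : 1 ≤ Real.log T := by
    rw [Real.le_log_iff_exp_le (by linarith)]
    linarith [Real.exp_one_lt_d9]
  have hs0 : ∀ n ∈ s, (0 : ℝ) < n := fun n hn => by linarith [hs n hn]
  have := h T hT s fun n hn => by exact_mod_cast hs0 n hn
  rw [mul_assoc, mul_div_right_comm]
  have hT0 : 0 < T := by linarith
  refine le_trans ?_ (mul_le_mul_of_nonneg_left this (by positivity))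
  rw [Finset.mul_sum]
  refine Finset.sum_le_sum fun n hn => ?_
  have hn0 := hs0 n hn
  have h1 : (n : ℝ) ^ (-1 + 1 / Real.log T) ≤ Real.exp 1 / T := by
    have h3 : 1 / Real.log T ≤ 1 := by rw [div_le_one (by linarith)]; exact hl
    refine (Real.rpow_le_rpow_of_nonpos hT0 (hs n hn) (by linarith)).trans_eq ?_
    rw [Real.rpow_add hT0, Real.rpow_neg_one, Real.rpow_def_of_pos hT0 (1 / Real.log T),
      mul_one_div_cancel (by linarith), inv_mul_eq_div]
  have h2 : (n : ℝ) ^ (-(1 + 1 / Real.log T)) * (n : ℝ) ^ (-1 + 1 / Real.log T) =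
      1 / (n : ℝ) ^ 2 := by
    rw [← Real.rpow_add hn0, show -(1 + 1 / Real.log T) + (-1 + 1 / Real.log T) = -(2 : ℕ) by
      push_cast; ring, Real.rpow_neg hn0.le, Real.rpow_natCast, one_div]
  rw [div_eq_mul_one_div, ← h2, ← mul_assoc]
  exact (mul_comm _ _).trans_le <|
    mul_le_mul_of_nonneg_right h1 (by positivity)

end ZetaProduct

section DirichletPolynomial

/-- The Dirichlet polynomial `∑_{n ≤ T} r(n) n⁻ᶻ`. -/
noncomputable def dirPoly (r : ℕ → ℂ) (T : ℝ) (z : ℂ) : ℂ :=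
  ∑ n ∈ Finset.Icc 1 ⌊T⌋₊, r n * (n : ℂ) ^ (-z)

/-- Logarithmic bounds for the second moments of the coefficients of a Dirichlet series. -/
structure HasSqBound (r : ℕ → ℂ) (C : ℝ) : Prop where
  nonneg : 0 ≤ C
  sum_le (T : ℝ) (hT : 3 ≤ T) (s : Finset ℕ) (hs : ∀ n ∈ s, 0 < n ∧ (n : ℝ) ≤ T) :
    ∑ n ∈ s, ‖r n‖ ^ 2 / n ≤ C * Real.log T ^ 2
  sum_tail_le (T : ℝ) (hT : 3 ≤ T) (s : Finset ℕ) (hs : ∀ n ∈ s, T ≤ n) :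
    ∑ n ∈ s, ‖r n‖ ^ 2 / (n : ℝ) ^ 2 ≤ C * Real.log T ^ 2 / T
  summable : LSeriesSummable r (3 / 2)

lemma natCast_cpow_add_mul_I {n : ℕ} (hn : 0 < n) (a t : ℝ) :
    (n : ℂ) ^ (-(a + t * I)) = ((n : ℝ) ^ (-a) : ℝ) * (n : ℂ) ^ (-(t * I)) := by
  rw [neg_add, cpow_add _ _ (by exact_mod_cast hn.ne'), ofReal_cpow (Nat.cast_nonneg _)]
  push_cast; rfl

lemma differentiable_dirPoly (r : ℕ → ℂ) (T : ℝ) : Differentiable ℂ (dirPoly r T) := by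
  unfold dirPoly
  refine Differentiable.fun_sum fun n hn => ?_
  have : (n : ℂ) ≠ 0 := by
    have := (Finset.mem_Icc.1 hn).1
    exact_mod_cast (by omega : n ≠ 0)
  exact (differentiable_const _).mul ((differentiable_neg).const_cpow (.inl this))

lemma exists_norm_dirPoly_le (r : ℕ → ℂ) (T : ℝ) :
    ∃ M, 0 ≤ M ∧ ∀ z : ℂ, -1 ≤ z.re → ‖dirPoly r T z‖ ≤ M := by
  refine ⟨∑ n ∈ Finset.Icc 1 ⌊T⌋₊, ‖r n‖ * n, by positivity, fun z hz => ?_⟩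
  refine norm_sum_le_of_le _ fun n hn => ?_
  have hn1 : 1 ≤ n := (Finset.mem_Icc.1 hn).1
  rw [norm_mul, norm_natCast_cpow_of_pos (by omega)]
  refine mul_le_mul_of_nonneg_left ?_ (norm_nonneg _)
  calc (n : ℝ) ^ (-z).re ≤ (n : ℝ) ^ (1 : ℝ) :=
        Real.rpow_le_rpow_of_exponent_le (by exact_mod_cast hn1) (by simp; linarith)
    _ = n := Real.rpow_one _

lemma dirPoly_add_mul_I (r : ℕ → ℂ) (T a t : ℝ) : dirPoly r T (a + t * I) =
    ∑ n ∈ Finset.Icc 1 ⌊T⌋₊, (r n * ((n : ℝ) ^ (-a) : ℝ)) * (n : ℂ) ^ (-(t * I)) := by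
  refine Finset.sum_congr rfl fun n hn => ?_
  rw [natCast_cpow_add_mul_I (by have := (Finset.mem_Icc.1 hn).1; omega), mul_assoc]

lemma integrable_norm_sq_mul_gaussian {g : ℝ → ℂ} (hg : Continuous g) {M : ℝ}
    (hM : ∀ t, ‖g t‖ ≤ M) {T : ℝ} (hT : 0 < T) :
    Integrable fun t => ‖g t‖ ^ 2 * Real.exp (-(t ^ 2 / T ^ 2)) := by
  refine (integrable_gaussian hT).bdd_mul (c := M ^ 2) (by fun_prop)
    (ae_of_all _ fun t => ?_)
  rw [norm_pow, norm_norm]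
  exact pow_le_pow_left₀ (norm_nonneg _) (hM t) 2

variable {r : ℕ → ℂ} {C : ℝ}

lemma HasSqBound.integral_dirPoly_half_le (h : HasSqBound r C) {T : ℝ} (hT : 3 ≤ T) :
    ∫ t : ℝ, ‖dirPoly r T ((1 / 2 : ℝ) + t * I)‖ ^ 2 * Real.exp (-(t ^ 2 / T ^ 2)) ≤
      60 * C * (T * Real.log T ^ 2) := by
  simp_rw [dirPoly_add_mul_I]
  have hs : ∀ n ∈ Finset.Icc 1 ⌊T⌋₊, 0 < n ∧ (n : ℝ) ≤ T := fun n hn =>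
    ⟨(Finset.mem_Icc.1 hn).1, (Nat.le_floor_iff (by linarith)).1 (Finset.mem_Icc.1 hn).2⟩
  refine (meanValue_finset _ (fun n hn => (hs n hn).1) _ (by linarith)).trans ?_
  have := h.sum_le T hT _ hs
  calc _ ≤ 30 * (2 * T * ∑ n ∈ Finset.Icc 1 ⌊T⌋₊, ‖r n‖ ^ 2 / n) := by
        refine mul_le_mul_of_nonneg_left ?_ (by norm_num)
        rw [Finset.mul_sum]
        refine Finset.sum_le_sum fun n hn => ?_
        have hn0 : (0 : ℝ) < n := by exact_mod_cast (hs n hn).1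
        rw [norm_mul, norm_real, Real.norm_of_nonneg (by positivity), mul_pow,
          ← Real.rpow_natCast ((n : ℝ) ^ _), ← Real.rpow_mul hn0.le,
          show -(1 / 2 : ℝ) * (2 : ℕ) = -1 by norm_num, Real.rpow_neg_one, ← div_eq_mul_inv]
        exact mul_le_mul_of_nonneg_right (by linarith [(hs n hn).2]) (by positivity)
    _ ≤ 30 * (2 * T * (C * Real.log T ^ 2)) := by gcongr
    _ = _ := by ring

lemma HasSqBound.integral_dirPoly_neg_half_le (h : HasSqBound r C) {T : ℝ} (hT : 3 ≤ T) :
    ∫ t : ℝ, ‖dirPoly r T ((-1 / 2 : ℝ) + t * I)‖ ^ 2 * Real.exp (-(t ^ 2 / T ^ 2)) ≤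
      60 * C * (T ^ 3 * Real.log T ^ 2) := by
  simp_rw [dirPoly_add_mul_I]
  have hs : ∀ n ∈ Finset.Icc 1 ⌊T⌋₊, 0 < n ∧ (n : ℝ) ≤ T := fun n hn =>
    ⟨(Finset.mem_Icc.1 hn).1, (Nat.le_floor_iff (by linarith)).1 (Finset.mem_Icc.1 hn).2⟩
  refine (meanValue_finset _ (fun n hn => (hs n hn).1) _ (by linarith)).trans ?_
  have := h.sum_le T hT _ hs
  calc _ ≤ 30 * (2 * T ^ 3 * ∑ n ∈ Finset.Icc 1 ⌊T⌋₊, ‖r n‖ ^ 2 / n) := by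
        refine mul_le_mul_of_nonneg_left ?_ (by norm_num)
        rw [Finset.mul_sum]
        refine Finset.sum_le_sum fun n hn => ?_
        have hn0 : (0 : ℝ) < n := by exact_mod_cast (hs n hn).1
        have hnT := (hs n hn).2
        rw [norm_mul, norm_real, Real.norm_of_nonneg (by positivity), mul_pow,
          ← Real.rpow_natCast ((n : ℝ) ^ _), ← Real.rpow_mul hn0.le,
          show -(-1 / 2 : ℝ) * (2 : ℕ) = 1 by norm_num, Real.rpow_one]
        have h1 : (T + n) * (n : ℝ) ^ 2 ≤ 2 * T ^ 3 := by
          have : (n : ℝ) ^ 2 ≤ T ^ 2 := by gcongr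
          calc (T + n) * (n : ℝ) ^ 2 ≤ (T + T) * T ^ 2 := by gcongr
            _ = 2 * T ^ 3 := by ring
        calc (T + n) * (‖r n‖ ^ 2 * n) = (T + n) * (n : ℝ) ^ 2 * (‖r n‖ ^ 2 / n) := by
              field_simp
          _ ≤ _ := mul_le_mul_of_nonneg_right h1 (by positivity)
    _ ≤ 30 * (2 * T ^ 3 * (C * Real.log T ^ 2)) := by gcongr
    _ = _ := by ring

lemma HasSqBound.exists_tail (h : HasSqBound r C) (T : ℝ) :
    ∃ a : ℕ → ℂ, (∀ n, a n = if (n : ℝ) ≤ T then 0 else r n * ((n : ℝ) ^ (-(3 / 2 : ℝ)) : ℝ)) ∧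
      (Summable fun n => ‖a n‖) ∧ ∀ t : ℝ,
      LSeries r ((3 / 2 : ℝ) + t * I) - dirPoly r T ((3 / 2 : ℝ) + t * I) =
        ∑' n, a n * (n : ℂ) ^ (-(t * I)) := by
  refine ⟨_, fun n => rfl, ?_, fun t => ?_⟩
  · refine h.summable.norm.of_nonneg_of_le (fun _ => norm_nonneg _) fun n => ?_
    split_ifs with hn
    · simp
    · rw [LSeries.norm_term_eq]
      rcases n.eq_zero_or_pos with rfl | hn0
      · norm_num [Real.zero_rpow]
      · rw [if_neg hn0.ne', norm_mul, norm_real, Real.norm_of_nonneg (by positivity),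
          Real.rpow_neg (by positivity), ← div_eq_mul_inv, show (3 / 2 : ℂ).re = 3 / 2 by norm_num]
  · have hs : LSeriesSummable r ((3 / 2 : ℝ) + t * I) :=
      h.summable.of_re_le_re (by simp)
    rw [sub_eq_iff_eq_add', LSeries, dirPoly]
    have hfin : HasSum (fun n : ℕ => if n ∈ Finset.Icc 1 ⌊T⌋₊ then
        r n * (n : ℂ) ^ (-((3 / 2 : ℝ) + t * I)) else 0)
        (∑ n ∈ Finset.Icc 1 ⌊T⌋₊, if n ∈ Finset.Icc 1 ⌊T⌋₊ then
        r n * (n : ℂ) ^ (-((3 / 2 : ℝ) + t * I)) else 0) :=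
      hasSum_sum_of_ne_finset_zero fun n hn => if_neg hn
    have h1 : ∀ n, LSeries.term r ((3 / 2 : ℝ) + t * I) n -
        (if n ∈ Finset.Icc 1 ⌊T⌋₊ then r n * (n : ℂ) ^ (-((3 / 2 : ℝ) + t * I)) else 0) =
        (if (n : ℝ) ≤ T then 0 else r n * ((n : ℝ) ^ (-(3 / 2 : ℝ)) : ℝ)) *
          (n : ℂ) ^ (-(t * I)) := by
      intro n
      rcases n.eq_zero_or_pos with rfl | hn0
      · simp [Real.zero_rpow]
      rw [LSeries.term_of_ne_zero hn0.ne', div_eq_mul_inv, ← cpow_neg]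
      by_cases hn : (n : ℝ) ≤ T
      · rw [if_pos hn, if_pos (Finset.mem_Icc.2 ⟨hn0, Nat.le_floor hn⟩), sub_self, zero_mul]
      · rw [if_neg hn, if_neg fun h => hn ?_, sub_zero, natCast_cpow_add_mul_I hn0, mul_assoc]
        have h2 := (Finset.mem_Icc.1 h).2
        exact (Nat.le_floor_iff' hn0.ne').1 h2
    have h2 := (hs.hasSum.sub hfin).tsum_eq
    simp only [h1] at h2
    rw [h2, Finset.sum_congr rfl fun n hn => if_pos hn]
    ring

lemma HasSqBound.integral_tail_le (h : HasSqBound r C) {T : ℝ} (hT : 3 ≤ T) :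
    ∫ t : ℝ, ‖LSeries r ((3 / 2 : ℝ) + t * I) - dirPoly r T ((3 / 2 : ℝ) + t * I)‖ ^ 2 *
      Real.exp (-(t ^ 2 / T ^ 2)) ≤ 60 * C * (Real.log T ^ 2 / T) := by
  obtain ⟨a, ha, hsum, hB⟩ := h.exists_tail T
  simp_rw [hB]
  refine (meanValue_tsum a (by rw [ha, if_pos (by simp; linarith)]) hsum (by linarith)
    (B := 2 * (C * Real.log T ^ 2 / T)) fun s => ?_).trans_eq (by ring)
  refine le_trans ?_ (mul_le_mul_of_nonneg_left (h.sum_tail_le T hT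
    (s.filter fun n : ℕ => ¬ (n : ℝ) ≤ T) fun n hn => ?_) zero_le_two)
  · rw [Finset.mul_sum, Finset.sum_filter]
    refine Finset.sum_le_sum fun n _ => ?_
    rw [ha]
    by_cases hn : (n : ℝ) ≤ T
    · simp [hn]
    · rw [if_neg hn, if_pos hn]
      push Not at hn
      have hn0 : (0 : ℝ) < n := by linarith
      rw [norm_mul, norm_real, Real.norm_of_nonneg (by positivity), mul_pow,
        ← Real.rpow_natCast ((n : ℝ) ^ _), ← Real.rpow_mul hn0.le,
        show -(3 / 2 : ℝ) * (2 : ℕ) = -(3 : ℕ) by norm_num, Real.rpow_neg hn0.le,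
        Real.rpow_natCast]
      calc (T + n) * (‖r n‖ ^ 2 * ((n : ℝ) ^ 3)⁻¹) ≤ (n + n) * (‖r n‖ ^ 2 * ((n : ℝ) ^ 3)⁻¹) := by
            gcongr
        _ = _ := by field_simp; ring
  · exact (not_le.1 (Finset.mem_filter.1 hn).2).le

lemma HasSqBound.exists_norm_tail_le (h : HasSqBound r C) (T : ℝ) :
    (Continuous fun t : ℝ =>
      LSeries r ((3 / 2 : ℝ) + t * I) - dirPoly r T ((3 / 2 : ℝ) + t * I)) ∧
    ∃ M, ∀ t : ℝ, ‖LSeries r ((3 / 2 : ℝ) + t * I) - dirPoly r T ((3 / 2 : ℝ) + t * I)‖ ≤ M := by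
  obtain ⟨a, ha, hsum, hB⟩ := h.exists_tail T
  have hle : ∀ (n : ℕ) (t : ℝ), ‖a n * (n : ℂ) ^ (-(t * I))‖ ≤ ‖a n‖ := fun n t => by
    rw [norm_mul]
    exact mul_le_of_le_one_right (norm_nonneg _) (norm_natCast_cpow_mul_I n t)
  simp_rw [hB]
  refine ⟨continuous_tsum (fun n => ?_) hsum hle, ∑' n, ‖a n‖, fun t => ?_⟩
  · rcases n.eq_zero_or_pos with rfl | hn
    · have : a 0 = 0 := by rw [ha]; split_ifs <;> simp [Real.zero_rpow]
      simp only [this, zero_mul]; exact continuous_const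
    · exact continuous_const.mul (continuous_natCast_cpow_mul_I hn)
  · exact tsum_of_norm_bounded hsum.hasSum fun n => hle n t

end DirichletPolynomial

section MeanSquare

open ComplexConjugate

/-- The analytic input for the mean square estimate: `W(z) = (z - 1)² Z(z)`, where `Z` is given by
the Dirichlet series with coefficients `r`, and the functional equation reads
`W(z) = X(z) Z(1 - z)`. -/
structure HasFunctionalEquation (r : ℕ → ℂ) (W X : ℂ → ℂ) (K : ℝ) : Prop where
  sq_bound : HasSqBound r K
  differentiable : Differentiable ℂ W
  differentiableAt (z : ℂ) (hz : z.re < 2) : DifferentiableAt ℂ X z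
  eq_LSeries (t : ℝ) : W ((3 / 2 : ℝ) + t * I) =
    ((3 / 2 : ℝ) + t * I - 1) ^ 2 * LSeries r ((3 / 2 : ℝ) + t * I)
  eq_mul_LSeries (t : ℝ) : W ((-1 / 2 : ℝ) + t * I) =
    X ((-1 / 2 : ℝ) + t * I) * LSeries r ((3 / 2 : ℝ) + (-t : ℝ) * I)
  norm_three_half_le (t : ℝ) : ‖X ((3 / 2 : ℝ) + t * I)‖ ≤ K
  norm_half_le (t : ℝ) : ‖X ((1 / 2 : ℝ) + t * I)‖ ≤ K * (1 + t ^ 2)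
  norm_neg_half_le (t : ℝ) : ‖X ((-1 / 2 : ℝ) + t * I)‖ ≤ K * (1 + t ^ 2) ^ 2
  growth (z : ℂ) (h1 : -1 / 2 ≤ z.re) (h2 : z.re ≤ 3 / 2) : ‖W z‖ ≤ K * Real.exp (5 * |z.im|)
  growth_factor (z : ℂ) (h1 : -1 / 2 ≤ z.re) (h2 : z.re ≤ 3 / 2) :
    ‖X z‖ ≤ K * Real.exp (5 * |z.im|)

/-- The error in the smoothed approximate functional equation. -/
noncomputable def afeError (r : ℕ → ℂ) (W X : ℂ → ℂ) (T : ℝ) (z : ℂ) : ℂ :=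
  (W z - (z - 1) ^ 2 * dirPoly r T z - X z * dirPoly r T (1 - z)) *
    cexp ((z - (1 / 2 : ℝ)) ^ 2 / (T : ℂ) ^ 2)

lemma one_add_sq_le {T : ℝ} (hT : 1 ≤ T) (t : ℝ) :
    (1 + t ^ 2) ^ 2 * Real.exp (-(t ^ 2 / T ^ 2)) ≤ 4 * T ^ 4 ∧
    (1 + t ^ 2) ^ 4 * Real.exp (-(t ^ 2 / T ^ 2)) ≤ 256 * T ^ 8 := by
  have hT0 : 0 < T := by linarith
  obtain ⟨u, hu⟩ : ∃ u, u = t ^ 2 / T ^ 2 := ⟨_, rfl⟩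
  have hu0 : 0 ≤ u := hu ▸ by positivity
  have h1 : 1 + t ^ 2 ≤ T ^ 2 * (1 + u) := by
    have : T ^ 2 * u = t ^ 2 := by rw [hu]; field_simp
    nlinarith
  have h2 : 1 + u ≤ 2 * Real.exp (u / 2) := by linarith [Real.add_one_le_exp (u / 2)]
  have h4 : 1 + u ≤ 4 * Real.exp (u / 4) := by linarith [Real.add_one_le_exp (u / 4)]
  rw [← hu, Real.exp_neg, ← div_eq_mul_inv, ← div_eq_mul_inv, div_le_iff₀ (Real.exp_pos u),
    div_le_iff₀ (Real.exp_pos u)]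
  constructor
  · calc (1 + t ^ 2) ^ 2 ≤ (T ^ 2 * (2 * Real.exp (u / 2))) ^ 2 := by
          refine pow_le_pow_left₀ (by positivity) (h1.trans ?_) 2
          gcongr
      _ = 4 * T ^ 4 * Real.exp (u / 2) ^ 2 := by ring
      _ = _ := by rw [← Real.exp_nat_mul]; congr 2; push_cast; ring
  · calc (1 + t ^ 2) ^ 4 ≤ (T ^ 2 * (4 * Real.exp (u / 4))) ^ 4 := by
          refine pow_le_pow_left₀ (by positivity) (h1.trans ?_) 4
          gcongr
      _ = 256 * T ^ 8 * Real.exp (u / 4) ^ 4 := by ring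
      _ = _ := by rw [← Real.exp_nat_mul]; congr 2; push_cast; ring

lemma exp_neg_sq_div_le_one (t T : ℝ) : Real.exp (-(t ^ 2 / T ^ 2)) ≤ 1 :=
  Real.exp_le_one_iff.2 (neg_nonpos.2 (by positivity))

lemma norm_cexp_sq_div (σ t : ℝ) (T : ℝ) :
    ‖cexp (((σ + t * I) - (1 / 2 : ℝ)) ^ 2 / (T : ℂ) ^ 2)‖ =
      Real.exp (((σ - 1 / 2) ^ 2 - t ^ 2) / T ^ 2) := by
  rw [norm_exp, ← ofReal_pow, div_ofReal_re]
  congr 2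
  simp [sq]

lemma norm_cexp_sq_div_sq_le {σ : ℝ} (h1 : -1 / 2 ≤ σ) (h2 : σ ≤ 3 / 2) (t : ℝ) {T : ℝ}
    (hT : 3 ≤ T) : ‖cexp (((σ + t * I) - (1 / 2 : ℝ)) ^ 2 / (T : ℂ) ^ 2)‖ ^ 2 ≤
      2 * (Real.exp (-(t ^ 2 / T ^ 2)) * Real.exp (-(t ^ 2 / T ^ 2))) := by
  rw [norm_cexp_sq_div, ← Real.exp_nat_mul, ← Real.exp_add]
  have h3 : (σ - 1 / 2) ^ 2 ≤ 1 := by nlinarith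
  have h4 : (σ - 1 / 2) ^ 2 / T ^ 2 ≤ 1 / 9 := by
    rw [div_le_div_iff₀ (by positivity) (by norm_num)]
    nlinarith
  have h5 : Real.exp (2 / 9) ≤ 2 := by
    have := Real.exp_bound_div_one_sub_of_interval (x := 2 / 9) (by norm_num) (by norm_num)
    linarith
  calc _ ≤ Real.exp (2 / 9 + (-(t ^ 2 / T ^ 2) + -(t ^ 2 / T ^ 2))) := by
        refine Real.exp_le_exp.2 ?_
        push_cast
        rw [sub_div]
        linarith
    _ = Real.exp (2 / 9) * Real.exp (-(t ^ 2 / T ^ 2) + -(t ^ 2 / T ^ 2)) := Real.exp_add _ _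
    _ ≤ _ := by gcongr

variable {r : ℕ → ℂ} {W X : ℂ → ℂ} {K : ℝ}

namespace HasFunctionalEquation

lemma differentiableAt_afeError (h : HasFunctionalEquation r W X K) (T : ℝ) {z : ℂ}
    (hz : z.re < 2) : DifferentiableAt ℂ (afeError r W X T) z := by
  have h1 := h.differentiable z
  have h2 := h.differentiableAt z hz
  have h3 := differentiable_dirPoly r T z
  have h4 : DifferentiableAt ℂ (fun z => dirPoly r T (1 - z)) z :=
    ((differentiable_dirPoly r T).comp (differentiable_const 1 |>.sub differentiable_id)) z
  unfold afeError
  fun_prop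

lemma exists_norm_afeError_le (h : HasFunctionalEquation r W X K) {T : ℝ} (hT : 3 ≤ T) :
    ∃ M, 0 ≤ M ∧ ∀ σ t : ℝ, -1 / 2 ≤ σ → σ ≤ 3 / 2 →
      ‖afeError r W X T (σ + t * I)‖ ≤ M * Real.exp (-(t ^ 2 / T ^ 2) / 2) := by
  obtain ⟨M, hM, hM'⟩ := exists_norm_dirPoly_le r T
  have hK := h.sq_bound.nonneg
  obtain ⟨c, hc⟩ : ∃ c, c = K + 4 * M + K * M := ⟨_, rfl⟩
  have hc0 : 0 ≤ c := hc ▸ by positivity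
  refine ⟨c * (2 * Real.exp (13 * T ^ 2)), by positivity, fun σ t h1 h2 => ?_⟩
  have hT0 : 0 < T := by linarith
  have hre : ((σ : ℂ) + t * I).re = σ := by simp
  have him : ((σ : ℂ) + t * I).im = t := by simp
  have hE : 1 ≤ Real.exp |t| := Real.one_le_exp (abs_nonneg t)
  have hz1 : ‖(σ : ℂ) + t * I - 1‖ ≤ 2 * Real.exp |t| := by
    refine (norm_le_abs_re_add_abs_im _).trans ?_
    simp only [sub_re, sub_im, hre, him, one_re, one_im, sub_zero]
    have : |σ - 1| ≤ 3 / 2 := abs_le.2 ⟨by linarith, by linarith⟩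
    nlinarith [Real.add_one_le_exp |t|]
  have hz2 : ‖(σ : ℂ) + t * I - 1‖ ^ 2 ≤ 4 * Real.exp (5 * |t|) := by
    calc _ ≤ (2 * Real.exp |t|) ^ 2 := pow_le_pow_left₀ (norm_nonneg _) hz1 2
      _ = 4 * Real.exp (2 * |t|) := by rw [mul_pow, ← Real.exp_nat_mul]; norm_num
      _ ≤ _ := by gcongr; norm_num
  have hW := h.growth (σ + t * I) (by rwa [hre]) (by rwa [hre])
  have hX := h.growth_factor (σ + t * I) (by rwa [hre]) (by rwa [hre])
  rw [him] at hW hX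
  have hA := hM' (σ + t * I) (by rw [hre]; linarith)
  have hA' := hM' (1 - (σ + t * I)) (by rw [sub_re, hre, one_re]; linarith)
  have hF : ‖W (σ + t * I) - (σ + t * I - 1) ^ 2 * dirPoly r T (σ + t * I) -
      X (σ + t * I) * dirPoly r T (1 - (σ + t * I))‖ ≤ c * Real.exp (5 * |t|) := by
    refine (norm_sub_le _ _).trans ((add_le_add_left (norm_sub_le _ _) _).trans ?_)
    rw [norm_mul, norm_mul, norm_pow]
    calc _ ≤ K * Real.exp (5 * |t|) + 4 * Real.exp (5 * |t|) * M + K * Real.exp (5 * |t|) * M := by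
          gcongr
      _ = _ := by rw [hc]; ring
  rw [afeError, norm_mul, norm_cexp_sq_div]
  calc _ ≤ c * Real.exp (5 * |t|) * Real.exp (((σ - 1 / 2) ^ 2 - t ^ 2) / T ^ 2) := by gcongr
    _ = c * Real.exp (5 * |t| + ((σ - 1 / 2) ^ 2 - t ^ 2) / T ^ 2) := by
        rw [mul_assoc, Real.exp_add]
    _ ≤ c * Real.exp (1 / 9 + (13 * T ^ 2 + -(t ^ 2 / T ^ 2) / 2)) := by
        refine mul_le_mul_of_nonneg_left (Real.exp_le_exp.2 ?_) hc0
        have h4 : (σ - 1 / 2) ^ 2 / T ^ 2 ≤ 1 / 9 := by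
          rw [div_le_div_iff₀ (by positivity) (by norm_num)]
          nlinarith
        have h5 : 5 * |t| ≤ 13 * T ^ 2 + t ^ 2 / T ^ 2 / 2 := by
          obtain ⟨v, hv⟩ : ∃ v, v = |t| / T := ⟨_, rfl⟩
          have h6 : |t| = T * v := by rw [hv]; field_simp
          have h7 : t ^ 2 / T ^ 2 = v ^ 2 := by rw [hv, div_pow, sq_abs]
          rw [h7, h6]
          nlinarith [sq_nonneg (v - 5 * T)]
        rw [sub_div]
        linarith
    _ = c * (Real.exp (1 / 9) * Real.exp (13 * T ^ 2)) * Real.exp (-(t ^ 2 / T ^ 2) / 2) := by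
        rw [Real.exp_add, Real.exp_add]; ring
    _ ≤ _ := by
        gcongr
        have := Real.exp_bound_div_one_sub_of_interval (x := 1 / 9) (by norm_num) (by norm_num)
        linarith

lemma continuous_afeError (h : HasFunctionalEquation r W X K) (T : ℝ) {σ : ℝ} (hσ : σ ≤ 3 / 2) :
    Continuous fun t : ℝ => afeError r W X T (σ + t * I) := by
  refine continuous_iff_continuousAt.2 fun t => ?_
  have h1 := (h.differentiableAt_afeError T (z := σ + t * I) (by simp; linarith)).continuousAt
  exact ContinuousAt.comp (f := fun t : ℝ => (σ : ℂ) + t * I) h1 (by fun_prop)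

lemma integrable_afeError_sq (h : HasFunctionalEquation r W X K) {T : ℝ} (hT : 3 ≤ T) {σ : ℝ}
    (h1 : -1 / 2 ≤ σ) (h2 : σ ≤ 3 / 2) :
    Integrable fun t : ℝ => ‖afeError r W X T (σ + t * I)‖ ^ 2 := by
  obtain ⟨M, hM, hM'⟩ := h.exists_norm_afeError_le hT
  refine ((integrable_gaussian (show 0 < T by linarith)).const_mul (M ^ 2)).mono'
    ((h.continuous_afeError T h2).norm.pow 2).aestronglyMeasurable (ae_of_all _ fun t => ?_)
  rw [norm_pow, norm_norm]
  refine (pow_le_pow_left₀ (norm_nonneg _) (hM' σ t h1 h2) 2).trans_eq ?_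
  rw [mul_pow, ← Real.exp_nat_mul]
  congr 2; push_cast; ring

lemma integral_afeError_sq_le (h : HasFunctionalEquation r W X K) {T : ℝ} (hT : 3 ≤ T) :
    ∫ t : ℝ, ‖afeError r W X T ((1 / 2 : ℝ) + t * I)‖ ^ 2 ≤
      (T ^ 2 * (∫ t : ℝ, ‖afeError r W X T ((3 / 2 : ℝ) + t * I)‖ ^ 2) +
        (T ^ 2)⁻¹ * ∫ t : ℝ, ‖afeError r W X T ((-1 / 2 : ℝ) + t * I)‖ ^ 2) / 2 := by
  have hT0 : 0 < T := by linarith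
  obtain ⟨M, hM, hM'⟩ := h.exists_norm_afeError_le hT
  obtain ⟨G, hG⟩ : ∃ G : ℂ → ℂ, G = fun z => afeError r W X T z *
    conj (afeError r W X T (conj (1 - z))) := ⟨_, rfl⟩
  have hconj : ∀ σ t : ℝ, conj (1 - ((σ : ℂ) + t * I)) = ((1 - σ : ℝ) : ℂ) + t * I := by
    intro σ t
    apply Complex.ext <;> simp
  have hGe : ∀ σ t : ℝ, G (σ + t * I) = afeError r W X T (σ + t * I) *
      conj (afeError r W X T ((1 - σ : ℝ) + t * I)) := by
    intro σ t; rw [hG]; dsimp only; rw [hconj]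
  have hGn : ∀ σ t : ℝ, -1 / 2 ≤ σ → σ ≤ 3 / 2 →
      ‖G (σ + t * I)‖ ≤ M ^ 2 * Real.exp (-(t ^ 2 / T ^ 2)) := by
    intro σ t h1 h2
    rw [hGe, norm_mul, RCLike.norm_conj]
    refine (mul_le_mul (hM' σ t h1 h2) (hM' (1 - σ) t (by linarith) (by linarith))
      (norm_nonneg _) (by positivity)).trans_eq ?_
    rw [mul_mul_mul_comm, ← Real.exp_add, ← sq, add_halves]
  have hGd : ∀ z : ℂ, -1 < z.re → z.re < 2 → DifferentiableAt ℂ G z := by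
    intro z h1 h2
    rw [hG]
    refine (h.differentiableAt_afeError T h2).mul ?_
    have h3 := DifferentiableAt.conj_conj (h.differentiableAt_afeError T (z := conj (1 - z))
        (by simp; linarith))
    rw [conj_conj] at h3
    exact h3.comp z (f := fun z => 1 - z) (by fun_prop)
  have hGi : ∀ σ : ℝ, -1 / 2 ≤ σ → σ ≤ 3 / 2 → Integrable fun t : ℝ => G (σ + t * I) := by
    intro σ h1 h2
    refine ((integrable_gaussian hT0).const_mul (M ^ 2)).mono' ?_
      (ae_of_all _ fun t => hGn σ t h1 h2)
    refine Continuous.aestronglyMeasurable ?_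
    refine continuous_iff_continuousAt.2 fun t => ?_
    have h3 := (hGd (σ + t * I) (by simp; linarith) (by simp; linarith)).continuousAt
    exact ContinuousAt.comp (f := fun t : ℝ => (σ : ℂ) + t * I) h3 (by fun_prop)
  have hshift := integral_vertical_eq (f := G) (a := 1 / 2) (b := 3 / 2)
    (g := fun t => M ^ 2 * Real.exp (-(t ^ 2 / T ^ 2))) (by norm_num)
    (fun z hz => (hGd z (by have := hz.1; linarith) (by
      have := hz.2; linarith)).differentiableWithinAt)
    (hGi _ (by norm_num) (by norm_num)) (hGi _ (by norm_num) (by norm_num)) (by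
      rw [← mul_zero (M ^ 2)]
      refine Tendsto.const_mul _ (Real.tendsto_exp_atBot.comp (tendsto_neg_atTop_atBot.comp ?_))
      exact (tendsto_pow_atTop two_ne_zero).atTop_div_const (by positivity))
    (fun σ t h1 h2 _ => by simpa only [sq_abs] using hGn σ t (by linarith) h2)
  have hleft : ∀ t : ℝ, G ((1 / 2 : ℝ) + t * I) =
      ((‖afeError r W X T ((1 / 2 : ℝ) + t * I)‖ ^ 2 : ℝ) : ℂ) := by
    intro t
    rw [hGe, show (1 - 1 / 2 : ℝ) = 1 / 2 by norm_num, Complex.mul_conj, Complex.normSq_eq_norm_sq]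
  have hi := integral_congr_ae (ae_of_all volume hleft)
  rw [integral_complex_ofReal] at hi
  rw [hi] at hshift
  have hnn : 0 ≤ ∫ t : ℝ, ‖afeError r W X T ((1 / 2 : ℝ) + t * I)‖ ^ 2 :=
    integral_nonneg fun t => by positivity
  have hn := congrArg norm hshift
  rw [norm_real, Real.norm_of_nonneg hnn] at hn
  rw [hn]
  have hI3 := h.integrable_afeError_sq hT (σ := 3 / 2) (by norm_num) (by norm_num)
  have hI1 := h.integrable_afeError_sq hT (σ := -1 / 2) (by norm_num) (by norm_num)
  rw [← integral_const_mul, ← integral_const_mul,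
    ← integral_add (hI3.const_mul _) (hI1.const_mul _), ← integral_div]
  refine norm_integral_le_of_norm_le (((hI3.const_mul _).add (hI1.const_mul _)).div_const _)
    (ae_of_all _ fun t => ?_)
  rw [hGe, show (1 - 3 / 2 : ℝ) = -1 / 2 by norm_num, norm_mul, RCLike.norm_conj]
  obtain ⟨x, hx⟩ : ∃ x, x = ‖afeError r W X T ((3 / 2 : ℝ) + t * I)‖ := ⟨_, rfl⟩
  obtain ⟨y, hy⟩ : ∃ y, y = ‖afeError r W X T ((-1 / 2 : ℝ) + t * I)‖ := ⟨_, rfl⟩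
  rw [← hx, ← hy]
  have : T ^ 2 * x ^ 2 + (T ^ 2)⁻¹ * y ^ 2 - 2 * (x * y) = (T * x - y / T) ^ 2 := by
    field_simp
    ring
  nlinarith [sq_nonneg (T * x - y / T)]

lemma continuous_dirPoly_line (r : ℕ → ℂ) (T σ : ℝ) :
    Continuous fun t : ℝ => dirPoly r T (σ + t * I) :=
  (differentiable_dirPoly r T).continuous.comp (by fun_prop)

lemma integrable_dirPoly_sq (r : ℕ → ℂ) {T : ℝ} (hT : 0 < T) {σ : ℝ} (hσ : -1 ≤ σ) :
    Integrable fun t : ℝ => ‖dirPoly r T (σ + t * I)‖ ^ 2 * Real.exp (-(t ^ 2 / T ^ 2)) := by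
  obtain ⟨M, -, hM⟩ := exists_norm_dirPoly_le r T
  exact integrable_norm_sq_mul_gaussian (continuous_dirPoly_line r T σ)
    (fun t => hM (σ + t * I) (by simpa using hσ)) hT

lemma integral_gaussian_comp_neg (f : ℝ → ℝ) (T : ℝ) :
    ∫ t : ℝ, f (-t) * Real.exp (-(t ^ 2 / T ^ 2)) = ∫ t : ℝ, f t * Real.exp (-(t ^ 2 / T ^ 2)) := by
  rw [← integral_neg_eq_self]
  simp

lemma integrable_gaussian_comp_neg {f : ℝ → ℝ} {T : ℝ}
    (hf : Integrable fun t : ℝ => f t * Real.exp (-(t ^ 2 / T ^ 2))) :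
    Integrable fun t : ℝ => f (-t) * Real.exp (-(t ^ 2 / T ^ 2)) := by
  simpa using hf.comp_neg

/-- Comparison of a Gaussian-weighted mean square with two simpler ones. -/
lemma integral_le_of_norm_sq_le {F a b : ℝ → ℝ} {α β A B : ℝ} {T : ℝ}
    (hF0 : ∀ t, 0 ≤ F t) (hα : 0 ≤ α) (hβ : 0 ≤ β)
    (hF : ∀ t, F t ≤ α * (a t * Real.exp (-(t ^ 2 / T ^ 2))) +
      β * (b t * Real.exp (-(t ^ 2 / T ^ 2))))
    (ha : Integrable fun t : ℝ => a t * Real.exp (-(t ^ 2 / T ^ 2)))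
    (hb : Integrable fun t : ℝ => b t * Real.exp (-(t ^ 2 / T ^ 2)))
    (hA : ∫ t : ℝ, a t * Real.exp (-(t ^ 2 / T ^ 2)) ≤ A)
    (hB : ∫ t : ℝ, b t * Real.exp (-(t ^ 2 / T ^ 2)) ≤ B) :
    ∫ t, F t ≤ α * A + β * B := by
  refine (integral_mono_of_nonneg (ae_of_all _ hF0)
    ((ha.const_mul α).add (hb.const_mul β)) (ae_of_all _ hF)).trans ?_
  simp only [Pi.add_apply]
  rw [integral_add (ha.const_mul α) (hb.const_mul β), integral_const_mul, integral_const_mul]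
  gcongr

lemma norm_sub_sq_mul_le (x y e : ℂ) : ‖(x - y) * e‖ ^ 2 ≤
    2 * ‖e‖ ^ 2 * (‖x‖ ^ 2 + ‖y‖ ^ 2) := by
  rw [norm_mul, mul_pow]
  have : ‖x - y‖ ^ 2 ≤ 2 * (‖x‖ ^ 2 + ‖y‖ ^ 2) := by
    have := pow_le_pow_left₀ (norm_nonneg _) (norm_sub_le x y) 2
    nlinarith [sq_nonneg (‖x‖ - ‖y‖)]
  nlinarith [sq_nonneg ‖e‖]

lemma norm_mul_I_pow_four_le {σ : ℝ} (h1 : -1 / 2 ≤ σ) (h2 : σ ≤ 3 / 2) (t : ℝ) :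
    ‖((σ : ℂ) + t * I - 1) ^ 2‖ ^ 2 ≤ 6 * (1 + t ^ 2) ^ 2 := by
  rw [norm_pow, ← normSq_eq_norm_sq, normSq_apply]
  have hre : ((σ : ℂ) + t * I - 1).re = σ - 1 := by simp
  have him : ((σ : ℂ) + t * I - 1).im = t := by simp
  rw [hre, him]
  have : (σ - 1) * (σ - 1) + t * t ≤ 9 / 4 * (1 + t ^ 2) := by nlinarith [sq_nonneg t]
  calc _ ≤ (9 / 4 * (1 + t ^ 2)) ^ 2 := pow_le_pow_left₀ (by nlinarith [sq_nonneg t]) this 2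
    _ ≤ _ := by nlinarith [sq_nonneg (1 + t ^ 2)]

lemma two_mul_mul_add_le {e E u v p q a b : ℝ} (he : e ≤ 2 * (E * E)) (hE : 0 ≤ E) (hu0 : 0 ≤ u)
    (hv0 : 0 ≤ v) (ha : 0 ≤ a) (hb : 0 ≤ b) (hu : u * E ≤ p) (hv : v * E ≤ q) :
    2 * e * (u * b + v * a) ≤ 4 * p * (b * E) + 4 * q * (a * E) := by
  calc 2 * e * (u * b + v * a) ≤ 2 * (2 * (E * E)) * (u * b + v * a) := by gcongr
    _ = 4 * (u * E) * (b * E) + 4 * (v * E) * (a * E) := by ring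
    _ ≤ _ := by gcongr

lemma integral_afeError_three_half_le (h : HasFunctionalEquation r W X K) {T : ℝ} (hT : 3 ≤ T) :
    ∫ t : ℝ, ‖afeError r W X T ((3 / 2 : ℝ) + t * I)‖ ^ 2 ≤
      (96 * T ^ 4) * (60 * K * (Real.log T ^ 2 / T)) +
        (4 * K ^ 2) * (60 * K * (T ^ 3 * Real.log T ^ 2)) := by
  have hK := h.sq_bound.nonneg
  obtain ⟨hBc, M, hM⟩ := h.sq_bound.exists_norm_tail_le T
  have hA := integrable_dirPoly_sq r (show 0 < T by linarith) (σ := -1 / 2) (by norm_num)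
  refine integral_le_of_norm_sq_le (T := T) (fun t => by positivity) (by positivity)
    (by positivity) (fun t => ?_) (integrable_norm_sq_mul_gaussian hBc hM (by linarith))
    (integrable_gaussian_comp_neg (f := fun t => ‖dirPoly r T ((-1 / 2 : ℝ) + t * I)‖ ^ 2) hA)
    (h.sq_bound.integral_tail_le hT)
    ((integral_gaussian_comp_neg (fun t => ‖dirPoly r T ((-1 / 2 : ℝ) + t * I)‖ ^ 2) T).trans_le
      (h.sq_bound.integral_dirPoly_neg_half_le hT))
  have h1 : (1 : ℂ) - ((3 / 2 : ℝ) + t * I) = (-1 / 2 : ℝ) + (-t : ℝ) * I := by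
    push_cast; ring
  have hX := pow_le_pow_left₀ (norm_nonneg _) (h.norm_three_half_le t) 2
  have hz := norm_mul_I_pow_four_le (σ := 3 / 2) (by norm_num) le_rfl t
  have hu := (one_add_sq_le (T := T) (by linarith) t).1
  have hE0 := Real.exp_pos (-(t ^ 2 / T ^ 2))
  have hE1 := exp_neg_sq_div_le_one t T
  rw [afeError, h.eq_LSeries, h1, ← mul_sub]
  refine (norm_sub_sq_mul_le _ _ _).trans ?_
  rw [norm_mul, norm_mul, mul_pow, mul_pow]
  refine (two_mul_mul_add_le (p := 24 * T ^ 4) (q := K ^ 2)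
    (norm_cexp_sq_div_sq_le (by norm_num) le_rfl t hT)
    hE0.le (by positivity) (by positivity) (by positivity) (by positivity) ?_ ?_).trans_eq ?_
  · calc _ ≤ 6 * (1 + t ^ 2) ^ 2 * Real.exp (-(t ^ 2 / T ^ 2)) := by gcongr
      _ ≤ _ := by linarith
  · calc _ ≤ K ^ 2 * 1 := by gcongr
      _ = _ := mul_one _
  · ring

lemma integral_afeError_neg_half_le (h : HasFunctionalEquation r W X K) {T : ℝ} (hT : 3 ≤ T) :
    ∫ t : ℝ, ‖afeError r W X T ((-1 / 2 : ℝ) + t * I)‖ ^ 2 ≤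
      (1024 * K ^ 2 * T ^ 8) * (60 * K * (Real.log T ^ 2 / T)) +
        (96 * T ^ 4) * (60 * K * (T ^ 3 * Real.log T ^ 2)) := by
  have hK := h.sq_bound.nonneg
  obtain ⟨hBc, M, hM⟩ := h.sq_bound.exists_norm_tail_le T
  have hA := integrable_dirPoly_sq r (show 0 < T by linarith) (σ := -1 / 2) (by norm_num)
  have hB := integrable_norm_sq_mul_gaussian hBc hM (show 0 < T by linarith)
  refine integral_le_of_norm_sq_le (T := T) (fun t => by positivity) (by positivity)
    (by positivity) (fun t => ?_) (integrable_gaussian_comp_neg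
      (f := fun t => ‖LSeries r ((3 / 2 : ℝ) + t * I) - dirPoly r T ((3 / 2 : ℝ) + t * I)‖ ^ 2) hB)
    hA ((integral_gaussian_comp_neg
      (fun t => ‖LSeries r ((3 / 2 : ℝ) + t * I) - dirPoly r T ((3 / 2 : ℝ) + t * I)‖ ^ 2)
      T).trans_le (h.sq_bound.integral_tail_le hT))
    (h.sq_bound.integral_dirPoly_neg_half_le hT)
  have h1 : (1 : ℂ) - ((-1 / 2 : ℝ) + t * I) = (3 / 2 : ℝ) + (-t : ℝ) * I := by
    push_cast; ring
  have hX := pow_le_pow_left₀ (norm_nonneg _) (h.norm_neg_half_le t) 2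
  have hz := norm_mul_I_pow_four_le (σ := -1 / 2) le_rfl (by norm_num) t
  have hu := one_add_sq_le (T := T) (by linarith) t
  have hE0 := Real.exp_pos (-(t ^ 2 / T ^ 2))
  have h2 : ∀ w x y z : ℂ, w * x - y - w * z = w * (x - z) - y := by intros; ring
  rw [afeError, h.eq_mul_LSeries, h1, h2]
  refine (norm_sub_sq_mul_le _ _ _).trans ?_
  rw [norm_mul, norm_mul, mul_pow, mul_pow]
  refine (two_mul_mul_add_le (p := 256 * K ^ 2 * T ^ 8) (q := 24 * T ^ 4)
    (norm_cexp_sq_div_sq_le le_rfl (by norm_num) t hT)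
    hE0.le (by positivity) (by positivity) (by positivity) (by positivity) ?_ ?_).trans_eq ?_
  · calc _ ≤ (K * (1 + t ^ 2) ^ 2) ^ 2 * Real.exp (-(t ^ 2 / T ^ 2)) := by gcongr
      _ = K ^ 2 * ((1 + t ^ 2) ^ 4 * Real.exp (-(t ^ 2 / T ^ 2))) := by ring
      _ ≤ K ^ 2 * (256 * T ^ 8) := mul_le_mul_of_nonneg_left hu.2 (by positivity)
      _ = _ := by ring
  · calc _ ≤ 6 * (1 + t ^ 2) ^ 2 * Real.exp (-(t ^ 2 / T ^ 2)) := by gcongr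
      _ ≤ _ := by linarith [hu.1]
  · ring

lemma integral_afeError_half_le (h : HasFunctionalEquation r W X K) {T : ℝ} (hT : 3 ≤ T) :
    ∫ t : ℝ, ‖afeError r W X T ((1 / 2 : ℝ) + t * I)‖ ^ 2 ≤
      60 * K * (96 + 514 * K ^ 2) * (T ^ 5 * Real.log T ^ 2) := by
  have hT0 : 0 < T := by linarith
  refine (h.integral_afeError_sq_le hT).trans ?_
  calc _ ≤ (T ^ 2 * ((96 * T ^ 4) * (60 * K * (Real.log T ^ 2 / T)) +
        (4 * K ^ 2) * (60 * K * (T ^ 3 * Real.log T ^ 2))) + (T ^ 2)⁻¹ *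
      ((1024 * K ^ 2 * T ^ 8) * (60 * K * (Real.log T ^ 2 / T)) +
        (96 * T ^ 4) * (60 * K * (T ^ 3 * Real.log T ^ 2)))) / 2 := by
        gcongr
        · exact h.integral_afeError_three_half_le hT
        · exact h.integral_afeError_neg_half_le hT
    _ = _ := by field_simp; ring

/-- The weighted mean square of `Z` on the critical line, up to the factor `(z - 1)²`. -/
theorem integral_half_le (h : HasFunctionalEquation r W X K) : ∃ C, 0 < C ∧ ∀ T : ℝ, 3 ≤ T →
    Integrable (fun t : ℝ => ‖W ((1 / 2 : ℝ) + t * I)‖ ^ 2 *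
      (Real.exp (-(t ^ 2 / T ^ 2)) * Real.exp (-(t ^ 2 / T ^ 2)))) ∧
    ∫ t : ℝ, ‖W ((1 / 2 : ℝ) + t * I)‖ ^ 2 *
      (Real.exp (-(t ^ 2 / T ^ 2)) * Real.exp (-(t ^ 2 / T ^ 2))) ≤
      C * (T ^ 5 * Real.log T ^ 2) := by
  have hK := h.sq_bound.nonneg
  refine ⟨3 * (60 * K * (96 + 514 * K ^ 2)) + (72 + 12 * K ^ 2) * (60 * K) + 1, by positivity,
    fun T hT => ?_⟩
  have hT0 : 0 < T := by linarith
  have hF := h.integrable_afeError_sq hT (σ := 1 / 2) (by norm_num) (by norm_num)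
  have hA := integrable_dirPoly_sq r hT0 (σ := 1 / 2) (by norm_num)
  have hA' := integrable_gaussian_comp_neg
    (f := fun t => ‖dirPoly r T ((1 / 2 : ℝ) + t * I)‖ ^ 2) hA
  have hsum := ((hF.const_mul 3).add (hA.const_mul (72 * T ^ 4))).add
    (hA'.const_mul (12 * K ^ 2 * T ^ 4))
  have hle : ∀ t : ℝ, ‖W ((1 / 2 : ℝ) + t * I)‖ ^ 2 *
      (Real.exp (-(t ^ 2 / T ^ 2)) * Real.exp (-(t ^ 2 / T ^ 2))) ≤
      3 * ‖afeError r W X T ((1 / 2 : ℝ) + t * I)‖ ^ 2 +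
      72 * T ^ 4 * (‖dirPoly r T ((1 / 2 : ℝ) + t * I)‖ ^ 2 * Real.exp (-(t ^ 2 / T ^ 2))) +
      12 * K ^ 2 * T ^ 4 * (‖dirPoly r T ((1 / 2 : ℝ) + (-t : ℝ) * I)‖ ^ 2 *
        Real.exp (-(t ^ 2 / T ^ 2))) := by
    intro t
    have h1 : (1 : ℂ) - ((1 / 2 : ℝ) + t * I) = (1 / 2 : ℝ) + (-t : ℝ) * I := by
      push_cast; ring
    have hX := pow_le_pow_left₀ (norm_nonneg _) (h.norm_half_le t) 2
    have hz := norm_mul_I_pow_four_le (σ := 1 / 2) (by norm_num) (by norm_num) t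
    have hu := (one_add_sq_le (T := T) (by linarith) t).1
    have hE0 := Real.exp_pos (-(t ^ 2 / T ^ 2))
    have he : ‖cexp ((((1 / 2 : ℝ) + t * I) - (1 / 2 : ℝ)) ^ 2 / (T : ℂ) ^ 2)‖ ^ 2 =
        Real.exp (-(t ^ 2 / T ^ 2)) * Real.exp (-(t ^ 2 / T ^ 2)) := by
      rw [norm_cexp_sq_div, ← Real.exp_nat_mul, ← Real.exp_add]
      congr 1
      push_cast; ring
    have h3 : ∀ w x y : ℂ, ‖w‖ ^ 2 ≤ 3 * (‖w - x - y‖ ^ 2 + ‖x‖ ^ 2 + ‖y‖ ^ 2) := by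
      intro w x y
      have h4 : ‖w‖ ≤ ‖w - x - y‖ + ‖x‖ + ‖y‖ := by
        calc ‖w‖ = ‖(w - x - y) + x + y‖ := by congr 1; ring
          _ ≤ _ := norm_add₃_le
      refine (pow_le_pow_left₀ (norm_nonneg _) h4 2).trans ?_
      nlinarith [sq_nonneg (‖w - x - y‖ - ‖x‖), sq_nonneg (‖w - x - y‖ - ‖y‖),
        sq_nonneg (‖x‖ - ‖y‖)]
    rw [afeError, h1, norm_mul, mul_pow, he]
    refine (mul_le_mul_of_nonneg_right (h3 _ (((1 / 2 : ℝ) + t * I - 1) ^ 2 *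
      dirPoly r T ((1 / 2 : ℝ) + t * I)) (X ((1 / 2 : ℝ) + t * I) *
      dirPoly r T ((1 / 2 : ℝ) + (-t : ℝ) * I))) (by positivity)).trans ?_
    rw [norm_mul, norm_mul, mul_pow, mul_pow]
    have hu1 : ‖((1 / 2 : ℝ) + t * I - 1 : ℂ) ^ 2‖ ^ 2 * Real.exp (-(t ^ 2 / T ^ 2)) ≤
        24 * T ^ 4 := by
      calc _ ≤ 6 * (1 + t ^ 2) ^ 2 * Real.exp (-(t ^ 2 / T ^ 2)) := by gcongr
        _ ≤ _ := by linarith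
    have hv1 : ‖X ((1 / 2 : ℝ) + t * I)‖ ^ 2 * Real.exp (-(t ^ 2 / T ^ 2)) ≤
        K ^ 2 * (4 * T ^ 4) := by
      calc _ ≤ (K * (1 + t ^ 2)) ^ 2 * Real.exp (-(t ^ 2 / T ^ 2)) := by gcongr
        _ = K ^ 2 * ((1 + t ^ 2) ^ 2 * Real.exp (-(t ^ 2 / T ^ 2))) := by ring
        _ ≤ _ := by gcongr
    have ha0 : 0 ≤ ‖dirPoly r T ((1 / 2 : ℝ) + (-t : ℝ) * I)‖ ^ 2 * Real.exp (-(t ^ 2 / T ^ 2)) := by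
      positivity
    have hb0 : 0 ≤ ‖dirPoly r T ((1 / 2 : ℝ) + t * I)‖ ^ 2 * Real.exp (-(t ^ 2 / T ^ 2)) := by
      positivity
    have h5 := mul_le_mul_of_nonneg_right hu1 hb0
    have h6 := mul_le_mul_of_nonneg_right hv1 ha0
    generalize ‖dirPoly r T ((1 / 2 : ℝ) + (-t : ℝ) * I)‖ ^ 2 = a at *
    generalize ‖dirPoly r T ((1 / 2 : ℝ) + t * I)‖ ^ 2 = b at *
    generalize ‖X ((1 / 2 : ℝ) + t * I)‖ ^ 2 = c at *
    linarith
  have hcont : Continuous fun t : ℝ => W ((1 / 2 : ℝ) + t * I) :=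
    h.differentiable.continuous.comp (by fun_prop)
  refine ⟨hsum.mono' ((hcont.norm.pow 2).mul
    (by fun_prop)).aestronglyMeasurable (ae_of_all _ fun t => ?_), ?_⟩
  · rw [Real.norm_of_nonneg (by positivity)]
    exact hle t
  refine (integral_mono_of_nonneg (ae_of_all _ fun t => by positivity) hsum
    (ae_of_all _ hle)).trans ?_
  have h7 := h.integral_afeError_half_le hT
  have h8 := h.sq_bound.integral_dirPoly_half_le hT
  have h9 := (integral_gaussian_comp_neg
    (fun t => ‖dirPoly r T ((1 / 2 : ℝ) + t * I)‖ ^ 2) T).trans_le h8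
  rw [integral_add' ((hF.const_mul 3).add (hA.const_mul (72 * T ^ 4)))
    (hA'.const_mul (12 * K ^ 2 * T ^ 4)), integral_add' (hF.const_mul 3)
    (hA.const_mul (72 * T ^ 4)), integral_const_mul, integral_const_mul, integral_const_mul]
  have hL : 0 ≤ T ^ 5 * Real.log T ^ 2 := by positivity
  calc _ ≤ 3 * (60 * K * (96 + 514 * K ^ 2) * (T ^ 5 * Real.log T ^ 2)) +
        72 * T ^ 4 * (60 * K * (T * Real.log T ^ 2)) +
        12 * K ^ 2 * T ^ 4 * (60 * K * (T * Real.log T ^ 2)) := by gcongr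
    _ = (3 * (60 * K * (96 + 514 * K ^ 2)) + (72 + 12 * K ^ 2) * (60 * K)) *
        (T ^ 5 * Real.log T ^ 2) := by ring
    _ ≤ _ := mul_le_mul_of_nonneg_right (by linarith) hL

end HasFunctionalEquation

end MeanSquare

section GammaBounds

open ComplexConjugate

lemma norm_exp_mul_I_le (w : ℂ) : ‖cexp (w * I)‖ ≤ Real.exp |w.im| := by
  rw [norm_exp]
  refine Real.exp_le_exp.2 ?_
  simpa using neg_le_abs w.im

lemma norm_cos_le (w : ℂ) : ‖cos w‖ ≤ Real.exp |w.im| := by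
  have h1 := norm_exp_mul_I_le w
  have h2 := norm_exp_mul_I_le (-w)
  rw [neg_im, abs_neg] at h2
  rw [Complex.cos, norm_div, norm_ofNat]
  linarith [norm_add_le (cexp (w * I)) (cexp (-w * I))]

lemma norm_sin_le (w : ℂ) : ‖sin w‖ ≤ Real.exp |w.im| := by
  rw [← cos_sub_pi_div_two]
  simpa [← ofReal_ofNat, ← ofReal_div] using norm_cos_le (w - ↑Real.pi / 2)

lemma norm_Gamma_half_sq_le (t : ℝ) :
    ‖Gamma ((1 / 2 : ℝ) + t * I)‖ ^ 2 * Real.exp (Real.pi * |t|) ≤ 7 := by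
  have h1 : conj (((1 / 2 : ℝ) : ℂ) + t * I) = 1 - ((1 / 2 : ℝ) + t * I) := by
    apply Complex.ext
    · simp; norm_num
    · simp
  have h2 := Gamma_mul_Gamma_one_sub ((1 / 2 : ℝ) + t * I)
  have h3 : sin (Real.pi * ((1 / 2 : ℝ) + t * I)) = (Real.cosh (Real.pi * t) : ℝ) := by
    rw [show (Real.pi : ℂ) * ((1 / 2 : ℝ) + t * I) = (Real.pi * t : ℝ) * I + Real.pi / 2 by
      push_cast; ring, sin_add_pi_div_two, cos_mul_I, ofReal_cosh]
  rw [← h1, Gamma_conj, mul_conj, h3, normSq_eq_norm_sq, ← ofReal_div] at h2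
  rw [ofReal_injective h2, div_mul_eq_mul_div, div_le_iff₀ (Real.cosh_pos _)]
  have h4 : Real.exp (Real.pi * |t|) ≤ 2 * Real.cosh (Real.pi * t) := by
    rw [← Real.cosh_abs, abs_mul, abs_of_pos Real.pi_pos, Real.cosh_eq]
    linarith [Real.exp_pos (-(Real.pi * |t|))]
  nlinarith [Real.pi_lt_d2, Real.cosh_pos (Real.pi * t), Real.pi_pos]

lemma norm_Gamma_add_one_sq_le {σ t B c : ℝ} (hσ : 0 < σ) (hσ' : σ ^ 2 ≤ c) (hc : 1 ≤ c)
    (hB : ‖Gamma (σ + t * I)‖ ^ 2 * Real.exp (Real.pi * |t|) ≤ B) :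
    ‖Gamma ((σ + 1 : ℝ) + t * I)‖ ^ 2 * Real.exp (Real.pi * |t|) ≤ c * (1 + t ^ 2) * B := by
  have h0 : (σ : ℂ) + t * I ≠ 0 := fun h => hσ.ne' (by simpa using congrArg re h)
  have h1 : ‖(σ : ℂ) + t * I‖ ^ 2 = σ ^ 2 + t ^ 2 := by
    rw [← normSq_eq_norm_sq, normSq_add_mul_I]
  rw [show ((σ + 1 : ℝ) : ℂ) + t * I = (σ + t * I) + 1 by push_cast; ring, Gamma_add_one _ h0,
    norm_mul, mul_pow, h1, mul_assoc]
  refine mul_le_mul ?_ hB (by positivity) (by positivity)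
  nlinarith [sq_nonneg t]

lemma exists_norm_Gamma_le {a b : ℝ} (ha : 0 < a) (hb : 0 < b) :
    ∃ M, 0 ≤ M ∧ ∀ z : ℂ, a ≤ z.re → z.re ≤ b → ‖Gamma z‖ ≤ M := by
  refine ⟨∫ x in Set.Ioi (0 : ℝ), (Real.exp (-x) * x ^ (a - 1) + Real.exp (-x) * x ^ (b - 1)),
    setIntegral_nonneg measurableSet_Ioi fun x hx => ?_, fun z h1 h2 => ?_⟩
  · have : 0 < x := hx
    positivity
  rw [Gamma_eq_integral (by linarith)]
  refine norm_integral_le_of_norm_le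
    ((Real.GammaIntegral_convergent ha).add (Real.GammaIntegral_convergent hb)) ?_
  filter_upwards [self_mem_ae_restrict measurableSet_Ioi] with x hx
  have hx0 : 0 < x := hx
  rw [norm_mul, norm_real, Real.norm_of_nonneg (Real.exp_pos _).le, norm_cpow_eq_rpow_re_of_pos hx0,
    ← mul_add]
  refine mul_le_mul_of_nonneg_left ?_ (Real.exp_pos _).le
  rw [sub_re, one_re]
  rcases le_total x 1 with h | h
  · have := Real.rpow_le_rpow_of_exponent_ge hx0 h (show a - 1 ≤ z.re - 1 by linarith)
    linarith [Real.rpow_nonneg hx0.le (b - 1)]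
  · have := Real.rpow_le_rpow_of_exponent_le h (show z.re - 1 ≤ b - 1 by linarith)
    linarith [Real.rpow_nonneg hx0.le (a - 1)]

end GammaBounds

section FunctionalEquation

open DirichletCharacter

variable {q : ℕ} {χ : DirichletCharacter ℂ q}

open scoped Classical in
/-- The trigonometric factor in the functional equation of a Dirichlet `L`-function. -/
noncomputable def trigFactor (χ : DirichletCharacter ℂ q) (w : ℂ) : ℂ :=
  if χ.Even then cos w else sin w

lemma norm_trigFactor_le (w : ℂ) : ‖trigFactor χ w‖ ≤ Real.exp |w.im| := by
  rw [trigFactor]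
  split_ifs
  exacts [norm_cos_le w, norm_sin_le w]

lemma differentiable_trigFactor : Differentiable ℂ (trigFactor χ) := by
  unfold trigFactor
  split_ifs
  exacts [differentiable_cos, differentiable_sin]

lemma gammaFactor_eq {s : ℂ} (hs : 0 < s.re) :
    gammaFactor χ s * (gammaFactor χ (1 - s))⁻¹ =
      Gammaℂ s * trigFactor χ (Real.pi * s / 2) := by
  have hs' : ∀ n : ℕ, s ≠ -n := by
    rintro n rfl
    simp at hs
    linarith [n.cast_nonneg (α := ℝ)]
  rw [trigFactor]
  split_ifs with h
  · rw [h.gammaFactor_def, h.gammaFactor_def, inv_Gammaℝ_one_sub hs']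
    field_simp [Gammaℝ_ne_zero_of_re_pos hs]
  · have h' := χ.even_or_odd.resolve_left h
    have h0 : Gammaℝ (s + 1) ≠ 0 := Gammaℝ_ne_zero_of_re_pos (by simp; linarith)
    rw [h'.gammaFactor_def, h'.gammaFactor_def, show 1 - s + 1 = 2 - s by ring,
      inv_Gammaℝ_two_sub hs']
    field_simp

variable [NeZero q]

lemma zetaL_one_sub (hχ : χ.IsPrimitive) (hq : q ≠ 1) (hinv : χ⁻¹ = χ) {s : ℂ} (hs : 0 < s.re)
    (hs1 : s ≠ 1) : zetaL χ (1 - s) = (q : ℂ) ^ (s - 1 / 2) * rootNumber χ * Gammaℂ s ^ 2 *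
      cos (Real.pi * s / 2) * trigFactor χ (Real.pi * s / 2) * zetaL χ s := by
  have hs0 : s ≠ 0 := by rintro rfl; simp at hs
  have hs' : ∀ n : ℕ, s ≠ -n := by
    rintro n rfl
    simp at hs
    linarith [n.cast_nonneg (α := ℝ)]
  have hγ : gammaFactor χ s ≠ 0 := by
    rcases χ.even_or_odd with h | h <;> rw [h.gammaFactor_def]
    · exact Gammaℝ_ne_zero_of_re_pos hs
    · exact Gammaℝ_ne_zero_of_re_pos (by simp; linarith)
  have hΓ : Gammaℝ s ≠ 0 := Gammaℝ_ne_zero_of_re_pos hs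
  have h1 := gammaFactor_eq (χ := χ) hs
  rw [zetaL, zetaL, riemannZeta_def_of_ne_zero hs0,
    riemannZeta_def_of_ne_zero (sub_ne_zero.2 hs1.symm),
    LFunction_eq_completed_div_gammaFactor χ s (Or.inr hq),
    LFunction_eq_completed_div_gammaFactor χ (1 - s) (Or.inr hq), completedRiemannZeta_one_sub,
    IsPrimitive.completedLFunction_one_sub hχ, hinv, div_eq_mul_inv _ (Gammaℝ (1 - s)),
    inv_Gammaℝ_one_sub hs', div_eq_mul_inv _ (gammaFactor χ (1 - s)),
    eq_div_of_mul_eq hγ ((mul_comm _ _).trans h1)]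
  field_simp

/-- The factor in the functional equation for `(z - 1)² ζ(z) L(z, χ)`, as a function of
`s = 1 - z`. -/
noncomputable def feFactor (χ : DirichletCharacter ℂ q) (s : ℂ) : ℂ :=
  (q : ℂ) ^ (s - 1 / 2) * rootNumber χ * (2 * (2 * Real.pi) ^ (-s) * Gamma (s + 1)) ^ 2 *
    cos (Real.pi * s / 2) * trigFactor χ (Real.pi * s / 2)

lemma feFactor_mul_zetaL (hχ : χ.IsPrimitive) (hq : q ≠ 1) (hinv : χ⁻¹ = χ) {s : ℂ} (hs : 0 < s.re)
    (hs1 : s ≠ 1) : feFactor χ s * zetaL χ s = s ^ 2 * zetaL χ (1 - s) := by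
  have hs0 : s ≠ 0 := by rintro rfl; simp at hs
  rw [zetaL_one_sub hχ hq hinv hs hs1, feFactor, Gamma_add_one s hs0, Gammaℂ_def]
  ring

lemma differentiableAt_feFactor {s : ℂ} (hs : -1 < s.re) : DifferentiableAt ℂ (feFactor χ) s := by
  have h1 : DifferentiableAt ℂ (fun s => Gamma (s + 1)) s :=
    (differentiableAt_Gamma (s + 1) fun m h => by
      have := congrArg re h
      simp at this
      linarith [m.cast_nonneg (α := ℝ)]).comp s (f := fun s => s + 1) (by fun_prop)
  have h2 : DifferentiableAt ℂ (fun s : ℂ => trigFactor χ (Real.pi * s / 2)) s :=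
    (differentiable_trigFactor _).comp s (f := fun s : ℂ => (Real.pi : ℂ) * s / 2) (by fun_prop)
  have h3 : DifferentiableAt ℂ (fun s : ℂ => (q : ℂ) ^ (s - 1 / 2)) s :=
    DifferentiableAt.const_cpow (by fun_prop) (Or.inl (NeZero.ne _))
  have h4 : DifferentiableAt ℂ (fun s : ℂ => (2 * Real.pi : ℂ) ^ (-s)) s :=
    DifferentiableAt.const_cpow (by fun_prop) (Or.inl (by simp [Real.pi_ne_zero]))
  unfold feFactor
  fun_prop

lemma norm_feFactor_le {s : ℂ} (h1 : -1 / 2 ≤ s.re) (h2 : s.re ≤ 3 / 2) :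
    ‖feFactor χ s‖ ≤ 196 * q * ‖rootNumber χ‖ *
      (‖Gamma (s + 1)‖ ^ 2 * Real.exp (Real.pi * |s.im|)) := by
  have hq : (1 : ℝ) ≤ q := by exact_mod_cast NeZero.one_le
  have h3 : ‖(q : ℂ) ^ (s - 1 / 2)‖ ≤ q := by
    rw [norm_natCast_cpow_of_pos (NeZero.pos q)]
    conv_rhs => rw [← Real.rpow_one (q : ℝ)]
    refine Real.rpow_le_rpow_of_exponent_le hq ?_
    simp; linarith
  have h4 : ‖(2 * Real.pi : ℂ) ^ (-s)‖ ≤ 7 := by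
    have hpi : (1 : ℝ) ≤ 2 * Real.pi := by linarith [Real.pi_gt_three]
    rw [← ofReal_ofNat, ← ofReal_mul, norm_cpow_eq_rpow_re_of_pos (by positivity)]
    calc _ ≤ (2 * Real.pi) ^ (1 : ℝ) := by
          refine Real.rpow_le_rpow_of_exponent_le hpi ?_
          simp; linarith
      _ ≤ _ := by rw [Real.rpow_one]; linarith [Real.pi_lt_d2]
  have him : (Real.pi * s / 2).im = Real.pi * s.im / 2 := by
    rw [div_ofNat_im, im_ofReal_mul]
  have h5 := norm_cos_le (Real.pi * s / 2)
  have h6 := norm_trigFactor_le (χ := χ) (Real.pi * s / 2)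
  have h7 : |(Real.pi * s / 2).im| = Real.pi * |s.im| / 2 := by
    rw [him, abs_div, abs_mul, abs_of_pos Real.pi_pos, abs_two]
  rw [h7] at h5 h6
  rw [feFactor, norm_mul, norm_mul, norm_mul, norm_mul, norm_pow, norm_mul, norm_mul, norm_ofNat]
  calc _ ≤ q * ‖rootNumber χ‖ * (2 * 7 * ‖Gamma (s + 1)‖) ^ 2 *
        Real.exp (Real.pi * |s.im| / 2) * Real.exp (Real.pi * |s.im| / 2) := by gcongr
    _ = 196 * q * ‖rootNumber χ‖ * (‖Gamma (s + 1)‖ ^ 2 *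
        (Real.exp (Real.pi * |s.im| / 2) * Real.exp (Real.pi * |s.im| / 2))) := by ring
    _ = _ := by rw [← Real.exp_add, add_halves]

lemma HasSqBound.mono {r : ℕ → ℂ} {C C' : ℝ} (h : HasSqBound r C) (hC : C ≤ C') :
    HasSqBound r C' where
  nonneg := h.nonneg.trans hC
  sum_le T hT s hs := (h.sum_le T hT s hs).trans (by gcongr)
  sum_tail_le T hT s hs := (h.sum_tail_le T hT s hs).trans (by gcongr)
  summable := h.summable

lemma exists_hasSqBound_zetaMul (hχ : χ ^ 2 = 1) (hχ1 : χ ≠ 1) : ∃ C, HasSqBound χ.zetaMul C := by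
  obtain ⟨C₁, hC₁, h₁⟩ := exists_sum_zetaMul_sq_div_le hχ hχ1
  obtain ⟨C₂, hC₂, h₂⟩ := exists_sum_zetaMul_sq_div_sq_le hχ hχ1
  refine ⟨C₁ + C₂, by positivity, fun T hT s hs => (h₁ T hT s hs).trans ?_,
    fun T hT s hs => (h₂ T hT s hs).trans ?_, χ.LSeriesSummable_zetaMul (by norm_num)⟩
  · gcongr; linarith
  · gcongr; linarith

lemma exists_norm_zetaL_le_abs_im (hχ1 : χ ≠ 1) :
    ∃ C, 0 ≤ C ∧ ∀ s : ℂ, 1 / 2 ≤ s.re → 1 ≤ |s.im| → ‖zetaL χ s‖ ≤ C * |s.im| := by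
  refine ⟨(4 + 3 * 0 + 5 * ‖(1 : ℂ)‖) * (4 + 3 * (2 * q) + 5 * ‖(0 : ℂ)‖), by positivity,
    fun s hs ht => ?_⟩
  have h1 := isLinearLSeries_riemannZeta.norm_le_sqrt hs ht
  have h2 := (isLinearLSeries_LFunction hχ1).norm_le_sqrt hs ht
  rw [zetaL, norm_mul]
  refine (mul_le_mul h1 h2 (norm_nonneg _) (by positivity)).trans_eq ?_
  rw [mul_mul_mul_comm, ← Real.rpow_add (by linarith)]
  norm_num

lemma exists_hasFunctionalEquation (hχp : χ.IsPrimitive) (hχ : χ ^ 2 = 1) (hχ1 : χ ≠ 1) :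
    ∃ K, HasFunctionalEquation χ.zetaMul (fun z => (z - 1) * zetaLReg χ z)
      (fun z => feFactor χ (1 - z)) K := by
  have hq : q ≠ 1 := by
    rintro rfl
    exact hχ1 (level_one χ)
  have hinv : χ⁻¹ = χ := inv_eq_of_mul_eq_one_right (by rw [← sq, hχ])
  obtain ⟨C, hC⟩ := exists_hasSqBound_zetaMul hχ hχ1
  obtain ⟨c, hc0, hc⟩ := exists_norm_zetaL_le_abs_im hχ1
  obtain ⟨M, hM0, hM⟩ := exists_norm_Gamma_le (a := 1 / 2) (b := 5 / 2) (by norm_num) (by norm_num)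
  have hWd : Differentiable ℂ fun z => (z - 1) * zetaLReg χ z :=
    (differentiable_id.sub_const 1).mul (differentiable_zetaLReg hχ1)
  have hWe : ∀ z : ℂ, z ≠ 1 → (z - 1) * zetaLReg χ z = (z - 1) ^ 2 * zetaL χ z := by
    intro z hz
    rw [zetaLReg_eq hz]; ring
  obtain ⟨B, hB⟩ := ((isCompact_Icc (a := (-1 / 2 : ℝ)) (b := 3 / 2)).reProdIm
    (isCompact_Icc (a := (-1 : ℝ)) (b := 1))).exists_bound_of_continuousOn hWd.continuous.continuousOn
  have hB0 : 0 ≤ B := (norm_nonneg _).trans (hB 0 (by rw [mem_reProdIm]; norm_num))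
  obtain ⟨d, hd⟩ : ∃ d, d = 196 * q * ‖rootNumber χ‖ := ⟨_, rfl⟩
  have hd0 : 0 ≤ d := hd ▸ by positivity
  have hfe : ∀ z : ℂ, z.re < 1 → z ≠ 0 → (z - 1) * zetaLReg χ z =
      feFactor χ (1 - z) * zetaL χ (1 - z) := by
    intro z hz hz0
    rw [hWe z (by rintro rfl; simp at hz), feFactor_mul_zetaL hχp hq hinv (by simpa using hz)
      (by simpa using hz0), sub_sub_cancel]
    ring
  have hX : ∀ z : ℂ, -1 / 2 ≤ z.re → z.re ≤ 3 / 2 →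
      ‖feFactor χ (1 - z)‖ ≤ d * M ^ 2 * Real.exp (Real.pi * |z.im|) := by
    intro z h1 h2
    refine (norm_feFactor_le (by simp; linarith) (by simp; linarith)).trans ?_
    rw [← hd, mul_assoc]
    have := hM (1 - z + 1) (by simp; linarith) (by simp; linarith)
    simp only [sub_im, one_im, zero_sub, abs_neg]
    gcongr
  have hG1 : ∀ t : ℝ, ‖Gamma ((1 / 2 : ℝ) + t * I)‖ ^ 2 * Real.exp (Real.pi * |t|) ≤ 7 :=
    norm_Gamma_half_sq_le
  have hG2 := fun t : ℝ =>
    norm_Gamma_add_one_sq_le (c := 1) (by norm_num) (by norm_num) le_rfl (hG1 t)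
  have hG3 := fun t : ℝ =>
    norm_Gamma_add_one_sq_le (c := 9 / 4) (by norm_num) (by norm_num) (by norm_num) (hG2 t)
  have hline : ∀ (σ t B : ℝ), -1 / 2 ≤ σ → σ ≤ 3 / 2 →
      ‖Gamma ((2 - σ : ℝ) + (-t : ℝ) * I)‖ ^ 2 * Real.exp (Real.pi * |-t|) ≤ B →
      ‖feFactor χ (1 - (σ + t * I))‖ ≤ d * B := by
    intro σ t B h1 h2 h3
    refine (norm_feFactor_le (by simp; linarith) (by simp; linarith)).trans ?_
    rw [← hd]
    refine mul_le_mul_of_nonneg_left ?_ hd0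
    refine le_trans (le_of_eq ?_) h3
    congr 4
    · push_cast; ring
    · simp
  have hdM : 0 ≤ d * M ^ 2 := by positivity
  have hdMc : 0 ≤ d * M ^ 2 * c := by positivity
  refine ⟨C + B + 4 * c + d * M ^ 2 * c + d * M ^ 2 + 16 * d,
    hC.mono (by linarith), hWd, fun z hz => ?_, fun t => ?_, fun t => ?_,
    fun t => ?_, fun t => ?_, fun t => ?_, fun z h1 h2 => ?_, fun z h1 h2 => ?_⟩
  · exact (differentiableAt_feFactor (by simp; linarith)).comp z (f := fun z => 1 - z) (by fun_prop)
  · rw [LSeries_zetaMul (by simp; norm_num)]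
    exact hWe _ fun h => by
      have := congrArg re h
      norm_num at this
  · rw [hfe _ (by simp; norm_num) (fun h => by
      have := congrArg re h
      norm_num at this), LSeries_zetaMul (by simp; norm_num)]
    congr 2
    push_cast; ring
  · refine (hline _ t 7 (by norm_num) le_rfl ?_).trans (by linarith [hC.nonneg])
    convert hG1 (-t) using 5
    norm_num
  · refine (hline _ t (1 * (1 + (-t) ^ 2) * 7) (by norm_num) (by norm_num) ?_).trans ?_
    · convert hG2 (-t) using 5
      norm_num
    · rw [neg_sq]
      have : 7 * d * (1 + t ^ 2) ≤ (C + B + 4 * c + d * M ^ 2 * c + d * M ^ 2 + 16 * d) *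
          (1 + t ^ 2) := by
        gcongr
        linarith [hC.nonneg]
      linarith
  · refine (hline _ t (9 / 4 * (1 + (-t) ^ 2) * (1 * (1 + (-t) ^ 2) * 7)) le_rfl
      (by norm_num) ?_).trans ?_
    · convert hG3 (-t) using 5
      norm_num
    · rw [neg_sq]
      have : 63 / 4 * d * (1 + t ^ 2) ^ 2 ≤
          (C + B + 4 * c + d * M ^ 2 * c + d * M ^ 2 + 16 * d) * (1 + t ^ 2) ^ 2 := by
        gcongr
        linarith [hC.nonneg]
      linarith
  · have hE1 : 1 ≤ Real.exp (5 * |z.im|) := Real.one_le_exp (by positivity)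
    have hE : |z.im| ≤ Real.exp |z.im| := by linarith [Real.add_one_le_exp |z.im|]
    have key : ∀ A, 0 ≤ A → A ≤ C + B + 4 * c + d * M ^ 2 * c + d * M ^ 2 + 16 * d →
        ‖(z - 1) * zetaLReg χ z‖ ≤ A * Real.exp (5 * |z.im|) → ‖(z - 1) * zetaLReg χ z‖ ≤
        (C + B + 4 * c + d * M ^ 2 * c + d * M ^ 2 + 16 * d) * Real.exp (5 * |z.im|) :=
      fun A _ hA' h => h.trans (by gcongr)
    have hC0 := hC.nonneg
    rcases le_or_gt |z.im| 1 with ht | ht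
    · refine key B hB0 (by linarith) ((hB z ?_).trans (le_mul_of_one_le_right hB0 hE1))
      rw [mem_reProdIm]
      exact ⟨⟨h1, h2⟩, abs_le.1 ht⟩
    have hne : ∀ w : ℂ, w.im = 0 → z ≠ w := by
      rintro w hw rfl
      norm_num [hw] at ht
    rcases le_or_gt (1 / 2) z.re with hσ | hσ
    · refine key (4 * c) (by positivity) (by linarith) ?_
      rw [hWe z (hne 1 one_im), norm_mul, norm_pow]
      have h3 : ‖z - 1‖ ≤ 2 * |z.im| := by
        refine (norm_le_abs_re_add_abs_im _).trans ?_
        have : |z.re - 1| ≤ 1 := abs_le.2 ⟨by linarith, by linarith⟩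
        simp only [sub_re, sub_im, one_re, one_im, sub_zero]
        linarith
      calc _ ≤ (2 * |z.im|) ^ 2 * (c * |z.im|) := by
            gcongr
            exact hc z hσ ht.le
        _ = 4 * c * |z.im| ^ 3 := by ring
        _ ≤ 4 * c * Real.exp |z.im| ^ 3 := by gcongr
        _ = 4 * c * Real.exp (3 * |z.im|) := by rw [← Real.exp_nat_mul]; norm_num
        _ ≤ _ := by gcongr; norm_num
    · refine key (d * M ^ 2 * c) hdMc (by linarith) ?_
      rw [hfe z (by linarith) (hne 0 zero_im), norm_mul]
      have h3 := hc (1 - z) (by simp; linarith) (by simpa using ht.le)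
      simp only [sub_im, one_im, zero_sub, abs_neg] at h3
      calc _ ≤ d * M ^ 2 * Real.exp (Real.pi * |z.im|) * (c * |z.im|) :=
            mul_le_mul (hX z h1 h2) h3 (norm_nonneg _) (by positivity)
        _ ≤ d * M ^ 2 * Real.exp (4 * |z.im|) * (c * Real.exp |z.im|) := by
            gcongr
            exact Real.pi_le_four
        _ = d * M ^ 2 * c * (Real.exp (4 * |z.im|) * Real.exp |z.im|) := by ring
        _ = _ := by rw [← Real.exp_add]; congr 2; ring
  · refine (hX z h1 h2).trans ?_
    have h3 : Real.pi ≤ 5 := by linarith [Real.pi_le_four]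
    have hC0 := hC.nonneg
    gcongr
    linarith

end FunctionalEquation

section CriticalLine

open DirichletCharacter

/-- The set of real numbers `t` with `T ≤ |t| ≤ 2 * T`. -/
def dyadicAnnulus (T : ℝ) : Set ℝ := {t | T ≤ |t| ∧ |t| ≤ 2 * T}

lemma isCompact_dyadicAnnulus (T : ℝ) : IsCompact (dyadicAnnulus T) := by
  refine (isCompact_Icc (a := -(2 * T)) (b := 2 * T)).of_isClosed_subset ?_
    fun t ht => abs_le.1 ht.2
  exact (isClosed_le continuous_const continuous_abs).inter
    (isClosed_le continuous_abs continuous_const)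

lemma measurableSet_dyadicAnnulus (T : ℝ) : MeasurableSet (dyadicAnnulus T) :=
  (isCompact_dyadicAnnulus T).measurableSet

variable {q : ℕ} [NeZero q] {χ : DirichletCharacter ℂ q}

lemma half_add_mul_I_ne_one (t : ℝ) : ((1 / 2 : ℝ) : ℂ) + t * I ≠ 1 := by
  intro h
  have := congrArg re h
  norm_num at this

lemma continuous_zetaL_half (hχ1 : χ ≠ 1) :
    Continuous fun t : ℝ => zetaL χ ((1 / 2 : ℝ) + t * I) :=
  continuous_iff_continuousAt.2 fun t =>
    ContinuousAt.comp (f := fun t : ℝ => ((1 / 2 : ℝ) : ℂ) + t * I)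
      (differentiableAt_zetaL hχ1 (half_add_mul_I_ne_one t)).continuousAt (by fun_prop)

lemma exists_integral_zetaL_half_le_of_isPrimitive (hχp : χ.IsPrimitive) (hχ : χ ^ 2 = 1)
    (hχ1 : χ ≠ 1) : ∃ C, 0 < C ∧ ∀ T : ℝ, 3 ≤ T →
      ∫ t in dyadicAnnulus T, ‖zetaL χ ((1 / 2 : ℝ) + t * I)‖ ^ 2 ≤ C * (T * Real.log T ^ 2) := by
  obtain ⟨K, hK⟩ := exists_hasFunctionalEquation hχp hχ hχ1
  obtain ⟨C, hC, h⟩ := hK.integral_half_le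
  refine ⟨Real.exp 8 * C, by positivity, fun T hT => ?_⟩
  obtain ⟨hi, hle⟩ := h T hT
  have hT0 : 0 < T := by linarith
  have key : ∀ t ∈ dyadicAnnulus T, ‖zetaL χ ((1 / 2 : ℝ) + t * I)‖ ^ 2 ≤
      Real.exp 8 / T ^ 4 * (‖((1 / 2 : ℝ) + t * I - 1 : ℂ) * zetaLReg χ ((1 / 2 : ℝ) + t * I)‖ ^ 2 *
      (Real.exp (-(t ^ 2 / T ^ 2)) * Real.exp (-(t ^ 2 / T ^ 2)))) := by
    intro t ht
    have h0 : ‖((1 / 2 : ℝ) + t * I - 1 : ℂ) * zetaLReg χ ((1 / 2 : ℝ) + t * I)‖ ^ 2 =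
        (‖((1 / 2 : ℝ) : ℂ) + t * I - 1‖ ^ 2) ^ 2 * ‖zetaL χ ((1 / 2 : ℝ) + t * I)‖ ^ 2 := by
      rw [zetaLReg_eq (half_add_mul_I_ne_one t), norm_mul, norm_mul]
      ring
    rw [h0, ← Real.exp_add]
    have h1 : T ≤ ‖((1 / 2 : ℝ) : ℂ) + t * I - 1‖ := by
      refine ht.1.trans ((le_of_eq ?_).trans (abs_im_le_norm _))
      simp
    have h2 : T ^ 4 ≤ (‖((1 / 2 : ℝ) : ℂ) + t * I - 1‖ ^ 2) ^ 2 := by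
      rw [← pow_mul]
      exact pow_le_pow_left₀ hT0.le h1 4
    have h3 : Real.exp (-8) ≤ Real.exp (-(t ^ 2 / T ^ 2) + -(t ^ 2 / T ^ 2)) := by
      refine Real.exp_le_exp.2 ?_
      have : t ^ 2 / T ^ 2 ≤ 4 := by
        rw [div_le_iff₀ (by positivity), ← sq_abs]
        nlinarith [ht.2, abs_nonneg t]
      linarith
    calc _ = Real.exp 8 / T ^ 4 * (T ^ 4 * ‖zetaL χ ((1 / 2 : ℝ) + t * I)‖ ^ 2 * Real.exp (-8)) := by
          rw [Real.exp_neg]; field_simp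
      _ ≤ _ := by gcongr
  have hi4 := hi.const_mul (Real.exp 8 / T ^ 4)
  calc _ ≤ ∫ t in dyadicAnnulus T, Real.exp 8 / T ^ 4 *
        (‖((1 / 2 : ℝ) + t * I - 1 : ℂ) * zetaLReg χ ((1 / 2 : ℝ) + t * I)‖ ^ 2 *
        (Real.exp (-(t ^ 2 / T ^ 2)) * Real.exp (-(t ^ 2 / T ^ 2)))) :=
        setIntegral_mono_on
          ((((continuous_zetaL_half hχ1).norm.pow 2).continuousOn).integrableOn_compact
          (isCompact_dyadicAnnulus T)) hi4.integrableOn (measurableSet_dyadicAnnulus T) key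
    _ ≤ ∫ t : ℝ, Real.exp 8 / T ^ 4 *
        (‖((1 / 2 : ℝ) + t * I - 1 : ℂ) * zetaLReg χ ((1 / 2 : ℝ) + t * I)‖ ^ 2 *
        (Real.exp (-(t ^ 2 / T ^ 2)) * Real.exp (-(t ^ 2 / T ^ 2)))) :=
        setIntegral_le_integral hi4 (ae_of_all _ fun t => by positivity)
    _ ≤ Real.exp 8 / T ^ 4 * (C * (T ^ 5 * Real.log T ^ 2)) := by
        rw [integral_const_mul]
        gcongr
    _ = _ := by field_simp

/-- The mean square of `ζ(s) L(s, χ)` on the critical line over a dyadic range. -/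
theorem exists_integral_zetaL_half_le (hχ : χ ^ 2 = 1) (hχ1 : χ ≠ 1) :
    ∃ C, 0 < C ∧ ∀ T : ℝ, 3 ≤ T →
      ∫ t in dyadicAnnulus T, ‖zetaL χ ((1 / 2 : ℝ) + t * I)‖ ^ 2 ≤ C * (T * Real.log T ^ 2) := by
  have : NeZero χ.conductor := ⟨χ.conductor_ne_zero⟩
  have hcl := χ.changeLevel_primitiveCharacter
  have h0 : χ.primitiveCharacter ≠ 1 := fun h => hχ1 (by rw [← hcl, h, map_one])
  have h2 : χ.primitiveCharacter ^ 2 = 1 :=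
    changeLevel_injective χ.conductor_dvd_level (by rw [map_pow, hcl, hχ, map_one])
  obtain ⟨C, hC, h⟩ := exists_integral_zetaL_half_le_of_isPrimitive
    χ.primitiveCharacter_isPrimitive h2 h0
  obtain ⟨m, hm⟩ : ∃ m, m = q.primeFactors.card := ⟨_, rfl⟩
  refine ⟨(2 ^ m) ^ 2 * C, by positivity, fun T hT => ?_⟩
  rw [mul_assoc]
  refine le_trans ?_ (mul_le_mul_of_nonneg_left (h T hT) (by positivity))
  rw [← integral_const_mul]
  refine setIntegral_mono_on
    ((((continuous_zetaL_half hχ1).norm.pow 2).continuousOn).integrableOn_compact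
      (isCompact_dyadicAnnulus T))
    (((((continuous_zetaL_half h0).norm.pow 2).const_mul _).continuousOn).integrableOn_compact
      (isCompact_dyadicAnnulus T)) (measurableSet_dyadicAnnulus T) fun t _ => ?_
  rw [← mul_pow]
  refine pow_le_pow_left₀ (norm_nonneg _) ?_ 2
  have h3 := LFunction_changeLevel χ.conductor_dvd_level χ.primitiveCharacter
    (s := (1 / 2 : ℝ) + t * I) (Or.inl h0)
  rw [hcl] at h3
  rw [zetaL, zetaL, h3, ← mul_assoc, norm_mul, mul_comm]
  refine mul_le_mul_of_nonneg_right ?_ (norm_nonneg _)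
  rw [norm_prod, hm, ← Finset.prod_const]
  refine Finset.prod_le_prod (fun p _ => norm_nonneg _) fun p hp => ?_
  have hp1 := Nat.Prime.pos (Nat.prime_of_mem_primeFactors hp)
  refine (norm_sub_le _ _).trans ?_
  have h4 : ‖χ.primitiveCharacter p * (p : ℂ) ^ (-(((1 / 2 : ℝ) : ℂ) + t * I))‖ ≤ 1 := by
    rw [norm_mul, norm_natCast_cpow_of_pos hp1]
    refine mul_le_one₀ (norm_le_one _ _) (by positivity)
      (Real.rpow_le_one_of_one_le_of_nonpos (by exact_mod_cast hp1) ?_)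
    simp
  rw [norm_one]
  linarith

/-- A pointwise bound for `ζ(s) L(s, χ)` on the critical line. -/
theorem exists_norm_zetaL_half_le_rpow (hχ1 : χ ≠ 1) :
    ∃ C, 0 < C ∧ ∀ t : ℝ, 1 ≤ |t| →
      ‖zetaL χ ((1 / 2 : ℝ) + t * I)‖ ≤ C * |t| ^ (99 / 200 : ℝ) := by
  obtain ⟨C₁, hC₁, h₁⟩ := isLinearLSeries_riemannZeta.exists_norm_le_rpow one_pos fun _ => rfl
  obtain ⟨C₂, hC₂, h₂⟩ := (isLinearLSeries_LFunction hχ1).exists_norm_le_rpow (NeZero.pos q)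
    fun n => by simp
  refine ⟨C₁ * C₂, by positivity, fun t ht => ?_⟩
  have h1 := h₁ t ht
  have h2 := h₂ t ht
  rw [zetaL, norm_mul, ofReal_div, ofReal_one, ofReal_ofNat]
  refine (mul_le_mul h1 h2 (norm_nonneg _) (by positivity)).trans_eq ?_
  rw [mul_mul_mul_comm, ← Real.rpow_add (by linarith)]
  norm_num

end CriticalLine

section Riesz

open DirichletCharacter

/-- The Mellin transform of `(log u)²` on the unit interval. -/
lemma hasMellin_log_sq {s : ℂ} (hs : 0 < s.re) :
    MellinConvergent (fun u : ℝ => Real.log u • Real.log u •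
      (Set.Ioc (0 : ℝ) 1).indicator (fun _ => (1 : ℂ)) u) s ∧
    mellin (fun u : ℝ => Real.log u • Real.log u •
      (Set.Ioc (0 : ℝ) 1).indicator (fun _ => (1 : ℂ)) u) s = 2 / s ^ 3 := by
  obtain ⟨f, hf⟩ : ∃ f : ℝ → ℂ, f = (Set.Ioc (0 : ℝ) 1).indicator (fun _ => (1 : ℂ)) := ⟨_, rfl⟩
  have hfm : Measurable f := by
    rw [hf]; exact measurable_const.indicator measurableSet_Ioc
  have hfle : ∀ u, ‖f u‖ ≤ 1 := fun u => by
    rw [hf, Set.indicator_apply]; split_ifs <;> simp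
  have hftop : f =ᶠ[atTop] 0 := by
    filter_upwards [eventually_gt_atTop 1] with u hu
    rw [hf, Set.indicator_of_notMem (fun h => by linarith [h.2]), Pi.zero_apply]
  have hfbot : f =O[𝓝[>] 0] fun x => x ^ (-(0 : ℝ)) := by
    refine IsBigO.of_bound 1 (Eventually.of_forall fun u => ?_)
    simpa using hfle u
  have hf1top : (fun u : ℝ => Real.log u • f u) =ᶠ[atTop] 0 := by
    filter_upwards [hftop] with u hu
    simp [hu]
  have hfl : LocallyIntegrableOn f (Set.Ioi 0) :=
    (locallyIntegrableOn_const (1 : ℂ)).mono hfm.aestronglyMeasurable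
      (ae_of_all _ fun u => by simpa using hfle u)
  have hf1l : LocallyIntegrableOn (fun u : ℝ => Real.log u • f u) (Set.Ioi 0) := by
    have h : LocallyIntegrableOn Real.log (Set.Ioi 0) :=
      ContinuousOn.locallyIntegrableOn (Real.continuousOn_log.mono fun x hx => ne_of_gt hx)
        measurableSet_Ioi
    refine h.mono (Real.measurable_log.smul hfm).aestronglyMeasurable (ae_of_all _ fun u => ?_)
    rw [norm_smul]
    exact mul_le_of_le_one_right (norm_nonneg _) (hfle u)
  have h1 : ∀ z : ℂ, 0 < z.re → mellin (fun u : ℝ => Real.log u • f u) z = -1 / z ^ 2 := by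
    intro z hz
    have hz0 : z ≠ 0 := fun h => by simp [h] at hz
    have h2 := (mellin_hasDerivAt_of_isBigO_rpow (a := z.re + 1) (b := 0) hfl
      (hftop.trans_isBigO (isBigO_zero _ _)) (by linarith) hfbot hz).2
    have h3 : mellin f =ᶠ[𝓝 z] fun w => w⁻¹ := by
      filter_upwards [(continuous_re.isOpen_preimage _ isOpen_Ioi).mem_nhds hz] with w hw
      rw [hf, (hasMellin_one_Ioc hw).2, one_div]
    exact h2.unique ((hasDerivAt_inv hz0).congr_of_eventuallyEq h3) |>.trans (by ring)
  have hs0 : s ≠ 0 := fun h => by simp [h] at hs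
  have h2 := mellin_hasDerivAt_of_isBigO_rpow (a := s.re + 1) (b := s.re / 2) hf1l
      (hf1top.trans_isBigO (isBigO_zero _ _)) (by linarith)
      (isBigO_rpow_zero_log_smul (by linarith) hfbot) (by linarith)
  rw [← hf]
  refine ⟨h2.1, h2.2.unique (HasDerivAt.congr_of_eventuallyEq (f := fun w => -1 / w ^ 2) ?_ ?_)⟩
  · have h3 := ((hasDerivAt_pow 2 s).inv (pow_ne_zero 2 hs0)).neg
    convert h3 using 1
    · ext w; simp [neg_div]
    · field_simp
      norm_num
  · filter_upwards [(continuous_re.isOpen_preimage _ isOpen_Ioi).mem_nhds hs] with w hw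
    exact h1 w hw

lemma norm_inv_cube_le {σ : ℝ} (hσ : 1 / 2 ≤ σ) (t : ℝ) :
    ‖1 / ((σ : ℂ) + t * I) ^ 3‖ ≤ 8 * (1 + t ^ 2)⁻¹ := by
  have h1 : 1 / 2 ≤ ‖(σ : ℂ) + t * I‖ := by
    refine hσ.trans ((le_abs_self _).trans ((le_of_eq ?_).trans (abs_re_le_norm _)))
    simp
  have h2 : ‖(σ : ℂ) + t * I‖ ^ 2 = σ ^ 2 + t ^ 2 := by
    rw [← normSq_eq_norm_sq, normSq_add_mul_I]
  have h3 : (1 + t ^ 2) / 8 ≤ ‖(σ : ℂ) + t * I‖ ^ 3 := by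
    rw [pow_succ _ 2, h2]
    nlinarith [sq_nonneg t, mul_nonneg (by nlinarith [sq_nonneg t] : 0 ≤ σ ^ 2 + t ^ 2)
      (sub_nonneg.2 h1)]
  rw [norm_div, norm_one, norm_pow, div_le_iff₀ (lt_of_lt_of_le (by positivity) h3)]
  calc 1 = 8 * (1 + t ^ 2)⁻¹ * ((1 + t ^ 2) / 8) := by field_simp
    _ ≤ _ := by gcongr

lemma add_mul_I_ne_zero {σ : ℝ} (hσ : 0 < σ) (t : ℝ) : (σ : ℂ) + t * I ≠ 0 := fun h => by
  have := congrArg re h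
  simp at this
  linarith

lemma integrable_inv_cube {σ : ℝ} (hσ : 1 / 2 ≤ σ) :
    Integrable fun t : ℝ => 1 / ((σ : ℂ) + t * I) ^ 3 := by
  refine (integrable_inv_one_add_sq.const_mul 8).mono' ?_
    (ae_of_all _ (norm_inv_cube_le hσ))
  refine Continuous.aestronglyMeasurable (continuous_const.div (by fun_prop) fun t => ?_)
  exact pow_ne_zero _ (add_mul_I_ne_zero (by linarith) t)

/-- The Perron-type formula with the kernel `y ^ s / s ^ 3`. -/
lemma integral_cpow_div_cube {y : ℝ} (hy : 0 < y) :
    ∫ t : ℝ, (y : ℂ) ^ (((2 : ℝ) : ℂ) + t * I) / (((2 : ℝ) : ℂ) + t * I) ^ 3 =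
      Real.pi * Real.posLog y ^ 2 := by
  obtain ⟨f, hf⟩ : ∃ f : ℝ → ℂ, f = fun u : ℝ => Real.log u • Real.log u •
      (Set.Ioc (0 : ℝ) 1).indicator (fun _ => (1 : ℂ)) u := ⟨_, rfl⟩
  have hfu : ∀ u : ℝ, 0 < u → f u = ((Real.posLog u⁻¹ ^ 2 : ℝ) : ℂ) := by
    intro u hu
    simp only [hf, Real.posLog_def, Pi.sup_apply, Pi.zero_apply]
    by_cases h : u ≤ 1
    · rw [Set.indicator_of_mem (show u ∈ Set.Ioc 0 1 from ⟨hu, h⟩), Real.log_inv,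
        max_eq_right (by linarith [Real.log_nonpos hu.le h])]
      simp [sq]
    · rw [Set.indicator_of_notMem (fun h2 => h h2.2), Real.log_inv,
        max_eq_left (by linarith [Real.log_pos (not_le.1 h)])]
      simp
  have hm := fun t : ℝ => hasMellin_log_sq (s := ((2 : ℝ) : ℂ) + t * I) (by simp)
  rw [← hf] at hm
  have hc : ContinuousAt f y⁻¹ := by
    have h1 : ContinuousAt (fun u : ℝ => ((Real.posLog u⁻¹ ^ 2 : ℝ) : ℂ)) y⁻¹ := by
      refine continuous_ofReal.continuousAt.comp ((ContinuousAt.pow ?_ 2))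
      exact Real.continuous_posLog.continuousAt.comp (continuousAt_inv₀ (by positivity))
    refine h1.congr ?_
    filter_upwards [Ioi_mem_nhds (inv_pos.2 hy)] with u hu
    exact (hfu u hu).symm
  have h := mellinInv_mellin_eq 2 f (inv_pos.2 hy)
    (hf ▸ (hasMellin_log_sq (s := ((2 : ℝ) : ℂ)) (by simp)).1) ?_ hc
  · rw [hfu _ (inv_pos.2 hy), inv_inv, mellinInv] at h
    simp_rw [(hm _).2] at h
    have h1 : ∀ t : ℝ, ((y⁻¹ : ℝ) : ℂ) ^ (-(((2 : ℝ) : ℂ) + t * I)) •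
        (2 / (((2 : ℝ) : ℂ) + t * I) ^ 3) =
        2 * ((y : ℂ) ^ (((2 : ℝ) : ℂ) + t * I) / (((2 : ℝ) : ℂ) + t * I) ^ 3) := by
      intro t
      rw [ofReal_inv, inv_cpow _ _ (by rw [arg_ofReal_of_nonneg hy.le]; exact Real.pi_pos.ne),
        cpow_neg, inv_inv, smul_eq_mul]
      ring
    simp_rw [h1, integral_const_mul, real_smul] at h
    have hpi : (Real.pi : ℂ) ≠ 0 := ofReal_ne_zero.2 Real.pi_ne_zero
    have h2 : ∀ J P : ℂ, 1 / (2 * Real.pi) * (2 * J) = P → J = Real.pi * P := by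
      rintro J P rfl
      field_simp
    push_cast at h ⊢
    exact h2 _ _ h
  · unfold VerticalIntegrable
    simp_rw [(hm _).2]
    simpa only [mul_one_div] using (integrable_inv_cube (σ := 2) (by norm_num)).const_mul 2

variable {q : ℕ} [NeZero q] {χ : DirichletCharacter ℂ q}

/-- The Riesz mean of the coefficients of `ζ(s)² L(s, χ)²` as a line integral. -/
lemma sum_mul_posLog_sq_eq_integral {X : ℝ} (hX : 0 < X) :
    Real.pi * ∑ n ∈ Finset.Icc 1 ⌊X⌋₊, (χ.zetaMul * χ.zetaMul) n * (Real.log (X / n) ^ 2 : ℝ) =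
      ∫ t : ℝ, zetaL χ (((2 : ℝ) : ℂ) + t * I) ^ 2 * (X : ℂ) ^ (((2 : ℝ) : ℂ) + t * I) /
        (((2 : ℝ) : ℂ) + t * I) ^ 3 := by
  obtain ⟨F, hF⟩ : ∃ F : ℕ → ℝ → ℂ, F = fun (n : ℕ) (t : ℝ) =>
      LSeries.term (fun n => (χ.zetaMul * χ.zetaMul) n) (((2 : ℝ) : ℂ) + t * I) n *
        ((X : ℂ) ^ (((2 : ℝ) : ℂ) + t * I) / (((2 : ℝ) : ℂ) + t * I) ^ 3) := ⟨_, rfl⟩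
  have hre : ∀ t : ℝ, 1 < (((2 : ℝ) : ℂ) + t * I).re := fun t => by simp
  have hF' : ∀ n : ℕ, n ≠ 0 → ∀ t : ℝ, F n t = (χ.zetaMul * χ.zetaMul) n *
      (((X / n : ℝ) : ℂ) ^ (((2 : ℝ) : ℂ) + t * I) / (((2 : ℝ) : ℂ) + t * I) ^ 3) := by
    intro n hn t
    rw [hF]
    dsimp only
    have hn0 : (0 : ℝ) < n := Nat.cast_pos.2 (Nat.pos_of_ne_zero hn)
    have h1 : (X : ℂ) ^ (((2 : ℝ) : ℂ) + t * I) =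
        ((X / n : ℝ) : ℂ) ^ (((2 : ℝ) : ℂ) + t * I) * (n : ℂ) ^ (((2 : ℝ) : ℂ) + t * I) := by
      rw [← ofReal_natCast, ← mul_cpow_ofReal_nonneg (by positivity) hn0.le, ← ofReal_mul,
        div_mul_cancel₀ _ hn0.ne']
    have h2 : (n : ℂ) ^ (((2 : ℝ) : ℂ) + t * I) ≠ 0 := by
      simp [cpow_eq_zero_iff, hn]
    rw [LSeries.term_of_ne_zero hn, h1]
    field_simp
  have hF0 : ∀ t : ℝ, F 0 t = 0 := fun t => by simp [hF]
  have hnorm : ∀ n : ℕ, ∀ t : ℝ, ‖F n t‖ =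
      ‖LSeries.term (fun n => (χ.zetaMul * χ.zetaMul) n) ((2 : ℝ) : ℂ) n‖ * X ^ 2 *
        ‖1 / (((2 : ℝ) : ℂ) + t * I) ^ 3‖ := by
    intro n t
    rw [hF]
    dsimp only
    rw [norm_mul, norm_div, norm_cpow_eq_rpow_re_of_pos hX, LSeries.norm_term_eq,
      LSeries.norm_term_eq, norm_div, norm_one]
    have h1 : (((2 : ℝ) : ℂ) + t * I).re = 2 := by simp
    rw [h1, ofReal_re, Real.rpow_two X, mul_assoc, mul_one_div]
  have hcont : ∀ n, Continuous (F n) := by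
    intro n
    rw [hF]
    refine Continuous.mul ?_ (Continuous.div ?_ (by fun_prop)
      fun t => pow_ne_zero _ (add_mul_I_ne_zero (by norm_num) t))
    · rcases eq_or_ne n 0 with rfl | hn
      · simpa using continuous_const
      · simp_rw [LSeries.term_of_ne_zero hn]
        refine continuous_const.div (Continuous.const_cpow (by fun_prop)
          (Or.inl (Nat.cast_ne_zero.2 hn))) fun t => ?_
        simp [cpow_eq_zero_iff, hn]
    · exact Continuous.const_cpow (by fun_prop) (Or.inl (ofReal_ne_zero.2 hX.ne'))
  have hint : ∀ n, Integrable (F n) := fun n => by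
    refine (((integrable_inv_cube (σ := 2) (by norm_num)).norm.const_mul
      (‖LSeries.term (fun n => (χ.zetaMul * χ.zetaMul) n) ((2 : ℝ) : ℂ) n‖ * X ^ 2)).mono'
      (hcont n).aestronglyMeasurable (ae_of_all _ fun t => (hnorm n t).le))
  have hsum : Summable fun n => ∫ t, ‖F n t‖ := by
    simp_rw [hnorm, integral_const_mul]
    exact ((LSeriesSummable_zetaMul_mul (by simp)).norm.mul_right _).mul_right _
  have h := hasSum_integral_of_summable_integral_norm hint hsum
  have h1 : ∀ t : ℝ, ∑' n, F n t = zetaL χ (((2 : ℝ) : ℂ) + t * I) ^ 2 *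
      (X : ℂ) ^ (((2 : ℝ) : ℂ) + t * I) / (((2 : ℝ) : ℂ) + t * I) ^ 3 := by
    intro t
    rw [hF]
    dsimp only
    rw [tsum_mul_right, ← LSeries, LSeries_zetaMul_mul (hre t), mul_div_assoc]
  simp_rw [h1] at h
  refine HasSum.unique ?_ h
  have h2 : ∀ n : ℕ, n ≠ 0 → ∫ t, F n t =
      (χ.zetaMul * χ.zetaMul) n * (Real.pi * Real.posLog (X / n) ^ 2) := by
    intro n hn
    simp_rw [hF' n hn, integral_const_mul]
    rw [integral_cpow_div_cube (div_pos hX (Nat.cast_pos.2 (Nat.pos_of_ne_zero hn)))]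
  have h3 : Real.pi * ∑ n ∈ Finset.Icc 1 ⌊X⌋₊,
      (χ.zetaMul * χ.zetaMul) n * (Real.log (X / n) ^ 2 : ℝ) =
      ∑ n ∈ Finset.Icc 1 ⌊X⌋₊, ∫ t, F n t := by
    rw [Finset.mul_sum]
    refine Finset.sum_congr rfl fun n hn => ?_
    rw [Finset.mem_Icc] at hn
    have hn0 : (0 : ℝ) < n := Nat.cast_pos.2 hn.1
    rw [h2 n (by lia), Real.posLog_def]
    dsimp only [Pi.sup_apply, Pi.zero_apply]
    rw [max_eq_right (Real.log_nonneg ((one_le_div hn0).2 ((Nat.le_floor_iff hX.le).1 hn.2)))]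
    push_cast
    ring
  rw [h3]
  refine hasSum_sum_of_ne_finset_zero fun n hn => ?_
  by_cases hn0 : n = 0
  · simp [hn0, hF0]
  · have hn1 : (0 : ℝ) < n := Nat.cast_pos.2 (Nat.pos_of_ne_zero hn0)
    have h4 : X < n := by
      by_contra! h5
      exact hn (Finset.mem_Icc.2 ⟨Nat.pos_of_ne_zero hn0, Nat.le_floor h5⟩)
    rw [h2 n hn0, Real.posLog_def]
    dsimp only [Pi.sup_apply, Pi.zero_apply]
    rw [max_eq_left (Real.log_nonpos (by positivity) ((div_le_one hn1).2 h4.le))]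
    simp

end Riesz

section DoublePole

lemma tendsto_inv_add_mul_I (σ : ℝ) {l : Filter ℝ} (hl : Tendsto (fun t : ℝ => |t|) l atTop) :
    Tendsto (fun t : ℝ => ((σ : ℂ) + t * I)⁻¹) l (𝓝 0) := by
  refine squeeze_zero_norm' ?_ (tendsto_inv_atTop_zero.comp hl)
  filter_upwards [hl.eventually_gt_atTop 0] with t ht
  rw [norm_inv]
  refine inv_anti₀ ht ((le_of_eq ?_).trans (abs_im_le_norm _))
  simp

lemma hasDerivAt_add_mul_I (σ t : ℝ) : HasDerivAt (fun t : ℝ => (σ : ℂ) + t * I) I t := by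
  simpa using (((hasDerivAt_id t).ofReal_comp).mul_const I).const_add (σ : ℂ)

lemma integral_inv_sq_eq_zero {σ : ℝ} (hσ : 0 < |σ|) :
    (Integrable fun t : ℝ => (((σ : ℂ) + t * I) ^ 2)⁻¹) ∧
      ∫ t : ℝ, (((σ : ℂ) + t * I) ^ 2)⁻¹ = 0 := by
  have h0 : ∀ t : ℝ, (σ : ℂ) + t * I ≠ 0 := fun t h => by
    have := congrArg re h
    simp at this
    simp [this] at hσ
  have hi : Integrable fun t : ℝ => (((σ : ℂ) + t * I) ^ 2)⁻¹ := by
    have h1 : Integrable fun t : ℝ => (σ ^ 2)⁻¹ * (1 + (σ⁻¹ * t) ^ 2)⁻¹ :=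
      (integrable_inv_one_add_sq.comp_mul_left' (inv_ne_zero (abs_pos.1 hσ))).const_mul _
    refine h1.mono' (Continuous.aestronglyMeasurable (Continuous.inv₀ (by fun_prop)
      fun t => pow_ne_zero _ (h0 t))) (ae_of_all _ fun t => le_of_eq ?_)
    rw [norm_inv, norm_pow, ← normSq_eq_norm_sq, normSq_add_mul_I, ← mul_inv]
    congr 1
    have := abs_pos.1 hσ
    field_simp
  refine ⟨hi, ?_⟩
  have h := integral_of_hasDerivAt_of_tendsto (f := fun t : ℝ => I * ((σ : ℂ) + t * I)⁻¹)
    (f' := fun t : ℝ => (((σ : ℂ) + t * I) ^ 2)⁻¹) (fun t => ?_) hi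
    ((tendsto_inv_add_mul_I σ tendsto_abs_atBot_atTop).const_mul I)
    ((tendsto_inv_add_mul_I σ tendsto_abs_atTop_atTop).const_mul I)
  · rw [h, sub_self]
  · refine (((hasDerivAt_add_mul_I σ t).inv (h0 t)).const_mul I).congr_deriv ?_
    have := h0 t
    field_simp
    rw [I_sq]; ring

lemma integral_inv_mul_two :
    (Integrable fun t : ℝ => ((((2 : ℝ) : ℂ) + t * I) * (((2 : ℝ) : ℂ) + t * I - 1))⁻¹) ∧
      ∫ t : ℝ, ((((2 : ℝ) : ℂ) + t * I) * (((2 : ℝ) : ℂ) + t * I - 1))⁻¹ = 0 := by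
  have h0 : ∀ t : ℝ, ((2 : ℝ) : ℂ) + t * I ≠ 0 := add_mul_I_ne_zero (by norm_num)
  have h1 : ∀ t : ℝ, ((2 : ℝ) : ℂ) + t * I - 1 ≠ 0 := fun t h => by
    have := congrArg re h
    norm_num at this
  have hi : Integrable fun t : ℝ =>
      ((((2 : ℝ) : ℂ) + t * I) * (((2 : ℝ) : ℂ) + t * I - 1))⁻¹ := by
    refine integrable_inv_one_add_sq.mono' (Continuous.aestronglyMeasurable
      (Continuous.inv₀ (by fun_prop) fun t => mul_ne_zero (h0 t) (h1 t)))
      (ae_of_all _ fun t => ?_)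
    rw [norm_inv, norm_mul]
    refine inv_anti₀ (by positivity) ?_
    have h2 : ((2 : ℝ) : ℂ) + t * I - 1 = ((1 : ℝ) : ℂ) + t * I := by push_cast; ring
    have h3 : ‖((1 : ℝ) : ℂ) + t * I‖ ^ 2 = 1 + t ^ 2 := by
      rw [← normSq_eq_norm_sq, normSq_add_mul_I]; norm_num
    have h4 : ‖((2 : ℝ) : ℂ) + t * I‖ ^ 2 = 4 + t ^ 2 := by
      rw [← normSq_eq_norm_sq, normSq_add_mul_I]; norm_num
    rw [h2, ← h3, sq]
    refine mul_le_mul_of_nonneg_right ?_ (norm_nonneg _)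
    exact abs_le_of_sq_le_sq' (by linarith) (norm_nonneg _) |>.2
  refine ⟨hi, ?_⟩
  have hlim : ∀ l : Filter ℝ, Tendsto (fun t : ℝ => |t|) l atTop → Tendsto
      (fun t : ℝ => -I * log (1 - (((2 : ℝ) : ℂ) + t * I)⁻¹)) l (𝓝 0) := by
    intro l hl
    have := ((tendsto_inv_add_mul_I 2 hl).const_sub 1).clog (by simp)
    simpa using this.const_mul (-I)
  have h := integral_of_hasDerivAt_of_tendsto
    (f := fun t : ℝ => -I * log (1 - (((2 : ℝ) : ℂ) + t * I)⁻¹))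
    (f' := fun t : ℝ => ((((2 : ℝ) : ℂ) + t * I) * (((2 : ℝ) : ℂ) + t * I - 1))⁻¹)
    (fun t => ?_) hi (hlim _ tendsto_abs_atBot_atTop) (hlim _ tendsto_abs_atTop_atTop)
  · rw [h, sub_self]
  · have hs : 1 - (((2 : ℝ) : ℂ) + t * I)⁻¹ ∈ slitPlane := by
      left
      have : ((((2 : ℝ) : ℂ) + t * I)⁻¹).re = 2 / (4 + t ^ 2) := by
        rw [inv_re, normSq_add_mul_I]; norm_num
      rw [sub_re, one_re, this, sub_pos, div_lt_one (by positivity)]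
      nlinarith [sq_nonneg t]
    refine (((((hasDerivAt_add_mul_I 2 t).inv (h0 t)).const_sub 1).clog_real hs).const_mul
      (-I)).congr_deriv ?_
    have h2 := h0 t
    have h3 := h1 t
    have h4 : 1 - (((2 : ℝ) : ℂ) + t * I)⁻¹ =
        (((2 : ℝ) : ℂ) + t * I - 1) / (((2 : ℝ) : ℂ) + t * I) := by field_simp
    rw [Pi.inv_apply, h4]
    field_simp
    rw [I_sq]; ring

lemma integral_inv_mul_half :
    (Integrable fun t : ℝ => ((((1 / 2 : ℝ) : ℂ) + t * I) * (((1 / 2 : ℝ) : ℂ) + t * I - 1))⁻¹) ∧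
      ∫ t : ℝ, ((((1 / 2 : ℝ) : ℂ) + t * I) * (((1 / 2 : ℝ) : ℂ) + t * I - 1))⁻¹ =
        -(2 * Real.pi) := by
  have h : (fun t : ℝ => ((((1 / 2 : ℝ) : ℂ) + t * I) * (((1 / 2 : ℝ) : ℂ) + t * I - 1))⁻¹) =
      fun t : ℝ => ((-4 * (1 + (2 * t) ^ 2)⁻¹ : ℝ) : ℂ) := by
    ext t
    have h1 : (((1 / 2 : ℝ) : ℂ) + t * I) * (((1 / 2 : ℝ) : ℂ) + t * I - 1) =
        ((-(1 + (2 * t) ^ 2) / 4 : ℝ) : ℂ) := by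
      push_cast
      linear_combination (t : ℂ) ^ 2 * I_sq
    rw [h1, ← ofReal_inv]
    congr 1
    field_simp
  have hi : Integrable fun t : ℝ => -4 * (1 + (2 * t) ^ 2)⁻¹ :=
    (integrable_inv_one_add_sq.comp_mul_left' two_ne_zero).const_mul _
  rw [h]
  refine ⟨hi.ofReal, ?_⟩
  rw [integral_complex_ofReal, integral_const_mul,
    Measure.integral_comp_mul_left (fun t : ℝ => (1 + t ^ 2)⁻¹) 2, integral_univ_inv_one_add_sq]
  norm_num
  ring

/-- The residue theorem for the strip `1/2 ≤ Re s ≤ 2` and a double pole at `1`. -/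
theorem integral_double_pole {φ : ℂ → ℂ} (hφ : DifferentiableOn ℂ φ {s | 0 < s.re})
    (h2 : Integrable fun t : ℝ => φ (((2 : ℝ) : ℂ) + t * I) / (((2 : ℝ) : ℂ) + t * I - 1) ^ 2)
    (h1 : Integrable fun t : ℝ =>
      φ (((1 / 2 : ℝ) : ℂ) + t * I) / (((1 / 2 : ℝ) : ℂ) + t * I - 1) ^ 2)
    {g : ℝ → ℝ} (hg : Tendsto g atTop (𝓝 0))
    (hφg : ∀ σ t : ℝ, 1 / 2 ≤ σ → σ ≤ 2 → 1 ≤ |t| →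
      ‖φ (σ + t * I) / ((σ : ℂ) + t * I - 1) ^ 2‖ ≤ g |t|) :
    ∫ t : ℝ, φ (((2 : ℝ) : ℂ) + t * I) / (((2 : ℝ) : ℂ) + t * I - 1) ^ 2 =
      2 * Real.pi * deriv φ 1 +
        ∫ t : ℝ, φ (((1 / 2 : ℝ) : ℂ) + t * I) / (((1 / 2 : ℝ) : ℂ) + t * I - 1) ^ 2 := by
  obtain ⟨k, hk⟩ : ∃ k : ℂ → ℂ, k = fun s => φ s - φ 1 - deriv φ 1 * ((s - 1) / s) := ⟨_, rfl⟩
  have hmem : {s : ℂ | 0 < s.re} ∈ 𝓝 (1 : ℂ) :=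
    (continuous_re.isOpen_preimage _ isOpen_Ioi).mem_nhds (by simp)
  have hφ1 : HasDerivAt φ (deriv φ 1) 1 := (hφ.differentiableAt hmem).hasDerivAt
  have hkd : DifferentiableOn ℂ k {s | 0 < s.re} := by
    rw [hk]
    refine (hφ.sub_const _).sub (DifferentiableOn.const_mul (DifferentiableOn.div (by fun_prop)
      (by fun_prop) fun s hs h => ?_) _)
    simp [h] at hs
  have hk1 : k 1 = 0 := by simp [hk]
  have hkd1 : deriv k 1 = 0 := by
    have h3 : HasDerivAt (fun s : ℂ => (s - 1) / s) 1 1 := by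
      refine (((hasDerivAt_id (1 : ℂ)).sub_const 1).div (hasDerivAt_id (1 : ℂ))
        one_ne_zero).congr_deriv ?_
      simp
    have h4 := (hφ1.sub_const (φ 1)).sub (h3.const_mul (deriv φ 1))
    rw [hk]
    exact h4.deriv.trans (by ring)
  have hf : ∀ s : ℂ, s ≠ 1 → dslope (dslope k 1) 1 s =
      φ s / (s - 1) ^ 2 - φ 1 * ((s - 1) ^ 2)⁻¹ - deriv φ 1 * (s * (s - 1))⁻¹ := by
    intro s hs
    have hs1 : s - 1 ≠ 0 := sub_ne_zero.2 hs
    rw [dslope_of_ne _ hs, slope_def_field, dslope_same, hkd1, dslope_of_ne _ hs, slope_def_field,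
      hk1, sub_zero, sub_zero, hk]
    by_cases hs0 : s = 0
    · simp [hs0]
      ring
    · field_simp
  have hsub : ∀ A B C : ℝ → ℂ, Integrable A → Integrable B → Integrable C →
      (Integrable fun t => A t - φ 1 * B t - deriv φ 1 * C t) ∧
      ∫ t, (A t - φ 1 * B t - deriv φ 1 * C t) =
        (∫ t, A t) - φ 1 * (∫ t, B t) - deriv φ 1 * ∫ t, C t := by
    intro A B C hA hB hC
    have h3 : Integrable fun t => A t - φ 1 * B t := hA.sub (hB.const_mul (φ 1))
    refine ⟨h3.sub (hC.const_mul (deriv φ 1)), ?_⟩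
    rw [← integral_const_mul, ← integral_const_mul, ← integral_sub hA (hB.const_mul _),
      ← integral_sub h3 (hC.const_mul _)]
  have hfd : DifferentiableOn ℂ (dslope (dslope k 1) 1) {s | 0 < s.re} := by
    rw [differentiableOn_dslope hmem, differentiableOn_dslope hmem]
    exact hkd
  have hne2 : ∀ t : ℝ, ((2 : ℝ) : ℂ) + t * I ≠ 1 := fun t h => by
    have := congrArg re h
    norm_num at this
  obtain ⟨i2, e2⟩ := integral_inv_sq_eq_zero (σ := 1) (by norm_num)
  obtain ⟨i1, e1⟩ := integral_inv_sq_eq_zero (σ := -1 / 2) (by norm_num)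
  obtain ⟨j2, d2⟩ := integral_inv_mul_two
  obtain ⟨j1, d1⟩ := integral_inv_mul_half
  have c2 : ∀ t : ℝ, ((1 : ℝ) : ℂ) + t * I = ((2 : ℝ) : ℂ) + t * I - 1 := fun t => by
    push_cast; ring
  have c1 : ∀ t : ℝ, ((-1 / 2 : ℝ) : ℂ) + t * I = ((1 / 2 : ℝ) : ℂ) + t * I - 1 := fun t => by
    push_cast; ring
  simp_rw [c2] at i2 e2
  simp_rw [c1] at i1 e1
  obtain ⟨I2, E2⟩ := hsub _ _ _ h2 i2 j2
  obtain ⟨I1, E1⟩ := hsub _ _ _ h1 i1 j1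
  have h := integral_vertical_eq (a := 1 / 2) (b := 2) (by norm_num)
    (hfd.mono fun s hs => lt_of_lt_of_le (by norm_num) hs.1)
    (I1.congr (ae_of_all _ fun t => (hf _ (half_add_mul_I_ne_one t)).symm))
    (I2.congr (ae_of_all _ fun t => (hf _ (hne2 t)).symm))
    (g := fun t => g t + (‖φ 1‖ + ‖deriv φ 1‖) * (t ^ 2)⁻¹) ?_ ?_
  · simp_rw [hf _ (half_add_mul_I_ne_one _), hf _ (hne2 _)] at h
    rw [E1, E2, e1, e2, d1, d2] at h
    linear_combination -h
  · have h5 : Tendsto (fun t : ℝ => (t ^ 2)⁻¹) atTop (𝓝 0) :=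
      tendsto_inv_atTop_zero.comp (tendsto_pow_atTop two_ne_zero)
    simpa using hg.add (h5.const_mul (‖φ 1‖ + ‖deriv φ 1‖))
  · intro σ t hσ1 hσ2 ht
    have hs1 : |t| ≤ ‖(σ : ℂ) + t * I‖ := (le_of_eq (by simp)).trans (abs_im_le_norm _)
    have hs2 : |t| ≤ ‖(σ : ℂ) + t * I - 1‖ := (le_of_eq (by simp)).trans (abs_im_le_norm _)
    have ht0 : 0 < |t| := by linarith
    have hne : (σ : ℂ) + t * I ≠ 1 := fun h => by
      rw [h, sub_self, norm_zero] at hs2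
      linarith
    rw [hf _ hne]
    refine (norm_sub_le _ _).trans ?_
    refine (add_le_add_left (norm_sub_le _ _) _).trans ?_
    have b1 : ‖φ 1 * (((σ : ℂ) + t * I - 1) ^ 2)⁻¹‖ ≤ ‖φ 1‖ * (|t| ^ 2)⁻¹ := by
      rw [norm_mul, norm_inv, norm_pow]
      gcongr
    have b2 : ‖deriv φ 1 * (((σ : ℂ) + t * I) * ((σ : ℂ) + t * I - 1))⁻¹‖ ≤
        ‖deriv φ 1‖ * (|t| ^ 2)⁻¹ := by
      rw [norm_mul, norm_inv, norm_mul, sq]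
      gcongr
    linarith [hφg σ t hσ1 hσ2 ht]

end DoublePole

section RieszShift

open DirichletCharacter

variable {q : ℕ} [NeZero q] {χ : DirichletCharacter ℂ q}

lemma hasDerivAt_zetaLReg_one (hχ1 : χ ≠ 1) :
    HasDerivAt (zetaLReg χ)
      (Real.eulerMascheroniConstant * χ.LFunction 1 + deriv χ.LFunction 1) 1 := by
  have hL : HasDerivAt χ.LFunction (deriv χ.LFunction 1) 1 :=
    (differentiable_LFunction hχ1 1).hasDerivAt
  rw [hasDerivAt_iff_tendsto_slope]
  have h1 := hasDerivAt_iff_tendsto_slope.1 hL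
  have h2 := (tendsto_riemannZeta_sub_one_div.mul
    (hL.continuousAt.tendsto.mono_left nhdsWithin_le_nhds)).add h1
  refine h2.congr' ?_
  filter_upwards [self_mem_nhdsWithin] with s hs
  have hs1 : s - 1 ≠ 0 := sub_ne_zero.2 hs
  rw [slope_def_field, slope_def_field, zetaLReg_eq hs, zetaLReg_one, zetaL]
  field_simp
  ring

lemma exists_norm_zetaL_half_sq_le (hχ1 : χ ≠ 1) :
    ∃ C, 0 < C ∧ ∀ t : ℝ,
      ‖zetaL χ (((1 / 2 : ℝ) : ℂ) + t * I)‖ ^ 2 ≤ C * (1 + t ^ 2) ^ (99 / 200 : ℝ) := by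
  obtain ⟨C, hC, h⟩ := exists_norm_zetaL_half_le_rpow hχ1
  obtain ⟨B, hB⟩ := (isCompact_Icc (a := (-1 : ℝ)) (b := 1)).exists_bound_of_continuousOn
    (continuous_zetaL_half hχ1).continuousOn
  refine ⟨C ^ 2 + B ^ 2, by positivity, fun t => ?_⟩
  have h1 : 0 ≤ t ^ 2 := sq_nonneg t
  have h0 : 1 ≤ (1 + t ^ 2) ^ (99 / 200 : ℝ) := Real.one_le_rpow (by linarith) (by norm_num)
  rcases le_total 1 |t| with ht | ht
  · have ht0 : 0 < |t| := by linarith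
    calc _ ≤ (C * |t| ^ (99 / 200 : ℝ)) ^ 2 := pow_le_pow_left₀ (norm_nonneg _) (h t ht) 2
      _ = C ^ 2 * (|t| ^ 2) ^ (99 / 200 : ℝ) := by
        rw [mul_pow, ← Real.rpow_natCast, ← Real.rpow_natCast, ← Real.rpow_mul ht0.le,
          ← Real.rpow_natCast, ← Real.rpow_mul ht0.le]
        norm_num
      _ ≤ (C ^ 2 + B ^ 2) * (1 + t ^ 2) ^ (99 / 200 : ℝ) := by
        rw [sq_abs]
        gcongr
        · linarith [sq_nonneg B]
        · linarith
  · calc _ ≤ B ^ 2 := pow_le_pow_left₀ (norm_nonneg _) (hB t (abs_le.1 ht)) 2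
      _ ≤ (C ^ 2 + B ^ 2) * 1 := by linarith [sq_nonneg C]
      _ ≤ _ := by gcongr

lemma norm_inv_half_cube_le (t : ℝ) :
    ‖1 / (((1 / 2 : ℝ) : ℂ) + t * I) ^ 3‖ ≤ 8 * (1 + t ^ 2) ^ (-(3 / 2) : ℝ) := by
  have h1 : ‖((1 / 2 : ℝ) : ℂ) + t * I‖ ^ 2 = 1 / 4 + t ^ 2 := by
    rw [← normSq_eq_norm_sq, normSq_add_mul_I]; norm_num
  have h2 : (1 + t ^ 2) / 4 ≤ ‖((1 / 2 : ℝ) : ℂ) + t * I‖ ^ 2 := by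
    rw [h1]; linarith [sq_nonneg t]
  have h3 : (1 + t ^ 2) ^ (3 / 2 : ℝ) / 8 ≤ ‖((1 / 2 : ℝ) : ℂ) + t * I‖ ^ 3 := by
    calc _ = ((1 + t ^ 2) / 4) ^ (3 / 2 : ℝ) := by
          rw [Real.div_rpow (by positivity) (by norm_num),
            show (4 : ℝ) = 2 ^ (2 : ℝ) by norm_num, ← Real.rpow_mul (by norm_num)]
          norm_num
      _ ≤ (‖((1 / 2 : ℝ) : ℂ) + t * I‖ ^ 2) ^ (3 / 2 : ℝ) := by gcongr
      _ = _ := by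
          rw [← Real.rpow_natCast, ← Real.rpow_mul (norm_nonneg _), ← Real.rpow_natCast]
          norm_num
  have h4 : 0 < (1 + t ^ 2) ^ (3 / 2 : ℝ) := by positivity
  rw [norm_div, norm_one, norm_pow, Real.rpow_neg (by positivity), ← div_eq_mul_inv,
    div_le_div_iff₀ (by linarith) h4]
  linarith

lemma integrable_zetaL_sq_mul_cpow_half (hχ1 : χ ≠ 1) {X : ℝ} (hX : 0 < X) :
    Integrable fun t : ℝ => zetaL χ (((1 / 2 : ℝ) : ℂ) + t * I) ^ 2 *
      (X : ℂ) ^ (((1 / 2 : ℝ) : ℂ) + t * I) / (((1 / 2 : ℝ) : ℂ) + t * I) ^ 3 := by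
  obtain ⟨C, hC, h⟩ := exists_norm_zetaL_half_sq_le hχ1
  have h1 : Integrable fun t : ℝ => (1 + ‖t‖ ^ 2) ^ (-(201 / 100 : ℝ) / 2) :=
    integrable_rpow_neg_one_add_norm_sq (by simp; norm_num)
  refine (h1.const_mul (C * X ^ (1 / 2 : ℝ) * 8)).mono' (Continuous.aestronglyMeasurable ?_)
    (ae_of_all _ fun t => ?_)
  · exact (((continuous_zetaL_half hχ1).pow 2).mul (Continuous.const_cpow (by fun_prop)
      (Or.inl (ofReal_ne_zero.2 hX.ne')))).div (by fun_prop)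
      fun t => pow_ne_zero _ (add_mul_I_ne_zero (by norm_num) t)
  · have hre : (((1 / 2 : ℝ) : ℂ) + t * I).re = 1 / 2 := by simp
    have hs := norm_inv_half_cube_le t
    rw [norm_div, norm_one] at hs
    rw [div_eq_mul_one_div, norm_mul, norm_mul, norm_pow, norm_cpow_eq_rpow_re_of_pos hX, hre,
      norm_div, norm_one]
    calc _ ≤ C * (1 + t ^ 2) ^ (99 / 200 : ℝ) * X ^ (1 / 2 : ℝ) *
          (8 * (1 + t ^ 2) ^ (-(3 / 2) : ℝ)) := by
          gcongr
          exact h t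
      _ = C * X ^ (1 / 2 : ℝ) * 8 *
          ((1 + t ^ 2) ^ (99 / 200 : ℝ) * (1 + t ^ 2) ^ (-(3 / 2) : ℝ)) := by ring
      _ = _ := by
        rw [← Real.rpow_add (by positivity), Real.norm_eq_abs, sq_abs]
        norm_num

/-- An explicit formula for the Riesz mean of the coefficients of `ζ(s)² L(s, χ)²`. -/
theorem sum_mul_log_sq_eq (hχ1 : χ ≠ 1) {X : ℝ} (hX : 0 < X) :
    Real.pi * ∑ n ∈ Finset.Icc 1 ⌊X⌋₊, (χ.zetaMul * χ.zetaMul) n * (Real.log (X / n) ^ 2 : ℝ) =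
      2 * Real.pi * (X * (χ.LFunction 1 ^ 2 * Real.log X +
        2 * χ.LFunction 1 * (Real.eulerMascheroniConstant * χ.LFunction 1 + deriv χ.LFunction 1) -
        3 * χ.LFunction 1 ^ 2)) +
      ∫ t : ℝ, zetaL χ (((1 / 2 : ℝ) : ℂ) + t * I) ^ 2 *
        (X : ℂ) ^ (((1 / 2 : ℝ) : ℂ) + t * I) / (((1 / 2 : ℝ) : ℂ) + t * I) ^ 3 := by
  obtain ⟨φ, hφ⟩ : ∃ φ : ℂ → ℂ, φ = fun s => zetaLReg χ s ^ 2 * (X : ℂ) ^ s / s ^ 3 := ⟨_, rfl⟩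
  have hX0 : (X : ℂ) ≠ 0 := ofReal_ne_zero.2 hX.ne'
  have hd : ∀ s : ℂ, s ≠ 0 → HasDerivAt φ
      (2 * zetaLReg χ s * deriv (zetaLReg χ) s * (X : ℂ) ^ s / s ^ 3 +
        zetaLReg χ s ^ 2 * ((X : ℂ) ^ s * log X) / s ^ 3 -
        3 * (zetaLReg χ s ^ 2 * (X : ℂ) ^ s / s ^ 4)) s := by
    intro s hs
    have h1 := ((differentiable_zetaLReg hχ1 s).hasDerivAt.pow 2).mul
      ((hasDerivAt_id s).const_cpow (c := (X : ℂ)) (Or.inl hX0))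
    have h2 := h1.div (hasDerivAt_pow 3 s) (pow_ne_zero 3 hs)
    rw [hφ]
    refine h2.congr_deriv ?_
    simp only [Pi.mul_apply, Pi.pow_apply, id]
    field_simp
    norm_num
    ring
  have hφd : DifferentiableOn ℂ φ {s | 0 < s.re} := fun s hs =>
    (hd s fun h => by simp [h] at hs).differentiableAt.differentiableWithinAt
  have hφe : ∀ s : ℂ, s ≠ 1 → φ s / (s - 1) ^ 2 = zetaL χ s ^ 2 * (X : ℂ) ^ s / s ^ 3 := by
    intro s hs
    have hs1 : s - 1 ≠ 0 := sub_ne_zero.2 hs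
    rw [hφ]
    dsimp only
    rw [zetaLReg_eq hs, mul_pow, mul_assoc, mul_div_assoc,
      mul_div_cancel_left₀ _ (pow_ne_zero 2 hs1)]
  have hne2 : ∀ t : ℝ, ((2 : ℝ) : ℂ) + t * I ≠ 1 := fun t h => by
    have := congrArg re h
    norm_num at this
  obtain ⟨c, hc0, hc⟩ := exists_norm_zetaL_le_abs_im hχ1
  have hi2 : Integrable fun t : ℝ => zetaL χ (((2 : ℝ) : ℂ) + t * I) ^ 2 *
      (X : ℂ) ^ (((2 : ℝ) : ℂ) + t * I) / (((2 : ℝ) : ℂ) + t * I) ^ 3 := by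
    have hre : ∀ t : ℝ, (((2 : ℝ) : ℂ) + t * I).re = 2 := fun t => by simp
    have hb : ∀ t : ℝ, ‖zetaL χ (((2 : ℝ) : ℂ) + t * I) ^ 2‖ ≤
        ∑' n, ‖LSeries.term (fun n => (χ.zetaMul * χ.zetaMul) n) ((2 : ℝ) : ℂ) n‖ := by
      intro t
      have hs : 1 < (((2 : ℝ) : ℂ) + t * I).re := by rw [hre]; norm_num
      rw [← LSeries_zetaMul_mul hs, LSeries]
      refine (norm_tsum_le_tsum_norm (LSeriesSummable_zetaMul_mul hs).norm).trans (le_of_eq ?_)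
      simp_rw [LSeries.norm_term_eq, hre, ofReal_re]
    obtain ⟨B, hB⟩ : ∃ B, B =
      ∑' n, ‖LSeries.term (fun n => (χ.zetaMul * χ.zetaMul) n) ((2 : ℝ) : ℂ) n‖ := ⟨_, rfl⟩
    rw [← hB] at hb
    refine ((integrable_inv_cube (σ := 2) (by norm_num)).norm.const_mul (B * X ^ 2)).mono'
      (Continuous.aestronglyMeasurable ?_) (ae_of_all _ fun t => ?_)
    · refine (Continuous.mul (Continuous.pow (continuous_iff_continuousAt.2 fun t => ?_) 2)
        (Continuous.const_cpow (by fun_prop) (Or.inl hX0))).div (by fun_prop)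
        fun t => pow_ne_zero _ (add_mul_I_ne_zero (by norm_num) t)
      exact ContinuousAt.comp (f := fun t : ℝ => ((2 : ℝ) : ℂ) + t * I)
        (differentiableAt_zetaL hχ1 (hne2 t)).continuousAt (by fun_prop)
    · rw [div_eq_mul_one_div, norm_mul, norm_mul, norm_cpow_eq_rpow_re_of_pos hX, hre,
        Real.rpow_two]
      gcongr
      exact hb t
  have hg0 : Tendsto (fun t : ℝ => c ^ 2 * (X ^ 2 + 1) * t⁻¹) atTop (𝓝 0) := by
    have := (tendsto_inv_atTop_zero (𝕜 := ℝ)).const_mul (c ^ 2 * (X ^ 2 + 1))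
    rwa [mul_zero] at this
  have h := integral_double_pole hφd
    (hi2.congr (ae_of_all _ fun t => (hφe _ (hne2 t)).symm))
    ((integrable_zetaL_sq_mul_cpow_half hχ1 hX).congr
      (ae_of_all _ fun t => (hφe _ (half_add_mul_I_ne_one t)).symm))
    hg0 ?_
  · simp_rw [hφe _ (half_add_mul_I_ne_one _), hφe _ (hne2 _)] at h
    rw [sum_mul_posLog_sq_eq_integral hX, h, (hd 1 one_ne_zero).deriv,
      (hasDerivAt_zetaLReg_one hχ1).deriv, zetaLReg_one, cpow_one, ← ofReal_log hX.le]
    ring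
  · intro σ t hσ1 hσ2 ht
    have ht0 : 0 < |t| := by linarith
    have hre : ((σ : ℂ) + t * I).re = σ := by simp
    have him : ((σ : ℂ) + t * I).im = t := by simp
    have hne : (σ : ℂ) + t * I ≠ 1 := fun h => by
      have := congrArg im h
      rw [him, one_im] at this
      simp [this] at ht0
    have hs1 : |t| ≤ ‖(σ : ℂ) + t * I‖ := (le_of_eq (by simp)).trans (abs_im_le_norm _)
    have h1 := hc ((σ : ℂ) + t * I) (by rw [hre]; exact hσ1) (by rw [him]; exact ht)
    rw [him] at h1
    rw [hφe _ hne, norm_div, norm_mul, norm_pow, norm_pow, norm_cpow_eq_rpow_re_of_pos hX, hre]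
    have h2 : X ^ σ ≤ X ^ 2 + 1 := by
      rcases le_total X 1 with hX1 | hX1
      · have := Real.rpow_le_one hX.le hX1 (by linarith : 0 ≤ σ)
        nlinarith [sq_nonneg X]
      · have := Real.rpow_le_rpow_of_exponent_le hX1 hσ2
        rw [Real.rpow_two] at this
        linarith
    calc _ ≤ (c * |t|) ^ 2 * (X ^ 2 + 1) / |t| ^ 3 := by gcongr
      _ = _ := by field_simp

end RieszShift

section Mertens

lemma sum_log_div_primorial_le {z : ℕ} (hz : 0 < z) :
    ∑ p ∈ (primorial z).primeFactors, Real.log p / p ≤ Real.log z + Real.log 4 := by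
  have hz' : (0 : ℝ) < z := by exact_mod_cast hz
  have hle : ∀ k ∈ Finset.Ioc 0 z, ∑ p ∈ (primorial z).primeFactors,
      (if p ∣ k then Real.log p else 0) ≤ Real.log z := by
    intro k hk
    obtain ⟨hk0, hkz⟩ := Finset.mem_Ioc.1 hk
    calc _ ≤ ∑ p ∈ k.primeFactors, Real.log p := by
          rw [← Finset.sum_filter]
          refine Finset.sum_le_sum_of_subset_of_nonneg (fun p hp => ?_) fun p _ _ =>
            Real.log_natCast_nonneg p
          obtain ⟨h1, h2⟩ := Finset.mem_filter.1 hp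
          exact Nat.mem_primeFactors.2 ⟨Nat.prime_of_mem_primeFactors h1, h2, hk0.ne'⟩
      _ = Real.log (∏ p ∈ k.primeFactors, p : ℕ) := by
          rw [Nat.cast_prod, Real.log_prod]
          exact fun p hp => by exact_mod_cast (Nat.prime_of_mem_primeFactors hp).ne_zero
      _ ≤ _ := by
          refine Real.log_le_log ?_ ?_
          · exact_mod_cast Finset.prod_pos fun p hp => (Nat.prime_of_mem_primeFactors hp).pos
          · exact_mod_cast (Nat.le_of_dvd hk0 (Nat.prod_primeFactors_dvd k)).trans hkz
  have h := Finset.sum_le_sum hle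
  rw [Finset.sum_comm, Finset.sum_const, Nat.card_Ioc, Nat.sub_zero, nsmul_eq_mul] at h
  have h2 : ∀ p ∈ (primorial z).primeFactors, z * (Real.log p / p) - Real.log p ≤
      ∑ k ∈ Finset.Ioc 0 z, (if p ∣ k then Real.log p else 0) := by
    intro p hp
    rw [← Finset.sum_filter, Finset.sum_const, Nat.Ioc_filter_dvd_card_eq_div, nsmul_eq_mul]
    have h3 := Nat.lt_floor_add_one ((z : ℝ) / p)
    rw [Nat.floor_div_eq_div] at h3
    have h4 := Real.log_natCast_nonneg p
    rw [mul_div_left_comm]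
    nlinarith
  have h5 := (Finset.sum_le_sum h2).trans h
  rw [Finset.sum_sub_distrib, ← Finset.mul_sum] at h5
  have h6 : ∑ p ∈ (primorial z).primeFactors, Real.log p ≤ z * Real.log 4 := by
    rw [primeFactors_primorial, ← Chebyshev.theta_eq_sum_primesLE_log, mul_comm]
    exact Chebyshev.theta_le_log4_mul_x hz'.le
  have h7 : z * ∑ p ∈ (primorial z).primeFactors, Real.log p / p ≤
      z * (Real.log z + Real.log 4) := by linarith
  exact le_of_mul_le_mul_left h7 hz'

lemma sum_divisors_primorial_rpow (z : ℕ) {σ : ℝ} (hσ : 0 < σ) :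
    ∑ a ∈ (primorial z).divisors, (a : ℝ) ^ (-σ) =
      ∏ p ∈ (primorial z).primeFactors, (1 + (p : ℝ) ^ (-σ)) := by
  obtain ⟨f, hf⟩ : ∃ f : ArithmeticFunction ℝ, ∀ n : ℕ, f n = (n : ℝ) ^ (-σ) :=
    ⟨⟨fun n => (n : ℝ) ^ (-σ), by simp [hσ.ne']⟩, fun _ => rfl⟩
  have hm : f.IsMultiplicative := by
    refine ArithmeticFunction.IsMultiplicative.iff_ne_zero.2 ⟨by simp [hf], fun _ _ _ => ?_⟩
    rw [hf, hf, hf, Nat.cast_mul, Real.mul_rpow (by positivity) (by positivity)]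
  simpa only [hf] using (hm.prodPrimeFactors_one_add_of_squarefree (squarefree_primorial z)).symm

lemma sum_rpow_neg_le {δ : ℝ} (hδ : 0 < δ) (s : Finset ℕ) (hs : ∀ n ∈ s, 0 < n) :
    ∑ a ∈ s, (a : ℝ) ^ (-(1 + δ)) ≤ 1 + 1 / δ := by
  have h1 : ∀ n : ℕ, δ * ((n + 1 + 1 : ℕ) : ℝ) ^ (-(1 + δ)) ≤
      ((n + 1 : ℕ) : ℝ) ^ (-δ) - ((n + 1 + 1 : ℕ) : ℝ) ^ (-δ) := by
    intro n
    have hn : (0 : ℝ) < (n + 1 : ℕ) := by positivity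
    have hn2 : (0 : ℝ) < (n + 1 + 1 : ℕ) := by positivity
    have h2 : Real.log (n + 1 : ℕ) ≤ Real.log (n + 1 + 1 : ℕ) - ((n + 1 + 1 : ℕ) : ℝ)⁻¹ := by
      have h3 := Real.log_le_sub_one_of_pos (div_pos hn hn2)
      rw [Real.log_div hn.ne' hn2.ne'] at h3
      have h4 : ((n + 1 : ℕ) : ℝ) / (n + 1 + 1 : ℕ) = 1 - ((n + 1 + 1 : ℕ) : ℝ)⁻¹ := by
        rw [eq_sub_iff_add_eq, ← one_div, ← add_div, div_eq_one_iff_eq hn2.ne']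
        push_cast
        ring
      linarith
    have h5 : ((n + 1 + 1 : ℕ) : ℝ) ^ (-δ) * (1 + δ * ((n + 1 + 1 : ℕ) : ℝ)⁻¹) ≤
        ((n + 1 : ℕ) : ℝ) ^ (-δ) := by
      rw [Real.rpow_def_of_pos hn, Real.rpow_def_of_pos hn2]
      calc _ ≤ Real.exp (Real.log (n + 1 + 1 : ℕ) * -δ) *
            Real.exp (δ * ((n + 1 + 1 : ℕ) : ℝ)⁻¹) := by
            gcongr
            linarith [Real.add_one_le_exp (δ * ((n + 1 + 1 : ℕ) : ℝ)⁻¹)]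
        _ ≤ _ := by
            rw [← Real.exp_add]
            refine Real.exp_le_exp.2 ?_
            nlinarith
    have h6 : ((n + 1 + 1 : ℕ) : ℝ) ^ (-(1 + δ)) =
        ((n + 1 + 1 : ℕ) : ℝ)⁻¹ * ((n + 1 + 1 : ℕ) : ℝ) ^ (-δ) := by
      rw [neg_add, Real.rpow_add hn2, Real.rpow_neg_one]
    rw [h6]
    linarith
  have h2 : ∀ N : ℕ, ∑ n ∈ Finset.range (N + 1), ((n + 1 : ℕ) : ℝ) ^ (-(1 + δ)) ≤
      1 + (1 - ((N + 1 : ℕ) : ℝ) ^ (-δ)) / δ := by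
    intro N
    induction N with
    | zero => simp
    | succ N ih =>
      rw [Finset.sum_range_succ]
      have h3 : ((N + 1 + 1 : ℕ) : ℝ) ^ (-(1 + δ)) ≤
          (((N + 1 : ℕ) : ℝ) ^ (-δ) - ((N + 1 + 1 : ℕ) : ℝ) ^ (-δ)) / δ := by
        rw [le_div_iff₀ hδ, mul_comm]
        exact h1 N
      rw [sub_div] at h3 ih ⊢
      linarith
  calc _ ≤ ∑ a ∈ Finset.Ico 1 (s.sup id + 1 + 1), (a : ℝ) ^ (-(1 + δ)) := by
        refine Finset.sum_le_sum_of_subset_of_nonneg (fun n hn => ?_) fun _ _ _ => by positivity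
        have : n ≤ s.sup id := Finset.le_sup (f := id) hn
        exact Finset.mem_Ico.2 ⟨hs n hn, by lia⟩
    _ = ∑ n ∈ Finset.range (s.sup id + 1), ((n + 1 : ℕ) : ℝ) ^ (-(1 + δ)) := by
        rw [Finset.sum_Ico_eq_sum_range]
        exact Finset.sum_congr (by simp) fun n _ => by rw [add_comm 1 n]
    _ ≤ _ := (h2 _).trans (by
        gcongr
        linarith [Real.rpow_nonneg (Nat.cast_nonneg (α := ℝ) (s.sup id + 1)) (-δ)])

lemma sum_divisors_primorial_le {z : ℕ} (hz : 3 ≤ z) :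
    ∑ a ∈ (primorial z).divisors, (1 / a : ℝ) ≤ 22 * Real.log z := by
  have hz' : (3 : ℝ) ≤ z := by exact_mod_cast hz
  have hl : 1 ≤ Real.log z := by
    rw [Real.le_log_iff_exp_le (by linarith)]
    linarith [Real.exp_one_lt_d9]
  obtain ⟨δ, hδ⟩ : ∃ δ, δ = 1 / Real.log z := ⟨_, rfl⟩
  have hδ0 : 0 < δ := by rw [hδ]; positivity
  have hδl : δ * Real.log z = 1 := by rw [hδ]; field_simp
  have h1 : ∑ a ∈ (primorial z).divisors, (1 / a : ℝ) =
      ∏ p ∈ (primorial z).primeFactors, (1 + (p : ℝ) ^ (-(1 : ℝ))) := by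
    rw [← sum_divisors_primorial_rpow z one_pos]
    exact Finset.sum_congr rfl fun a _ => by rw [Real.rpow_neg_one, one_div]
  have h2 : ∀ p ∈ (primorial z).primeFactors, 1 + (p : ℝ) ^ (-(1 : ℝ)) ≤
      (1 + (p : ℝ) ^ (-(1 + δ))) * Real.exp (δ * (Real.log p / p)) := by
    intro p hp
    have hp0 : (0 : ℝ) < p := by exact_mod_cast (Nat.prime_of_mem_primeFactors hp).pos
    have h3 : 1 - δ * Real.log p ≤ (p : ℝ) ^ (-δ) := by
      rw [Real.rpow_def_of_pos hp0]
      linarith [Real.add_one_le_exp (Real.log p * -δ)]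
    have h4 : (p : ℝ) ^ (-(1 + δ)) = (p : ℝ)⁻¹ * (p : ℝ) ^ (-δ) := by
      rw [neg_add, Real.rpow_add hp0, Real.rpow_neg_one]
    have h5 : (p : ℝ)⁻¹ * (1 - δ * Real.log p) ≤ (p : ℝ)⁻¹ * (p : ℝ) ^ (-δ) := by gcongr
    have h6 : 0 ≤ δ * (Real.log p / p) := by
      have := Real.log_natCast_nonneg p
      positivity
    rw [h4, Real.rpow_neg_one]
    calc 1 + (p : ℝ)⁻¹ ≤ (1 + (p : ℝ)⁻¹ * (p : ℝ) ^ (-δ)) + δ * (Real.log p / p) := by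
          have : (p : ℝ)⁻¹ * (1 - δ * Real.log p) = (p : ℝ)⁻¹ - δ * (Real.log p / p) := by
            field_simp
          linarith
      _ ≤ (1 + (p : ℝ)⁻¹ * (p : ℝ) ^ (-δ)) * (1 + δ * (Real.log p / p)) := by
          have : 0 ≤ (p : ℝ)⁻¹ * (p : ℝ) ^ (-δ) := by positivity
          nlinarith
      _ ≤ _ := by
          gcongr
          linarith [Real.add_one_le_exp (δ * (Real.log p / p))]
  rw [h1]
  calc _ ≤ ∏ p ∈ (primorial z).primeFactors,
        (1 + (p : ℝ) ^ (-(1 + δ))) * Real.exp (δ * (Real.log p / p)) :=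
        Finset.prod_le_prod (fun p _ => by positivity) h2
    _ = (∑ a ∈ (primorial z).divisors, (a : ℝ) ^ (-(1 + δ))) *
        Real.exp (δ * ∑ p ∈ (primorial z).primeFactors, Real.log p / p) := by
        rw [Finset.prod_mul_distrib, sum_divisors_primorial_rpow z (by linarith),
          ← Real.exp_sum, Finset.mul_sum]
    _ ≤ (1 + 1 / δ) * Real.exp (1 + Real.log 4) := by
        have h7 := sum_rpow_neg_le hδ0 (primorial z).divisors fun n hn =>
          Nat.pos_of_mem_divisors hn
        have h8 := sum_log_div_primorial_le (z := z) (by lia)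
        have h9 : δ * ∑ p ∈ (primorial z).primeFactors, Real.log p / p ≤ 1 + Real.log 4 := by
          have h10 : δ ≤ 1 := by nlinarith
          have h11 : 0 < Real.log 4 := Real.log_pos (by norm_num)
          nlinarith
        have h12 := Real.exp_le_exp.2 h9
        gcongr
    _ ≤ _ := by
        rw [Real.exp_add, Real.exp_log (by norm_num), hδ, one_div_one_div]
        nlinarith [Real.exp_one_lt_d9]

end Mertens

section RieszSum

/-- The logarithmic Riesz sum of order two of an arithmetic function. -/
noncomputable def rieszSum (f : ℕ → ℂ) (X : ℝ) : ℂ :=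
  ∑ n ∈ Finset.Icc 1 ⌊X⌋₊, f n * (Real.log (X / n) ^ 2 : ℝ)

lemma rieszSum_of_lt_one (f : ℕ → ℂ) {X : ℝ} (hX : X < 1) : rieszSum f X = 0 := by
  rw [rieszSum, Nat.floor_eq_zero.2 hX]
  simp

lemma rieszSum_eq_sum_posLog (f : ℕ → ℂ) {X : ℝ} (hX : 0 < X) {N : ℕ} (hN : ⌊X⌋₊ ≤ N) :
    rieszSum f X = ∑ n ∈ Finset.Ioc 0 N, f n * (Real.posLog (X / n) ^ 2 : ℝ) := by
  refine (Finset.sum_congr rfl fun n hn => ?_).trans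
    (Finset.sum_subset (s₁ := Finset.Icc 1 ⌊X⌋₊) (fun n hn => ?_) fun n hn hn2 => ?_)
  · obtain ⟨hn1, hn2⟩ := Finset.mem_Icc.1 hn
    have hn0 : (0 : ℝ) < n := by exact_mod_cast hn1
    have h1 : 1 ≤ X / n := (one_le_div hn0).2 ((Nat.le_floor_iff hX.le).1 hn2)
    rw [Real.posLog, max_eq_right (Real.log_nonneg h1)]
  · obtain ⟨hn1, hn2⟩ := Finset.mem_Icc.1 hn
    exact Finset.mem_Ioc.2 ⟨hn1, hn2.trans hN⟩
  · have hn1 := (Finset.mem_Ioc.1 hn).1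
    have hn0 : (0 : ℝ) < n := by exact_mod_cast hn1
    have h1 : X / n ≤ 1 := (div_le_one hn0).2 (le_of_lt <| (Nat.floor_lt hX.le).1 <| by
      by_contra! h
      exact hn2 (Finset.mem_Icc.2 ⟨hn1, h⟩))
    rw [Real.posLog, max_eq_left (Real.log_nonpos (by positivity) h1)]
    simp

lemma rieszSum_mul (f g : ArithmeticFunction ℂ) {X : ℝ} (hX : 0 < X) {N : ℕ} (hN : ⌊X⌋₊ ≤ N) :
    rieszSum (fun n => (f * g) n) X =
      ∑ d ∈ Finset.Ioc 0 N, g d * rieszSum (fun n => f n) (X / d) := by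
  have h1 : ∀ d ∈ Finset.Ioc 0 N, rieszSum (fun n => f n) (X / d) =
      ∑ n ∈ Finset.Ioc 0 N, f n * (Real.posLog (X / d / n) ^ 2 : ℝ) := by
    intro d hd
    have hd0 : 0 < d := (Finset.mem_Ioc.1 hd).1
    have hd1 : (1 : ℝ) ≤ d := by exact_mod_cast hd0
    exact rieszSum_eq_sum_posLog _ (by positivity)
      ((Nat.floor_mono (div_le_self hX.le hd1)).trans hN)
  rw [rieszSum_eq_sum_posLog _ hX hN]
  calc _ = ∑ n ∈ Finset.Ioc 0 N, ∑ x ∈ Finset.Ioc 0 N ×ˢ Finset.Ioc 0 N,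
        if x.1 * x.2 = n then f x.1 * g x.2 * (Real.posLog (X / n) ^ 2 : ℝ) else 0 := by
        refine Finset.sum_congr rfl fun n hn => ?_
        obtain ⟨hn0, hnN⟩ := Finset.mem_Ioc.1 hn
        rw [ArithmeticFunction.mul_apply, Nat.divisorsAntidiagonal_eq_prod_filter_of_le hn0.ne' hnN,
          Finset.sum_mul, Finset.sum_filter]
    _ = ∑ x ∈ Finset.Ioc 0 N ×ˢ Finset.Ioc 0 N,
        f x.1 * g x.2 * (Real.posLog (X / (x.1 * x.2 : ℕ)) ^ 2 : ℝ) := by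
        rw [Finset.sum_comm]
        refine Finset.sum_congr rfl fun x hx => ?_
        rw [Finset.mem_product, Finset.mem_Ioc, Finset.mem_Ioc] at hx
        rw [Finset.sum_ite_eq]
        split_ifs with h
        · rfl
        · have h2 : N < x.1 * x.2 := by
            by_contra! h3
            exact h (Finset.mem_Ioc.2 ⟨Nat.mul_pos hx.1.1 hx.2.1, h3⟩)
          have h3 : X < (x.1 * x.2 : ℕ) := (Nat.floor_lt hX.le).1 (hN.trans_lt h2)
          have h4 : X / (x.1 * x.2 : ℕ) ≤ 1 := (div_le_one (hX.trans h3)).2 h3.le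
          rw [Real.posLog, max_eq_left (Real.log_nonpos (by positivity) h4)]
          simp
    _ = _ := by
        rw [Finset.sum_product_right]
        refine Finset.sum_congr rfl fun d hd => ?_
        rw [h1 d hd, Finset.mul_sum]
        refine Finset.sum_congr rfl fun n _ => ?_
        rw [div_div, Nat.cast_mul, mul_comm (n : ℝ)]
        ring

/-- The Möbius function restricted to integers coprime to `q`. -/
noncomputable def moebiusCoprime (q m : ℕ) : ℂ :=
  if m.Coprime q then (ArithmeticFunction.moebius m : ℂ) else 0

lemma norm_moebiusCoprime_le (q m : ℕ) : ‖moebiusCoprime q m‖ ≤ 1 := by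
  rw [moebiusCoprime]
  split_ifs
  · rw [norm_intCast]
    exact_mod_cast ArithmeticFunction.abs_moebius_le_one
  · simp

lemma moebiusCoprime_eq_zero {q m : ℕ} (hm : ¬ Squarefree m) : moebiusCoprime q m = 0 := by
  rw [moebiusCoprime, ArithmeticFunction.moebius_eq_zero_of_not_squarefree hm]
  simp

lemma moebiusCoprime_mul {q a b : ℕ} (hab : a.Coprime b) :
    moebiusCoprime q (a * b) = moebiusCoprime q a * moebiusCoprime q b := by
  simp only [moebiusCoprime, Nat.coprime_mul_iff_left,
    ArithmeticFunction.isMultiplicative_moebius.map_mul_of_coprime hab]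
  rw [ite_and]
  split_ifs <;> simp

lemma sum_moebiusSq_mul {q N M : ℕ} (hN : M ^ 2 ≤ N) (F : ℕ → ℂ) (hF : ∀ d, M ^ 2 < d → F d = 0) :
    ∑ d ∈ Finset.Ioc 0 N, moebiusSq q d * F d =
      ∑ m ∈ Finset.Ioc 0 M, moebiusCoprime q m * F (m ^ 2) := by
  symm
  refine Finset.sum_of_injOn (fun m => m ^ 2) (fun a _ b _ h => ?_) (fun m hm => ?_)
    (fun d hd hd2 => ?_) fun m hm => ?_
  · exact Nat.pow_left_injective two_ne_zero h
  · obtain ⟨h1, h2⟩ := Finset.mem_Ioc.1 (Finset.mem_coe.1 hm)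
    exact Finset.mem_coe.2 (Finset.mem_Ioc.2 ⟨by positivity, (Nat.pow_le_pow_left h2 2).trans hN⟩)
  · by_cases hdM : M ^ 2 < d
    · rw [hF d hdM, mul_zero]
    rw [moebiusSq_apply, if_neg, zero_mul]
    rintro ⟨h1, -⟩
    refine hd2 ⟨d.sqrt, Finset.mem_coe.2 (Finset.mem_Ioc.2 ⟨?_, ?_⟩), h1⟩
    · exact Nat.sqrt_pos.2 (Finset.mem_Ioc.1 hd).1
    · exact (Nat.pow_le_pow_iff_left two_ne_zero).1 (by rw [h1]; lia)
  · rw [moebiusSq_apply, moebiusCoprime, Nat.sqrt_eq']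
    simp [Nat.coprime_pow_left_iff]

lemma sum_moebiusDvd_mul {q N : ℕ} (hq : 0 < q) (hN : q ≤ N) (F : ℕ → ℂ) :
    ∑ d ∈ Finset.Ioc 0 N, moebiusDvd q d * F d =
      ∑ e ∈ q.divisors, (ArithmeticFunction.moebius e : ℂ) * F e := by
  symm
  refine (Finset.sum_congr rfl fun e he => ?_).trans (Finset.sum_subset (fun e he => ?_)
    fun e he he2 => ?_)
  · rw [moebiusDvd_apply, if_pos (Nat.dvd_of_mem_divisors he)]
  · exact Finset.mem_Ioc.2 ⟨Nat.pos_of_mem_divisors he, (Nat.divisor_le he).trans hN⟩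
  · rw [moebiusDvd_apply, if_neg fun h => he2 (Nat.mem_divisors.2 ⟨h, hq.ne'⟩), zero_mul]

variable {q : ℕ} [NeZero q] {χ : DirichletCharacter ℂ q}

lemma rieszSum_zetaMul_sq (hχ : χ ^ 2 = 1) {X : ℝ} (hX : 0 < X) {M : ℕ} (hM : X < M ^ 2)
    {s : Finset ℕ} (hs0 : 0 ∉ s) (hs : ∀ m, Squarefree m → m ≤ M → m ∈ s) :
    rieszSum (fun n => χ.zetaMul n ^ 2) X = ∑ e ∈ q.divisors, (ArithmeticFunction.moebius e : ℂ) *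
      ∑ m ∈ s, moebiusCoprime q m *
        rieszSum (fun n => (χ.zetaMul * χ.zetaMul) n) (X / (e * m ^ 2)) := by
  have hM0 : 0 < M ^ 2 := by
    have : (0 : ℝ) < M ^ 2 := hX.trans hM
    exact_mod_cast this
  have hM1 : (1 : ℝ) ≤ (M : ℝ) ^ 2 := by exact_mod_cast hM0
  have hf : ⌊X⌋₊ ≤ M ^ 2 := Nat.floor_le_of_le (by push_cast; exact hM.le)
  have hlt : ∀ d : ℕ, M ^ 2 ≤ d → X / d < 1 := by
    intro d hd
    have hd' : (M : ℝ) ^ 2 ≤ d := by exact_mod_cast hd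
    exact (div_lt_one (by linarith)).2 (by linarith)
  simp_rw [zetaMul_sq_eq hχ]
  rw [mul_comm (moebiusDvd q), ← mul_assoc,
    rieszSum_mul _ (moebiusDvd q) hX (hf.trans (Nat.le_add_left _ q)),
    sum_moebiusDvd_mul (Nat.pos_of_neZero q) (Nat.le_add_right q _)]
  refine Finset.sum_congr rfl fun e he => ?_
  have he0 : 0 < e := Nat.pos_of_mem_divisors he
  have he1 : (1 : ℝ) ≤ e := by exact_mod_cast he0
  have hXe : X / e ≤ X := div_le_self hX.le he1
  rw [rieszSum_mul _ (moebiusSq q) (by positivity : 0 < X / e) ((Nat.floor_mono hXe).trans hf),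
    sum_moebiusSq_mul le_rfl (fun d => rieszSum (fun n => (χ.zetaMul * χ.zetaMul) n) (X / e / d))]
  · congr 1
    simp_rw [Nat.cast_pow, div_div]
    have h0 : ∀ m : ℕ, M ≤ m → rieszSum (fun n => (χ.zetaMul * χ.zetaMul) n)
        (X / (e * (m : ℝ) ^ 2)) = 0 := by
      intro m hm
      refine rieszSum_of_lt_one _ ?_
      have hm' : (M : ℝ) ^ 2 ≤ (m : ℝ) ^ 2 := by gcongr
      rw [div_lt_one (by nlinarith)]
      nlinarith
    have hu : ∀ t : Finset ℕ, 0 ∉ t → (∀ m, Squarefree m → m ≤ M → m ∈ t) →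
        ∑ m ∈ t, moebiusCoprime q m * rieszSum (fun n => (χ.zetaMul * χ.zetaMul) n)
          (X / (e * (m : ℝ) ^ 2)) = ∑ m ∈ (Finset.Ioc 0 M).filter Squarefree,
        moebiusCoprime q m * rieszSum (fun n => (χ.zetaMul * χ.zetaMul) n)
          (X / (e * (m : ℝ) ^ 2)) := by
      intro t ht0 ht
      symm
      refine Finset.sum_subset (fun m hm => ?_) fun m hm hm2 => ?_
      · rw [Finset.mem_filter, Finset.mem_Ioc] at hm
        exact ht m hm.2 hm.1.2
      · by_cases hsq : Squarefree m
        · rw [h0 m, mul_zero]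
          by_contra! h
          exact hm2 (Finset.mem_filter.2 ⟨Finset.mem_Ioc.2
            ⟨Nat.pos_of_ne_zero fun h => ht0 (h ▸ hm), h.le⟩, hsq⟩)
        · rw [moebiusCoprime_eq_zero hsq, zero_mul]
    rw [hu s hs0 hs, hu (Finset.Ioc 0 M) (by simp) fun m hm hmM =>
      Finset.mem_Ioc.2 ⟨Nat.pos_of_ne_zero hm.ne_zero, hmM⟩]
  · intro d hd
    refine rieszSum_of_lt_one _ (lt_of_le_of_lt ?_ (hlt d hd.le))
    gcongr

end RieszSum

section SmoothRough

/-- The products of a squarefree `z`-smooth integer and a `z`-rough integer at most `M`. -/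
def smoothMulRough (z M : ℕ) : Finset ℕ :=
  ((primorial z).divisors ×ˢ (Finset.Ioc 0 M).filter fun b => b.Coprime (primorial z)).image
    fun x => x.1 * x.2

lemma zero_notMem_smoothMulRough (z M : ℕ) : 0 ∉ smoothMulRough z M := by
  intro h
  simp only [smoothMulRough, Finset.mem_image, Finset.mem_product, Finset.mem_filter,
    Finset.mem_Ioc, Nat.mem_divisors] at h
  obtain ⟨x, ⟨⟨h1, h2⟩, h3, h4⟩, h5⟩ := h
  rcases Nat.mul_eq_zero.1 h5 with h6 | h6
  · exact h2 (zero_dvd_iff.1 (h6 ▸ h1))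
  · lia

lemma mem_smoothMulRough {z M m : ℕ} (hm : Squarefree m) (hmM : m ≤ M) :
    m ∈ smoothMulRough z M := by
  have h0 := hm.ne_zero
  obtain ⟨b, hb⟩ := Nat.gcd_dvd_left m (primorial z)
  simp only [smoothMulRough, Finset.mem_image, Finset.mem_product, Finset.mem_filter,
    Finset.mem_Ioc, Nat.mem_divisors]
  refine ⟨(m.gcd (primorial z), b), ⟨⟨Nat.gcd_dvd_right _ _, primorial_ne_zero z⟩,
    ⟨Nat.pos_of_ne_zero fun h => h0 (by rw [hb, show b = 0 from h, mul_zero]), ?_⟩, ?_⟩, hb.symm⟩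
  · exact (Nat.le_of_dvd (Nat.pos_of_ne_zero h0) ⟨_, hb.trans (mul_comm _ _)⟩).trans hmM
  · refine Nat.coprime_of_dvd fun p hp hpb hpP => ?_
    have h1 : p ∣ m := hpb.trans ⟨_, hb.trans (mul_comm _ _)⟩
    have h2 : p * p ∣ m := by
      rw [hb]
      exact mul_dvd_mul (Nat.dvd_gcd h1 hpP) hpb
    exact hp.one_lt.ne' (Nat.isUnit_iff.1 (hm p h2))

lemma sum_smoothMulRough (q z M : ℕ) (F : ℕ → ℂ) :
    ∑ m ∈ smoothMulRough z M, moebiusCoprime q m * F m =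
      ∑ a ∈ (primorial z).divisors, ∑ b ∈ (Finset.Ioc 0 M).filter fun b => b.Coprime (primorial z),
        moebiusCoprime q a * moebiusCoprime q b * F (a * b) := by
  have hcop : ∀ x ∈ (primorial z).divisors ×ˢ (Finset.Ioc 0 M).filter
      fun b => b.Coprime (primorial z), x.1 ∣ primorial z ∧ x.2.Coprime (primorial z) := by
    intro x hx
    rw [Finset.mem_product, Finset.mem_filter, Nat.mem_divisors] at hx
    exact ⟨hx.1.1, hx.2.2⟩
  rw [smoothMulRough, Finset.sum_image, Finset.sum_product]
  · refine Finset.sum_congr rfl fun a ha => Finset.sum_congr rfl fun b hb => ?_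
    obtain ⟨h1, h2⟩ := hcop (a, b) (Finset.mem_product.2 ⟨ha, hb⟩)
    rw [moebiusCoprime_mul (h2.symm.coprime_dvd_left h1)]
  · have hgcd : ∀ x ∈ (primorial z).divisors ×ˢ (Finset.Ioc 0 M).filter
        fun b => b.Coprime (primorial z), (x.1 * x.2).gcd (primorial z) = x.1 := by
      intro x hx
      obtain ⟨h1, h2⟩ := hcop x hx
      rw [Nat.Coprime.gcd_mul_right_cancel _ h2, Nat.gcd_eq_left h1]
    intro x hx y hy hxy
    have h1 : x.1 = y.1 := by
      rw [← hgcd x hx, ← hgcd y hy]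
      exact congrArg (fun n : ℕ => n.gcd (primorial z)) hxy
    have h2 : 0 < x.1 := Nat.pos_of_dvd_of_pos (hcop x hx).1 (primorial_pos z)
    refine Prod.ext h1 (Nat.eq_of_mul_eq_mul_left h2 ?_)
    calc x.1 * x.2 = y.1 * y.2 := hxy
      _ = _ := by rw [h1]

end SmoothRough

section SecondDiff

/-- The multiplicative second difference of a function with step `h`. -/
noncomputable def secondDiff (f : ℝ → ℂ) (h y : ℝ) : ℂ :=
  f (y * Real.exp (2 * h)) - 2 * f (y * Real.exp h) + f y

variable {q : ℕ} [NeZero q] {χ : DirichletCharacter ℂ q}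

/-- The contribution of the pole of `zetaL χ s ^ 2` at `1` to half of the logarithmic Riesz sum
of its coefficients. -/
noncomputable def rieszMain (χ : DirichletCharacter ℂ q) (X : ℝ) : ℂ :=
  X * (χ.LFunction 1 ^ 2 * Real.log X +
    2 * χ.LFunction 1 * (Real.eulerMascheroniConstant * χ.LFunction 1 + deriv χ.LFunction 1) -
      3 * χ.LFunction 1 ^ 2)

lemma pi_mul_rieszSum_eq (hχ1 : χ ≠ 1) {X : ℝ} (hX : 0 < X) :
    Real.pi * rieszSum (fun n => (χ.zetaMul * χ.zetaMul) n) X =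
      2 * Real.pi * rieszMain χ X + ∫ t : ℝ, zetaL χ (((1 / 2 : ℝ) : ℂ) + t * I) ^ 2 *
        (X : ℂ) ^ (((1 / 2 : ℝ) : ℂ) + t * I) / (((1 / 2 : ℝ) : ℂ) + t * I) ^ 3 := by
  rw [rieszSum, sum_mul_log_sq_eq hχ1 hX, rieszMain]

lemma cpow_mul_exp {X : ℝ} (hX : 0 < X) (h : ℝ) (s : ℂ) :
    ((X * Real.exp h : ℝ) : ℂ) ^ s = (X : ℂ) ^ s * cexp (h * s) := by
  rw [ofReal_mul, mul_cpow_ofReal_nonneg hX.le (Real.exp_nonneg h),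
    cpow_def_of_ne_zero (x := (Real.exp h : ℝ)) (by exact_mod_cast (Real.exp_pos h).ne'),
    ← ofReal_log (Real.exp_nonneg h), Real.log_exp]

lemma integrable_secondDiff (hχ1 : χ ≠ 1) {X : ℝ} (hX : 0 < X) (h : ℝ) :
    (Integrable fun t : ℝ => zetaL χ (((1 / 2 : ℝ) : ℂ) + t * I) ^ 2 *
      ((X : ℂ) ^ (((1 / 2 : ℝ) : ℂ) + t * I) *
        ((cexp (h * (((1 / 2 : ℝ) : ℂ) + t * I)) - 1) ^ 2 / (((1 / 2 : ℝ) : ℂ) + t * I) ^ 3))) ∧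
    Real.pi * secondDiff (rieszSum fun n => (χ.zetaMul * χ.zetaMul) n) h X =
      2 * Real.pi * secondDiff (rieszMain χ) h X +
        ∫ t : ℝ, zetaL χ (((1 / 2 : ℝ) : ℂ) + t * I) ^ 2 *
          ((X : ℂ) ^ (((1 / 2 : ℝ) : ℂ) + t * I) *
            ((cexp (h * (((1 / 2 : ℝ) : ℂ) + t * I)) - 1) ^ 2 /
              (((1 / 2 : ℝ) : ℂ) + t * I) ^ 3)) := by
  have hX1 : 0 < X * Real.exp h := by positivity
  have hX2 : 0 < X * Real.exp (2 * h) := by positivity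
  have hi0 := integrable_zetaL_sq_mul_cpow_half hχ1 hX
  have hi1 := integrable_zetaL_sq_mul_cpow_half hχ1 hX1
  have hi2 := integrable_zetaL_sq_mul_cpow_half hχ1 hX2
  have he : ∀ t : ℝ, zetaL χ (((1 / 2 : ℝ) : ℂ) + t * I) ^ 2 *
      ((X : ℂ) ^ (((1 / 2 : ℝ) : ℂ) + t * I) *
        ((cexp (h * (((1 / 2 : ℝ) : ℂ) + t * I)) - 1) ^ 2 / (((1 / 2 : ℝ) : ℂ) + t * I) ^ 3)) =
      (zetaL χ (((1 / 2 : ℝ) : ℂ) + t * I) ^ 2 * ((X * Real.exp (2 * h) : ℝ) : ℂ) ^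
        (((1 / 2 : ℝ) : ℂ) + t * I) / (((1 / 2 : ℝ) : ℂ) + t * I) ^ 3 -
      2 * (zetaL χ (((1 / 2 : ℝ) : ℂ) + t * I) ^ 2 * ((X * Real.exp h : ℝ) : ℂ) ^
        (((1 / 2 : ℝ) : ℂ) + t * I) / (((1 / 2 : ℝ) : ℂ) + t * I) ^ 3)) +
      zetaL χ (((1 / 2 : ℝ) : ℂ) + t * I) ^ 2 * (X : ℂ) ^
        (((1 / 2 : ℝ) : ℂ) + t * I) / (((1 / 2 : ℝ) : ℂ) + t * I) ^ 3 := by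
    intro t
    rw [cpow_mul_exp hX, cpow_mul_exp hX]
    have : cexp ((2 * h : ℝ) * (((1 / 2 : ℝ) : ℂ) + t * I)) =
        cexp (h * (((1 / 2 : ℝ) : ℂ) + t * I)) ^ 2 := by
      rw [← Complex.exp_nat_mul]
      push_cast
      ring_nf
    rw [this]
    ring
  have h21 : Integrable fun t : ℝ => zetaL χ (((1 / 2 : ℝ) : ℂ) + t * I) ^ 2 *
      ((X * Real.exp (2 * h) : ℝ) : ℂ) ^ (((1 / 2 : ℝ) : ℂ) + t * I) /
        (((1 / 2 : ℝ) : ℂ) + t * I) ^ 3 -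
      2 * (zetaL χ (((1 / 2 : ℝ) : ℂ) + t * I) ^ 2 * ((X * Real.exp h : ℝ) : ℂ) ^
        (((1 / 2 : ℝ) : ℂ) + t * I) / (((1 / 2 : ℝ) : ℂ) + t * I) ^ 3) :=
    hi2.sub (hi1.const_mul 2)
  refine ⟨(h21.add hi0).congr (ae_of_all _ fun t => (he t).symm), ?_⟩
  simp_rw [he]
  rw [integral_add h21 hi0, integral_sub hi2 (hi1.const_mul 2), integral_const_mul, secondDiff,
    secondDiff]
  linear_combination pi_mul_rieszSum_eq hχ1 hX2 - 2 * pi_mul_rieszSum_eq hχ1 hX1 +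
    pi_mul_rieszSum_eq hχ1 hX

lemma norm_secondDiff_sub_le (hχ : χ ^ 2 = 1) (hχ1 : χ ≠ 1) {y h : ℝ} (hy : 0 < y) (hh : 0 < h)
    {M : ℕ} (hM : y * Real.exp (2 * h) < M ^ 2) {s : Finset ℕ} (hs0 : 0 ∉ s)
    (hs : ∀ m, Squarefree m → m ≤ M → m ∈ s) :
    ‖Real.pi * secondDiff (rieszSum fun n => χ.zetaMul n ^ 2) h y -
      2 * Real.pi * ∑ e ∈ q.divisors, (ArithmeticFunction.moebius e : ℂ) *
        ∑ m ∈ s, moebiusCoprime q m * secondDiff (rieszMain χ) h (y / (e * m ^ 2))‖ ≤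
    y ^ (1 / 2 : ℝ) * ∫ t : ℝ, ‖zetaL χ (((1 / 2 : ℝ) : ℂ) + t * I)‖ ^ 2 *
      ‖∑ e ∈ q.divisors, (ArithmeticFunction.moebius e : ℂ) * ∑ m ∈ s, moebiusCoprime q m *
        ((e * m ^ 2 : ℕ) : ℂ) ^ (-(((1 / 2 : ℝ) : ℂ) + t * I))‖ *
      ‖(cexp (h * (((1 / 2 : ℝ) : ℂ) + t * I)) - 1) ^ 2 / (((1 / 2 : ℝ) : ℂ) + t * I) ^ 3‖ := by
  obtain ⟨J, hJ⟩ : ∃ J : ℝ → ℝ → ℂ, J = fun X t : ℝ => zetaL χ (((1 / 2 : ℝ) : ℂ) + t * I) ^ 2 *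
      ((X : ℂ) ^ (((1 / 2 : ℝ) : ℂ) + t * I) *
        ((cexp (h * (((1 / 2 : ℝ) : ℂ) + t * I)) - 1) ^ 2 /
          (((1 / 2 : ℝ) : ℂ) + t * I) ^ 3)) := ⟨_, rfl⟩
  have hJi : ∀ X : ℝ, 0 < X → Integrable (J X) := fun X hX => by
    rw [hJ]
    exact (integrable_secondDiff hχ1 hX h).1
  have hJe : ∀ X : ℝ, 0 < X →
      Real.pi * secondDiff (rieszSum fun n => (χ.zetaMul * χ.zetaMul) n) h X =
      2 * Real.pi * secondDiff (rieszMain χ) h X + ∫ t, J X t := fun X hX => by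
    rw [hJ]
    exact (integrable_secondDiff hχ1 hX h).2
  have hpos : ∀ e ∈ q.divisors, ∀ m ∈ s, 0 < e * m ^ 2 := fun e he m hm =>
    Nat.mul_pos (Nat.pos_of_mem_divisors he)
      (pow_pos (Nat.pos_of_ne_zero fun h => hs0 (h ▸ hm)) 2)
  have hypos : ∀ e ∈ q.divisors, ∀ m ∈ s, 0 < y / (e * m ^ 2 : ℝ) := fun e he m hm => by
    have : (0 : ℝ) < (e * m ^ 2 : ℕ) := by exact_mod_cast hpos e he m hm
    push_cast at this
    positivity
  have h1 : secondDiff (rieszSum fun n => χ.zetaMul n ^ 2) h y =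
      ∑ e ∈ q.divisors, (ArithmeticFunction.moebius e : ℂ) * ∑ m ∈ s, moebiusCoprime q m *
        secondDiff (rieszSum fun n => (χ.zetaMul * χ.zetaMul) n) h (y / (e * m ^ 2)) := by
    have hle : ∀ u : ℝ, u ≤ 2 * h → y * Real.exp u < M ^ 2 := fun u hu =>
      lt_of_le_of_lt (by gcongr) hM
    have h0 := hle 0 (by linarith)
    rw [Real.exp_zero, mul_one] at h0
    simp_rw [secondDiff]
    rw [rieszSum_zetaMul_sq hχ (by positivity) hM hs0 hs,
      rieszSum_zetaMul_sq hχ (by positivity) (hle h (by linarith)) hs0 hs,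
      rieszSum_zetaMul_sq hχ hy h0 hs0 hs, Finset.mul_sum, ← Finset.sum_sub_distrib,
      ← Finset.sum_add_distrib]
    refine Finset.sum_congr rfl fun e _ => ?_
    rw [mul_left_comm, ← mul_sub, ← mul_add, Finset.mul_sum, ← Finset.sum_sub_distrib,
      ← Finset.sum_add_distrib]
    congr 1
    refine Finset.sum_congr rfl fun m _ => ?_
    rw [div_mul_eq_mul_div, div_mul_eq_mul_div]
    ring
  have h2 : Real.pi * secondDiff (rieszSum fun n => χ.zetaMul n ^ 2) h y -
      2 * Real.pi * ∑ e ∈ q.divisors, (ArithmeticFunction.moebius e : ℂ) *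
        ∑ m ∈ s, moebiusCoprime q m * secondDiff (rieszMain χ) h (y / (e * m ^ 2)) =
      ∫ t, ∑ e ∈ q.divisors, (ArithmeticFunction.moebius e : ℂ) *
        ∑ m ∈ s, moebiusCoprime q m * J (y / (e * m ^ 2)) t := by
    rw [integral_finsetSum _ fun e he => (integrable_finsetSum _ fun m hm =>
      (hJi _ (hypos e he m hm)).const_mul _).const_mul _, h1, Finset.mul_sum, Finset.mul_sum,
      ← Finset.sum_sub_distrib]
    refine Finset.sum_congr rfl fun e he => ?_
    rw [integral_const_mul, integral_finsetSum _ fun m hm =>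
      (hJi _ (hypos e he m hm)).const_mul _, mul_left_comm, mul_left_comm (2 * (Real.pi : ℂ)),
      ← mul_sub, Finset.mul_sum, Finset.mul_sum, ← Finset.sum_sub_distrib]
    congr 1
    refine Finset.sum_congr rfl fun m hm => ?_
    rw [integral_const_mul, mul_left_comm, hJe _ (hypos e he m hm)]
    ring
  rw [h2, ← integral_const_mul]
  refine (norm_integral_le_integral_norm _).trans (le_of_eq (integral_congr_ae
    (ae_of_all _ fun t => ?_)))
  beta_reduce
  have h3 : ∑ e ∈ q.divisors, (ArithmeticFunction.moebius e : ℂ) *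
        ∑ m ∈ s, moebiusCoprime q m * J (y / (e * m ^ 2)) t =
      J y t * ∑ e ∈ q.divisors, (ArithmeticFunction.moebius e : ℂ) * ∑ m ∈ s,
        moebiusCoprime q m * ((e * m ^ 2 : ℕ) : ℂ) ^ (-(((1 / 2 : ℝ) : ℂ) + t * I)) := by
    rw [Finset.mul_sum]
    refine Finset.sum_congr rfl fun e he => ?_
    rw [mul_left_comm, Finset.mul_sum, Finset.mul_sum, Finset.mul_sum]
    refine Finset.sum_congr rfl fun m hm => ?_
    have hc : ((y / (e * m ^ 2) : ℝ) : ℂ) ^ (((1 / 2 : ℝ) : ℂ) + t * I) =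
        (y : ℂ) ^ (((1 / 2 : ℝ) : ℂ) + t * I) *
          ((e * m ^ 2 : ℕ) : ℂ) ^ (-(((1 / 2 : ℝ) : ℂ) + t * I)) := by
      have he0 : ((e * m ^ 2 : ℕ) : ℝ)⁻¹ = (e * m ^ 2 : ℝ)⁻¹ := by push_cast; rfl
      rw [div_eq_mul_inv, ← he0, ofReal_mul,
        mul_cpow_ofReal_nonneg hy.le (by positivity), cpow_neg, ofReal_inv, ofReal_natCast,
        inv_cpow]
      rw [natCast_arg]
      exact Real.pi_pos.ne
    rw [hJ]
    dsimp only
    rw [hc]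
    ring
  rw [h3, hJ]
  dsimp only
  rw [norm_mul, norm_mul, norm_mul, norm_pow, norm_cpow_eq_rpow_re_of_pos hy]
  have : (((1 / 2 : ℝ) : ℂ) + t * I).re = 1 / 2 := by simp
  rw [this]
  ring

end SecondDiff

section ConvolutionPower

open ArithmeticFunction in
lemma sum_mul_eq_mul_sum {R : Type*} [CommSemiring R] (f g : ArithmeticFunction R) {N N' : ℕ}
    (hf : ∀ n, N < n → f n = 0) (hg : ∀ n, N' < n → g n = 0) (φ : ℕ → R)
    (hφ : ∀ a b, 0 < a → 0 < b → φ (a * b) = φ a * φ b) :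
    ∑ n ∈ Finset.Ioc 0 (N * N'), (f * g) n * φ n =
      (∑ a ∈ Finset.Ioc 0 N, f a * φ a) * ∑ b ∈ Finset.Ioc 0 N', g b * φ b := by
  rw [Finset.sum_mul_sum, ← Finset.sum_product']
  calc _ = ∑ n ∈ Finset.Ioc 0 (N * N'), ∑ x ∈ Finset.Ioc 0 N ×ˢ Finset.Ioc 0 N',
        if x.1 * x.2 = n then f x.1 * g x.2 * φ n else 0 := by
        refine Finset.sum_congr rfl fun n hn => ?_
        rw [mul_apply, Finset.sum_mul, ← Finset.sum_filter]
        symm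
        refine Finset.sum_subset (fun x hx => ?_) fun x hx hx2 => ?_
        · rw [Finset.mem_filter] at hx
          exact Nat.mem_divisorsAntidiagonal.2 ⟨hx.2, (Finset.mem_Ioc.1 hn).1.ne'⟩
        · obtain ⟨h1, h2⟩ := Nat.mem_divisorsAntidiagonal.1 hx
          have h3 : 0 < x.1 ∧ 0 < x.2 := by
            rw [← h1] at h2
            exact ⟨Nat.pos_of_ne_zero (left_ne_zero_of_mul h2),
              Nat.pos_of_ne_zero (right_ne_zero_of_mul h2)⟩
          by_cases h4 : x.1 ≤ N
          · by_cases h5 : x.2 ≤ N'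
            · exact absurd (Finset.mem_filter.2 ⟨Finset.mem_product.2
                ⟨Finset.mem_Ioc.2 ⟨h3.1, h4⟩, Finset.mem_Ioc.2 ⟨h3.2, h5⟩⟩, h1⟩) hx2
            · rw [hg _ (not_le.1 h5)]
              simp
          · rw [hf _ (not_le.1 h4)]
            simp
    _ = _ := by
        rw [Finset.sum_comm]
        refine Finset.sum_congr rfl fun x hx => ?_
        rw [Finset.mem_product, Finset.mem_Ioc, Finset.mem_Ioc] at hx
        rw [Finset.sum_ite_eq, if_pos (Finset.mem_Ioc.2
          ⟨Nat.mul_pos hx.1.1 hx.2.1, Nat.mul_le_mul hx.1.2 hx.2.2⟩), hφ _ _ hx.1.1 hx.2.1]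
        ring

variable {f : ArithmeticFunction ℂ} {Δ N P : ℕ}

lemma pow_apply_ne_zero (hf : ∀ n, f n ≠ 0 → Δ ≤ n ∧ n ≤ N ∧ n.Coprime P) (k : ℕ) {n : ℕ}
    (hn : (f ^ k) n ≠ 0) : Δ ^ k ≤ n ∧ n ≤ N ^ k ∧ n.Coprime P := by
  induction k generalizing n with
  | zero =>
    rw [pow_zero, ArithmeticFunction.one_apply] at hn
    have : n = 1 := by by_contra h; simp [h] at hn
    simp [this]
  | succ k ih =>
    rw [pow_succ, ArithmeticFunction.mul_apply] at hn
    obtain ⟨x, hx, hx2⟩ := Finset.exists_ne_zero_of_sum_ne_zero hn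
    obtain ⟨h1, h2, h3⟩ := ih (left_ne_zero_of_mul hx2)
    obtain ⟨h4, h5, h6⟩ := hf _ (right_ne_zero_of_mul hx2)
    rw [← (Nat.mem_divisorsAntidiagonal.1 hx).1, pow_succ, pow_succ]
    exact ⟨Nat.mul_le_mul h1 h4, Nat.mul_le_mul h2 h5, h3.mul_left h6⟩

lemma pow_apply_eq_zero (hf : ∀ n, N < n → f n = 0) {k n : ℕ} (hn : N ^ k < n) :
    (f ^ k) n = 0 := by
  by_contra h
  have := (pow_apply_ne_zero (f := f) (Δ := 0) (N := N) (P := 1) (fun n hn => ⟨zero_le, ?_,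
    Nat.coprime_one_right n⟩) k h).2.1
  · lia
  · by_contra! h2
    exact hn (hf n h2)

lemma sum_pow_mul_eq (hf : ∀ n, N < n → f n = 0) (φ : ℕ → ℂ) (hφ1 : φ 1 = 1)
    (hφ : ∀ a b, 0 < a → 0 < b → φ (a * b) = φ a * φ b) (k : ℕ) :
    ∑ n ∈ Finset.Ioc 0 (N ^ k), (f ^ k) n * φ n = (∑ a ∈ Finset.Ioc 0 N, f a * φ a) ^ k := by
  induction k with
  | zero =>
    have : Finset.Ioc 0 1 = {1} := rfl
    simp [this, hφ1]
  | succ k ih =>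
    rw [pow_succ, pow_succ, pow_succ, sum_mul_eq_mul_sum _ f (fun n hn => pow_apply_eq_zero hf hn)
      hf φ hφ, ih]

lemma sum_norm_pow_le (hf : ∀ n, N < n → f n = 0) (k : ℕ) :
    ∑ n ∈ Finset.Ioc 0 (N ^ k), ‖(f ^ k) n‖ ≤ (∑ a ∈ Finset.Ioc 0 N, ‖f a‖) ^ k := by
  obtain ⟨F, hF⟩ : ∃ F : ArithmeticFunction ℂ → ArithmeticFunction ℝ, ∀ f n, F f n = ‖f n‖ :=
    ⟨fun f => ⟨fun n => ‖f n‖, by simp⟩, fun _ _ => rfl⟩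
  induction k with
  | zero =>
    have : Finset.Ioc 0 1 = {1} := rfl
    simp [this]
  | succ k ih =>
    have h := sum_mul_eq_mul_sum (F (f ^ k)) (F f) (N := N ^ k) (N' := N)
      (fun n hn => by rw [hF, pow_apply_eq_zero hf hn, norm_zero])
      (fun n hn => by rw [hF, hf n hn, norm_zero])
      (fun _ => 1) (fun _ _ _ _ => by simp)
    simp only [mul_one, hF] at h
    rw [pow_succ (∑ a ∈ Finset.Ioc 0 N, ‖f a‖), pow_succ N]
    calc _ ≤ ∑ n ∈ Finset.Ioc 0 (N ^ k * N), (F (f ^ k) * F f) n := by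
          refine Finset.sum_le_sum fun n _ => ?_
          rw [pow_succ, ArithmeticFunction.mul_apply, ArithmeticFunction.mul_apply]
          refine (norm_sum_le _ _).trans (le_of_eq (Finset.sum_congr rfl fun x _ => ?_))
          rw [norm_mul, hF, hF]
      _ ≤ _ := by rw [h]; gcongr

lemma sum_divisors_pow_cardFactors_le (k : ℕ) {n : ℕ} (hn : n ≠ 0) :
    ∑ d ∈ n.divisors, k ^ ArithmeticFunction.cardFactors d ≤
      (k + 1) ^ ArithmeticFunction.cardFactors n := by
  induction n using induction_on_primes with
  | zero => exact absurd rfl hn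
  | one => simp
  | prime_mul p a hp ih =>
    have ha : a ≠ 0 := right_ne_zero_of_mul hn
    have hsub : (p * a).divisors ⊆ a.divisors ∪ a.divisors.image (p * ·) := by
      intro d hd
      have hd' := Nat.dvd_of_mem_divisors hd
      obtain ⟨d1, d2, h1, h2, h3⟩ := (Nat.dvd_mul).1 hd'
      rcases (Nat.dvd_prime hp).1 h1 with h4 | h4
      · refine Finset.mem_union_left _ (Nat.mem_divisors.2 ⟨?_, ha⟩)
        rwa [← h3, h4, one_mul]
      · exact Finset.mem_union_right _ (Finset.mem_image.2 ⟨d2, Nat.mem_divisors.2 ⟨h2, ha⟩,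
          by rw [← h3, h4]⟩)
    calc _ ≤ ∑ d ∈ a.divisors ∪ a.divisors.image (p * ·),
          k ^ ArithmeticFunction.cardFactors d := Finset.sum_le_sum_of_subset hsub
      _ ≤ ∑ d ∈ a.divisors, k ^ ArithmeticFunction.cardFactors d +
          ∑ d ∈ a.divisors.image (p * ·), k ^ ArithmeticFunction.cardFactors d := by
          rw [← Finset.sum_union_inter]
          exact Nat.le_add_right _ _
      _ = (k + 1) * ∑ d ∈ a.divisors, k ^ ArithmeticFunction.cardFactors d := by
          rw [Finset.sum_image fun _ _ _ _ h => Nat.eq_of_mul_eq_mul_left hp.pos h, add_comm,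
            add_mul, one_mul, Finset.mul_sum]
          congr 1
          refine Finset.sum_congr rfl fun d hd => ?_
          rw [ArithmeticFunction.cardFactors_mul hp.ne_zero (Nat.pos_of_mem_divisors hd).ne',
            ArithmeticFunction.cardFactors_apply_prime hp, pow_add, pow_one]
      _ ≤ _ := by
          rw [ArithmeticFunction.cardFactors_mul hp.ne_zero ha,
            ArithmeticFunction.cardFactors_apply_prime hp, pow_add, pow_one]
          gcongr
          exact ih ha

lemma norm_pow_apply_le (hf : ∀ n, ‖f n‖ ≤ 1 / n) (k n : ℕ) :
    ‖(f ^ k) n‖ ≤ k ^ ArithmeticFunction.cardFactors n / n := by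
  induction k generalizing n with
  | zero =>
    rw [pow_zero, ArithmeticFunction.one_apply]
    split_ifs with h
    · simp [h]
    · rw [norm_zero]
      positivity
  | succ k ih =>
    rcases eq_or_ne n 0 with rfl | hn
    · simp
    rw [pow_succ, ArithmeticFunction.mul_apply]
    calc _ ≤ ∑ x ∈ n.divisorsAntidiagonal,
          (k : ℝ) ^ ArithmeticFunction.cardFactors x.1 / n := by
          refine norm_sum_le_of_le _ fun x hx => ?_
          rw [norm_mul, ← (Nat.mem_divisorsAntidiagonal.1 hx).1, Nat.cast_mul,
            ← div_div, div_eq_mul_one_div _ (x.2 : ℝ)]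
          gcongr
          · exact ih _
          · exact hf _
      _ = (∑ d ∈ n.divisors, k ^ ArithmeticFunction.cardFactors d : ℕ) / n := by
          rw [← Finset.sum_div, Nat.sum_divisorsAntidiagonal
            (fun d _ => (k : ℝ) ^ ArithmeticFunction.cardFactors d)]
          push_cast
          rfl
      _ ≤ _ := by
          gcongr
          exact_mod_cast sum_divisors_pow_cardFactors_le k hn

lemma pow_cardFactors_le {z n : ℕ} (hn : n ≠ 0) (hnz : n.Coprime (primorial z)) :
    z ^ ArithmeticFunction.cardFactors n ≤ n := by
  induction n using induction_on_primes with
  | zero => exact absurd rfl hn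
  | one => simp
  | prime_mul p a hp ih =>
    have ha : a ≠ 0 := right_ne_zero_of_mul hn
    obtain ⟨h1, h2⟩ := Nat.coprime_mul_iff_left.1 hnz
    rw [ArithmeticFunction.cardFactors_mul hp.ne_zero ha,
      ArithmeticFunction.cardFactors_apply_prime hp, pow_add, pow_one]
    refine Nat.mul_le_mul ?_ (ih ha h2)
    by_contra! h
    exact (Nat.Prime.coprime_iff_not_dvd hp).1 h1 (hp.dvd_primorial_iff.2 h.le)

end ConvolutionPower

section BlockMeanValue

variable {f : ArithmeticFunction ℂ} {Δ z : ℕ}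

lemma sum_norm_block_le (hf : ∀ n, f n ≠ 0 → Δ < n ∧ n ≤ 2 * Δ ∧ n.Coprime (primorial z))
    (hf2 : ∀ n, ‖f n‖ ≤ 1 / n) : ∑ n ∈ Finset.Ioc 0 (2 * Δ), ‖f n‖ ≤ 1 := by
  calc _ = ∑ n ∈ Finset.Ioc Δ (2 * Δ), ‖f n‖ := by
        symm
        refine Finset.sum_subset (fun n hn => ?_) fun n hn hn2 => ?_
        · rw [Finset.mem_Ioc] at hn ⊢
          lia
        · by_contra h
          exact hn2 (Finset.mem_Ioc.2 ⟨(hf n (norm_ne_zero_iff.1 h)).1, (Finset.mem_Ioc.1 hn).2⟩)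
    _ ≤ ∑ n ∈ Finset.Ioc Δ (2 * Δ), (1 / Δ : ℝ) := by
        refine Finset.sum_le_sum fun n hn => (hf2 n).trans ?_
        obtain ⟨h1, h2⟩ := Finset.mem_Ioc.1 hn
        have h3 : (0 : ℝ) < Δ := by
          have : 0 < Δ := by lia
          exact_mod_cast this
        gcongr
    _ ≤ 1 := by
        rw [Finset.sum_const, Nat.card_Ioc, nsmul_eq_mul, show 2 * Δ - Δ = Δ by lia, mul_one_div]
        exact div_self_le_one _

lemma norm_sum_block_le (hf : ∀ n, f n ≠ 0 → Δ < n ∧ n ≤ 2 * Δ ∧ n.Coprime (primorial z))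
    (hf2 : ∀ n, ‖f n‖ ≤ 1 / n) (u : ℝ) :
    ‖∑ n ∈ Finset.Ioc 0 (2 * Δ), f n * (n : ℂ) ^ (-(u * I))‖ ≤ 1 := by
  refine (norm_sum_le_of_le _ fun n _ => ?_).trans (sum_norm_block_le hf hf2)
  rw [norm_mul]
  exact mul_le_of_le_one_right (norm_nonneg _) (norm_natCast_cpow_mul_I n u)

lemma continuous_sum_natCast_cpow_mul_I (a : ℕ → ℂ) (s : Finset ℕ) (hs : ∀ n ∈ s, 0 < n) :
    Continuous fun u : ℝ => ∑ n ∈ s, a n * (n : ℂ) ^ (-(u * I)) :=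
  continuous_finsetSum _ fun n hn =>
    continuous_const.mul (continuous_natCast_cpow_mul_I (hs n hn))

lemma integral_block_pow_le (hf : ∀ n, f n ≠ 0 → Δ < n ∧ n ≤ 2 * Δ ∧ n.Coprime (primorial z))
    (hf2 : ∀ n, ‖f n‖ ≤ 1 / n) {k : ℕ} {T c : ℝ} (hT : 1 ≤ T) (hTk : T ≤ Δ ^ k) (hc : 0 ≤ c)
    (hck : ∀ n, n ≠ 0 → n ≤ (2 * Δ) ^ k → n.Coprime (primorial z) →
      (k : ℝ) ^ ArithmeticFunction.cardFactors n ≤ c) :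
    ∫ t in dyadicAnnulus T,
      ‖∑ n ∈ Finset.Ioc 0 (2 * Δ), f n * (n : ℂ) ^ (-(((2 * t : ℝ) : ℂ) * I))‖ ^ (2 * k) ≤
      250 * c := by
  obtain ⟨F, hF⟩ : ∃ F : ℝ → ℝ, F = fun u : ℝ =>
    ‖∑ n ∈ Finset.Ioc 0 (2 * Δ), f n * (n : ℂ) ^ (-((u : ℂ) * I))‖ ^ (2 * k) := ⟨_, rfl⟩
  have hT0 : (0 : ℝ) < 4 * T := by linarith
  have hFc : Continuous F := by
    rw [hF]
    exact (continuous_sum_natCast_cpow_mul_I _ _ fun n hn => (Finset.mem_Ioc.1 hn).1).norm.pow _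
  have hF0 : ∀ u, 0 ≤ F u := fun u => by rw [hF]; positivity
  have hF1 : ∀ u, F u ≤ 1 := fun u => by
    rw [hF]
    exact pow_le_one₀ (norm_nonneg _) (norm_sum_block_le hf hf2 u)
  have hint : Integrable fun u => F u * Real.exp (-(u ^ 2 / (4 * T) ^ 2)) := by
    refine (integrable_gaussian hT0).mono' (by fun_prop) (ae_of_all _ fun u => ?_)
    rw [norm_mul, Real.norm_of_nonneg (hF0 u), Real.norm_of_nonneg (Real.exp_nonneg _)]
    exact mul_le_of_le_one_left (Real.exp_nonneg _) (hF1 u)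
  have hmean : ∫ u, F u * Real.exp (-(u ^ 2 / (4 * T) ^ 2)) ≤ 150 * c := by
    have h1 : ∀ u, F u =
        ‖∑ n ∈ Finset.Ioc 0 ((2 * Δ) ^ k), (f ^ k) n * (n : ℂ) ^ (-((u : ℂ) * I))‖ ^ 2 := by
      intro u
      rw [sum_pow_mul_eq (fun n hn => ?_) _ (by simp) (fun a b _ _ => ?_), hF, norm_pow, ← pow_mul,
        mul_comm k]
      · by_contra h
        have := (hf n h).2.1
        lia
      · push_cast
        rw [natCast_mul_natCast_cpow]
    simp_rw [h1]
    refine (meanValue_finset _ (fun n hn => (Finset.mem_Ioc.1 hn).1) _ (by linarith)).trans ?_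
    have h2 : ∀ n ∈ Finset.Ioc 0 ((2 * Δ) ^ k), (4 * T + n) * ‖(f ^ k) n‖ ^ 2 ≤
        5 * c * ‖(f ^ k) n‖ := by
      intro n hn
      have hn0 : (0 : ℝ) < n := by exact_mod_cast (Finset.mem_Ioc.1 hn).1
      by_cases h : (f ^ k) n = 0
      · simp [h]
      obtain ⟨h3, h4, h5⟩ := pow_apply_ne_zero (fun n hn => ⟨(hf n hn).1.le, (hf n hn).2⟩) k h
      have h6 : T ≤ n := hTk.trans (by exact_mod_cast h3)
      have h7 := norm_pow_apply_le hf2 k n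
      have h8 := hck n (Finset.mem_Ioc.1 hn).1.ne' h4 h5
      rw [sq, ← mul_assoc]
      refine mul_le_mul_of_nonneg_right ?_ (norm_nonneg _)
      calc _ ≤ (4 * n + n) * (c / n) := by
            gcongr
            exact h7.trans (by gcongr)
        _ = 5 * c := by field_simp; ring
    have h3 := (sum_norm_pow_le (fun n hn => ?_) k).trans
      (pow_le_one₀ (Finset.sum_nonneg fun _ _ => norm_nonneg _) (sum_norm_block_le hf hf2))
    · have h4 := Finset.sum_le_sum h2
      rw [← Finset.mul_sum] at h4
      nlinarith
    · by_contra h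
      have := (hf n h).2.1
      lia
  have he : ∀ t ∈ dyadicAnnulus T, F (2 * t) ≤
      Real.exp 1 * (F (2 * t) * Real.exp (-((2 * t) ^ 2 / (4 * T) ^ 2))) := by
    intro t ht
    have h1 : (2 * t) ^ 2 / (4 * T) ^ 2 ≤ 1 := by
      rw [div_le_one (by positivity), sq_le_sq, abs_mul, abs_of_pos hT0, abs_two]
      linarith [ht.2]
    rw [mul_left_comm, ← Real.exp_add]
    exact le_mul_of_one_le_right (hF0 _) (Real.one_le_exp (by linarith))
  have hint2 : Integrable fun t => F (2 * t) * Real.exp (-((2 * t) ^ 2 / (4 * T) ^ 2)) :=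
    hint.comp_mul_left' two_ne_zero
  have hFe : ∀ t : ℝ, ‖∑ n ∈ Finset.Ioc 0 (2 * Δ), f n * (n : ℂ) ^ (-(((2 * t : ℝ) : ℂ) * I))‖ ^
      (2 * k) = F (2 * t) := fun t => by rw [hF]
  simp_rw [hFe]
  calc _ ≤ ∫ t in dyadicAnnulus T,
        Real.exp 1 * (F (2 * t) * Real.exp (-((2 * t) ^ 2 / (4 * T) ^ 2))) :=
        setIntegral_mono_on ((hFc.comp (by fun_prop)).continuousOn.integrableOn_compact
          (isCompact_dyadicAnnulus T)) (hint2.const_mul _).integrableOn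
          (measurableSet_dyadicAnnulus T) he
    _ ≤ ∫ t, Real.exp 1 * (F (2 * t) * Real.exp (-((2 * t) ^ 2 / (4 * T) ^ 2))) :=
        setIntegral_le_integral (hint2.const_mul _) (ae_of_all _ fun t =>
          mul_nonneg (Real.exp_nonneg _) (mul_nonneg (hF0 _) (Real.exp_nonneg _)))
    _ = Real.exp 1 * (1 / 2 * ∫ u, F u * Real.exp (-(u ^ 2 / (4 * T) ^ 2))) := by
        rw [integral_const_mul, Measure.integral_comp_mul_left
          (fun u => F u * Real.exp (-(u ^ 2 / (4 * T) ^ 2)))]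
        norm_num
    _ ≤ _ := by
        have := Real.exp_one_lt_d9
        have h0 : 0 ≤ ∫ u, F u * Real.exp (-(u ^ 2 / (4 * T) ^ 2)) :=
          integral_nonneg fun u => mul_nonneg (hF0 u) (Real.exp_nonneg _)
        nlinarith [Real.exp_pos 1]

lemma exists_pow_ge {T : ℝ} (hT : 1 < T) (hΔ : 2 ≤ Δ) :
    ∃ k : ℕ, 0 < k ∧ T ≤ (Δ : ℝ) ^ k ∧ (Δ : ℝ) ^ (k - 1) < T := by
  have hΔ' : (1 : ℝ) < Δ := by exact_mod_cast (by lia : 1 < Δ)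
  have hex : ∃ k : ℕ, T ≤ (Δ : ℝ) ^ k :=
    (pow_unbounded_of_one_lt T hΔ').imp fun _ h => h.le
  classical
  have h0 : 0 < Nat.find hex := by
    refine Nat.pos_of_ne_zero fun h => ?_
    have h1 := Nat.find_spec hex
    rw [h, pow_zero] at h1
    linarith
  exact ⟨Nat.find hex, h0, Nat.find_spec hex, not_le.1 (Nat.find_min hex (by lia))⟩

lemma pow_cardFactors_le_rpow {L T : ℝ} (hL : 4 ≤ L) (hT : 3 ≤ T) (hTL : Real.log T ≤ L + 2)
    (hz : L ^ 1000 ≤ z) (hzΔ : z ≤ Δ) {k : ℕ} (hk : 0 < k) (hk2 : (Δ : ℝ) ^ (k - 1) < T) :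
    L ^ (2 * k - 1) ≤ L * T ^ (2 / 1000 : ℝ) ∧
    ∀ n, n ≠ 0 → n ≤ (2 * Δ) ^ k → n.Coprime (primorial z) →
      (k : ℝ) ^ ArithmeticFunction.cardFactors n ≤ T ^ (4 / 1000 : ℝ) := by
  have hzΔ' : (z : ℝ) ≤ Δ := by exact_mod_cast hzΔ
  have hLΔ : L ^ 1000 ≤ Δ := hz.trans hzΔ'
  have hΔ16 : (16 : ℝ) ≤ Δ := by
    calc (16 : ℝ) = 4 ^ 2 := by norm_num
      _ ≤ L ^ 2 := by gcongr
      _ ≤ L ^ 1000 := pow_le_pow_right₀ (by linarith) (by norm_num)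
      _ ≤ _ := hLΔ
  obtain ⟨j, rfl⟩ : ∃ j, k = j + 1 := ⟨k - 1, by lia⟩
  rw [Nat.add_sub_cancel] at hk2
  have hroot : ∀ {x : ℝ} {i : ℕ}, 0 ≤ x → x ^ 1000 ≤ T ^ i → x ≤ T ^ (i / 1000 : ℝ) := by
    intro x i hx h
    refine le_of_pow_le_pow_left₀ (n := 1000) (by norm_num) (by positivity) (h.trans (le_of_eq ?_))
    rw [← Real.rpow_natCast, ← Real.rpow_natCast, ← Real.rpow_mul (by linarith)]
    norm_num
  refine ⟨?_, fun n hn hn2 hcop => ?_⟩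
  · rw [show 2 * (j + 1) - 1 = 2 * j + 1 by lia, pow_succ, mul_comm]
    gcongr
    refine hroot (i := 2) (by positivity) ?_
    calc (L ^ (2 * j)) ^ 1000 = ((L ^ 1000) ^ j) ^ 2 := by ring
      _ ≤ ((Δ : ℝ) ^ j) ^ 2 := by gcongr
      _ ≤ T ^ 2 := by gcongr
  · rcases Nat.eq_zero_or_pos j with rfl | hj
    · simpa using Real.one_le_rpow (by linarith : (1 : ℝ) ≤ T) (by norm_num : (0 : ℝ) ≤ 4 / 1000)
    have hkL : ((j + 1 : ℕ) : ℝ) ≤ L := by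
      have h1 : Real.log ((Δ : ℝ) ^ j) ≤ Real.log T := Real.log_le_log (by positivity) hk2.le
      rw [Real.log_pow] at h1
      have h2 : 2 ≤ Real.log Δ := by
        rw [Real.le_log_iff_exp_le (by linarith)]
        have := Real.exp_one_lt_d9
        calc Real.exp 2 = Real.exp 1 * Real.exp 1 := by rw [← Real.exp_add]; norm_num
          _ ≤ _ := by nlinarith [Real.exp_pos 1]
      have h3 : (j : ℝ) * 2 ≤ j * Real.log Δ := by gcongr
      push_cast
      linarith
    calc _ ≤ L ^ ArithmeticFunction.cardFactors n := by gcongr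
      _ ≤ _ := by
        refine hroot (i := 4) (by positivity) ?_
        have h4 : (2 * Δ : ℝ) ^ (j + 1) ≤ T ^ 4 := by
          calc (2 * Δ : ℝ) ^ (j + 1) ≤ (Δ * Δ : ℝ) ^ (j + 1) := by gcongr; linarith
            _ = ((Δ : ℝ) ^ j) ^ 2 * (Δ ^ 1) ^ 2 := by ring
            _ ≤ T ^ 2 * ((Δ : ℝ) ^ j) ^ 2 := by
                gcongr
                · linarith
                · exact hj
            _ ≤ T ^ 2 * T ^ 2 := by gcongr
            _ = T ^ 4 := by ring
        calc (L ^ ArithmeticFunction.cardFactors n) ^ 1000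
            = (L ^ 1000) ^ ArithmeticFunction.cardFactors n := by ring
          _ ≤ (z : ℝ) ^ ArithmeticFunction.cardFactors n := by gcongr
          _ ≤ n := by exact_mod_cast pow_cardFactors_le hn hcop
          _ ≤ ((2 * Δ) ^ (j + 1) : ℕ) := by exact_mod_cast hn2
          _ ≤ _ := by exact_mod_cast h4

variable {q : ℕ} [NeZero q] {χ : DirichletCharacter ℂ q}

lemma exists_integral_zetaL_mul_block_le (hχ : χ ^ 2 = 1) (hχ1 : χ ≠ 1) :
    ∃ C, 0 < C ∧ ∀ {f : ArithmeticFunction ℂ} {Δ z : ℕ} {T L : ℝ},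
      (∀ n, f n ≠ 0 → Δ < n ∧ n ≤ 2 * Δ ∧ n.Coprime (primorial z)) → (∀ n, ‖f n‖ ≤ 1 / n) →
      4 ≤ L → 3 ≤ T → Real.log T ≤ L + 2 → L ^ 1000 ≤ z → z ≤ Δ →
      ∫ t in dyadicAnnulus T, ‖zetaL χ (((1 / 2 : ℝ) : ℂ) + t * I)‖ ^ 2 *
        ‖∑ n ∈ Finset.Ioc 0 (2 * Δ), f n * (n : ℂ) ^ (-(((2 * t : ℝ) : ℂ) * I))‖ ≤
      C * (T * Real.log T ^ 2 / L + L * T ^ (996 / 1000 : ℝ)) := by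
  obtain ⟨C₁, hC₁, h₁⟩ := exists_integral_zetaL_half_le hχ hχ1
  obtain ⟨C₂, hC₂, h₂⟩ := exists_norm_zetaL_half_le_rpow hχ1
  refine ⟨C₁ + 500 * C₂ ^ 2, by positivity, fun {f Δ z T L} hf hf2 hL hT hTL hz hzΔ => ?_⟩
  have hΔ2 : 2 ≤ Δ := by
    have : (2 : ℝ) ≤ Δ := by
      calc (2 : ℝ) ≤ L ^ 1 := by linarith
        _ ≤ L ^ 1000 := pow_le_pow_right₀ (by linarith) (by norm_num)
        _ ≤ z := hz
        _ ≤ Δ := by exact_mod_cast hzΔ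
    exact_mod_cast this
  obtain ⟨k, hk, hTk, hkT⟩ := exists_pow_ge (by linarith : 1 < T) hΔ2
  obtain ⟨hL2, hck⟩ := pow_cardFactors_le_rpow hL hT hTL hz hzΔ hk hkT
  have hT0 : 0 < T := by linarith
  have hmean := integral_block_pow_le hf hf2 (by linarith) hTk (by positivity) hck
  obtain ⟨B, hB⟩ : ∃ B : ℝ → ℝ, B = fun t : ℝ =>
    ‖∑ n ∈ Finset.Ioc 0 (2 * Δ), f n * (n : ℂ) ^ (-(((2 * t : ℝ) : ℂ) * I))‖ := ⟨_, rfl⟩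
  have hBe : ∀ t : ℝ, ‖∑ n ∈ Finset.Ioc 0 (2 * Δ),
    f n * (n : ℂ) ^ (-(((2 * t : ℝ) : ℂ) * I))‖ = B t := fun t => by rw [hB]
  have hBc : Continuous B := by
    rw [hB]
    exact ((continuous_sum_natCast_cpow_mul_I f (Finset.Ioc 0 (2 * Δ)) fun n hn =>
      (Finset.mem_Ioc.1 hn).1).comp (continuous_const_mul (2 : ℝ))).norm
  have hB0 : ∀ t, 0 ≤ B t := fun t => by rw [hB]; positivity
  simp_rw [hBe] at hmean ⊢
  have hZc := (continuous_zetaL_half hχ1).norm.pow 2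
  have hL0 : 0 < L := by linarith
  have hpt : ∀ t ∈ dyadicAnnulus T, ‖zetaL χ (((1 / 2 : ℝ) : ℂ) + t * I)‖ ^ 2 * B t ≤
      1 / L * ‖zetaL χ (((1 / 2 : ℝ) : ℂ) + t * I)‖ ^ 2 +
      2 * C₂ ^ 2 * T ^ (99 / 100 : ℝ) * (L * T ^ (2 / 1000 : ℝ)) * B t ^ (2 * k) := by
    intro t ht
    rcases le_total (B t) (1 / L) with h | h
    · calc _ ≤ ‖zetaL χ (((1 / 2 : ℝ) : ℂ) + t * I)‖ ^ 2 * (1 / L) := by gcongr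
        _ ≤ _ := by
          rw [mul_comm, le_add_iff_nonneg_right]
          have := hB0 t
          positivity
    · have h1 : B t ≤ L ^ (2 * k - 1) * B t ^ (2 * k) := by
        have h2 : 1 ≤ (L * B t) ^ (2 * k - 1) :=
          one_le_pow₀ (by rwa [div_le_iff₀ hL0, mul_comm] at h)
        have h3 : B t ^ (2 * k) = B t ^ (2 * k - 1) * B t := by
          rw [← pow_succ, Nat.sub_add_cancel (by lia)]
        rw [h3, ← mul_assoc, ← mul_pow]
        exact le_mul_of_one_le_left (hB0 t) h2
      have h4 : ‖zetaL χ (((1 / 2 : ℝ) : ℂ) + t * I)‖ ^ 2 ≤ 2 * C₂ ^ 2 * T ^ (99 / 100 : ℝ) := by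
        have ht1 : 1 ≤ |t| := by linarith [ht.1]
        calc _ ≤ (C₂ * |t| ^ (99 / 200 : ℝ)) ^ 2 := by gcongr; exact h₂ t ht1
          _ = C₂ ^ 2 * |t| ^ (99 / 100 : ℝ) := by
              rw [mul_pow, ← Real.rpow_mul_natCast (abs_nonneg t)]
              norm_num
          _ ≤ C₂ ^ 2 * (2 * T) ^ (99 / 100 : ℝ) := by
              have := ht.2
              gcongr
          _ ≤ C₂ ^ 2 * (2 * T ^ (99 / 100 : ℝ)) := by
              rw [Real.mul_rpow (by norm_num) hT0.le]
              gcongr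
              exact (Real.rpow_le_rpow_of_exponent_le (by norm_num) (by norm_num)).trans_eq
                (Real.rpow_one 2)
          _ = _ := by ring
      calc _ ≤ (2 * C₂ ^ 2 * T ^ (99 / 100 : ℝ)) *
            ((L * T ^ (2 / 1000 : ℝ)) * B t ^ (2 * k)) := by
            have := hB0 t
            gcongr
            exact h1.trans (by gcongr)
        _ ≤ _ := by
            rw [← mul_assoc, le_add_iff_nonneg_left]
            positivity
  have hcpt := isCompact_dyadicAnnulus T
  have hi1 : IntegrableOn (fun t : ℝ => 1 / L * ‖zetaL χ (((1 / 2 : ℝ) : ℂ) + t * I)‖ ^ 2)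
    (dyadicAnnulus T) := (continuous_const.mul hZc).continuousOn.integrableOn_compact hcpt
  have hi2 : IntegrableOn (fun t : ℝ => 2 * C₂ ^ 2 * T ^ (99 / 100 : ℝ) *
    (L * T ^ (2 / 1000 : ℝ)) * B t ^ (2 * k)) (dyadicAnnulus T) :=
    (continuous_const.mul (hBc.pow _)).continuousOn.integrableOn_compact hcpt
  have hpow : T ^ (99 / 100 : ℝ) * (T ^ (2 / 1000 : ℝ) * T ^ (4 / 1000 : ℝ)) =
      T ^ (996 / 1000 : ℝ) := by
    rw [← Real.rpow_add hT0, ← Real.rpow_add hT0]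
    norm_num
  calc _ ≤ ∫ t in dyadicAnnulus T, (1 / L * ‖zetaL χ (((1 / 2 : ℝ) : ℂ) + t * I)‖ ^ 2 +
        2 * C₂ ^ 2 * T ^ (99 / 100 : ℝ) * (L * T ^ (2 / 1000 : ℝ)) * B t ^ (2 * k)) :=
        setIntegral_mono_on ((hZc.mul hBc).continuousOn.integrableOn_compact hcpt)
          (hi1.add hi2) (measurableSet_dyadicAnnulus T) hpt
    _ ≤ 1 / L * (C₁ * (T * Real.log T ^ 2)) + 2 * C₂ ^ 2 * T ^ (99 / 100 : ℝ) *
          (L * T ^ (2 / 1000 : ℝ)) * (250 * T ^ (4 / 1000 : ℝ)) := by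
        rw [integral_add hi1 hi2, integral_const_mul, integral_const_mul]
        have := h₁ T hT
        gcongr
    _ = C₁ * (T * Real.log T ^ 2 / L) + 500 * C₂ ^ 2 * (L * T ^ (996 / 1000 : ℝ)) := by
        rw [← hpow]
        ring
    _ ≤ _ := by
        have h5 : 0 ≤ C₁ * (L * T ^ (996 / 1000 : ℝ)) := by positivity
        have h6 : 0 ≤ 500 * C₂ ^ 2 * (T * Real.log T ^ 2 / L) := by positivity
        linarith

end BlockMeanValue

section RoughPoly

/-- The Dirichlet polynomial `∑ ν(b) / b ^ (1 + 2 * i * t)` over `b ≤ M` without prime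
factor `≤ z`. -/
noncomputable def roughPoly (q z M : ℕ) (t : ℝ) : ℂ :=
  ∑ b ∈ (Finset.Ioc 0 M).filter fun b => b.Coprime (primorial z),
    moebiusCoprime q b / b * (b : ℂ) ^ (-(((2 * t : ℝ) : ℂ) * I))

/-- The coefficients of `roughPoly` on the dyadic block `(Δ, 2Δ]`. -/
noncomputable def roughBlock (q z Δ : ℕ) : ArithmeticFunction ℂ where
  toFun n := if Δ < n ∧ n ≤ 2 * Δ ∧ n.Coprime (primorial z) then moebiusCoprime q n / n else 0
  map_zero' := by simp

lemma roughBlock_apply (q z Δ n : ℕ) : roughBlock q z Δ n =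
    if Δ < n ∧ n ≤ 2 * Δ ∧ n.Coprime (primorial z) then moebiusCoprime q n / n else 0 := rfl

lemma roughBlock_ne_zero {q z Δ n : ℕ} (h : roughBlock q z Δ n ≠ 0) :
    Δ < n ∧ n ≤ 2 * Δ ∧ n.Coprime (primorial z) := by
  by_contra h2
  exact h (by rw [roughBlock_apply, if_neg h2])

lemma norm_moebiusCoprime_div_le (q n : ℕ) : ‖moebiusCoprime q n / n‖ ≤ 1 / n := by
  rw [norm_div, norm_natCast]
  gcongr
  exact norm_moebiusCoprime_le q n

lemma norm_roughBlock_le (q z Δ n : ℕ) : ‖roughBlock q z Δ n‖ ≤ 1 / n := by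
  rw [roughBlock_apply]
  split_ifs
  · exact norm_moebiusCoprime_div_le q n
  · simp

lemma continuous_roughPoly (q z M : ℕ) : Continuous (roughPoly q z M) :=
  (continuous_sum_natCast_cpow_mul_I (fun b => moebiusCoprime q b / b)
    ((Finset.Ioc 0 M).filter fun b => b.Coprime (primorial z)) fun _ hn =>
      (Finset.mem_Ioc.1 (Finset.mem_filter.1 hn).1).1).comp (continuous_const_mul (2 : ℝ))

lemma norm_roughPoly_le (q z M : ℕ) (t : ℝ) : ‖roughPoly q z M t‖ ≤ 1 + Real.log M := by
  refine le_trans ?_ (harmonic_le_one_add_log M)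
  rw [harmonic_eq_sum_Icc]
  push_cast
  refine (norm_sum_le_of_le (f := _) _ fun b _ => ?_).trans
    (Finset.sum_le_sum_of_subset_of_nonneg (Finset.filter_subset _ _) fun _ _ _ => by positivity)
  rw [norm_mul, ← one_div]
  exact (mul_le_of_le_one_right (norm_nonneg _) (norm_natCast_cpow_mul_I b (2 * t))).trans
    (norm_moebiusCoprime_div_le q b)

lemma sum_rough_eq (z J : ℕ) (hz : 1 ≤ z) (g : ℕ → ℂ) :
    ∑ b ∈ (Finset.Ioc 0 (z * 2 ^ J)).filter (fun b => b.Coprime (primorial z)), g b =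
    g 1 + ∑ j ∈ Finset.range J, ∑ b ∈ (Finset.Ioc (z * 2 ^ j) (2 * (z * 2 ^ j))).filter
      (fun b => b.Coprime (primorial z)), g b := by
  induction J with
  | zero =>
    rw [Finset.sum_range_zero, add_zero, pow_zero, mul_one]
    refine Finset.sum_eq_single_of_mem 1 (by simp [hz]) fun b hb hb1 => ?_
    obtain ⟨h1, h2⟩ := Finset.mem_filter.1 hb
    obtain ⟨p, hp, hpb⟩ := Nat.exists_prime_and_dvd hb1
    have h3 : p ∣ primorial z := (hp.dvd_primorial_iff).2
      ((Nat.le_of_dvd (Finset.mem_Ioc.1 h1).1 hpb).trans (Finset.mem_Ioc.1 h1).2)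
    exact absurd (Nat.dvd_gcd hpb h3) (by rw [h2]; exact hp.not_dvd_one)
  | succ J ih =>
    rw [Finset.sum_range_succ, ← add_assoc, ← ih, ← Finset.sum_union]
    · congr 1
      rw [← Finset.filter_union, Finset.Ioc_union_Ioc_eq_Ioc (by simp) (by lia),
        pow_succ, mul_comm 2, mul_assoc]
    · exact Finset.disjoint_filter_filter (Finset.Ioc_disjoint_Ioc_of_le le_rfl)

lemma norm_roughPoly_le_add_sum (q J : ℕ) {z : ℕ} (hz : 1 ≤ z) (t : ℝ) :
    ‖roughPoly q z (z * 2 ^ J) t‖ ≤ 1 + ∑ j ∈ Finset.range J,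
      ‖∑ n ∈ Finset.Ioc 0 (2 * (z * 2 ^ j)),
        roughBlock q z (z * 2 ^ j) n * (n : ℂ) ^ (-(((2 * t : ℝ) : ℂ) * I))‖ := by
  rw [roughPoly, sum_rough_eq z J hz]
  refine (norm_add_le _ _).trans (add_le_add ?_ (norm_sum_le_of_le _ fun j _ => le_of_eq ?_))
  · simpa using norm_moebiusCoprime_le q 1
  · congr 1
    rw [Finset.sum_filter]
    refine Finset.sum_subset_zero_on_sdiff (Finset.Ioc_subset_Ioc_left (Nat.zero_le _))
      (fun n hn => ?_) fun n hn => ?_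
    · rw [Finset.mem_sdiff, Finset.mem_Ioc, Finset.mem_Ioc] at hn
      rw [roughBlock_apply, if_neg (by tauto), zero_mul]
    · rw [Finset.mem_Ioc] at hn
      rw [roughBlock_apply]
      split_ifs <;> first | rfl | tauto | simp

lemma natCast_sq_cpow {m : ℕ} (hm : 0 < m) (t : ℝ) :
    ((m ^ 2 : ℕ) : ℂ) ^ (-(((1 / 2 : ℝ) : ℂ) + t * I)) =
      (m : ℂ)⁻¹ * (m : ℂ) ^ (-(((2 * t : ℝ) : ℂ) * I)) := by
  rw [sq, Nat.cast_mul, natCast_mul_natCast_cpow, ← cpow_add _ _ (by exact_mod_cast hm.ne'),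
    ← cpow_neg_one, ← cpow_add _ _ (by exact_mod_cast hm.ne')]
  congr 1
  push_cast
  ring

lemma norm_sum_smoothMulRough_le (q z M : ℕ) (t : ℝ) :
    ‖∑ e ∈ q.divisors, (ArithmeticFunction.moebius e : ℂ) * ∑ m ∈ smoothMulRough z M,
      moebiusCoprime q m * ((e * m ^ 2 : ℕ) : ℂ) ^ (-(((1 / 2 : ℝ) : ℂ) + t * I))‖ ≤
    q.divisors.card * (∑ a ∈ (primorial z).divisors, (1 / a : ℝ)) * ‖roughPoly q z M t‖ := by
  have hm0 : ∀ m ∈ smoothMulRough z M, 0 < m := fun m hm =>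
    Nat.pos_of_ne_zero fun h => zero_notMem_smoothMulRough z M (h ▸ hm)
  have h1 : ∀ e : ℕ, ∑ m ∈ smoothMulRough z M,
      moebiusCoprime q m * ((e * m ^ 2 : ℕ) : ℂ) ^ (-(((1 / 2 : ℝ) : ℂ) + t * I)) =
      (e : ℂ) ^ (-(((1 / 2 : ℝ) : ℂ) + t * I)) * ((∑ a ∈ (primorial z).divisors,
        moebiusCoprime q a / a * (a : ℂ) ^ (-(((2 * t : ℝ) : ℂ) * I))) * roughPoly q z M t) := by
    intro e
    have h2 : ∀ m ∈ smoothMulRough z M,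
        moebiusCoprime q m * ((e * m ^ 2 : ℕ) : ℂ) ^ (-(((1 / 2 : ℝ) : ℂ) + t * I)) =
        (e : ℂ) ^ (-(((1 / 2 : ℝ) : ℂ) + t * I)) * (moebiusCoprime q m *
          ((m : ℂ)⁻¹ * (m : ℂ) ^ (-(((2 * t : ℝ) : ℂ) * I)))) := by
      intro m hm
      rw [Nat.cast_mul, natCast_mul_natCast_cpow, natCast_sq_cpow (hm0 m hm)]
      ring
    rw [Finset.sum_congr rfl h2, ← Finset.mul_sum,
      sum_smoothMulRough q z M fun m => (m : ℂ)⁻¹ * (m : ℂ) ^ (-(((2 * t : ℝ) : ℂ) * I)),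
      roughPoly, Finset.sum_mul_sum]
    congr 1
    refine Finset.sum_congr rfl fun a _ => Finset.sum_congr rfl fun b _ => ?_
    push_cast
    rw [natCast_mul_natCast_cpow, mul_inv]
    ring
  simp_rw [h1, ← mul_assoc, ← Finset.sum_mul]
  rw [norm_mul, norm_mul]
  gcongr
  · refine (norm_sum_le_of_le (f := _) _ fun e he => ?_).trans_eq
      (by rw [Finset.sum_const, nsmul_eq_mul, mul_one])
    have he0 := Nat.pos_of_mem_divisors he
    rw [norm_mul, norm_natCast_cpow_of_pos he0, ← one_mul (1 : ℝ)]
    have he1 : (1 : ℝ) ≤ e := by exact_mod_cast he0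
    have h3 : ‖(ArithmeticFunction.moebius e : ℂ)‖ ≤ 1 := by
      rw [norm_intCast]
      exact_mod_cast ArithmeticFunction.abs_moebius_le_one
    gcongr
    refine Real.rpow_le_one_of_one_le_of_nonpos he1 ?_
    simp
  · refine norm_sum_le_of_le _ fun a _ => ?_
    rw [norm_mul]
    exact (mul_le_of_le_one_right (norm_nonneg _) (norm_natCast_cpow_mul_I a (2 * t))).trans
      (norm_moebiusCoprime_div_le q a)

end RoughPoly

section RoughIntegral

/-- The kernel `|(e ^ {hs} - 1) ^ 2 / s ^ 3|` on the line `s = 1/2 + it`. -/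
noncomputable def halfKernel (h t : ℝ) : ℝ :=
  ‖(cexp (h * (((1 / 2 : ℝ) : ℂ) + t * I)) - 1) ^ 2 / (((1 / 2 : ℝ) : ℂ) + t * I) ^ 3‖

lemma halfKernel_nonneg (h t : ℝ) : 0 ≤ halfKernel h t := norm_nonneg _

lemma continuous_halfKernel (h : ℝ) : Continuous (halfKernel h) := by
  unfold halfKernel
  refine (Continuous.div (by fun_prop) (by fun_prop) fun t => ?_).norm
  exact pow_ne_zero 3 (add_mul_I_ne_zero (by norm_num) t)

lemma norm_exp_sub_one_half_le {h : ℝ} (hh1 : h ≤ 1) (t : ℝ) :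
    ‖cexp (h * (((1 / 2 : ℝ) : ℂ) + t * I)) - 1‖ ≤ 3 := by
  refine (norm_sub_le _ _).trans ?_
  rw [norm_exp, norm_one]
  have h1 : (h * (((1 / 2 : ℝ) : ℂ) + t * I)).re = h / 2 := by simp; ring
  have h2 : Real.exp (h / 2) ≤ Real.exp (1 / 2) := Real.exp_le_exp.2 (by linarith)
  have h3 : Real.exp (1 / 2) * Real.exp (1 / 2) = Real.exp 1 := by
    rw [← Real.exp_add]; norm_num
  rw [h1]
  nlinarith [Real.exp_pos (1 / 2), Real.exp_one_lt_d9]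

lemma halfKernel_le_cube {h : ℝ} (hh1 : h ≤ 1) (t : ℝ) :
    halfKernel h t ≤ 72 * (1 + t ^ 2) ^ (-(3 / 2) : ℝ) := by
  have h1 := norm_exp_sub_one_half_le hh1 t
  have h2 := norm_inv_half_cube_le t
  rw [halfKernel, div_eq_mul_one_div, norm_mul, norm_pow]
  calc _ ≤ (3 : ℝ) ^ 2 * (8 * (1 + t ^ 2) ^ (-(3 / 2) : ℝ)) := by gcongr
    _ = _ := by ring

lemma halfKernel_le_div {h : ℝ} (hh : 0 < h) (hh1 : h ≤ 1) {t T : ℝ} (hT : 0 < T)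
    (hTt : T ≤ ‖((1 / 2 : ℝ) : ℂ) + t * I‖) : halfKernel h t ≤ 9 * h ^ 2 / T := by
  have hs : 0 < ‖((1 / 2 : ℝ) : ℂ) + t * I‖ := hT.trans_le hTt
  have h1 : ‖cexp (h * (((1 / 2 : ℝ) : ℂ) + t * I)) - 1‖ ≤
      3 * (h * ‖((1 / 2 : ℝ) : ℂ) + t * I‖) := by
    have h2 : ‖(h : ℂ) * (((1 / 2 : ℝ) : ℂ) + t * I)‖ = h * ‖((1 / 2 : ℝ) : ℂ) + t * I‖ := by
      rw [norm_mul, norm_real, Real.norm_of_nonneg hh.le]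
    rw [← h2]
    rcases le_total ‖(h : ℂ) * (((1 / 2 : ℝ) : ℂ) + t * I)‖ 1 with h3 | h3
    · exact (norm_exp_sub_one_le h3).trans (by gcongr; norm_num)
    · exact (norm_exp_sub_one_half_le hh1 t).trans (by linarith)
  rw [halfKernel, norm_div, norm_pow, norm_pow]
  calc _ ≤ (3 * (h * ‖((1 / 2 : ℝ) : ℂ) + t * I‖)) ^ 2 / ‖((1 / 2 : ℝ) : ℂ) + t * I‖ ^ 3 := by
        gcongr
    _ = 9 * h ^ 2 / ‖((1 / 2 : ℝ) : ℂ) + t * I‖ := by field_simp; norm_num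
    _ ≤ _ := by gcongr

lemma abs_le_norm_half_add (t : ℝ) : |t| ≤ ‖((1 / 2 : ℝ) : ℂ) + t * I‖ := by
  simpa using abs_im_le_norm (((1 / 2 : ℝ) : ℂ) + t * I)

lemma half_le_norm_half_add (t : ℝ) : 1 / 2 ≤ ‖((1 / 2 : ℝ) : ℂ) + t * I‖ := by
  have := abs_re_le_norm (((1 / 2 : ℝ) : ℂ) + t * I)
  simp only [add_re, ofReal_re, re_ofReal_mul, I_re, mul_zero, add_zero] at this
  rwa [abs_of_pos (by norm_num)] at this

lemma setIntegral_le_add {g : ℝ → ℝ} (hg : Integrable g) (hg0 : ∀ t, 0 ≤ g t) {A s u : Set ℝ}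
    (hA : A ⊆ s ∪ u) : ∫ t in A, g t ≤ (∫ t in s, g t) + ∫ t in u, g t := by
  rw [← integral_add_measure hg.integrableOn hg.integrableOn]
  exact integral_mono_measure ((Measure.restrict_mono hA le_rfl).trans
    (Measure.restrict_union_le s u)) (ae_of_all _ hg0)
    (Integrable.add_measure hg.integrableOn hg.integrableOn)

lemma setIntegral_abs_gt_le_sum {g : ℝ → ℝ} (hg : Integrable g) (hg0 : ∀ t, 0 ≤ g t) (R : ℝ)
    (N : ℕ) : ∫ t in {t | R < |t|}, g t ≤ (∑ j ∈ Finset.range N,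
      ∫ t in dyadicAnnulus (R * 2 ^ j), g t) + ∫ t in {t | R * 2 ^ N < |t|}, g t := by
  induction N with
  | zero => simp
  | succ N ih =>
    rw [Finset.sum_range_succ, add_assoc]
    refine ih.trans (add_le_add_right (setIntegral_le_add hg hg0 fun t ht => ?_) _)
    rcases le_or_gt |t| (R * 2 ^ (N + 1)) with h | h
    · exact Or.inl ⟨le_of_lt ht, h.trans_eq (by ring)⟩
    · exact Or.inr h

lemma integral_le_dyadic_sum {g : ℝ → ℝ} (hg : Integrable g) (hg0 : ∀ t, 0 ≤ g t) (R : ℝ)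
    (N : ℕ) : ∫ t, g t ≤ (∫ t in Set.Icc (-R) R, g t) + ((∑ j ∈ Finset.range N,
      ∫ t in dyadicAnnulus (R * 2 ^ j), g t) + ∫ t in {t | R * 2 ^ N < |t|}, g t) := by
  rw [← setIntegral_univ]
  refine (setIntegral_le_add (u := {t | R < |t|}) hg hg0 fun t _ => ?_).trans
    (add_le_add_right (setIntegral_abs_gt_le_sum hg hg0 R N) _)
  rcases le_or_gt |t| R with h | h
  · exact Or.inl (abs_le.1 h)
  · exact Or.inr h

variable {q : ℕ} [NeZero q] {χ : DirichletCharacter ℂ q}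

lemma exists_integral_rough_annulus_le (hχ : χ ^ 2 = 1) (hχ1 : χ ≠ 1) :
    ∃ C, 0 < C ∧ ∀ {T Λ : ℝ} {z J : ℕ}, 4 ≤ Λ → 3 ≤ T → Real.log T ≤ Λ + 2 → Λ ^ 1000 ≤ z →
      J ≤ 2 * Λ → Λ ^ 2 ≤ Real.log T ^ 3 →
      ∫ t in dyadicAnnulus T, ‖zetaL χ (((1 / 2 : ℝ) : ℂ) + t * I)‖ ^ 2 *
        ‖roughPoly q z (z * 2 ^ J) t‖ ≤ C * (T * Real.log T ^ 2) := by
  obtain ⟨C₁, hC₁, h₁⟩ := exists_integral_zetaL_half_le hχ hχ1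
  obtain ⟨C₂, hC₂, h₂⟩ := exists_integral_zetaL_mul_block_le hχ hχ1
  refine ⟨C₁ + 2 * C₂ * (1 + 1000 ^ 3), by positivity,
    fun {T Λ z J} hΛ hT hTΛ hz hJ hΛT => ?_⟩
  have hT0 : 0 < T := by linarith
  have hlog1 : 1 ≤ Real.log T := by
    rw [Real.le_log_iff_exp_le hT0]
    linarith [Real.exp_one_lt_d9]
  have hz1 : 1 ≤ z := by
    have : (1 : ℝ) ≤ z := (one_le_pow₀ (by linarith)).trans hz
    exact_mod_cast this
  have hZc := (continuous_zetaL_half hχ1).norm.pow 2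
  have hcpt := isCompact_dyadicAnnulus T
  obtain ⟨B, hB⟩ : ∃ B : ℕ → ℝ → ℝ, B = fun j t => ‖∑ n ∈ Finset.Ioc 0 (2 * (z * 2 ^ j)),
    roughBlock q z (z * 2 ^ j) n * (n : ℂ) ^ (-(((2 * t : ℝ) : ℂ) * I))‖ := ⟨_, rfl⟩
  have hBc : ∀ j, Continuous (B j) := fun j => by
    rw [hB]
    exact ((continuous_sum_natCast_cpow_mul_I (roughBlock q z (z * 2 ^ j)) _ fun n hn =>
      (Finset.mem_Ioc.1 hn).1).comp (continuous_const_mul (2 : ℝ))).norm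
  have hi1 : IntegrableOn (fun t : ℝ => ‖zetaL χ (((1 / 2 : ℝ) : ℂ) + t * I)‖ ^ 2)
    (dyadicAnnulus T) := hZc.continuousOn.integrableOn_compact hcpt
  have hi2 : ∀ j, IntegrableOn (fun t : ℝ => ‖zetaL χ (((1 / 2 : ℝ) : ℂ) + t * I)‖ ^ 2 * B j t)
    (dyadicAnnulus T) := fun j => (hZc.mul (hBc j)).continuousOn.integrableOn_compact hcpt
  have hblock : ∀ j, ∫ t in dyadicAnnulus T, ‖zetaL χ (((1 / 2 : ℝ) : ℂ) + t * I)‖ ^ 2 * B j t ≤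
      C₂ * (T * Real.log T ^ 2 / Λ + Λ * T ^ (996 / 1000 : ℝ)) := fun j => by
    rw [hB]
    exact h₂ (fun n hn => roughBlock_ne_zero hn) (norm_roughBlock_le q z _) hΛ hT hTΛ hz
      (Nat.le_mul_of_pos_right _ (by positivity))
  have hpow : Λ ^ 2 * T ^ (996 / 1000 : ℝ) ≤ 1000 ^ 3 * (T * Real.log T ^ 2) := by
    have h3 : Real.log T ≤ 1000 * T ^ (1 / 1000 : ℝ) := by
      refine (Real.log_le_rpow_div hT0.le (by norm_num : (0 : ℝ) < 1 / 1000)).trans_eq ?_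
      ring
    calc _ ≤ Real.log T ^ 3 * T ^ (996 / 1000 : ℝ) := by gcongr
      _ ≤ (1000 * T ^ (1 / 1000 : ℝ)) ^ 3 * T ^ (996 / 1000 : ℝ) := by gcongr
      _ = 1000 ^ 3 * T ^ (999 / 1000 : ℝ) := by
          rw [mul_pow, ← Real.rpow_mul_natCast hT0.le, mul_assoc, ← Real.rpow_add hT0]
          norm_num
      _ ≤ 1000 ^ 3 * T ^ (1 : ℝ) := by
          gcongr
          · linarith
          · norm_num
      _ ≤ _ := by
          rw [Real.rpow_one]
          gcongr
          exact le_mul_of_one_le_right hT0.le (one_le_pow₀ hlog1)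
  calc _ ≤ ∫ t in dyadicAnnulus T, (‖zetaL χ (((1 / 2 : ℝ) : ℂ) + t * I)‖ ^ 2 +
        ∑ j ∈ Finset.range J, ‖zetaL χ (((1 / 2 : ℝ) : ℂ) + t * I)‖ ^ 2 * B j t) := by
        refine setIntegral_mono_on ((hZc.mul
          (continuous_roughPoly q z _).norm).continuousOn.integrableOn_compact hcpt)
          (hi1.add (integrable_finsetSum _ fun j _ => hi2 j)) (measurableSet_dyadicAnnulus T)
          fun t _ => ?_
        rw [← Finset.mul_sum, hB]
        have := norm_roughPoly_le_add_sum q J hz1 t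
        calc _ ≤ _ := mul_le_mul_of_nonneg_left this (by positivity)
          _ = _ := by ring
    _ = (∫ t in dyadicAnnulus T, ‖zetaL χ (((1 / 2 : ℝ) : ℂ) + t * I)‖ ^ 2) +
        ∑ j ∈ Finset.range J,
          ∫ t in dyadicAnnulus T, ‖zetaL χ (((1 / 2 : ℝ) : ℂ) + t * I)‖ ^ 2 * B j t := by
        rw [integral_add hi1 (integrable_finsetSum _ fun j _ => hi2 j),
          integral_finsetSum _ fun j _ => hi2 j]
    _ ≤ C₁ * (T * Real.log T ^ 2) +
        2 * Λ * (C₂ * (T * Real.log T ^ 2 / Λ + Λ * T ^ (996 / 1000 : ℝ))) := by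
        refine add_le_add (h₁ T hT) ((Finset.sum_le_sum fun j _ => hblock j).trans ?_)
        rw [Finset.sum_const, Finset.card_range, nsmul_eq_mul]
        gcongr
    _ = C₁ * (T * Real.log T ^ 2) + 2 * C₂ * (T * Real.log T ^ 2 +
          Λ ^ 2 * T ^ (996 / 1000 : ℝ)) := by
        field_simp
    _ ≤ C₁ * (T * Real.log T ^ 2) + 2 * C₂ * (T * Real.log T ^ 2 +
          1000 ^ 3 * (T * Real.log T ^ 2)) := by gcongr
    _ = _ := by ring

end RoughIntegral

section RoughIntegralBound

variable {q : ℕ} [NeZero q] {χ : DirichletCharacter ℂ q}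

lemma integrable_zetaL_mul_roughPoly (hχ1 : χ ≠ 1) (z M : ℕ) {h : ℝ} (hh1 : h ≤ 1) :
    Integrable fun t : ℝ => ‖zetaL χ (((1 / 2 : ℝ) : ℂ) + t * I)‖ ^ 2 *
      ‖roughPoly q z M t‖ * halfKernel h t := by
  obtain ⟨C, hC, hZ⟩ := exists_norm_zetaL_half_sq_le hχ1
  have h1 : (1 : ℝ) < 201 / 100 := by norm_num
  have hint := ((integrable_rpow_neg_one_add_norm_sq (E := ℝ) (μ := volume)
    (r := 201 / 100) (by simpa using h1))).const_mul (C * (1 + Real.log M) * 72)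
  refine hint.mono' ((((continuous_zetaL_half hχ1).norm.pow 2).mul
    (continuous_roughPoly q z M).norm).mul (continuous_halfKernel h)).aestronglyMeasurable
    (ae_of_all _ fun t => ?_)
  rw [Real.norm_of_nonneg (mul_nonneg (by positivity) (halfKernel_nonneg h t))]
  have hB := norm_roughPoly_le q z M t
  have h0 : (0 : ℝ) < 1 + t ^ 2 := by positivity
  have hM := (norm_nonneg _).trans hB
  calc _ ≤ (C * (1 + t ^ 2) ^ (99 / 200 : ℝ)) * (1 + Real.log M) *
        (72 * (1 + t ^ 2) ^ (-(3 / 2) : ℝ)) := by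
        have := hZ t
        have := halfKernel_le_cube hh1 t
        have := halfKernel_nonneg h t
        gcongr
    _ = C * (1 + Real.log M) * 72 *
        ((1 + t ^ 2) ^ (99 / 200 : ℝ) * (1 + t ^ 2) ^ (-(3 / 2) : ℝ)) := by ring
    _ = _ := by
        rw [← Real.rpow_add h0, Real.norm_eq_abs, sq_abs]
        norm_num

lemma exists_setIntegral_tail_le (hχ1 : χ ≠ 1) :
    ∃ C, 0 < C ∧ ∀ {Λ h R : ℝ} {z M : ℕ}, 0 ≤ Λ → h ≤ 1 → 1 ≤ 4 * Real.exp (Λ / 2) * h ^ 2 →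
      1 + Real.log M ≤ 4 * Λ → Real.exp Λ ≤ R →
      ∫ t in {t | R < |t|}, ‖zetaL χ (((1 / 2 : ℝ) : ℂ) + t * I)‖ ^ 2 *
        ‖roughPoly q z M t‖ * halfKernel h t ≤ C * (h ^ 2 * Λ) := by
  obtain ⟨C, hC, hZ⟩ := exists_norm_zetaL_half_sq_le hχ1
  have hint := ((integrable_rpow_neg_one_add_norm_sq (E := ℝ) (μ := volume)
    (r := 151 / 100) (by simpa using (by norm_num : (1 : ℝ) < 151 / 100))))
  obtain ⟨D, hD⟩ : ∃ D, D = ∫ t : ℝ, (1 + ‖t‖ ^ 2) ^ (-(151 / 100 : ℝ) / 2) := ⟨_, rfl⟩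
  have hD0 : 0 ≤ D := by rw [hD]; exact integral_nonneg fun t => by positivity
  refine ⟨C * 4 * 72 * 4 * D + 1, by positivity, fun {Λ h R z M} hΛ hh1 hh hM hR => ?_⟩
  have hmeas : MeasurableSet {t : ℝ | R < |t|} := measurableSet_lt measurable_const (by fun_prop)
  calc _ ≤ ∫ t in {t : ℝ | R < |t|}, C * 4 * 72 * 4 * (h ^ 2 * Λ) *
        (1 + ‖t‖ ^ 2) ^ (-(151 / 100 : ℝ) / 2) := by
        refine setIntegral_mono_on (integrable_zetaL_mul_roughPoly hχ1 z M hh1).integrableOn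
          (hint.const_mul _).integrableOn hmeas fun t (ht : R < |t|) => ?_
        have hB := (norm_roughPoly_le q z M t).trans hM
        have h0 : (0 : ℝ) < 1 + t ^ 2 := by positivity
        have hexp : Real.exp (Λ / 2) ≤ (1 + t ^ 2) ^ (1 / 4 : ℝ) := by
          rw [show (1 / 4 : ℝ) = 1 / 2 * (1 / 2) by norm_num, Real.rpow_mul h0.le,
            ← Real.sqrt_eq_rpow, ← Real.sqrt_eq_rpow]
          refine Real.le_sqrt_of_sq_le (Real.le_sqrt_of_sq_le ?_)
          rw [← pow_mul, ← Real.exp_nat_mul]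
          have h1 : Real.exp Λ ^ 2 ≤ |t| ^ 2 := by
            have := hR.trans ht.le
            gcongr
          rw [sq_abs, ← Real.exp_nat_mul] at h1
          have h2 : ((2 * 2 : ℕ) : ℝ) * (Λ / 2) = (2 : ℕ) * Λ := by push_cast; ring
          rw [h2]
          linarith
        calc _ ≤ (C * (1 + t ^ 2) ^ (99 / 200 : ℝ)) * (4 * Λ) *
              (72 * (1 + t ^ 2) ^ (-(3 / 2) : ℝ)) * 1 := by
              have := hZ t
              have := halfKernel_le_cube hh1 t
              have := halfKernel_nonneg h t
              rw [mul_one]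
              gcongr
          _ ≤ (C * (1 + t ^ 2) ^ (99 / 200 : ℝ)) * (4 * Λ) *
              (72 * (1 + t ^ 2) ^ (-(3 / 2) : ℝ)) * (4 * (1 + t ^ 2) ^ (1 / 4 : ℝ) * h ^ 2) := by
              gcongr
              exact hh.trans (by gcongr)
          _ = C * 4 * 72 * 4 * (h ^ 2 * Λ) * ((1 + t ^ 2) ^ (99 / 200 : ℝ) *
              (1 + t ^ 2) ^ (-(3 / 2) : ℝ) * (1 + t ^ 2) ^ (1 / 4 : ℝ)) := by ring
          _ = _ := by
              rw [← Real.rpow_add h0, ← Real.rpow_add h0, Real.norm_eq_abs, sq_abs]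
              norm_num
    _ ≤ ∫ t : ℝ, C * 4 * 72 * 4 * (h ^ 2 * Λ) * (1 + ‖t‖ ^ 2) ^ (-(151 / 100 : ℝ) / 2) :=
        setIntegral_le_integral (hint.const_mul _) (ae_of_all _ fun t => by positivity)
    _ = C * 4 * 72 * 4 * D * (h ^ 2 * Λ) := by rw [integral_const_mul, ← hD]; ring
    _ ≤ _ := by
        have : 0 ≤ h ^ 2 * Λ := by positivity
        linarith

lemma exists_integral_rough_annulus_kernel_le (hχ : χ ^ 2 = 1) (hχ1 : χ ≠ 1) :
    ∃ C, 0 < C ∧ ∀ {Λ h : ℝ} {z J j : ℕ}, 4 ≤ Λ → 0 < h → h ≤ 1 → Λ ^ 1000 ≤ z → J ≤ 2 * Λ →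
      1 + Real.log ((z * 2 ^ J : ℕ) : ℝ) ≤ 4 * Λ → (2 : ℝ) ^ j ≤ Real.exp Λ →
      ∫ t in dyadicAnnulus (3 * 2 ^ j), ‖zetaL χ (((1 / 2 : ℝ) : ℂ) + t * I)‖ ^ 2 *
        ‖roughPoly q z (z * 2 ^ J) t‖ * halfKernel h t ≤
      C * h ^ 2 * (Λ ^ 2 + if (j : ℝ) ≤ 2 * Λ ^ (2 / 3 : ℝ) then Λ * Λ ^ (4 / 3 : ℝ) else 0) := by
  obtain ⟨C₁, hC₁, h₁⟩ := exists_integral_zetaL_half_le hχ hχ1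
  obtain ⟨C₂, hC₂, h₂⟩ := exists_integral_rough_annulus_le hχ hχ1
  refine ⟨36 * C₂ + 576 * C₁, by positivity, fun {Λ h z J j} hΛ hh hh1 hz hJ hM hj => ?_⟩
  obtain ⟨T, hT⟩ : ∃ T : ℝ, T = 3 * 2 ^ j := ⟨_, rfl⟩
  rw [← hT]
  have hT3 : 3 ≤ T := by
    rw [hT]
    exact le_mul_of_one_le_right (by norm_num) (one_le_pow₀ (by norm_num))
  have hT0 : 0 < T := by linarith
  have hlogT : Real.log T = Real.log 3 + j * Real.log 2 := by
    rw [hT, Real.log_mul (by norm_num) (by positivity), Real.log_pow]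
  have hlog3 : Real.log 3 ≤ 2 := by
    have := Real.log_le_sub_one_of_pos (by norm_num : (0 : ℝ) < 3)
    linarith
  have hlog3' : 0 < Real.log 3 := Real.log_pos (by norm_num)
  have hlog2 := Real.log_two_gt_d9
  have hlog2' := Real.log_two_lt_d9
  have hjΛ : j * Real.log 2 ≤ Λ := by
    rw [← Real.log_pow]
    exact (Real.log_le_log (by positivity) hj).trans_eq (Real.log_exp Λ)
  have hlog0 : 0 ≤ Real.log T := by rw [hlogT]; positivity
  have hcpt := isCompact_dyadicAnnulus T
  have hZc := (continuous_zetaL_half hχ1).norm.pow 2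
  have hZBi : IntegrableOn (fun t : ℝ => ‖zetaL χ (((1 / 2 : ℝ) : ℂ) + t * I)‖ ^ 2 *
      ‖roughPoly q z (z * 2 ^ J) t‖) (dyadicAnnulus T) :=
    (hZc.mul (continuous_roughPoly q z _).norm).continuousOn.integrableOn_compact hcpt
  have hker : ∫ t in dyadicAnnulus T, ‖zetaL χ (((1 / 2 : ℝ) : ℂ) + t * I)‖ ^ 2 *
        ‖roughPoly q z (z * 2 ^ J) t‖ * halfKernel h t ≤
      9 * h ^ 2 / T * ∫ t in dyadicAnnulus T, ‖zetaL χ (((1 / 2 : ℝ) : ℂ) + t * I)‖ ^ 2 *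
        ‖roughPoly q z (z * 2 ^ J) t‖ := by
    rw [← integral_const_mul]
    refine setIntegral_mono_on (integrable_zetaL_mul_roughPoly hχ1 z _ hh1).integrableOn
      (hZBi.const_mul _) (measurableSet_dyadicAnnulus T) fun t ht => ?_
    rw [mul_comm]
    have := halfKernel_le_div hh hh1 hT0 (ht.1.trans (abs_le_norm_half_add t))
    gcongr
  refine hker.trans ?_
  have hΛ0 : 0 < Λ := by linarith
  split_ifs with hjl
  · have hl : Real.log T ≤ 4 * Λ ^ (2 / 3 : ℝ) := by
      have h3 : 1 ≤ Λ ^ (2 / 3 : ℝ) := Real.one_le_rpow (by linarith) (by norm_num)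
      rw [hlogT]
      nlinarith [Nat.cast_nonneg (α := ℝ) j]
    have hl2 : Real.log T ^ 2 ≤ 16 * Λ ^ (4 / 3 : ℝ) := by
      calc _ ≤ (4 * Λ ^ (2 / 3 : ℝ)) ^ 2 := by gcongr
        _ = _ := by
          rw [mul_pow, ← Real.rpow_mul_natCast hΛ0.le]
          norm_num
    calc _ ≤ 9 * h ^ 2 / T * ∫ t in dyadicAnnulus T,
          4 * Λ * ‖zetaL χ (((1 / 2 : ℝ) : ℂ) + t * I)‖ ^ 2 := by
          refine mul_le_mul_of_nonneg_left (setIntegral_mono_on hZBi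
            ((continuous_const.mul hZc).continuousOn.integrableOn_compact hcpt)
            (measurableSet_dyadicAnnulus T) fun t _ => ?_) (by positivity)
          rw [mul_comm]
          have := (norm_roughPoly_le q z (z * 2 ^ J) t).trans hM
          gcongr
      _ ≤ 9 * h ^ 2 / T * (4 * Λ * (C₁ * (T * (16 * Λ ^ (4 / 3 : ℝ))))) := by
          rw [integral_const_mul]
          gcongr
          exact (h₁ T hT3).trans (by gcongr)
      _ = 576 * C₁ * h ^ 2 * (Λ * Λ ^ (4 / 3 : ℝ)) := by field_simp; ring
      _ ≤ _ := by
          have h4 : 0 ≤ 36 * C₂ * h ^ 2 * (Λ * Λ ^ (4 / 3 : ℝ)) := by positivity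
          have h5 : 0 ≤ (36 * C₂ + 576 * C₁) * h ^ 2 * Λ ^ 2 := by positivity
          linarith
  · push Not at hjl
    have hl : Λ ^ (2 / 3 : ℝ) ≤ Real.log T := by
      rw [hlogT]
      nlinarith [Nat.cast_nonneg (α := ℝ) j]
    have hl3 : Λ ^ 2 ≤ Real.log T ^ 3 := by
      calc Λ ^ 2 = (Λ ^ (2 / 3 : ℝ)) ^ 3 := by
            rw [← Real.rpow_mul_natCast hΛ0.le]
            norm_num
        _ ≤ _ := by gcongr
    have hlT : Real.log T ≤ 2 * Λ := by rw [hlogT]; linarith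
    calc _ ≤ 9 * h ^ 2 / T * (C₂ * (T * Real.log T ^ 2)) := by
          gcongr
          exact h₂ hΛ hT3 (by rw [hlogT]; linarith) hz hJ hl3
      _ ≤ 9 * h ^ 2 / T * (C₂ * (T * (2 * Λ) ^ 2)) := by gcongr
      _ = 36 * C₂ * h ^ 2 * Λ ^ 2 := by field_simp; ring
      _ ≤ _ := by
          rw [add_zero]
          have h4 : 0 ≤ 576 * C₁ * h ^ 2 * Λ ^ 2 := by positivity
          linarith

lemma exists_integral_rough_le (hχ : χ ^ 2 = 1) (hχ1 : χ ≠ 1) :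
    ∃ C, 0 < C ∧ ∀ {Λ h : ℝ} {z J : ℕ}, 4 ≤ Λ → 0 < h → h ≤ 1 →
      1 ≤ 4 * Real.exp (Λ / 2) * h ^ 2 → Λ ^ 1000 ≤ z → J ≤ 2 * Λ →
      1 + Real.log ((z * 2 ^ J : ℕ) : ℝ) ≤ 4 * Λ →
      ∫ t : ℝ, ‖zetaL χ (((1 / 2 : ℝ) : ℂ) + t * I)‖ ^ 2 *
        ‖roughPoly q z (z * 2 ^ J) t‖ * halfKernel h t ≤ C * (h ^ 2 * Λ ^ 3) := by
  obtain ⟨C₁, hC₁, h₁⟩ := exists_setIntegral_tail_le hχ1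
  obtain ⟨C₂, hC₂, h₂⟩ := exists_integral_rough_annulus_kernel_le hχ hχ1
  have hZc := (continuous_zetaL_half hχ1).norm.pow 2
  obtain ⟨D, hD⟩ : ∃ D, D = ∫ t in Set.Icc (-3 : ℝ) 3,
    ‖zetaL χ (((1 / 2 : ℝ) : ℂ) + t * I)‖ ^ 2 := ⟨_, rfl⟩
  have hD0 : 0 ≤ D := by rw [hD]; exact integral_nonneg fun t => by positivity
  refine ⟨72 * D + C₂ * 7 + C₁, by positivity, fun {Λ h z J} hΛ hh hh1 hhΛ hz hJ hM => ?_⟩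
  have hΛ0 : 0 < Λ := by linarith
  obtain ⟨n, hn, hn2⟩ := exists_nat_pow_near (Real.one_le_exp hΛ0.le) (one_lt_two (α := ℝ))
  have hnΛ : (n : ℝ) ≤ 2 * Λ := by
    have h3 := Real.log_le_log (by positivity) hn
    rw [Real.log_exp, Real.log_pow] at h3
    nlinarith [Real.log_two_gt_d9, Nat.cast_nonneg (α := ℝ) n]
  have hi := integrable_zetaL_mul_roughPoly hχ1 z (z * 2 ^ J) hh1
  have h0 : ∀ t : ℝ, 0 ≤ ‖zetaL χ (((1 / 2 : ℝ) : ℂ) + t * I)‖ ^ 2 *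
      ‖roughPoly q z (z * 2 ^ J) t‖ * halfKernel h t := fun t =>
    mul_nonneg (by positivity) (halfKernel_nonneg h t)
  have hmid : ∫ t in Set.Icc (-3 : ℝ) 3, ‖zetaL χ (((1 / 2 : ℝ) : ℂ) + t * I)‖ ^ 2 *
      ‖roughPoly q z (z * 2 ^ J) t‖ * halfKernel h t ≤ 72 * D * (h ^ 2 * Λ) := by
    calc _ ≤ ∫ t in Set.Icc (-3 : ℝ) 3,
          ‖zetaL χ (((1 / 2 : ℝ) : ℂ) + t * I)‖ ^ 2 * (4 * Λ * (9 * h ^ 2 / (1 / 2))) := by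
          refine setIntegral_mono_on hi.integrableOn ((hZc.mul
            continuous_const).continuousOn.integrableOn_compact isCompact_Icc)
            measurableSet_Icc fun t _ => ?_
          rw [mul_assoc]
          have := (norm_roughPoly_le q z (z * 2 ^ J) t).trans hM
          have := halfKernel_le_div hh hh1 (by norm_num) (half_le_norm_half_add t)
          have := halfKernel_nonneg h t
          gcongr
      _ = _ := by rw [integral_mul_const, ← hD]; ring
  have htail := h₁ hΛ0.le hh1 hhΛ hM (R := 3 * 2 ^ (n + 1)) (z := z)
    (by nlinarith [Real.exp_pos Λ])
  have hsum : ∑ j ∈ Finset.range (n + 1), ∫ t in dyadicAnnulus (3 * 2 ^ j),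
      ‖zetaL χ (((1 / 2 : ℝ) : ℂ) + t * I)‖ ^ 2 * ‖roughPoly q z (z * 2 ^ J) t‖ *
        halfKernel h t ≤ C₂ * h ^ 2 * (7 * Λ ^ 3) := by
    refine (Finset.sum_le_sum fun j hj => h₂ hΛ hh hh1 hz hJ hM ((pow_le_pow_right₀ one_le_two
      (Nat.lt_succ_iff.1 (Finset.mem_range.1 hj))).trans hn)).trans ?_
    rw [← Finset.mul_sum, Finset.sum_add_distrib, ← Finset.sum_filter, Finset.sum_const,
      Finset.sum_const, Finset.card_range, nsmul_eq_mul, nsmul_eq_mul]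
    have h3 : 1 ≤ Λ ^ (2 / 3 : ℝ) := Real.one_le_rpow (by linarith) (by norm_num)
    have hcard : (((Finset.range (n + 1)).filter fun j : ℕ =>
        (j : ℝ) ≤ 2 * Λ ^ (2 / 3 : ℝ)).card : ℝ) ≤ 3 * Λ ^ (2 / 3 : ℝ) := by
      have h4 : ((Finset.range (n + 1)).filter fun j : ℕ => (j : ℝ) ≤ 2 * Λ ^ (2 / 3 : ℝ)) ⊆
          Finset.range (⌊2 * Λ ^ (2 / 3 : ℝ)⌋₊ + 1) := fun j hj =>
        Finset.mem_range.2 (Nat.lt_succ_iff.2 (Nat.le_floor (Finset.mem_filter.1 hj).2))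
      have h5 := Finset.card_le_card h4
      rw [Finset.card_range] at h5
      have h6 : (⌊2 * Λ ^ (2 / 3 : ℝ)⌋₊ : ℝ) ≤ 2 * Λ ^ (2 / 3 : ℝ) :=
        Nat.floor_le (by positivity)
      have h7 : (((Finset.range (n + 1)).filter fun j : ℕ =>
        (j : ℝ) ≤ 2 * Λ ^ (2 / 3 : ℝ)).card : ℝ) ≤ ⌊2 * Λ ^ (2 / 3 : ℝ)⌋₊ + 1 := by
        exact_mod_cast h5
      linarith
    have h8 : Λ ^ (2 / 3 : ℝ) * (Λ * Λ ^ (4 / 3 : ℝ)) = Λ ^ 3 := by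
      rw [mul_left_comm, ← Real.rpow_add hΛ0]
      norm_num
      ring
    gcongr
    calc _ ≤ (2 * Λ + 1) * Λ ^ 2 + 3 * Λ ^ (2 / 3 : ℝ) * (Λ * Λ ^ (4 / 3 : ℝ)) := by
          push_cast
          gcongr
      _ ≤ _ := by
          rw [mul_assoc 3, h8]
          nlinarith [sq_nonneg Λ]
  refine (integral_le_dyadic_sum hi h0 3 (n + 1)).trans ?_
  have h9 : h ^ 2 * Λ ≤ h ^ 2 * Λ ^ 3 := by
    gcongr
    exact le_self_pow₀ (by linarith) (by norm_num)
  have h10 : 72 * D * (h ^ 2 * Λ) ≤ 72 * D * (h ^ 2 * Λ ^ 3) := by gcongr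
  have h11 : C₁ * (h ^ 2 * Λ) ≤ C₁ * (h ^ 2 * Λ ^ 3) := by gcongr
  linarith

end RoughIntegralBound

section MainTerm

lemma secondDiff_mul_log (a b : ℂ) (h : ℝ) {X : ℝ} (hX : 0 < X) :
    secondDiff (fun X => X * (a * Real.log X + b)) h X =
      X * (((Real.exp h - 1) ^ 2 : ℝ) * (a * Real.log X + b) +
        a * (2 * h * (Real.exp h * (Real.exp h - 1)) : ℝ)) := by
  have h2 : Real.exp (2 * h) = Real.exp h ^ 2 := by rw [← Real.exp_nat_mul]; norm_num
  rw [secondDiff, Real.log_mul hX.ne' (Real.exp_ne_zero _), Real.log_mul hX.ne'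
    (Real.exp_ne_zero _), Real.log_exp, Real.log_exp, h2]
  push_cast
  ring

lemma exists_exp_sub_one_approx {h : ℝ} (hh : 0 < h) (hh1 : h ≤ 1) :
    ∃ ε₁ ε₂ : ℝ, |ε₁| ≤ 3 * h ∧ |ε₂| ≤ 5 * h ∧ (Real.exp h - 1) ^ 2 = h ^ 2 * (1 + ε₁) ∧
      2 * h * (Real.exp h * (Real.exp h - 1)) = h ^ 2 * (2 * (1 + ε₂)) := by
  obtain ⟨r, hr⟩ : ∃ r, r = Real.exp h - 1 - h := ⟨_, rfl⟩
  have hr2 : |r| ≤ h ^ 2 := by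
    rw [hr]
    exact Real.abs_exp_sub_one_sub_id_le (by rwa [abs_of_pos hh])
  obtain ⟨hr3, hr4⟩ := abs_le.1 hr2
  have he : Real.exp h = 1 + h + r := by rw [hr]; ring
  have hhh : h ^ 2 ≤ h := by nlinarith
  refine ⟨(2 * h * r + r ^ 2) / h ^ 2, (r + (h + r) ^ 2) / h, ?_, ?_, ?_, ?_⟩
  · rw [abs_div, abs_of_pos (by positivity : 0 < h ^ 2), div_le_iff₀ (by positivity), abs_le]
    constructor <;> nlinarith
  · rw [abs_div, abs_of_pos hh, div_le_iff₀ hh, abs_le]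
    constructor <;> nlinarith
  · rw [he]
    field_simp
    ring
  · rw [he]
    field_simp
    ring

lemma exists_norm_main_sub_le (a b S₀ S₁ : ℂ) {D : ℝ} (hD : 0 ≤ D) :
    ∃ C, 0 < C ∧ ∀ {y h : ℝ} {s₀ s₁ : ℂ}, 1 ≤ y → 1 ≤ Real.log y → 0 < h → h ≤ y ^ (-(1 / 2) : ℝ) →
      ‖s₀ - S₀‖ ≤ D * y ^ (-(1 / 2) : ℝ) → ‖s₁ - S₁‖ ≤ D * y ^ (-(1 / 2) : ℝ) →
      ‖y * ((((Real.exp h - 1) ^ 2 : ℝ) * (a * Real.log y + b) +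
        a * (2 * h * (Real.exp h * (Real.exp h - 1)) : ℝ)) * s₀ -
          a * ((Real.exp h - 1) ^ 2 : ℝ) * s₁) -
        h ^ 2 * (y * (a * S₀ * Real.log y + ((b + 2 * a) * S₀ - a * S₁)))‖ ≤
      C * (h ^ 2 * (y ^ (1 / 2 : ℝ) * Real.log y)) := by
  refine ⟨(3 * (‖a‖ + ‖b‖) + 10 * ‖a‖) * (‖S₀‖ + D) + (3 * ‖a‖ + ‖b‖) * D +
    3 * ‖a‖ * (‖S₁‖ + D) + ‖a‖ * D + 1, by positivity,
    fun {y h s₀ s₁} hy hY hh hhy h₀ h₁ => ?_⟩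
  obtain ⟨δ, hδ⟩ : ∃ δ, δ = y ^ (-(1 / 2) : ℝ) := ⟨_, rfl⟩
  obtain ⟨Y, hY'⟩ : ∃ Y, Y = Real.log y := ⟨_, rfl⟩
  rw [← hδ] at hhy h₀ h₁
  rw [← hY'] at hY
  have hδ1 : δ ≤ 1 := hδ ▸ Real.rpow_le_one_of_one_le_of_nonpos hy (by norm_num)
  have hδ0 : 0 < δ := hh.trans_le hhy
  have hyδ : y ^ (1 / 2 : ℝ) = y * δ := by
    rw [hδ]
    nth_rw 2 [← Real.rpow_one y]
    rw [← Real.rpow_add (by linarith)]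
    norm_num
  obtain ⟨ε₁, ε₂, hε₁, hε₂, he₁, he₂⟩ := exists_exp_sub_one_approx hh (hhy.trans hδ1)
  have hε₁' : ‖(ε₁ : ℂ)‖ ≤ 3 * δ := by rw [norm_real]; exact hε₁.trans (by gcongr)
  have hε₂' : ‖(ε₂ : ℂ)‖ ≤ 5 * δ := by rw [norm_real]; exact hε₂.trans (by gcongr)
  obtain ⟨η₀, rfl⟩ : ∃ η, s₀ = S₀ + η := ⟨s₀ - S₀, by ring⟩
  obtain ⟨η₁, rfl⟩ : ∃ η, s₁ = S₁ + η := ⟨s₁ - S₁, by ring⟩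
  rw [add_sub_cancel_left] at h₀ h₁
  have hYn : ‖(Y : ℂ)‖ = Y := by rw [norm_real, Real.norm_of_nonneg (by linarith)]
  have hbY : ‖b‖ ≤ ‖b‖ * Y := le_mul_of_one_le_right (norm_nonneg _) hY
  have haY : ‖a‖ ≤ ‖a‖ * Y := le_mul_of_one_le_right (norm_nonneg _) hY
  have hη₀ : ‖S₀ + η₀‖ ≤ ‖S₀‖ + D :=
    (norm_add_le _ _).trans (add_le_add_right (h₀.trans (mul_le_of_le_one_right hD hδ1)) _)
  have hη₁ : ‖S₁ + η₁‖ ≤ ‖S₁‖ + D :=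
    (norm_add_le _ _).trans (add_le_add_right (h₁.trans (mul_le_of_le_one_right hD hδ1)) _)
  rw [he₁, he₂, ← hY', hyδ]
  have hid : (y : ℂ) * ((((h ^ 2 * (1 + ε₁) : ℝ) : ℂ) * (a * Y + b) +
        a * (h ^ 2 * (2 * (1 + ε₂)) : ℝ)) * (S₀ + η₀) -
          a * (h ^ 2 * (1 + ε₁) : ℝ) * (S₁ + η₁)) -
        h ^ 2 * (y * (a * S₀ * Y + ((b + 2 * a) * S₀ - a * S₁))) =
      ((h ^ 2 * y : ℝ) : ℂ) * ((ε₁ * (a * Y + b) + 2 * a * ε₂) * (S₀ + η₀) +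
        (a * Y + b + 2 * a) * η₀ - a * ε₁ * (S₁ + η₁) - a * η₁) := by
    push_cast
    ring
  have h2a : ‖2 * a‖ = 2 * ‖a‖ := by rw [norm_mul]; norm_num
  have hB₁ : ‖a * Y + b‖ ≤ (‖a‖ + ‖b‖) * Y := by
    refine (norm_add_le _ _).trans ?_
    rw [norm_mul, hYn]
    linarith
  have hB₂ : ‖a * Y + b + 2 * a‖ ≤ (3 * ‖a‖ + ‖b‖) * Y := by
    refine (norm_add_le _ _).trans ?_
    rw [h2a]
    linarith
  have t₁ : ‖(ε₁ * (a * Y + b) + 2 * a * ε₂) * (S₀ + η₀)‖ ≤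
      (3 * (‖a‖ + ‖b‖) + 10 * ‖a‖) * (‖S₀‖ + D) * (δ * Y) := by
    rw [norm_mul]
    calc _ ≤ (3 * δ * ((‖a‖ + ‖b‖) * Y) + 2 * (‖a‖ * Y) * (5 * δ)) * (‖S₀‖ + D) := by
          gcongr
          refine (norm_add_le _ _).trans ?_
          rw [norm_mul, norm_mul, h2a]
          gcongr
      _ = _ := by ring
  have t₂ : ‖(a * Y + b + 2 * a) * η₀‖ ≤ (3 * ‖a‖ + ‖b‖) * D * (δ * Y) := by
    rw [norm_mul]
    exact (mul_le_mul hB₂ h₀ (norm_nonneg _) (by positivity)).trans_eq (by ring)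
  have t₃ : ‖a * ε₁ * (S₁ + η₁)‖ ≤ 3 * ‖a‖ * (‖S₁‖ + D) * (δ * Y) := by
    rw [norm_mul, norm_mul]
    calc _ ≤ ‖a‖ * Y * (3 * δ) * (‖S₁‖ + D) := by gcongr
      _ = _ := by ring
  have t₄ : ‖a * η₁‖ ≤ ‖a‖ * D * (δ * Y) := by
    rw [norm_mul]
    calc _ ≤ ‖a‖ * Y * (D * δ) := by gcongr
      _ = _ := by ring
  rw [hid, norm_mul, norm_real, Real.norm_of_nonneg (by positivity)]
  calc _ ≤ h ^ 2 * y * (((3 * (‖a‖ + ‖b‖) + 10 * ‖a‖) * (‖S₀‖ + D) + (3 * ‖a‖ + ‖b‖) * D +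
          3 * ‖a‖ * (‖S₁‖ + D) + ‖a‖ * D + 1) * (δ * Y)) := by
        gcongr
        have := norm_sub_le ((ε₁ * (a * Y + b) + 2 * a * ε₂) * (S₀ + η₀) +
          (a * Y + b + 2 * a) * η₀ - a * ε₁ * (S₁ + η₁)) (a * η₁)
        have := norm_sub_le ((ε₁ * (a * Y + b) + 2 * a * ε₂) * (S₀ + η₀) +
          (a * Y + b + 2 * a) * η₀) (a * ε₁ * (S₁ + η₁))
        have := norm_add_le ((ε₁ * (a * Y + b) + 2 * a * ε₂) * (S₀ + η₀))
          ((a * Y + b + 2 * a) * η₀)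
        have : 0 ≤ δ * Y := by positivity
        linarith
    _ = _ := by ring

lemma norm_sum_sub_tsum_le {c : ℕ → ℂ} {D : ℝ} (hD : 0 ≤ D)
    (hc : ∀ m, ‖c m‖ ≤ D * (m : ℝ) ^ (-(7 / 4) : ℝ)) {s : Finset ℕ} {M : ℕ} {y : ℝ} (hy : 0 < y)
    (hyM : y ≤ M) (hs : ∀ m, c m ≠ 0 → m ≤ M → m ∈ s) :
    Summable c ∧ ‖(∑ m ∈ s, c m) - ∑' m, c m‖ ≤
      D * (∑' m : ℕ, (m : ℝ) ^ (-(5 / 4) : ℝ)) * y ^ (-(1 / 2) : ℝ) := by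
  have h54 : Summable fun m : ℕ => (m : ℝ) ^ (-(5 / 4) : ℝ) :=
    Real.summable_nat_rpow.2 (by norm_num)
  have hsum : Summable c := .of_norm_bounded
    ((Real.summable_nat_rpow.2 (by norm_num : (-(7 / 4) : ℝ) < -1)).mul_left D) hc
  refine ⟨hsum, ?_⟩
  have hb : ∀ m : ℕ, ‖if m ∈ s then 0 else c m‖ ≤
      D * y ^ (-(1 / 2) : ℝ) * (m : ℝ) ^ (-(5 / 4) : ℝ) := by
    intro m
    by_cases h : m ∈ s ∨ c m = 0
    · rw [show (if m ∈ s then 0 else c m) = 0 by split_ifs <;> tauto, norm_zero]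
      positivity
    · push Not at h
      have hm : y < m := hyM.trans_lt (by
        have := mt (hs m h.2) h.1
        exact_mod_cast not_le.1 this)
      have hm0 : (0 : ℝ) < m := hy.trans hm
      rw [if_neg h.1]
      calc _ ≤ D * ((m : ℝ) ^ (-(1 / 2) : ℝ) * (m : ℝ) ^ (-(5 / 4) : ℝ)) := by
            rw [← Real.rpow_add hm0]
            norm_num
            exact_mod_cast hc m
        _ ≤ D * (y ^ (-(1 / 2) : ℝ) * (m : ℝ) ^ (-(5 / 4) : ℝ)) := by
            gcongr ?_ * (?_ * ?_)
            exact Real.rpow_le_rpow_of_nonpos hy hm.le (by norm_num)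
        _ = _ := by ring
  have hsplit : (∑ m ∈ s, c m) + ∑' m, (if m ∈ s then 0 else c m) = ∑' m, c m := by
    have h1 : ∑ m ∈ s, c m = ∑' m, if m ∈ s then c m else 0 := by
      rw [tsum_eq_sum (s := s) fun m hm => if_neg hm]
      exact Finset.sum_congr rfl fun m hm => (if_pos hm).symm
    rw [h1, ← Summable.tsum_add]
    · refine tsum_congr fun m => ?_
      split_ifs <;> simp
    · exact summable_of_ne_finset_zero (s := s) fun m hm => if_neg hm
    · exact .of_norm_bounded (h54.mul_left _) hb
  rw [← hsplit, sub_add_cancel_left, norm_neg]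
  refine (tsum_of_norm_bounded (h54.mul_left _).hasSum hb).trans_eq ?_
  rw [tsum_mul_left]
  ring

end MainTerm

section SecondDiffAsymptotic

/-- The value at `s = 1` of the Dirichlet series `ζ(2 * s)⁻¹ ∏_{p ∣ q} (1 + p^{-s})⁻¹`. -/
noncomputable def eulerConst (q : ℕ) : ℂ :=
  ∑ e ∈ q.divisors, (ArithmeticFunction.moebius e : ℂ) *
    ∑' m : ℕ, moebiusCoprime q m * (1 / (e * m ^ 2) : ℝ)

/-- The negative of the derivative at `s = 1` of the Dirichlet series
`ζ(2 * s)⁻¹ ∏_{p ∣ q} (1 + p^{-s})⁻¹`. -/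
noncomputable def eulerLogConst (q : ℕ) : ℂ :=
  ∑ e ∈ q.divisors, (ArithmeticFunction.moebius e : ℂ) *
    ∑' m : ℕ, moebiusCoprime q m * (Real.log (e * m ^ 2) / (e * m ^ 2) : ℝ)

lemma norm_intCast_moebius_le (e : ℕ) : ‖(ArithmeticFunction.moebius e : ℂ)‖ ≤ 1 := by
  rw [norm_intCast]
  exact_mod_cast ArithmeticFunction.abs_moebius_le_one

lemma moebiusCoprime_zero (q : ℕ) : moebiusCoprime q 0 = 0 :=
  moebiusCoprime_eq_zero (by simp)

lemma norm_moebiusCoprime_mul_le (q m : ℕ) {e : ℕ} (he : 0 < e) :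
    ‖moebiusCoprime q m * (1 / (e * m ^ 2) : ℝ)‖ ≤ 9 * (m : ℝ) ^ (-(7 / 4) : ℝ) ∧
    ‖moebiusCoprime q m * (Real.log (e * m ^ 2) / (e * m ^ 2) : ℝ)‖ ≤
      9 * (m : ℝ) ^ (-(7 / 4) : ℝ) := by
  rcases Nat.eq_zero_or_pos m with rfl | hm
  · rw [moebiusCoprime_zero, zero_mul, zero_mul, norm_zero]
    constructor <;> positivity
  have he1 : (1 : ℝ) ≤ e := by exact_mod_cast he
  have hm1 : (1 : ℝ) ≤ m := by exact_mod_cast hm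
  have hm0 : (0 : ℝ) < m := by linarith
  have hν := norm_moebiusCoprime_le q m
  have hpow : (m : ℝ) ^ (-(7 / 4) : ℝ) = (m : ℝ) ^ (1 / 4 : ℝ) / m ^ 2 := by
    rw [eq_div_iff (by positivity), ← Real.rpow_natCast, ← Real.rpow_add hm0]
    norm_num
  have hq : 1 ≤ (m : ℝ) ^ (1 / 4 : ℝ) := Real.one_le_rpow hm1 (by norm_num)
  have h1 : (1 / (e * m ^ 2) : ℝ) ≤ (m : ℝ) ^ (1 / 4 : ℝ) / m ^ 2 := by
    gcongr
    exact le_mul_of_one_le_left (by positivity) he1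
  have hlog : 0 ≤ Real.log (e * m ^ 2) :=
    Real.log_nonneg (one_le_mul_of_one_le_of_one_le he1 (one_le_pow₀ hm1))
  have h2 : Real.log (e * m ^ 2) / (e * m ^ 2) ≤ 9 * ((m : ℝ) ^ (1 / 4 : ℝ) / m ^ 2) := by
    have h3 := Real.log_le_sub_one_of_pos (by linarith : (0 : ℝ) < e)
    have h4 := Real.log_le_rpow_div hm0.le (by norm_num : (0 : ℝ) < 1 / 4)
    have h5 : Real.log (e * m ^ 2) ≤ e * (9 * (m : ℝ) ^ (1 / 4 : ℝ)) := by
      rw [Real.log_mul (by positivity) (by positivity), Real.log_pow]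
      push_cast
      nlinarith
    calc _ ≤ e * (9 * (m : ℝ) ^ (1 / 4 : ℝ)) / (e * m ^ 2) := by gcongr
      _ = _ := by field_simp
  rw [norm_mul, norm_mul, norm_real, norm_real, Real.norm_of_nonneg (by positivity),
    Real.norm_of_nonneg (by positivity), hpow]
  constructor
  · refine (mul_le_of_le_one_left (by positivity) hν).trans (h1.trans ?_)
    exact le_mul_of_one_le_left (by positivity) (by norm_num)
  · exact (mul_le_of_le_one_left (by positivity) hν).trans h2

lemma norm_sum_divisors_sub_le {q M : ℕ} {c : ℕ → ℕ → ℂ} {D y : ℝ} (hD : 0 ≤ D)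
    (hc : ∀ e ∈ q.divisors, ∀ m, ‖c e m‖ ≤ D * (m : ℝ) ^ (-(7 / 4) : ℝ)) (hy : 0 < y)
    (hyM : y ≤ M) {s : Finset ℕ} (hs : ∀ e m, c e m ≠ 0 → m ≤ M → m ∈ s) :
    ‖(∑ e ∈ q.divisors, (ArithmeticFunction.moebius e : ℂ) * ∑ m ∈ s, c e m) -
      ∑ e ∈ q.divisors, (ArithmeticFunction.moebius e : ℂ) * ∑' m, c e m‖ ≤
    q.divisors.card * (D * ∑' m : ℕ, (m : ℝ) ^ (-(5 / 4) : ℝ)) * y ^ (-(1 / 2) : ℝ) := by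
  rw [← Finset.sum_sub_distrib]
  refine (norm_sum_le_of_le _ fun e he => ?_).trans_eq
    ((Finset.sum_const _).trans ((nsmul_eq_mul _ _).trans (mul_assoc _ _ _).symm))
  rw [← mul_sub, norm_mul]
  exact (mul_le_of_le_one_left (norm_nonneg _) (norm_intCast_moebius_le e)).trans
    (norm_sum_sub_tsum_le hD (hc e he) hy hyM (hs e)).2

lemma sum_secondDiff_rieszMain {q : ℕ} (a b : ℂ) (h : ℝ) {y : ℝ} (hy : 0 < y) {s : Finset ℕ}
    (hs0 : 0 ∉ s) :
    ∑ e ∈ q.divisors, (ArithmeticFunction.moebius e : ℂ) * ∑ m ∈ s, moebiusCoprime q m *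
      secondDiff (fun X => X * (a * Real.log X + b)) h (y / (e * m ^ 2)) =
    y * ((((Real.exp h - 1) ^ 2 : ℝ) * (a * Real.log y + b) +
        a * (2 * h * (Real.exp h * (Real.exp h - 1)) : ℝ)) *
          (∑ e ∈ q.divisors, (ArithmeticFunction.moebius e : ℂ) *
            ∑ m ∈ s, moebiusCoprime q m * (1 / (e * m ^ 2) : ℝ)) -
        a * ((Real.exp h - 1) ^ 2 : ℝ) *
          ∑ e ∈ q.divisors, (ArithmeticFunction.moebius e : ℂ) *
            ∑ m ∈ s, moebiusCoprime q m * (Real.log (e * m ^ 2) / (e * m ^ 2) : ℝ)) := by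
  simp_rw [mul_sub, Finset.mul_sum, ← Finset.sum_sub_distrib]
  refine Finset.sum_congr rfl fun e he => Finset.sum_congr rfl fun m hm => ?_
  have he0 : (0 : ℝ) < e := by exact_mod_cast Nat.pos_of_mem_divisors he
  have hm0 : (0 : ℝ) < m := by
    exact_mod_cast Nat.pos_of_ne_zero fun h => hs0 (h ▸ hm)
  rw [secondDiff_mul_log a b h (by positivity), Real.log_div hy.ne' (by positivity)]
  push_cast
  ring

lemma exists_rough_parameters : ∀ᶠ y : ℝ in atTop, ∃ z J : ℕ, 3 ≤ z ∧
    (2 * Real.log y) ^ 1000 ≤ z ∧ (J : ℝ) ≤ 2 * (2 * Real.log y) ∧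
    1 + Real.log ((z * 2 ^ J : ℕ) : ℝ) ≤ 4 * (2 * Real.log y) ∧ y ≤ (z * 2 ^ J : ℕ) ∧
    Real.log z ≤ 3000 * Real.log (Real.log y) := by
  have hlog : ∀ᶠ u : ℝ in atTop, Real.log u ≤ 1 / 3000 * u := by
    filter_upwards [Real.isLittleO_log_id_atTop.bound (by norm_num : (0 : ℝ) < 1 / 3000),
      eventually_ge_atTop 0] with u hu hu0
    exact (le_abs_self _).trans (by simpa [abs_of_nonneg hu0] using hu)
  filter_upwards [Real.tendsto_log_atTop.eventually hlog, eventually_ge_atTop 1,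
    Real.tendsto_log_atTop.eventually_ge_atTop 4,
    (Real.tendsto_log_atTop.comp Real.tendsto_log_atTop).eventually_ge_atTop 1] with y h1 hy h2 h3
  obtain ⟨u, hu⟩ : ∃ u, u = Real.log y := ⟨_, rfl⟩
  simp only [Function.comp_apply] at h3
  rw [← hu] at h1 h2 h3 ⊢
  have hu1 : 1 ≤ (2 * u) ^ 1000 := one_le_pow₀ (by linarith)
  have hz := Nat.le_ceil ((2 * u) ^ 1000)
  have hz2 := Nat.ceil_lt_add_one (by positivity : 0 ≤ (2 * u) ^ 1000)
  have hJ := Nat.le_ceil (2 * u)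
  have hJ2 := Nat.ceil_lt_add_one (by positivity : 0 ≤ 2 * u)
  have hl2 := Real.log_two_gt_d9
  have hl2' := Real.log_two_lt_d9
  have hz0 : (1 : ℝ) ≤ ⌈(2 * u) ^ 1000⌉₊ := hu1.trans hz
  have hlogz : Real.log ⌈(2 * u) ^ 1000⌉₊ ≤ 3000 * Real.log u := by
    have h4 : Real.log ⌈(2 * u) ^ 1000⌉₊ ≤ Real.log (2 * (2 * u) ^ 1000) :=
      Real.log_le_log (by linarith) (by linarith)
    rw [Real.log_mul (by norm_num) (by positivity), Real.log_pow,
      Real.log_mul (by norm_num) (by positivity)] at h4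
    push_cast at h4
    linarith
  refine ⟨⌈(2 * u) ^ 1000⌉₊, ⌈2 * u⌉₊, ?_, hz, by linarith, ?_, ?_, hlogz⟩
  · have : (3 : ℝ) ≤ ⌈(2 * u) ^ 1000⌉₊ :=
      (by linarith : (3 : ℝ) ≤ 2 * u).trans
        ((le_self_pow₀ (by linarith) (by norm_num)).trans hz)
    exact_mod_cast this
  · rw [Nat.cast_mul, Nat.cast_pow, Real.log_mul (by positivity) (by positivity), Real.log_pow]
    push_cast
    nlinarith
  · rw [Nat.cast_mul, Nat.cast_pow]
    calc y = Real.exp u := by rw [hu, Real.exp_log (by linarith)]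
      _ ≤ Real.exp (⌈2 * u⌉₊ * Real.log 2) := Real.exp_le_exp.2 (by nlinarith)
      _ = 2 ^ ⌈2 * u⌉₊ := by rw [← Real.log_pow, Real.exp_log (by positivity)]
      _ ≤ _ := by
          push_cast
          exact le_mul_of_one_le_left (by positivity) hz0

variable {q : ℕ} [NeZero q] {χ : DirichletCharacter ℂ q}

lemma exists_norm_secondDiff_rieszSum_sub_le (hχ : χ ^ 2 = 1) (hχ1 : χ ≠ 1) :
    ∃ C, 0 < C ∧ ∀ᶠ y : ℝ in atTop, ∀ h, 0 < h → h ≤ y ^ (-(1 / 2) : ℝ) → 1 ≤ 4 * y * h ^ 2 →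
      ‖secondDiff (rieszSum fun n => χ.zetaMul n ^ 2) h y - 2 * (h ^ 2 * (y *
        (χ.LFunction 1 ^ 2 * eulerConst q * Real.log y + ((-χ.LFunction 1 ^ 2 + 2 * χ.LFunction 1 *
          (Real.eulerMascheroniConstant * χ.LFunction 1 + deriv χ.LFunction 1)) * eulerConst q -
            χ.LFunction 1 ^ 2 * eulerLogConst q))))‖ ≤
      C * (h ^ 2 * (y ^ (1 / 2 : ℝ) * Real.log y ^ 3 * Real.log (Real.log y))) := by
  obtain ⟨b, hb⟩ : ∃ b, b = 2 * χ.LFunction 1 *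
    (Real.eulerMascheroniConstant * χ.LFunction 1 + deriv χ.LFunction 1) -
      3 * χ.LFunction 1 ^ 2 := ⟨_, rfl⟩
  obtain ⟨a, ha⟩ : ∃ a, a = χ.LFunction 1 ^ 2 := ⟨_, rfl⟩
  obtain ⟨C₁, hC₁, h₁⟩ := exists_integral_rough_le hχ hχ1
  have hK : 0 ≤ ∑' m : ℕ, (m : ℝ) ^ (-(5 / 4) : ℝ) := tsum_nonneg fun m => by positivity
  obtain ⟨C₂, hC₂, h₂⟩ := exists_norm_main_sub_le a b (eulerConst q) (eulerLogConst q)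
    (by positivity : 0 ≤ q.divisors.card * (9 * ∑' m : ℕ, (m : ℝ) ^ (-(5 / 4) : ℝ)))
  refine ⟨2 * C₂ + q.divisors.card * (22 * 3000) * (C₁ * 8), by positivity, ?_⟩
  filter_upwards [exists_rough_parameters, Real.tendsto_log_atTop.eventually_ge_atTop 2,
    eventually_ge_atTop 8,
    (Real.tendsto_log_atTop.comp Real.tendsto_log_atTop).eventually_ge_atTop 1] with
    y ⟨z, J, hz3, hz, hJ, hM, hyM, hlogz⟩ hlog hy hll h hh hhy hhy2
  simp only [Function.comp_apply] at hll
  have hy0 : 0 < y := by linarith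
  have hh1 : h ≤ 1 :=
    hhy.trans (Real.rpow_le_one_of_one_le_of_nonpos (by linarith) (by norm_num))
  obtain ⟨s, hs⟩ : ∃ s, s = smoothMulRough z (z * 2 ^ J) := ⟨_, rfl⟩
  have hs0 : 0 ∉ s := hs ▸ zero_notMem_smoothMulRough z _
  have hsM : ∀ m, Squarefree m → m ≤ z * 2 ^ J → m ∈ s := fun m h1 h2 =>
    hs ▸ mem_smoothMulRough h1 h2
  have hsM2 : ∀ {w : ℂ} {m : ℕ}, moebiusCoprime q m * w ≠ 0 → m ≤ z * 2 ^ J → m ∈ s :=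
    fun {w m} hm hmM => hsM m (by
      by_contra hsq
      exact hm (by rw [moebiusCoprime_eq_zero hsq, zero_mul])) hmM
  have hMy : y * Real.exp (2 * h) < ((z * 2 ^ J : ℕ) : ℝ) ^ 2 := by
    have h3 : Real.exp (2 * h) < 8 := by
      calc _ ≤ Real.exp (1 + 1) := Real.exp_le_exp.2 (by linarith)
        _ < 8 := by
          rw [Real.exp_add]
          nlinarith [Real.exp_one_lt_d9, Real.exp_pos 1]
    calc _ < y * 8 := by gcongr
      _ ≤ y ^ 2 := by nlinarith
      _ ≤ _ := by gcongr
  have hmain := h₂ (by linarith) (by linarith) hh hhy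
    (norm_sum_divisors_sub_le (c := fun e m => moebiusCoprime q m * (1 / (e * m ^ 2) : ℝ))
      (by norm_num) (fun e he m => (norm_moebiusCoprime_mul_le q m
        (Nat.pos_of_mem_divisors he)).1) hy0 hyM fun e m => hsM2)
    (norm_sum_divisors_sub_le (c := fun e m => moebiusCoprime q m *
      (Real.log (e * m ^ 2) / (e * m ^ 2) : ℝ))
      (by norm_num) (fun e he m => (norm_moebiusCoprime_mul_le q m
        (Nat.pos_of_mem_divisors he)).2) hy0 hyM fun e m => hsM2)
  rw [← sum_secondDiff_rieszMain a b h hy0 hs0] at hmain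
  have herr := norm_secondDiff_sub_le hχ hχ1 hy0 hh hMy hs0 hsM
  have hrm : rieszMain χ = fun X : ℝ => (X : ℂ) * (a * Real.log X + b) := by
    ext X
    rw [rieszMain, ha, hb]
    ring
  rw [hrm] at herr
  obtain ⟨m, hm⟩ : ∃ m, m = ∑ e ∈ q.divisors, (ArithmeticFunction.moebius e : ℂ) * ∑ m ∈ s,
    moebiusCoprime q m * secondDiff (fun X => X * (a * Real.log X + b)) h (y / (e * m ^ 2)) :=
    ⟨_, rfl⟩
  rw [← hm] at hmain herr
  have hint : ∫ t : ℝ, ‖zetaL χ (((1 / 2 : ℝ) : ℂ) + t * I)‖ ^ 2 *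
      ‖∑ e ∈ q.divisors, (ArithmeticFunction.moebius e : ℂ) * ∑ m ∈ s, moebiusCoprime q m *
        ((e * m ^ 2 : ℕ) : ℂ) ^ (-(((1 / 2 : ℝ) : ℂ) + t * I))‖ *
      ‖(cexp (h * (((1 / 2 : ℝ) : ℂ) + t * I)) - 1) ^ 2 / (((1 / 2 : ℝ) : ℂ) + t * I) ^ 3‖ ≤
      q.divisors.card * (22 * (3000 * Real.log (Real.log y))) *
        (C₁ * (h ^ 2 * (2 * Real.log y) ^ 3)) := by
    have hP := sum_divisors_primorial_le hz3
    have hP0 : 0 ≤ ∑ a ∈ (primorial z).divisors, (1 / a : ℝ) :=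
      Finset.sum_nonneg fun _ _ => by positivity
    have hexp : 1 ≤ 4 * Real.exp (2 * Real.log y / 2) * h ^ 2 := by
      rwa [mul_div_cancel_left₀ _ (by norm_num), Real.exp_log hy0]
    calc _ ≤ ∫ t : ℝ, (q.divisors.card * ∑ a ∈ (primorial z).divisors, (1 / a : ℝ)) *
          (‖zetaL χ (((1 / 2 : ℝ) : ℂ) + t * I)‖ ^ 2 *
            ‖roughPoly q z (z * 2 ^ J) t‖ * halfKernel h t) := by
          refine integral_mono_of_nonneg (ae_of_all _ fun t => by positivity)
            ((integrable_zetaL_mul_roughPoly hχ1 z _ hh1).const_mul _) (ae_of_all _ fun t => ?_)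
          have h4 := norm_sum_smoothMulRough_le q z (z * 2 ^ J) t
          rw [← hs] at h4
          beta_reduce
          rw [halfKernel]
          calc _ ≤ _ := mul_le_mul_of_nonneg_right (mul_le_mul_of_nonneg_left h4 (by positivity))
                (norm_nonneg _)
            _ = _ := by ring
      _ ≤ _ := by
          rw [integral_const_mul]
          have h5 := h₁ (by linarith : 4 ≤ 2 * Real.log y) hh hh1 hexp hz hJ hM
          gcongr
          · exact integral_nonneg fun t => mul_nonneg (by positivity) (halfKernel_nonneg h t)
          · exact hP.trans (by gcongr)
  have hpi : (0 : ℝ) < Real.pi := Real.pi_pos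
  have hdiv : ‖secondDiff (rieszSum fun n => χ.zetaMul n ^ 2) h y - 2 * m‖ ≤
      y ^ (1 / 2 : ℝ) * (q.divisors.card * (22 * (3000 * Real.log (Real.log y))) *
        (C₁ * (h ^ 2 * (2 * Real.log y) ^ 3))) := by
    have h6 := herr.trans (mul_le_mul_of_nonneg_left hint (by positivity))
    rw [show (2 : ℂ) * Real.pi * m = Real.pi * (2 * m) by ring, ← mul_sub, norm_mul, norm_real,
      Real.norm_of_nonneg hpi.le] at h6
    refine le_trans ?_ h6
    exact le_mul_of_one_le_left (norm_nonneg _) (by linarith [Real.pi_gt_three])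
  have hB : -χ.LFunction 1 ^ 2 + 2 * χ.LFunction 1 *
      (Real.eulerMascheroniConstant * χ.LFunction 1 + deriv χ.LFunction 1) = b + 2 * a := by
    rw [ha, hb]
    ring
  rw [hB, ← ha]
  have h7 : Real.log y ≤ Real.log y ^ 3 * Real.log (Real.log y) :=
    (le_self_pow₀ (by linarith) (by norm_num)).trans
      (le_mul_of_one_le_right (by positivity) hll)
  refine (norm_sub_le_norm_sub_add_norm_sub _ (2 * m) _).trans ?_
  rw [← mul_sub 2 m, norm_mul, RCLike.norm_two]
  calc _ ≤ y ^ (1 / 2 : ℝ) * (q.divisors.card * (22 * (3000 * Real.log (Real.log y))) *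
        (C₁ * (h ^ 2 * (2 * Real.log y) ^ 3))) + 2 * (C₂ * (h ^ 2 * (y ^ (1 / 2 : ℝ) *
          (Real.log y ^ 3 * Real.log (Real.log y))))) := by
        refine add_le_add hdiv (mul_le_mul_of_nonneg_left (hmain.trans ?_) (by norm_num))
        gcongr
    _ = _ := by ring

end SecondDiffAsymptotic

section Desmoothing

lemma secondDiff_rieszSum_mem_Icc {f : ℕ → ℝ} (hf : ∀ n, 0 ≤ f n) {h y : ℝ} (hh : 0 < h)
    (hy : 0 < y) : ∃ r : ℝ, secondDiff (rieszSum fun n => (f n : ℂ)) h y = r ∧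
      2 * h ^ 2 * ∑ n ∈ Finset.Icc 1 ⌊y⌋₊, f n ≤ r ∧
      r ≤ 2 * h ^ 2 * ∑ n ∈ Finset.Icc 1 ⌊y * Real.exp (2 * h)⌋₊, f n := by
  have hy1 : y ≤ y * Real.exp h := le_mul_of_one_le_right hy.le (Real.one_le_exp hh.le)
  have hy2 : y * Real.exp h ≤ y * Real.exp (2 * h) := by gcongr; linarith
  obtain ⟨w, hw⟩ : ∃ w : ℕ → ℝ, w = fun n : ℕ => Real.posLog (y * Real.exp (2 * h) / n) ^ 2 -
    2 * Real.posLog (y * Real.exp h / n) ^ 2 + Real.posLog (y / n) ^ 2 := ⟨_, rfl⟩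
  have hsub : Finset.Icc 1 ⌊y⌋₊ ⊆ Finset.Icc 1 ⌊y * Real.exp (2 * h)⌋₊ :=
    Finset.Icc_subset_Icc_right (Nat.floor_le_floor (hy1.trans hy2))
  have hwn : ∀ n : ℕ, 0 < n → 0 ≤ w n ∧ w n ≤ 2 * h ^ 2 ∧ ((n : ℝ) ≤ y → w n = 2 * h ^ 2) := by
    intro n hn
    have hn0 : (0 : ℝ) < n := by exact_mod_cast hn
    have hlog : ∀ v, Real.log (y * Real.exp v / n) = Real.log (y / n) + v := fun v => by
      rw [mul_div_right_comm, Real.log_mul (by positivity) (by positivity), Real.log_exp]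
    simp only [hw, Real.posLog, hlog]
    have h0 : (n : ℝ) ≤ y → 0 ≤ Real.log (y / n) := fun h => Real.log_nonneg ((one_le_div hn0).2 h)
    generalize Real.log (y / n) = u at h0 ⊢
    rcases le_total 0 u with h1 | h1
    · rw [max_eq_right (by linarith), max_eq_right (by linarith), max_eq_right h1]
      exact ⟨by nlinarith, by nlinarith, fun _ => by ring⟩
    · have h3 : ∀ hle : (n : ℝ) ≤ y, u = 0 := fun hle => le_antisymm h1 (h0 hle)
      rw [max_eq_left h1]
      rcases le_total 0 (u + h) with h4 | h4
      · rw [max_eq_right (by linarith), max_eq_right h4]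
        exact ⟨by nlinarith, by nlinarith, fun hle => by rw [h3 hle]; ring⟩
      · rw [max_eq_left h4]
        rcases le_total 0 (u + 2 * h) with h5 | h5
        · rw [max_eq_right h5]
          exact ⟨by nlinarith, by nlinarith, fun hle => by linarith [h3 hle]⟩
        · rw [max_eq_left h5]
          exact ⟨by norm_num, by nlinarith, fun hle => by linarith [h3 hle]⟩
  refine ⟨∑ n ∈ Finset.Icc 1 ⌊y * Real.exp (2 * h)⌋₊, f n * w n, ?_, ?_, ?_⟩
  · rw [secondDiff, rieszSum_eq_sum_posLog _ (by positivity) le_rfl,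
      rieszSum_eq_sum_posLog _ (by positivity) (Nat.floor_le_floor hy2),
      rieszSum_eq_sum_posLog _ hy (Nat.floor_le_floor (hy1.trans hy2)), Finset.mul_sum,
      ← Finset.sum_sub_distrib, ← Finset.sum_add_distrib]
    push_cast
    refine Finset.sum_congr rfl fun n _ => ?_
    rw [hw]
    push_cast
    ring
  · rw [Finset.mul_sum]
    refine (Finset.sum_le_sum fun n hn => ?_).trans (Finset.sum_le_sum_of_subset_of_nonneg hsub
      fun n hn _ => mul_nonneg (hf n) (hwn n (Finset.mem_Icc.1 hn).1).1)
    rw [(hwn n (Finset.mem_Icc.1 hn).1).2.2 ((Nat.le_floor_iff hy.le).1 (Finset.mem_Icc.1 hn).2),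
      mul_comm]
  · rw [Finset.mul_sum]
    refine Finset.sum_le_sum fun n hn => ?_
    rw [mul_comm]
    exact mul_le_mul_of_nonneg_right (hwn n (Finset.mem_Icc.1 hn).1).2.1 (hf n)

lemma isBigO_sum_sub_of_secondDiff {f : ℕ → ℝ} (hf : ∀ n, 0 ≤ f n) {A B : ℂ} {C : ℝ}
    (hC : 0 < C) (H : ∀ᶠ y : ℝ in atTop, ∀ h, 0 < h → h ≤ y ^ (-(1 / 2) : ℝ) → 1 ≤ 4 * y * h ^ 2 →
      ‖secondDiff (rieszSum fun n => (f n : ℂ)) h y - 2 * (h ^ 2 * (y * (A * Real.log y + B)))‖ ≤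
      C * (h ^ 2 * (y ^ (1 / 2 : ℝ) * Real.log y ^ 3 * Real.log (Real.log y)))) :
    (fun x : ℝ => (∑ n ∈ Finset.Icc 1 ⌊x⌋₊, (f n : ℂ)) - x * (A * Real.log x + B)) =O[atTop]
      fun x : ℝ => x ^ ((1 : ℝ) / 2) * Real.log x ^ 3 * Real.log (Real.log x) := by
  obtain ⟨y₀, hy₀⟩ := eventually_atTop.1 (H.and
    ((Real.tendsto_log_atTop.eventually_ge_atTop 1).and (eventually_gt_atTop 0)))
  refine IsBigO.of_bound (2 * C + 4 * (2 * ‖A‖ + ‖B‖)) ?_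
  filter_upwards [eventually_ge_atTop 16, eventually_ge_atTop y₀, eventually_ge_atTop (2 * y₀),
    (Real.tendsto_log_atTop.comp Real.tendsto_log_atTop).eventually_ge_atTop 1]
    with x hx16 hx1 hx2 hll
  have hx0 : 0 < x := by linarith
  obtain ⟨h, hh⟩ : ∃ h, h = x ^ (-(1 / 2) : ℝ) := ⟨_, rfl⟩
  have hh0 : 0 < h := hh ▸ by positivity
  have hhx : h * x = x ^ (1 / 2 : ℝ) := by
    rw [hh, ← Real.rpow_add_one hx0.ne']
    norm_num
  have hh2 : x * h ^ 2 = 1 := by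
    rw [hh, ← Real.rpow_natCast, ← Real.rpow_mul hx0.le]
    norm_num [Real.rpow_neg_one, hx0.ne']
  have hh4 : h ≤ 1 / 4 := by nlinarith
  obtain ⟨ε, hε⟩ : ∃ ε, ε = Real.exp (-(2 * h)) := ⟨_, rfl⟩
  have hε1 : 1 - 2 * h ≤ ε := by linarith [Real.add_one_le_exp (-(2 * h))]
  have hε2 : ε ≤ 1 := hε ▸ Real.exp_le_one_iff.2 (by linarith)
  have hy1 : y₀ ≤ x * ε := by nlinarith
  have hyx : x * ε ≤ x := mul_le_of_le_one_right hx0.le hε2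
  obtain ⟨hP, hLx, -⟩ := hy₀ x hx1
  obtain ⟨hQ, hLy, hy0⟩ := hy₀ _ hy1
  obtain ⟨r, hr, hr1, -⟩ := secondDiff_rieszSum_mem_Icc hf hh0 hx0
  obtain ⟨t, ht, -, ht1⟩ := secondDiff_rieszSum_mem_Icc hf hh0 hy0
  rw [hε, mul_assoc x, ← Real.exp_add, neg_add_cancel, Real.exp_zero, mul_one] at ht1
  have h1 := hP h hh0 hh.le (by linarith)
  have h2 := hQ h hh0 (hh ▸ Real.rpow_le_rpow_of_nonpos hy0 hyx (by norm_num)) (by nlinarith)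
  rw [hr] at h1
  rw [ht] at h2
  obtain ⟨E, hE⟩ : ∃ E, E = x ^ (1 / 2 : ℝ) * Real.log x ^ 3 * Real.log (Real.log x) := ⟨_, rfl⟩
  have hE2 : (x * ε) ^ (1 / 2 : ℝ) * Real.log (x * ε) ^ 3 * Real.log (Real.log (x * ε)) ≤ E := by
    rw [hE]
    have := Real.log_nonneg hLy
    gcongr
  have hE3 : x ^ (1 / 2 : ℝ) * Real.log x ≤ E := by
    rw [hE, mul_assoc]
    gcongr
    exact (le_self_pow₀ hLx (by norm_num)).trans (le_mul_of_one_le_right (by positivity) hll)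
  obtain ⟨m, hm⟩ : ∃ m, m = x * (A * Real.log x + B) := ⟨_, rfl⟩
  have hM : ‖m - (x * ε : ℝ) * (A * Real.log (x * ε) + B)‖ ≤ 2 * (2 * ‖A‖ + ‖B‖) * E := by
    rw [Real.log_mul hx0.ne' (hε ▸ Real.exp_ne_zero _), hε, Real.log_exp, ← hε, hm]
    calc _ = ‖(x * (1 - ε) : ℝ) * (A * Real.log x + B) + (2 * (h * x) * ε : ℝ) * A‖ := by
          congr 1
          push_cast
          ring
      _ ≤ 2 * x ^ (1 / 2 : ℝ) * (‖A‖ * Real.log x + ‖B‖) + 2 * x ^ (1 / 2 : ℝ) * ‖A‖ := by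
          refine (norm_add_le _ _).trans (add_le_add ?_ ?_)
          · rw [norm_mul, norm_real, Real.norm_of_nonneg (mul_nonneg hx0.le (by linarith))]
            refine mul_le_mul (by nlinarith) ((norm_add_le _ _).trans_eq ?_) (norm_nonneg _)
              (by positivity)
            rw [norm_mul, norm_real, Real.norm_of_nonneg (by linarith)]
          · rw [norm_mul, norm_real, hhx, Real.norm_of_nonneg (by rw [hε]; positivity)]
            exact mul_le_mul_of_nonneg_right (mul_le_of_le_one_right (by positivity) hε2)
              (norm_nonneg A)
      _ ≤ 2 * (2 * ‖A‖ + ‖B‖) * (x ^ (1 / 2 : ℝ) * Real.log x) := by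
          have := mul_nonneg (by positivity : 0 ≤ 2 * x ^ (1 / 2 : ℝ) * (‖A‖ + ‖B‖))
            (by linarith : 0 ≤ Real.log x - 1)
          nlinarith
      _ ≤ _ := by gcongr
  rw [← hm] at h1 ⊢
  rw [← hE] at h1 ⊢
  rw [Real.norm_of_nonneg ((by positivity : 0 ≤ x ^ (1 / 2 : ℝ) * Real.log x).trans hE3)]
  have h2' := h2.trans (mul_le_mul_of_nonneg_left (mul_le_mul_of_nonneg_left hE2
    (sq_nonneg h)) hC.le)
  generalize ((x * ε : ℝ) : ℂ) * (A * Real.log (x * ε) + B) = m' at *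
  rw [← ofReal_sum]
  generalize ∑ n ∈ Finset.Icc 1 ⌊x⌋₊, f n = S at *
  have h3 : ‖((2 * h ^ 2 * S : ℝ) : ℂ) - r‖ ≤ ‖(r : ℂ) - 2 * (h ^ 2 * m)‖ +
      (2 * h ^ 2 * ‖m - m'‖ + ‖(t : ℂ) - 2 * (h ^ 2 * m')‖) := by
    have h4 : ‖((2 * h ^ 2 * S : ℝ) : ℂ) - r‖ ≤ ‖(r : ℂ) - t‖ := by
      rw [← ofReal_sub, ← ofReal_sub, norm_real, norm_real, Real.norm_eq_abs, Real.norm_eq_abs,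
        abs_of_nonpos (by linarith)]
      linarith [le_abs_self (r - t)]
    refine h4.trans ?_
    have : (r : ℂ) - t = (r - 2 * (h ^ 2 * m)) + (((2 * h ^ 2 : ℝ) : ℂ) * (m - m') -
      (t - 2 * (h ^ 2 * m'))) := by push_cast; ring
    rw [this]
    refine (norm_add_le _ _).trans (add_le_add le_rfl ((norm_sub_le _ _).trans_eq ?_))
    rw [norm_mul, norm_real, Real.norm_of_nonneg (by positivity)]
  have h4 : 2 * h ^ 2 * ‖(S : ℂ) - m‖ ≤
      2 * h ^ 2 * ((2 * C + 4 * (2 * ‖A‖ + ‖B‖)) * E) := by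
    have h5 := norm_add_le (((2 * h ^ 2 * S : ℝ) : ℂ) - r) (r - 2 * (h ^ 2 * m))
    rw [show ((2 * h ^ 2 * S : ℝ) : ℂ) - r + (r - 2 * (h ^ 2 * m)) =
      ((2 * h ^ 2 : ℝ) : ℂ) * (S - m) by push_cast; ring, norm_mul, norm_real,
      Real.norm_of_nonneg (by positivity)] at h5
    have hE0 : 0 ≤ E := (by positivity : 0 ≤ x ^ (1 / 2 : ℝ) * Real.log x).trans hE3
    have h6 := mul_le_mul_of_nonneg_left hM (by positivity : 0 ≤ 2 * h ^ 2)
    have h7 : 0 ≤ C * (h ^ 2 * E) := by positivity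
    have h8 : 0 ≤ h ^ 2 * ((2 * ‖A‖ + ‖B‖) * E) := by positivity
    linarith
  exact le_of_mul_le_mul_left h4 (by positivity)

end Desmoothing

section EulerConstants

lemma sum_moebius_mul_cpow {q : ℕ} (hq : q ≠ 0) (s : ℂ) :
    ∑ e ∈ q.divisors, (ArithmeticFunction.moebius e : ℂ) * (e : ℂ) ^ (-s) =
      ∏ p ∈ q.primeFactors, (1 - (p : ℂ) ^ (-s)) := by
  let f : ArithmeticFunction ℂ := ⟨fun n => if n = 0 then 0 else (n : ℂ) ^ (-s), if_pos rfl⟩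
  have hf : ∀ n ≠ 0, f n = (n : ℂ) ^ (-s) := fun n hn => if_neg hn
  have hmul : f.IsMultiplicative := by
    refine ArithmeticFunction.IsMultiplicative.iff_ne_zero.2
      ⟨by rw [hf 1 one_ne_zero]; simp, fun {m n} hm hn _ => ?_⟩
    rw [hf _ (mul_ne_zero hm hn), hf _ hm, hf _ hn, Nat.cast_mul, natCast_mul_natCast_cpow]
  have h := hmul.prodPrimeFactors_one_sub_of_squarefree f
    (UniqueFactorizationMonoid.squarefree_radical (a := q))
  rw [Nat.primeFactors_radical] at h
  rw [← Finset.sum_subset (Nat.divisors_subset_of_dvd hq UniqueFactorizationMonoid.radical_dvd_self)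
    fun e he he2 => ?_, ← Finset.prod_congr rfl fun p hp => ?_, h]
  · exact Finset.sum_congr rfl fun e he => by rw [hf e (Nat.pos_of_mem_divisors he).ne']
  · rw [hf p (Nat.prime_of_mem_primeFactors hp).ne_zero]
  · rw [ArithmeticFunction.moebius_eq_zero_of_not_squarefree, Int.cast_zero, zero_mul]
    refine fun hsq => he2 (Nat.mem_divisors.2 ⟨?_, UniqueFactorizationMonoid.radical_ne_zero⟩)
    exact (UniqueFactorizationMonoid.dvd_radical_iff hsq.isRadical hq).2
      (Nat.dvd_of_mem_divisors he)

lemma abscissaOfAbsConv_moebiusCoprime_le (q : ℕ) :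
    LSeries.abscissaOfAbsConv (moebiusCoprime q) ≤ 1 :=
  LSeries.abscissaOfAbsConv_le_of_le_const ⟨1, fun m _ => norm_moebiusCoprime_le q m⟩

lemma LSeries_moebiusCoprime_mul {q : ℕ} [NeZero q] {w : ℂ} (hw : 1 < w.re) :
    LSeries (moebiusCoprime q) w *
      ((∏ p ∈ q.primeFactors, (1 - (p : ℂ) ^ (-w))) * riemannZeta w) = 1 := by
  rw [← DirichletCharacter.LFunctionTrivChar_eq_mul_riemannZeta (by rintro rfl; simp at hw),
    DirichletCharacter.LFunctionTrivChar, DirichletCharacter.LFunction_eq_LSeries _ hw, mul_comm]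
  rw [← DirichletCharacter.LSeries.mul_mu_eq_one (1 : DirichletCharacter ℂ q) hw]
  congr 2
  ext m
  rw [moebiusCoprime, Pi.mul_apply]
  split_ifs with h
  · rw [MulChar.one_apply ((ZMod.isUnit_iff_coprime m q).2 h), one_mul]
  · rw [MulChar.map_nonunit _ (mt (ZMod.isUnit_iff_coprime m q).1 h), zero_mul]

lemma tsum_moebiusCoprime_mul (q : ℕ) {e : ℕ} (he : e ≠ 0) :
    ∑' m : ℕ, moebiusCoprime q m * (1 / (e * m ^ 2) : ℝ) =
      (e : ℂ) ^ (-1 : ℂ) * LSeries (moebiusCoprime q) 2 ∧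
    ∑' m : ℕ, moebiusCoprime q m * (Real.log (e * m ^ 2) / (e * m ^ 2) : ℝ) =
      (e : ℂ) ^ (-1 : ℂ) * (Real.log e * LSeries (moebiusCoprime q) 2 +
        2 * LSeries (LSeries.logMul (moebiusCoprime q)) 2) := by
  have ha : LSeries.abscissaOfAbsConv (moebiusCoprime q) < (2 : ℂ).re :=
    (abscissaOfAbsConv_moebiusCoprime_le q).trans_lt (by norm_num; exact_mod_cast one_lt_two)
  have h1 := LSeriesSummable_of_abscissaOfAbsConv_lt_re ha
  have h2 := LSeriesSummable_logMul_of_lt_re ha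
  rw [LSeries, LSeries, ← tsum_mul_left, ← tsum_mul_left, ← tsum_mul_left,
    ← (h1.mul_left _).tsum_add (h2.mul_left _), ← tsum_mul_left]
  have he0 : (0 : ℝ) < e := by positivity
  constructor <;> refine tsum_congr fun m => ?_ <;> rcases eq_or_ne m 0 with rfl | hm
  · simp [moebiusCoprime_zero]
  · rw [LSeries.term_of_ne_zero hm, cpow_neg_one, cpow_ofNat]
    push_cast
    field_simp
  · simp [moebiusCoprime_zero]
  · have hm0 : (0 : ℝ) < m := by positivity
    rw [LSeries.term_of_ne_zero hm, LSeries.term_of_ne_zero hm, cpow_neg_one, cpow_ofNat,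
      LSeries.logMul, Real.log_mul he0.ne' (by positivity), Real.log_pow, ← natCast_log]
    push_cast
    field_simp

lemma hasDerivAt_eulerConst (q : ℕ) [NeZero q] :
    (∏ p ∈ q.primeFactors, (1 - (p : ℂ) ^ (-1 : ℂ))) * LSeries (moebiusCoprime q) (2 * 1) =
      eulerConst q ∧
    HasDerivAt (fun s => (∏ p ∈ q.primeFactors, (1 - (p : ℂ) ^ (-s))) *
      LSeries (moebiusCoprime q) (2 * s)) (-eulerLogConst q) 1 := by
  simp_rw [← sum_moebius_mul_cpow (NeZero.ne q), eulerConst, eulerLogConst, Finset.sum_mul]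
  have he : ∀ e ∈ q.divisors, e ≠ 0 := fun e he => (Nat.pos_of_mem_divisors he).ne'
  constructor
  · refine Finset.sum_congr rfl fun e h => ?_
    rw [(tsum_moebiusCoprime_mul q (he e h)).1, mul_one, mul_assoc]
  rw [← Finset.sum_neg_distrib]
  refine HasDerivAt.fun_sum fun e h => ?_
  have ha : LSeries.abscissaOfAbsConv (moebiusCoprime q) < (2 * 1 : ℂ).re :=
    (abscissaOfAbsConv_moebiusCoprime_le q).trans_lt (by norm_num; exact_mod_cast one_lt_two)
  have h1 := (LSeries_hasDerivAt ha).comp (1 : ℂ) ((hasDerivAt_id (1 : ℂ)).const_mul 2)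
  have h2 := ((hasDerivAt_id (1 : ℂ)).neg.const_cpow (c := e) (.inl (by exact_mod_cast he e h)))
  refine ((h2.const_mul (ArithmeticFunction.moebius e : ℂ)).mul h1).congr_deriv ?_
  rw [(tsum_moebiusCoprime_mul q (he e h)).2, ← natCast_log]
  simp only [Function.comp_apply, id, mul_one, Pi.neg_apply]
  ring

theorem eulerConst_eq (q : ℕ) [NeZero q] :
    eulerConst q = 6 / (Real.pi : ℂ) ^ 2 * ∏ p ∈ q.primeFactors, ((p : ℂ) / (p + 1)) ∧
    eulerLogConst q = eulerConst q * (12 / (Real.pi : ℂ) ^ 2 * deriv riemannZeta 2 -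
      ∑ p ∈ q.primeFactors, (Real.log p : ℂ) / (p + 1)) := by
  obtain ⟨h1, h2⟩ := hasDerivAt_eulerConst q
  have hp0 : ∀ p ∈ q.primeFactors, (p : ℂ) ≠ 0 := fun p hp => by
    exact_mod_cast (Nat.prime_of_mem_primeFactors hp).ne_zero
  have hp1 : ∀ p : ℕ, (p : ℂ) + 1 ≠ 0 := fun p => by exact_mod_cast p.succ_ne_zero
  have hpi : (Real.pi : ℂ) ≠ 0 := by exact_mod_cast Real.pi_ne_zero
  have hpc : ∀ p ∈ q.primeFactors, 1 + (p : ℂ) ^ (-1 : ℂ) = ((p : ℂ) / (p + 1))⁻¹ :=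
    fun p hp => by
      rw [cpow_neg_one]
      field_simp [hp0 p hp, hp1 p]
  have hd : ∀ p ∈ q.primeFactors, HasDerivAt (fun s : ℂ => 1 + (p : ℂ) ^ (-s))
      ((p : ℂ) ^ (-1 : ℂ) * Real.log p * -1) 1 := fun p hp => by
    rw [natCast_log]
    exact ((hasDerivAt_id (1 : ℂ)).neg.const_cpow (.inl (hp0 p hp))).const_add 1
  have hne : ∀ p ∈ q.primeFactors, 1 + (p : ℂ) ^ (-1 : ℂ) ≠ 0 := fun p hp => by
    rw [hpc p hp]
    exact inv_ne_zero (div_ne_zero (hp0 p hp) (hp1 p))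
  have hH : HasDerivAt (fun s : ℂ => ∏ p ∈ q.primeFactors, (1 + (p : ℂ) ^ (-s)))
      ((∏ p ∈ q.primeFactors, (1 + (p : ℂ) ^ (-1 : ℂ))) *
        -∑ p ∈ q.primeFactors, (Real.log p : ℂ) / (p + 1)) 1 := by
    have hdiff : DifferentiableAt ℂ (fun s : ℂ => ∏ p ∈ q.primeFactors, (1 + (p : ℂ) ^ (-s))) 1 :=
      DifferentiableAt.fun_finsetProd fun p hp => (hd p hp).differentiableAt
    refine hdiff.hasDerivAt.congr_deriv ?_
    have := logDeriv_prod hne fun p hp => (hd p hp).differentiableAt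
    rw [logDeriv_apply, div_eq_iff (Finset.prod_ne_zero_iff.2 hne)] at this
    rw [this, mul_comm, ← Finset.sum_neg_distrib]
    congr 1
    refine Finset.sum_congr rfl fun p hp => ?_
    rw [logDeriv_apply, (hd p hp).deriv, hpc p hp, cpow_neg_one]
    field_simp [hp0 p hp, hp1 p]
  have hz : HasDerivAt (fun s : ℂ => riemannZeta (2 * s)) (deriv riemannZeta (2 * 1) * (2 * 1)) 1 :=
    (differentiableAt_riemannZeta (by norm_num)).hasDerivAt.comp (1 : ℂ)
      ((hasDerivAt_id (1 : ℂ)).const_mul 2)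
  have key : ∀ᶠ s : ℂ in 𝓝 1, (∏ p ∈ q.primeFactors, (1 - (p : ℂ) ^ (-s))) *
      LSeries (moebiusCoprime q) (2 * s) *
        (riemannZeta (2 * s) * ∏ p ∈ q.primeFactors, (1 + (p : ℂ) ^ (-s))) = 1 := by
    have : ∀ᶠ s : ℂ in 𝓝 1, 1 / 2 < s.re :=
      continuous_re.continuousAt.eventually (lt_mem_nhds (by norm_num))
    filter_upwards [this] with s hs
    have h := LSeries_moebiusCoprime_mul (q := q) (w := 2 * s) (by simpa using by linarith)
    rw [Finset.prod_congr rfl fun (p : ℕ) _ => show 1 - (p : ℂ) ^ (-(2 * s)) =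
        (1 - (p : ℂ) ^ (-s)) * (1 + (p : ℂ) ^ (-s)) by
          rw [show -(2 * s) = (2 : ℕ) * -s by push_cast; ring, cpow_nat_mul]; ring,
      Finset.prod_mul_distrib] at h
    linear_combination h
  have hk := key.self_of_nhds
  have hD := (h2.mul (hz.mul hH)).unique
    ((hasDerivAt_const (1 : ℂ) (1 : ℂ)).congr_of_eventuallyEq key)
  simp only [Pi.mul_apply, mul_one] at hk hD
  rw [mul_one] at h1
  rw [h1, riemannZeta_two, Finset.prod_congr rfl hpc, Finset.prod_inv_distrib] at hk
  rw [h1, riemannZeta_two, Finset.prod_congr rfl hpc, Finset.prod_inv_distrib] at hD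
  generalize ∏ p ∈ q.primeFactors, ((p : ℂ) / (p + 1)) = P at *
  have hP : P ≠ 0 := by rintro rfl; simp at hk
  constructor
  · field_simp at hk ⊢
    linear_combination hk
  · field_simp at hD ⊢
    linear_combination -hD

end EulerConstants

section Ideals

lemma card_filter_eq_one_iff_of_sum_mul_eq_two {ι : Type*} [Fintype ι] {e f : ι → ℕ}
    (he : ∀ i, 0 < e i) (hf : ∀ i, 0 < f i) (h : ∑ i, e i * f i = 2) :
    (Finset.univ.filter fun i => f i = 1).card = 1 ↔ ∃ i, e i ≠ 1 := by
  classical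
  constructor
  · intro hc
    by_contra! he1
    obtain ⟨j, hj⟩ := Finset.card_eq_one.1 hc
    have hfj : f j = 1 := by
      simpa using hj.ge (Finset.mem_singleton_self j)
    simp only [he1, one_mul] at h
    rw [← Finset.add_sum_erase _ _ (Finset.mem_univ j), hfj] at h
    obtain ⟨i, hi⟩ : (Finset.univ.erase j).Nonempty := by
      rw [Finset.nonempty_iff_ne_empty]
      intro h0
      simp [h0] at h
    have h1 := Finset.single_le_sum (f := f) (fun _ _ => Nat.zero_le _) hi
    have h2 : f i ≠ 1 := fun h3 =>
      (Finset.mem_erase.1 hi).1 (Finset.mem_singleton.1 (hj.le (by simp [h3])))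
    have := hf i
    omega
  · rintro ⟨j, hj⟩
    rw [← Finset.add_sum_erase _ _ (Finset.mem_univ j)] at h
    have hej : 2 ≤ e j := by have := he j; omega
    have hfj := hf j
    have h0 : Finset.univ.erase j = ∅ := by
      by_contra hne
      have := Finset.sum_pos (f := fun i => e i * f i)
        (fun i _ => Nat.mul_pos (he i) (hf i)) (Finset.nonempty_iff_ne_empty.2 hne)
      nlinarith
    have hf1 : f j = 1 := by
      rw [h0, Finset.sum_empty] at h
      nlinarith
    refine Finset.card_eq_one.2 ⟨j, ?_⟩
    ext i
    have : i = j := by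
      by_contra hij
      exact Finset.notMem_empty i (h0 ▸ Finset.mem_erase.2 ⟨hij, Finset.mem_univ i⟩)
    simp [this, hf1]

variable (K : Type*) [Field K] [NumberField K]

lemma rK_eq_card_of_ne_zero {n : ℕ} (hn : n ≠ 0) :
    rK K n = Nat.card {I : Ideal (NumberField.RingOfIntegers K) // Ideal.absNorm I = n} :=
  Nat.card_congr <| Equiv.subtypeEquivRight fun I =>
    ⟨And.left, fun h => ⟨h, fun h0 => hn (by rw [← h, h0, Ideal.absNorm_bot])⟩⟩

lemma rK_prime_eq_one_iff (hK2 : Module.finrank ℚ K = 2) {p : ℕ} (hp : p.Prime) :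
    rK K p = 1 ↔ (p : ℤ) ∣ NumberField.discr K := by
  let S := NumberField.RingOfIntegers K
  let 𝔭 : Ideal ℤ := Ideal.span {(p : ℤ)}
  have hpZ : Prime (p : ℤ) := Nat.prime_iff_prime_int.1 hp
  have : 𝔭.IsPrime := (Ideal.span_singleton_prime hpZ.ne_zero).2 hpZ
  have : Fintype (𝔭.primesOver S) := (Algebra.QuasiFinite.finite_primesOver 𝔭).fintype
  have hcard : rK K p =
      (Finset.univ.filter fun P : 𝔭.primesOver S => P.1.inertiaDeg ℤ = 1).card := by
    rw [rK_eq_card_of_ne_zero K hp.ne_zero, ← Fintype.card_subtype, ← Nat.card_eq_fintype_card]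
    have hprime {I : Ideal S} (hI : Ideal.absNorm I = p) : I.IsPrime :=
      Ideal.isPrime_of_irreducible_absNorm (by rwa [hI])
    have hover {I : Ideal S} (hI : Ideal.absNorm I = p) : I.LiesOver 𝔭 :=
      ⟨by rw [Ideal.under, ← Ideal.span_singleton_absNorm (by rwa [hI]), hI]⟩
    refine Nat.card_congr ⟨fun I => ⟨⟨I.1, hprime I.2, hover I.2⟩, ?_⟩, fun P => ⟨P.1.1, ?_⟩,
      fun _ => rfl, fun _ => rfl⟩
    · have := hprime I.2
      have := hover I.2
      rw [← Nat.pow_eq_self_iff hp.one_lt, Ideal.pow_inertiaDeg p I.1, I.2]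
    · obtain ⟨⟨P, hP, hl⟩, h⟩ := P
      rw [← Ideal.pow_inertiaDeg p P, h, pow_one]
  have hsum := Ideal.sum_ramification_inertia_eq_finrank 𝔭 S
  rw [NumberField.RingOfIntegers.rank, hK2] at hsum
  rw [hcard, card_filter_eq_one_iff_of_sum_mul_eq_two (fun P => ?_) (fun P => ?_) hsum,
    ← not_iff_not, NumberField.not_dvd_discr_iff_isUnramifiedIn K S hpZ,
    Algebra.isUnramifiedIn_iff_forall_ramificationIdx_eq_one]
  · push Not
    exact ⟨fun h P hP hl => h ⟨P, hP, hl⟩, fun h P => @h P.1 P.2.1 P.2.2⟩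
  · have := P.2.1
    exact Ideal.ramificationIdx_pos P.1 ℤ
  · have := P.2.1
    exact Ideal.inertiaDeg_pos P.1 ℤ

end Ideals

section Character

lemma sq_eq_one_of_im_eq_zero {q : ℕ} {χ : DirichletCharacter ℂ q}
    (hχ : ∀ n : ZMod q, (χ n).im = 0) : χ ^ 2 = 1 := by
  ext a
  have h1 := χ.unit_norm_eq_one a
  have h2 := hχ a
  have h3 := Complex.sq_norm (χ a)
  rw [h1, Complex.normSq_apply, h2] at h3
  rw [MulChar.pow_apply_coe, MulChar.one_apply_coe]
  apply Complex.ext <;> simp [sq, h2]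
  linarith

variable {K : Type*} [Field K] [NumberField K] {q : ℕ} [NeZero q] {χ : DirichletCharacter ℂ q}

lemma rK_eq_zetaMul (hfact : ∀ s : ℂ, 1 < s.re →
      LSeries (fun n => (rK K n : ℂ)) s = riemannZeta s * DirichletCharacter.LFunction χ s)
    {n : ℕ} (hn : n ≠ 0) : (rK K n : ℂ) = χ.zetaMul n := by
  have h2 : 1 < (2 : ℂ).re := by norm_num
  refine LSeries.eq_of_LSeries_eventually_eq (f := fun n => (rK K n : ℂ)) ?_ ?_ ?_ hn
  · refine lt_top_iff_ne_top.2 fun h => ?_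
    have := hfact 2 h2
    rw [LSeries_eq_zero_of_abscissaOfAbsConv_eq_top h] at this
    exact mul_ne_zero (riemannZeta_ne_zero_of_one_lt_re h2)
      (DirichletCharacter.LFunction_ne_zero_of_one_le_re χ (.inr (by norm_num)) h2.le) this.symm
  · exact (χ.LSeriesSummable_zetaMul h2).abscissaOfAbsConv_le.trans_lt (EReal.coe_lt_top _)
  · filter_upwards [eventually_gt_atTop 1] with x hx
    rw [hfact x (by simpa), LSeries_zetaMul (by simpa), zetaL]

lemma ne_one_of_LSeries_rK_eq (hfact : ∀ s : ℂ, 1 < s.re →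
      LSeries (fun n => (rK K n : ℂ)) s = riemannZeta s * DirichletCharacter.LFunction χ s) :
    χ ≠ 1 := by
  rintro rfl
  have hR : Tendsto (fun s : ℝ => (s : ℂ)) (𝓝[>] 1) (𝓝[≠] 1) := by
    refine tendsto_nhdsWithin_iff.2 ⟨?_, ?_⟩
    · exact (Complex.continuous_ofReal.tendsto' 1 1 (by simp)).mono_left nhdsWithin_le_nhds
    · filter_upwards [self_mem_nhdsWithin] with s hs
      simpa using (Set.mem_Ioi.1 hs).ne'
  have h0 : Tendsto (fun s : ℝ => (s : ℂ) - 1) (𝓝[>] 1) (𝓝 0) :=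
    (Continuous.tendsto' (by fun_prop) 1 0 (by simp)).mono_left nhdsWithin_le_nhds
  have h1 := h0.mul (NumberField.tendsto_sub_one_mul_dedekindZeta_nhdsGT K)
  have h2 := (riemannZeta_residue_one.comp hR).mul
    ((DirichletCharacter.LFunctionTrivChar_residue_one (N := q)).comp hR)
  rw [zero_mul] at h1
  refine absurd (tendsto_nhds_unique (h2.congr' ?_) h1) ?_
  · filter_upwards [self_mem_nhdsWithin] with s hs
    have hs : 1 < (s : ℂ).re := hs
    have : NumberField.dedekindZeta K s = LSeries (fun n => (rK K n : ℂ)) s :=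
      LSeries_congr (fun hn => by rw [rK_eq_card_of_ne_zero K hn]) _
    simp only [Function.comp, this, hfact _ hs, DirichletCharacter.LFunctionTrivChar]
    ring
  · rw [one_mul]
    refine Finset.prod_ne_zero_iff.2 fun p hp => sub_ne_zero.2 fun h => ?_
    exact (Nat.prime_of_mem_primeFactors hp).ne_one (by exact_mod_cast inv_eq_one.1 h.symm)

lemma primeFactors_discr (hK2 : Module.finrank ℚ K = 2)
    (hfact : ∀ s : ℂ, 1 < s.re →
      LSeries (fun n => (rK K n : ℂ)) s = riemannZeta s * DirichletCharacter.LFunction χ s) :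
    (NumberField.discr K).natAbs.primeFactors = q.primeFactors := by
  ext p
  simp only [Nat.mem_primeFactors, ne_eq, Int.natAbs_eq_zero, NumberField.discr_ne_zero,
    NeZero.ne q, not_false_eq_true, and_true]
  refine and_congr_right fun hp => ?_
  have h := rK_eq_zetaMul hfact hp.ne_zero
  have h1 := zetaMul_prime_pow (χ := χ) hp 1
  rw [pow_one, ← h] at h1
  rw [← Int.natCast_dvd, ← rK_prime_eq_one_iff K hK2 hp, ← @Nat.cast_inj ℂ, h1]
  simp only [Finset.sum_range_succ, Finset.range_zero, Finset.sum_empty, pow_zero, pow_one,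
    zero_add, Nat.cast_one, add_eq_left]
  rw [← not_iff_not, ← ne_eq, ← hp.coprime_iff_not_dvd, ← ZMod.isUnit_iff_coprime]
  exact ⟨fun h => not_imp_comm.1 (χ.map_nonunit) h, fun h => (h.map χ).ne_zero⟩

end Character

end QuadIdealSq

open QuadIdealSq in
/-- **Corollary 1.** For a quadratic number field `K` of discriminant `D`, with real
Dirichlet character `χ_D` satisfying `ζ_K(s) = ζ(s) L(s, χ_D)`,
`∑_{n ≤ x} r_K(n)² = A₁ x log x + B₁ x + O(x^{1/2} (log x)³ log log x)`, where
`A₁ = (6/π²) L(1,χ_D)² ∏_{p∣D} p/(p+1)` and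
`B₁ = A₁ (−1 + 2γ + ∑_{p∣D} log p/(p+1) + 2 L′(1,χ_D)/L(1,χ_D) − (12/π²) ζ′(2))`. -/
theorem sum_rK_sq_asymptotics
    (K : Type) [Field K] [NumberField K] (hK2 : Module.finrank ℚ K = 2)
    (q : ℕ) [NeZero q] (χ : DirichletCharacter ℂ q)
    (hχ_real : ∀ n : ZMod q, (χ n).im = 0)
    (hfact : ∀ s : ℂ, 1 < s.re →
      LSeries (fun n => (rK K n : ℂ)) s = riemannZeta s * DirichletCharacter.LFunction χ s)
    (A₁ B₁ : ℂ)
    (hA₁ : A₁ = 6 / (Real.pi : ℂ) ^ 2 * (DirichletCharacter.LFunction χ 1) ^ 2 *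
      ∏ p ∈ (NumberField.discr K).natAbs.primeFactors, ((p : ℂ) / (p + 1)))
    (hB₁ : B₁ = A₁ *
      (-1 + 2 * (Real.eulerMascheroniConstant : ℂ)
        + ∑ p ∈ (NumberField.discr K).natAbs.primeFactors, ((Real.log p : ℂ) / (p + 1))
        + 2 * deriv (DirichletCharacter.LFunction χ) 1 / DirichletCharacter.LFunction χ 1
        - 12 / (Real.pi : ℂ) ^ 2 * deriv riemannZeta 2)) :
    (fun x : ℝ => (∑ n ∈ Finset.Icc 1 ⌊x⌋₊, ((rK K n : ℂ)) ^ 2)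
        - (A₁ * x * Real.log x + B₁ * x)) =O[atTop]
      fun x : ℝ => x ^ ((1 : ℝ) / 2) * Real.log x ^ 3 * Real.log (Real.log x) := by
  have hχ1 := ne_one_of_LSeries_rK_eq hfact
  have hL := DirichletCharacter.LFunction_apply_one_ne_zero hχ1
  obtain ⟨C, hC, H⟩ := exists_norm_secondDiff_rieszSum_sub_le (sq_eq_one_of_im_eq_zero hχ_real) hχ1
  have hf : (rieszSum fun n => χ.zetaMul n ^ 2) =
      rieszSum fun n => (((rK K n : ℝ) ^ 2 : ℝ) : ℂ) := by
    ext X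
    refine Finset.sum_congr rfl fun n hn => ?_
    simp [← rK_eq_zetaMul hfact (Nat.one_le_iff_ne_zero.1 (Finset.mem_Icc.1 hn).1)]
  rw [hf] at H
  have := isBigO_sum_sub_of_secondDiff (fun n => sq_nonneg (rK K n : ℝ)) hC H
  refine this.congr_left fun x => ?_
  rw [primeFactors_discr hK2 hfact] at hA₁ hB₁
  rw [(eulerConst_eq q).2, hB₁, hA₁, (eulerConst_eq q).1]
  push_cast
  field_simp
  ring
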